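/- Let 1/2<γ<1 and let Φ, 𝒜_0,…,𝒜_3 be smooth radiation fields with D_{|I|+3} ≤ 1, where D_k := ‖Φ‖_{k,∞,γ} + Σ_α‖𝒜_α‖_{k,∞,γ}. With φ_app, A_{α,app}, 𝒥_α, 𝐪 as in the context, for every multiindex I and every m>0 there is a constant C depending only on |I|, γ, m such that for all (t,x) with t≥0, x≠0: (i) | Z^I( □φ_app + i·e^{−i(𝐪/4π)ln r}·(𝐪/(2π))·(∂_qΦ(q,ω)/r²)·χ(⟨q⟩/r) ) | ≤ C·D_{|I|+2}·⟨t+r⟩^{−3}⟨t−r⟩^{−γ}·1_{⟨q⟩≤(3/4)r}; and (ii) | Z^I( □A_{α,app} + (𝒥_α(q,ω)/r²)·χ(⟨q⟩/r) ) | ≤ C·( D_{|I|+2}·⟨t+r⟩^{−3}⟨t−r⟩^{−γ}·1_{⟨q⟩≤(3/4)r} + D_{|I|+1}²·⟨t+r⟩^{−m} + D_{|I|+3}²·⟨t+r⟩^{−3}⟨t−r⟩^{−2γ}·(1+ln(⟨t+r⟩/⟨t−r⟩))·1_{⟨q⟩≤(3/4)r} ). -/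

import Mathlib

noncomputable section

open Real MeasureTheory Filter
open scoped RealInnerProductSpace Topology

/-- Spatial points: `ℝ³` with the Euclidean norm. -/
abbrev Pt : Type := EuclideanSpace ℝ (Fin 3)

/-- `r = |x|`. -/
def rad (x : Pt) : ℝ := ‖x‖

/-- Japanese bracket `⟨a⟩ = (1+a²)^{1/2}`. -/
def jb (a : ℝ) : ℝ := Real.sqrt (1 + a ^ 2)

/-- `∂_t`. -/
def dT (f : ℝ → Pt → ℂ) : ℝ → Pt → ℂ := fun t x => deriv (fun s => f s x) t

/-- `∂_i`. -/
def dX (i : Fin 3) (f : ℝ → Pt → ℂ) : ℝ → Pt → ℂ :=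
  fun t x => fderiv ℝ (fun y => f t y) x (EuclideanSpace.single i 1)

/-- `∂_r = Σ (x_i/r) ∂_i`. -/
def dR (f : ℝ → Pt → ℂ) : ℝ → Pt → ℂ :=
  fun t x => ((rad x : ℝ) : ℂ)⁻¹ * ∑ i, ((x i : ℝ) : ℂ) * dX i f t x

/-- `L = ∂_t + ∂_r`. -/
def dL (f : ℝ → Pt → ℂ) : ℝ → Pt → ℂ := fun t x => dT f t x + dR f t x

/-- `L̲ = ∂_t − ∂_r`. -/
def dLbar (f : ℝ → Pt → ℂ) : ℝ → Pt → ℂ := fun t x => dT f t x - dR f t x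

/-- angular derivative `∂̸_i = ∂_i − ω_i ∂_r`. -/
def dAng (i : Fin 3) (f : ℝ → Pt → ℂ) : ℝ → Pt → ℂ :=
  fun t x => dX i f t x - ((x i / rad x : ℝ) : ℂ) * dR f t x

/-- `|∂̸ f|²`. -/
def angSq (f : ℝ → Pt → ℂ) (t : ℝ) (x : Pt) : ℝ := ∑ i, ‖dAng i f t x‖ ^ 2

/-- multiplication by `r`. -/
def rmul (f : ℝ → Pt → ℂ) : ℝ → Pt → ℂ := fun t x => ((rad x : ℝ) : ℂ) * f t x

/-- `□ = −∂_t² + Δ`. -/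
def box (f : ℝ → Pt → ℂ) : ℝ → Pt → ℂ :=
  fun t x => - dT (dT f) t x + ∑ i, dX i (dX i f) t x

/-- rotation `Ω_{ij} = x_i ∂_j − x_j ∂_i`. -/
def vrot (i j : Fin 3) (f : ℝ → Pt → ℂ) : ℝ → Pt → ℂ :=
  fun t x => ((x i : ℝ) : ℂ) * dX j f t x - ((x j : ℝ) : ℂ) * dX i f t x

/-- boost `Ω_{0i} = t ∂_i + x_i ∂_t`. -/
def vboost (i : Fin 3) (f : ℝ → Pt → ℂ) : ℝ → Pt → ℂ :=
  fun t x => (t : ℂ) * dX i f t x + ((x i : ℝ) : ℂ) * dT f t x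

/-- scaling `S = t ∂_t + r ∂_r`. -/
def vscal (f : ℝ → Pt → ℂ) : ℝ → Pt → ℂ :=
  fun t x => (t : ℂ) * dT f t x + ((rad x : ℝ) : ℂ) * dR f t x

/-- The commutator vector fields `Z`. -/
inductive VF : Type
  | time : VF
  | space : Fin 3 → VF
  | rot : Fin 3 → Fin 3 → VF
  | boost : Fin 3 → VF
  | scal : VF
  deriving DecidableEq, Fintype

/-- Action of a commutator vector field on a function. -/
def VF.app : VF → (ℝ → Pt → ℂ) → (ℝ → Pt → ℂ)
  | time => dT
  | space i => dX i
  | rot i j => vrot i j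
  | boost i => vboost i
  | scal => vscal

/-- `Z^I` for a multiindex `I` (a list of vector fields). -/
def Ziter : List VF → (ℝ → Pt → ℂ) → ℝ → Pt → ℂ
  | [], f => f
  | z :: l, f => z.app (Ziter l f)

/-- `C^∞` smoothness for a function of `(t,x)`. -/
def Smooth2 (f : ℝ → Pt → ℂ) : Prop := ContDiff ℝ (⊤ : ℕ∞) (Function.uncurry f)

/-- real-valued versions of the derivative operators -/
def dTR (f : ℝ → Pt → ℝ) : ℝ → Pt → ℝ := fun t x => deriv (fun s => f s x) t

def dXR (i : Fin 3) (f : ℝ → Pt → ℝ) : ℝ → Pt → ℝ :=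
  fun t x => fderiv ℝ (fun y => f t y) x (EuclideanSpace.single i 1)

def boxR (f : ℝ → Pt → ℝ) : ℝ → Pt → ℝ :=
  fun t x => - dTR (dTR f) t x + ∑ i, dXR i (dXR i f) t x

/-- `∂_q` acting on radiation fields `F(q,ω)`. -/
def dq (F : ℝ → Pt → ℂ) : ℝ → Pt → ℂ := fun q ω => deriv (fun s => F s ω) q

/-- `∂_{ω_i}` acting on radiation fields. -/
def dOm (i : Fin 3) (F : ℝ → Pt → ℂ) : ℝ → Pt → ℂ :=
  fun q ω => fderiv ℝ (fun y => F q y) ω (EuclideanSpace.single i 1)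

/-- angular rotation `ω_i ∂_{ω_j} − ω_j ∂_{ω_i}` on radiation fields. -/
def aRot (i j : Fin 3) (F : ℝ → Pt → ℂ) : ℝ → Pt → ℂ :=
  fun q ω => ((ω i : ℝ) : ℂ) * dOm j F q ω - ((ω j : ℝ) : ℂ) * dOm i F q ω

/-- `⟨q⟩∂_q` on radiation fields. -/
def qdq (F : ℝ → Pt → ℂ) : ℝ → Pt → ℂ := fun q ω => ((jb q : ℝ) : ℂ) * dq F q ω

/-- `q∂_q` on radiation fields. -/
def qmdq (F : ℝ → Pt → ℂ) : ℝ → Pt → ℂ := fun q ω => (q : ℂ) * dq F q ω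

/-- iterated angular derivatives `∂_ω^α` (as iterated rotations). -/
def aIter : List (Fin 3 × Fin 3) → (ℝ → Pt → ℂ) → ℝ → Pt → ℂ
  | [], F => F
  | p :: l, F => aRot p.1 p.2 (aIter l F)

/-- `‖F‖_{N,∞,γ} ≤ ε`, stated term by term: every seminorm
`sup |(⟨q⟩∂_q)^k ∂_ω^α F| ⟨q⟩^γ` with `k+|α| ≤ N` is at most `ε`. -/
def RadBound (N : ℕ) (γ ε : ℝ) (F : ℝ → Pt → ℂ) : Prop :=
  ∀ (k : ℕ) (l : List (Fin 3 × Fin 3)), k + l.length ≤ N →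
    ∀ (q : ℝ) (ω : Pt), rad ω = 1 →
      ‖(qdq^[k]) (aIter l F) q ω‖ * jb q ^ γ ≤ ε

/-- spacetime indices `α ∈ {0,1,2,3}`: `none` is the time index. -/
abbrev Ix : Type := Option (Fin 3)

/-- `L^α(ω) = (1, ω)`. -/
def Lup : Ix → Pt → ℝ
  | none => fun _ => 1
  | some i => fun ω => ω i

/-- `L_α(ω) = (−1, ω)`. -/
def Llow : Ix → Pt → ℝ
  | none => fun _ => -1
  | some i => fun ω => ω i

/-- `∂_α`. -/
def pd : Ix → (ℝ → Pt → ℂ) → ℝ → Pt → ℂ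
  | none => dT
  | some i => dX i

/-- `∂_α` (real valued). -/
def pdR : Ix → (ℝ → Pt → ℝ) → ℝ → Pt → ℝ
  | none => dTR
  | some i => dXR i

/-- the surface measure on the unit sphere `S² ⊆ ℝ³`. -/
def sphM : Measure (Metric.sphere (0 : Pt) 1) := (volume : Measure Pt).toSphere

/-- weighted `L²` norm `(∫ |g(t,x)|² w(r−t) dx)^{1/2}`. -/
def sqL2 (w : ℝ → ℝ) (g : ℝ → Pt → ℂ) (t : ℝ) : ℝ :=
  Real.sqrt (∫ x : Pt, ‖g t x‖ ^ 2 * w (rad x - t))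


/-- `𝒥_α(q,σ) = L_α(σ)·Im(Φ(q,σ)·conj(∂_qΦ(q,σ)))` -/
def Jr (Φ : ℝ → Pt → ℂ) (α : Ix) (q : ℝ) (σ : Pt) : ℝ :=
  Llow α σ * (Φ q σ * (starRingEnd ℂ) (dq Φ q σ)).im

/-- the charge `𝐪 = ∫∫ 𝒥₀ dS dq` -/
def charge (Φ : ℝ → Pt → ℂ) : ℝ :=
  ∫ q : ℝ, ∫ σ : Metric.sphere (0 : Pt) 1, Jr Φ none q σ ∂sphM

/-- the approximate scalar field
`φ_app(t,rω) = e^{−i(𝐪/4π)ln r}·Φ(q,ω)·χ(⟨q⟩/r)/r` -/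
def phiApp (χ : ℝ → ℝ) (Φ : ℝ → Pt → ℂ) : ℝ → Pt → ℂ := fun t x =>
  Complex.exp (-Complex.I * ((charge Φ / (4 * π) : ℝ) : ℂ) * ((Real.log (rad x) : ℝ) : ℂ))
    * Φ (rad x - t) ((rad x)⁻¹ • x)
    * ((χ (jb (rad x - t) / rad x) : ℝ) : ℂ) / ((rad x : ℝ) : ℂ)

/-- the approximate gauge potential `A_{α,app}` -/
def Aapp (χ χin χex : ℝ → ℝ) (Φ : ℝ → Pt → ℂ) (𝒜 : Ix → ℝ → Pt → ℝ) (α : Ix) :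
    ℝ → Pt → ℝ := fun t x =>
  (1 / (4 * π)) * (∫ η : ℝ, ∫ σ : Metric.sphere (0 : Pt) 1,
      Jr Φ α η σ / (t - ⟪x, (σ : Pt)⟫) ∂sphM) * χex (t / 12) * χin (rad x - t)
  - (1 / (2 * rad x)) * Real.log (2 * rad x / jb (t - rad x))
      * (∫ η in Set.Iic (rad x - t), Jr Φ α η ((rad x)⁻¹ • x))
      * χ (jb (rad x - t) / rad x) * χin (rad x - t)
  + (1 / (2 * rad x)) * Real.log (2 * rad x / jb (t - rad x))
      * (∫ η in Set.Ioi (rad x - t), Jr Φ α η ((rad x)⁻¹ • x))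
      * χ (jb (rad x - t) / rad x) * (1 - χin (rad x - t))
  + (charge Φ / (4 * π * rad x)) * (if α = none then 1 else 0) * χex (rad x - t)
  + 𝒜 α (rad x - t) ((rad x)⁻¹ • x) * χ (jb (rad x - t) / rad x) / rad x

/-- complexification of `A_{α,app}` -/
def AappC (χ χin χex : ℝ → ℝ) (Φ : ℝ → Pt → ℂ) (𝒜 : Ix → ℝ → Pt → ℝ) (α : Ix) :
    ℝ → Pt → ℂ := fun t x => ((Aapp χ χin χex Φ 𝒜 α t x : ℝ) : ℂ)

/-- the indicator `1_{⟨q⟩ ≤ (3/4)r}` -/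
def indWZ (t : ℝ) (x : Pt) : ℝ := if jb (rad x - t) ≤ (3 / 4) * rad x then 1 else 0

section PartOne
open scoped ContDiff

abbrev E4 : Type := ℝ × Pt

section framework
variable {F : Type*} [NormedAddCommGroup F] [NormedSpace ℝ F]
variable {X : Type*} [NormedAddCommGroup X] [NormedSpace ℝ X]

/-- smooth near a point -/
def SmA (f : X → F) (p : X) : Prop := ∀ᶠ y in 𝓝 p, ContDiffAt ℝ ∞ f y

/-- derivative along a vector field -/
def Dv (V : X → X) (f : X → F) : X → F := fun p => fderiv ℝ f p (V p)

theorem SmA.at {f : X → F} {p : X} (h : SmA f p) : ContDiffAt ℝ ∞ f p := h.self_of_nhds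

theorem SmA.diff {f : X → F} {p : X} (h : SmA f p) : DifferentiableAt ℝ f p :=
  h.at.differentiableAt (by simp)

theorem SmA.ev {f : X → F} {p : X} (h : SmA f p) : ∀ᶠ y in 𝓝 p, SmA f y :=
  Filter.Eventually.eventually_nhds h

theorem SmA.of_open {f : X → F} {p : X} {U : Set X} (hU : IsOpen U) (hp : p ∈ U)
    (h : ∀ y ∈ U, ContDiffAt ℝ ∞ f y) : SmA f p :=
  Filter.eventually_of_mem (hU.mem_nhds hp) h

theorem SmA.of_contDiff {f : X → F} {p : X} (h : ContDiff ℝ ∞ f) : SmA f p :=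
  Filter.Eventually.of_forall fun _ => h.contDiffAt

theorem SmA.congr {f g : X → F} {p : X} (h : SmA f p) (hfg : f =ᶠ[𝓝 p] g) : SmA g p := by
  have h2 := hfg.eventually_nhds
  filter_upwards [h, h2] with y hy hy2
  exact hy.congr_of_eventuallyEq (EventuallyEq.symm hy2)

theorem SmA.dv {f : X → F} {V : X → X} {p : X} (hV : SmA V p) (h : SmA f p) :
    SmA (Dv V f) p := by
  filter_upwards [h, hV] with y hy hVy
  exact (hy.fderiv_right (m := ∞) (by simp)).clm_apply hVy

theorem Dv_congr {f g : X → F} {V : X → X} {p : X} (hfg : f =ᶠ[𝓝 p] g) :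
    Dv V f =ᶠ[𝓝 p] Dv V g := by
  filter_upwards [hfg.eventually_nhds] with y hy
  unfold Dv
  rw [EventuallyEq.fderiv_eq hy]

theorem Dv_congr_at {f g : X → F} {V : X → X} {p : X} (hfg : f =ᶠ[𝓝 p] g) :
    Dv V f p = Dv V g p := (Dv_congr hfg).self_of_nhds

theorem Dv_of_curve {f : X → F} {V : X → X} {p : X} {c : F} (hf : DifferentiableAt ℝ f p)
    (h : HasDerivAt (fun ε : ℝ => f (p + ε • V p)) c 0) : Dv V f p = c := by
  have h1 : HasLineDerivAt ℝ f (fderiv ℝ f p (V p)) p (V p) := hf.hasFDerivAt.hasLineDerivAt (V p)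
  exact HasDerivAt.unique h1 h

theorem SmA.const {c : F} {p : X} : SmA (fun _ => c) p := SmA.of_contDiff contDiff_const

theorem SmA.add {f g : X → F} {p : X} (hf : SmA f p) (hg : SmA g p) :
    SmA (fun y => f y + g y) p := by
  filter_upwards [hf, hg] with y h1 h2 using h1.add h2

theorem SmA.sub {f g : X → F} {p : X} (hf : SmA f p) (hg : SmA g p) :
    SmA (fun y => f y - g y) p := by
  filter_upwards [hf, hg] with y h1 h2 using h1.sub h2

theorem SmA.neg {f : X → F} {p : X} (hf : SmA f p) :
    SmA (fun y => - f y) p := by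
  filter_upwards [hf] with y h1 using h1.neg

theorem SmA.mul {𝔸 : Type*} [NormedRing 𝔸] [NormedAlgebra ℝ 𝔸] {f g : X → 𝔸} {p : X}
    (hf : SmA f p) (hg : SmA g p) :
    SmA (fun y => f y * g y) p := by
  filter_upwards [hf, hg] with y h1 h2 using h1.mul h2

theorem SmA.sum {ι : Type*} {s : Finset ι} {f : ι → X → F} {p : X}
    (hf : ∀ i ∈ s, SmA (f i) p) : SmA (fun y => ∑ i ∈ s, f i y) p := by
  have : ∀ᶠ y in 𝓝 p, ∀ i ∈ s, ContDiffAt ℝ ∞ (f i) y := by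
    rw [Filter.eventually_all_finset]; exact hf
  filter_upwards [this] with y hy using ContDiffAt.sum hy

theorem SmA.comp {Y : Type*} [NormedAddCommGroup Y] [NormedSpace ℝ Y] {f : Y → F} {g : X → Y}
    {p : X} (hf : SmA f (g p)) (hg : SmA g p) : SmA (fun y => f (g y)) p := by
  have h1 := hg.at.continuousAt.eventually hf
  filter_upwards [h1, hg] with y h1 h2 using ContDiffAt.comp y h1 h2

theorem SmA.ofReal {f : X → ℝ} {p : X} (hf : SmA f p) : SmA (fun y => ((f y : ℝ) : ℂ)) p :=
  SmA.comp (f := fun x : ℝ => (x : ℂ)) (SmA.of_contDiff Complex.ofRealCLM.contDiff) hf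

theorem SmA.clm {G : Type*} [NormedAddCommGroup G] [NormedSpace ℝ G] (L : F →L[ℝ] G)
    {f : X → F} {p : X} (hf : SmA f p) : SmA (fun y => L (f y)) p :=
  SmA.comp (f := fun x => L x) (SmA.of_contDiff L.contDiff) hf

theorem Dv_const {c : F} {V : X → X} {p : X} : Dv V (fun _ => c) p = 0 := by simp [Dv]

theorem Dv_add {f g : X → F} {V : X → X} {p : X} (hf : SmA f p) (hg : SmA g p) :
    Dv V (fun y => f y + g y) p = Dv V f p + Dv V g p := by
  simp [Dv, fderiv_fun_add hf.diff hg.diff]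

theorem Dv_sub {f g : X → F} {V : X → X} {p : X} (hf : SmA f p) (hg : SmA g p) :
    Dv V (fun y => f y - g y) p = Dv V f p - Dv V g p := by
  simp [Dv, fderiv_fun_sub hf.diff hg.diff]

theorem Dv_neg {f : X → F} {V : X → X} {p : X} :
    Dv V (fun y => - f y) p = - Dv V f p := by
  simp [Dv, fderiv_fun_neg]

theorem Dv_mul {𝔸 : Type*} [NormedCommRing 𝔸] [NormedAlgebra ℝ 𝔸] {f g : X → 𝔸} {V : X → X} {p : X}
    (hf : SmA f p) (hg : SmA g p) :
    Dv V (fun y => f y * g y) p = Dv V f p * g p + f p * Dv V g p := by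
  simp only [Dv, fderiv_fun_mul hf.diff hg.diff]
  simp [mul_comm]
  ring

theorem Dv_sum {ι : Type*} {s : Finset ι} {f : ι → X → F} {V : X → X} {p : X}
    (hf : ∀ i ∈ s, SmA (f i) p) :
    Dv V (fun y => ∑ i ∈ s, f i y) p = ∑ i ∈ s, Dv V (f i) p := by
  simp only [Dv]
  rw [fderiv_fun_sum (fun i hi => (hf i hi).diff)]
  simp

theorem Dv_clm {G : Type*} [NormedAddCommGroup G] [NormedSpace ℝ G] (L : F →L[ℝ] G)
    {f : X → F} {V : X → X} {p : X} (hf : SmA f p) :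
    Dv V (fun y => L (f y)) p = L (Dv V f p) := by
  simp only [Dv]
  have := (L.hasFDerivAt.comp p hf.diff.hasFDerivAt).fderiv
  have h2 : fderiv ℝ (fun y => L (f y)) p = L.comp (fderiv ℝ f p) := this
  rw [h2]; rfl

theorem Dv_ofReal {f : X → ℝ} {V : X → X} {p : X} (hf : SmA f p) :
    Dv V (fun y => ((f y : ℝ) : ℂ)) p = ((Dv V f p : ℝ) : ℂ) :=
  Dv_clm Complex.ofRealCLM hf

theorem Dv_comp_real {f : X → ℝ} {h : ℝ → F} {V : X → X} {p : X} (hh : DifferentiableAt ℝ h (f p))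
    (hf : SmA f p) : Dv V (fun y => h (f y)) p = Dv V f p • deriv h (f p) := by
  simp only [Dv]
  have := (hh.hasFDerivAt.comp p hf.diff.hasFDerivAt).fderiv
  have h2 : fderiv ℝ (fun y => h (f y)) p = (fderiv ℝ h (f p)).comp (fderiv ℝ f p) := this
  rw [h2]
  simp

/-- second derivative along fields -/
theorem Dv_Dv {f : X → F} {V W : X → X} {p : X} (hW : SmA W p) (hf : SmA f p) :
    Dv V (Dv W f) p = fderiv ℝ (fderiv ℝ f) p (V p) (W p)
      + fderiv ℝ f p (fderiv ℝ W p (V p)) := by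
  have h1 : DifferentiableAt ℝ (fderiv ℝ f) p :=
    (hf.at.fderiv_right (m := ∞) (by simp)).differentiableAt (by simp)
  have := (h1.hasFDerivAt.clm_apply hW.diff.hasFDerivAt).fderiv
  have h2 : fderiv ℝ (Dv W f) p = _ := this
  unfold Dv at h2 ⊢
  rw [h2]
  simp [add_comm]

/-! iterated -/
variable {ι : Type*}
def It (V : ι → X → X) : List ι → (X → F) → (X → F)
  | [], f => f
  | i :: l, f => Dv (V i) (It V l f)

theorem It_append_singleton (V : ι → X → X) (l : List ι) (i : ι) (f : X → F) :
    It V (l ++ [i]) f = It V l (Dv (V i) f) := by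
  induction l with
  | nil => rfl
  | cons j l ih => simp only [List.cons_append, It, ih]

theorem It_congr (V : ι → X → X) (l : List ι) {f g : X → F} {p : X} (h : f =ᶠ[𝓝 p] g) :
    It V l f =ᶠ[𝓝 p] It V l g := by
  induction l with
  | nil => exact h
  | cons j l ih => exact Dv_congr ih

theorem It_smooth {V : ι → X → X} (hV : ∀ i p, SmA (V i) p) (l : List ι) {f : X → F} {p : X}
    (h : SmA f p) : SmA (It V l f) p := by
  induction l with
  | nil => exact h
  | cons j l ih => exact SmA.dv (hV j p) ih

/-- all derivatives of order at most `n` are bounded by `c` at `p` -/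
def Bd (V : ι → X → X) (n : ℕ) (f : X → F) (p : X) (c : ℝ) : Prop :=
  SmA f p ∧ ∀ l : List ι, l.length ≤ n → ‖It V l f p‖ ≤ c

variable {V : ι → X → X} {n : ℕ} {f g : X → F} {p : X} {c a b : ℝ}

theorem Bd.congr (h : Bd V n f p c) (hfg : f =ᶠ[𝓝 p] g) : Bd V n g p c :=
  ⟨h.1.congr hfg, fun l hl => by
    rw [← (It_congr V l hfg).self_of_nhds]; exact h.2 l hl⟩

theorem Bd.mono {m : ℕ} {c' : ℝ} (h : Bd V n f p c) (hm : m ≤ n) (hc : c ≤ c') : Bd V m f p c' :=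
  ⟨h.1, fun l hl => (h.2 l (hl.trans hm)).trans hc⟩

theorem Bd.le {c' : ℝ} (h : Bd V n f p c) (hc : c ≤ c') : Bd V n f p c' := h.mono le_rfl hc

theorem Bd.nonneg (h : Bd V n f p c) : 0 ≤ c := (norm_nonneg _).trans (h.2 [] (by simp))

theorem Bd.val (h : Bd V n f p c) : ‖f p‖ ≤ c := h.2 [] (by simp)

theorem Bd.dv (h : Bd V (n + 1) f p c) (hV : ∀ i p, SmA (V i) p) (i : ι) :
    Bd V n (Dv (V i) f) p c :=
  ⟨SmA.dv (hV i p) h.1, fun l hl => by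
    rw [← It_append_singleton]; exact h.2 _ (by simpa using hl)⟩

theorem Bd.zero (h : SmA f p) (hc : ‖f p‖ ≤ c) : Bd V 0 f p c :=
  ⟨h, fun l hl => by
    have : l = [] := List.eq_nil_of_length_eq_zero (by omega)
    subst this; exact hc⟩

theorem Bd.succ (h : SmA f p) (hc : ‖f p‖ ≤ c) (hd : ∀ i, Bd V n (Dv (V i) f) p c) :
    Bd V (n + 1) f p c :=
  ⟨h, fun l hl => by
    rcases List.eq_nil_or_concat l with rfl | ⟨l', i, rfl⟩
    · exact hc
    · rw [List.concat_eq_append, It_append_singleton]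
      exact (hd i).2 l' (by simpa using hl)⟩

theorem Bd.add (hV : ∀ i p, SmA (V i) p) (hf : Bd V n f p a) (hg : Bd V n g p b) :
    Bd V n (fun y => f y + g y) p (a + b) := by
  induction n generalizing f g with
  | zero => exact Bd.zero (hf.1.add hg.1) ((norm_add_le _ _).trans (add_le_add hf.val hg.val))
  | succ n ih =>
    refine Bd.succ (hf.1.add hg.1) ((norm_add_le _ _).trans (add_le_add hf.val hg.val)) fun i => ?_
    refine (ih (hf.dv hV i) (hg.dv hV i)).congr ?_
    filter_upwards [hf.1.ev, hg.1.ev] with y h1 h2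
    rw [Dv_add h1 h2]

theorem Bd.clm {G : Type*} [NormedAddCommGroup G] [NormedSpace ℝ G] (L : F →L[ℝ] G)
    (hL : ∀ v, ‖L v‖ ≤ ‖v‖)
    (hV : ∀ i p, SmA (V i) p) (hf : Bd V n f p a) :
    Bd V n (fun y => L (f y)) p a := by
  induction n generalizing f with
  | zero => exact Bd.zero (hf.1.clm L) ((hL _).trans hf.val)
  | succ n ih =>
    refine Bd.succ (hf.1.clm L) ((hL _).trans hf.val) fun i => ?_
    refine (ih (hf.dv hV i)).congr ?_
    filter_upwards [hf.1.ev] with y h1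
    rw [Dv_clm L h1]

theorem Bd.neg (hV : ∀ i p, SmA (V i) p) (hf : Bd V n f p a) :
    Bd V n (fun y => - f y) p a :=
  Bd.clm (-ContinuousLinearMap.id ℝ F) (by simp) hV hf

theorem Bd.zero_fun (n : ℕ) (hc : 0 ≤ c) : Bd V n (fun _ => (0 : F)) p c := by
  induction n with
  | zero => exact Bd.zero SmA.const (by simpa using hc)
  | succ n ih =>
    refine Bd.succ SmA.const (by simpa using hc) fun i => ih.congr ?_
    filter_upwards with y
    rw [Dv_const]

theorem Bd.const (n : ℕ) (k : F) : Bd V n (fun _ => k) p ‖k‖ := by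
  cases n with
  | zero => exact Bd.zero SmA.const le_rfl
  | succ n =>
    refine Bd.succ SmA.const le_rfl fun i =>
      (Bd.zero_fun n (norm_nonneg k)).congr ?_
    filter_upwards with y
    rw [Dv_const]

theorem Bd.mul {𝔸 : Type*} [NormedCommRing 𝔸] [NormedAlgebra ℝ 𝔸] {f g : X → 𝔸}
    (hV : ∀ i p, SmA (V i) p)
    (hf : Bd V n f p a) (hg : Bd V n g p b) :
    Bd V n (fun y => f y * g y) p (2 ^ n * (a * b)) := by
  induction n generalizing f g with
  | zero =>
    refine Bd.zero (hf.1.mul hg.1) ?_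
    simpa using (norm_mul_le _ _).trans
      (mul_le_mul hf.val hg.val (norm_nonneg _) hf.nonneg)
  | succ n ih =>
    have hab : 0 ≤ a * b := mul_nonneg hf.nonneg hg.nonneg
    refine Bd.succ (hf.1.mul hg.1) ?_ fun i => ?_
    · refine (norm_mul_le _ _).trans ((mul_le_mul hf.val hg.val (norm_nonneg _) hf.nonneg).trans ?_)
      have : (1 : ℝ) ≤ 2 ^ (n + 1) := one_le_pow₀ (by norm_num)
      nlinarith
    · have h1 := Bd.add hV (ih (hf.dv hV i) (hg.mono (Nat.le_succ n) le_rfl))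
        (ih (hf.mono (Nat.le_succ n) le_rfl) (hg.dv hV i))
      refine (h1.le (le_of_eq (by ring))).congr ?_
      filter_upwards [hf.1.ev, hg.1.ev] with y h1 h2
      rw [Dv_mul h1 h2]

end framework
end PartOne

section PartTwo
open scoped ContDiff

section uniform
variable {F : Type*} [NormedAddCommGroup F] [NormedSpace ℝ F]
variable {X : Type*} [NormedAddCommGroup X] [NormedSpace ℝ X]
variable {ι Θ : Type*}

/-- uniform bounds for families -/
def OB (V : ι → X → X) (P : Θ → X → Prop) (n : ℕ) (f : Θ → X → F) (w : Θ → X → ℝ) : Prop :=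
  ∃ C : ℝ, 0 ≤ C ∧ ∀ θ p, P θ p → Bd V n (f θ) p (C * w θ p)

variable {V : ι → X → X} {P : Θ → X → Prop} {n : ℕ} {f g : Θ → X → F} {w w' : Θ → X → ℝ}

theorem OB.congr (h : OB V P n f w) (hfg : ∀ θ p, P θ p → f θ =ᶠ[𝓝 p] g θ) : OB V P n g w := by
  obtain ⟨C, hC, h⟩ := h
  exact ⟨C, hC, fun θ p hp => (h θ p hp).congr (hfg θ p hp)⟩

theorem OB.mono {m : ℕ} (h : OB V P n f w) (hm : m ≤ n) : OB V P m f w := by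
  obtain ⟨C, hC, h⟩ := h
  exact ⟨C, hC, fun θ p hp => (h θ p hp).mono hm le_rfl⟩

theorem OB.restrict {P' : Θ → X → Prop} (h : OB V P n f w) (hP : ∀ θ p, P' θ p → P θ p) :
    OB V P' n f w := by
  obtain ⟨C, hC, h⟩ := h
  exact ⟨C, hC, fun θ p hp => h θ p (hP θ p hp)⟩

theorem OB.weight (h : OB V P n f w) (K : ℝ) (hK : 0 ≤ K)
    (hw : ∀ θ p, P θ p → w θ p ≤ K * w' θ p) : OB V P n f w' := by
  obtain ⟨C, hC, h⟩ := h
  refine ⟨C * K, by positivity, fun θ p hp => (h θ p hp).le ?_⟩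
  have := mul_le_mul_of_nonneg_left (hw θ p hp) hC
  linarith

theorem OB.add (hV : ∀ i p, SmA (V i) p) (hf : OB V P n f w) (hg : OB V P n g w) :
    OB V P n (fun θ y => f θ y + g θ y) w := by
  obtain ⟨C, hC, h⟩ := hf
  obtain ⟨C', hC', h'⟩ := hg
  exact ⟨C + C', by positivity, fun θ p hp =>
    (Bd.add hV (h θ p hp) (h' θ p hp)).le (le_of_eq (by ring))⟩

theorem OB.neg (hV : ∀ i p, SmA (V i) p) (hf : OB V P n f w) :
    OB V P n (fun θ y => - f θ y) w := by
  obtain ⟨C, hC, h⟩ := hf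
  exact ⟨C, hC, fun θ p hp => Bd.neg hV (h θ p hp)⟩

theorem OB.sub (hV : ∀ i p, SmA (V i) p) (hf : OB V P n f w) (hg : OB V P n g w) :
    OB V P n (fun θ y => f θ y - g θ y) w := by
  simpa only [sub_eq_add_neg] using OB.add hV hf (OB.neg hV hg)

theorem OB.mul {𝔸 : Type*} [NormedCommRing 𝔸] [NormedAlgebra ℝ 𝔸] {f g : Θ → X → 𝔸}
    (hV : ∀ i p, SmA (V i) p) (hf : OB V P n f w) (hg : OB V P n g w') :
    OB V P n (fun θ y => f θ y * g θ y) (fun θ y => w θ y * w' θ y) := by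
  obtain ⟨C, hC, h⟩ := hf
  obtain ⟨C', hC', h'⟩ := hg
  exact ⟨2 ^ n * (C * C'), by positivity, fun θ p hp =>
    (Bd.mul hV (h θ p hp) (h' θ p hp)).le (le_of_eq (by ring))⟩

theorem OB.zero (hw : ∀ θ p, P θ p → 0 ≤ w θ p) : OB V P n (fun _ _ => (0 : F)) w :=
  ⟨0, le_rfl, fun θ p hp => Bd.zero_fun n (by simp)⟩

theorem OB.const (k : F) : OB V P n (fun _ _ => k) (fun _ _ => 1) :=
  ⟨‖k‖, norm_nonneg _, fun θ p hp => by simpa using Bd.const n k⟩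

theorem OB.sum {κ : Type*} (s : Finset κ) {f : κ → Θ → X → F} (hV : ∀ i p, SmA (V i) p)
    (hw : ∀ θ p, P θ p → 0 ≤ w θ p)
    (hf : ∀ k ∈ s, OB V P n (f k) w) : OB V P n (fun θ y => ∑ k ∈ s, f k θ y) w := by
  classical
  induction s using Finset.induction_on with
  | empty => simpa using OB.zero hw
  | insert a s ha ih =>
    simp only [Finset.sum_insert ha]
    exact OB.add hV (hf a (by simp)) (ih fun k hk => hf k (by simp [hk]))

theorem OB.succ [Fintype ι] (hs : ∀ θ p, P θ p → SmA (f θ) p)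
    (hw : ∀ θ p, P θ p → 0 ≤ w θ p)
    (h0 : ∃ C : ℝ, 0 ≤ C ∧ ∀ θ p, P θ p → ‖f θ p‖ ≤ C * w θ p)
    (hd : ∀ i, OB V P n (fun θ => Dv (V i) (f θ)) w) : OB V P (n + 1) f w := by
  obtain ⟨C, hC, h0⟩ := h0
  choose D hD hd using hd
  have hsum : 0 ≤ ∑ i, D i := Finset.sum_nonneg fun i _ => hD i
  refine ⟨C + ∑ i, D i, by positivity, fun θ p hp => Bd.succ (hs θ p hp) ?_ fun i => ?_⟩
  · refine (h0 θ p hp).trans (mul_le_mul_of_nonneg_right (by linarith) (hw θ p hp))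
  · refine (hd i θ p hp).le (mul_le_mul_of_nonneg_right ?_ (hw θ p hp))
    have := Finset.single_le_sum (f := D) (fun i _ => hD i) (Finset.mem_univ i)
    linarith

theorem OB.zeroth (hs : ∀ θ p, P θ p → SmA (f θ) p)
    (h0 : ∃ C : ℝ, 0 ≤ C ∧ ∀ θ p, P θ p → ‖f θ p‖ ≤ C * w θ p) : OB V P 0 f w := by
  obtain ⟨C, hC, h0⟩ := h0
  exact ⟨C, hC, fun θ p hp => Bd.zero (hs θ p hp) (h0 θ p hp)⟩

theorem OB.sm (h : OB V P n f w) {θ : Θ} {p : X} (hp : P θ p) : SmA (f θ) p := by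
  obtain ⟨C, hC, h⟩ := h
  exact (h θ p hp).1

theorem OB.val (h : OB V P n f w) :
    ∃ C : ℝ, 0 ≤ C ∧ ∀ θ p, P θ p → ‖f θ p‖ ≤ C * w θ p := by
  obtain ⟨C, hC, h⟩ := h
  exact ⟨C, hC, fun θ p hp => (h θ p hp).val⟩

theorem OB.dv (h : OB V P (n + 1) f w) (hV : ∀ i p, SmA (V i) p) (i : ι) :
    OB V P n (fun θ => Dv (V i) (f θ)) w := by
  obtain ⟨C, hC, h⟩ := h
  exact ⟨C, hC, fun θ p hp => (h θ p hp).dv hV i⟩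

end uniform

/-! frames -/
abbrev ee (i : Fin 3) : Pt := EuclideanSpace.single i 1

def ZV : VF → E4 → E4
  | .time => fun _ => (1, 0)
  | .space i => fun _ => (0, ee i)
  | .rot i j => fun p => (0, p.2 i • ee j - p.2 j • ee i)
  | .boost i => fun p => (p.2 i, p.1 • ee i)
  | .scal => fun p => p

inductive RF : Type
  | qd : RF
  | eul : RF
  | rot : Fin 3 → Fin 3 → RF
  deriving DecidableEq, Fintype

theorem jb_pos (q : ℝ) : 0 < jb q := Real.sqrt_pos.2 (by positivity)
theorem jb_sq (q : ℝ) : jb q ^ 2 = 1 + q ^ 2 := Real.sq_sqrt (by positivity)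
theorem jb_ge_one (q : ℝ) : 1 ≤ jb q := by
  rw [jb, Real.one_le_sqrt]; nlinarith [sq_nonneg q]
theorem jb_ge_abs (q : ℝ) : |q| ≤ jb q := by
  apply Real.abs_le_sqrt; linarith
theorem jb_le (q : ℝ) : jb q ≤ 1 + |q| := by
  rw [jb, Real.sqrt_le_left (by positivity)]
  nlinarith [sq_abs q, abs_nonneg q]
theorem jb_neg (q : ℝ) : jb (-q) = jb q := by simp [jb]
theorem jb_contDiff : ContDiff ℝ ∞ jb := by
  unfold jb
  exact ContDiff.sqrt (by fun_prop) (fun x => by positivity)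
theorem jb_hasDerivAt (q : ℝ) : HasDerivAt jb (q * (jb q)⁻¹) q := by
  have h1 : HasDerivAt (fun q : ℝ => 1 + q ^ 2) (2 * q) q := by
    simpa using ((hasDerivAt_pow 2 q).const_add 1)
  have h2 := h1.sqrt (by positivity)
  refine h2.congr_deriv ?_
  change 2 * q / (2 * jb q) = _
  have := (jb_pos q).ne'
  field_simp

def RV : RF → E4 → E4
  | .qd => fun p => (jb p.1, 0)
  | .eul => fun p => (0, p.2)
  | .rot i j => fun p => (0, p.2 i • ee j - p.2 j • ee i)

def MV : E4 → E4 := fun p => (‖p.2‖, p.2)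
def NV : E4 → E4 := fun p => (-‖p.2‖, p.2)

theorem xx_contDiff (i : Fin 3) : ContDiff ℝ ∞ (fun p : E4 => p.2 i) := by
  fun_prop

theorem ZV_smooth (z : VF) (p : E4) : SmA (ZV z) p := by
  apply SmA.of_contDiff
  cases z <;> simp only [ZV] <;> fun_prop

theorem RV_smooth (z : RF) (p : E4) : SmA (RV z) p := by
  apply SmA.of_contDiff
  have := jb_contDiff
  cases z <;> simp only [RV] <;> fun_prop

theorem x0_open : IsOpen {p : E4 | p.2 ≠ 0} := isOpen_ne_fun continuous_snd continuous_const

theorem x0_ev {p : E4} (hp : p.2 ≠ 0) : ∀ᶠ y : E4 in 𝓝 p, y.2 ≠ 0 := x0_open.mem_nhds hp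

theorem SmA.of_x0 {F : Type*} [NormedAddCommGroup F] [NormedSpace ℝ F] {f : E4 → F} {p : E4}
    (hp : p.2 ≠ 0) (h : ∀ y : E4, y.2 ≠ 0 → ContDiffAt ℝ ∞ f y) : SmA f p :=
  SmA.of_open x0_open hp h

theorem eq_of_x0 {F : Type*} {f g : E4 → F} {p : E4}
    (hp : p.2 ≠ 0) (h : ∀ y : E4, y.2 ≠ 0 → f y = g y) : f =ᶠ[𝓝 p] g := by
  filter_upwards [x0_ev hp] with y hy using h y hy

/-! base functions (real valued) -/
def rr : E4 → ℝ := fun p => ‖p.2‖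
def gq : E4 → ℝ := fun p => ‖p.2‖ - p.1
def gρ : E4 → ℝ := fun p => ‖p.2‖⁻¹
def gj : E4 → ℝ := fun p => jb (gq p)
def ga : E4 → ℝ := fun p => (jb (gq p))⁻¹
def gb : E4 → ℝ := fun p => gq p * ga p
def gs : E4 → ℝ := fun p => gj p * gρ p
def gω (i : Fin 3) : E4 → ℝ := fun p => p.2 i * gρ p
def gτ : E4 → ℝ := fun p => p.1 * gρ p
def gL : E4 → ℝ := fun p => Real.log (2 * rr p) - Real.log (gj p)
def gκ : E4 → ℝ := fun p => (1 + gτ p)⁻¹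

theorem rr_pos {p : E4} (hp : p.2 ≠ 0) : 0 < rr p := norm_pos_iff.2 hp
theorem gρ_pos {p : E4} (hp : p.2 ≠ 0) : 0 < gρ p := inv_pos.2 (rr_pos hp)
theorem gj_pos (p : E4) : 0 < gj p := jb_pos _
theorem ga_pos (p : E4) : 0 < ga p := inv_pos.2 (jb_pos _)

theorem rr_sm {p : E4} (hp : p.2 ≠ 0) : SmA rr p :=
  SmA.of_x0 hp fun y hy => contDiffAt_snd.norm ℝ hy
theorem fst_sm {p : E4} : SmA (fun p : E4 => p.1) p := SmA.of_contDiff contDiff_fst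
theorem xi_sm {i : Fin 3} {p : E4} : SmA (fun p : E4 => p.2 i) p := SmA.of_contDiff (xx_contDiff i)
theorem gq_sm {p : E4} (hp : p.2 ≠ 0) : SmA gq p := (rr_sm hp).sub fst_sm
theorem SmA.inv {X : Type*} [NormedAddCommGroup X] [NormedSpace ℝ X] {f : X → ℝ} {p : X}
    (h : SmA f p) (h0 : f p ≠ 0) : SmA (fun y => (f y)⁻¹) p := by
  have h1 := h.at.continuousAt.eventually_ne h0
  filter_upwards [h, h1] with y h2 h3 using h2.inv h3
theorem gρ_sm {p : E4} (hp : p.2 ≠ 0) : SmA gρ p := (rr_sm hp).inv (rr_pos hp).ne'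
theorem gj_sm {p : E4} (hp : p.2 ≠ 0) : SmA gj p :=
  SmA.comp (f := jb) (SmA.of_contDiff jb_contDiff) (gq_sm hp)
theorem ga_sm {p : E4} (hp : p.2 ≠ 0) : SmA ga p := (gj_sm hp).inv (gj_pos p).ne'
theorem gb_sm {p : E4} (hp : p.2 ≠ 0) : SmA gb p := (gq_sm hp).mul (ga_sm hp)
theorem gs_sm {p : E4} (hp : p.2 ≠ 0) : SmA gs p := (gj_sm hp).mul (gρ_sm hp)
theorem gω_sm {i : Fin 3} {p : E4} (hp : p.2 ≠ 0) : SmA (gω i) p := xi_sm.mul (gρ_sm hp)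
theorem gτ_sm {p : E4} (hp : p.2 ≠ 0) : SmA gτ p := fst_sm.mul (gρ_sm hp)
theorem SmA.log {X : Type*} [NormedAddCommGroup X] [NormedSpace ℝ X] {f : X → ℝ} {p : X}
    (h : SmA f p) (h0 : f p ≠ 0) : SmA (fun y => Real.log (f y)) p := by
  have h1 := h.at.continuousAt.eventually_ne h0
  filter_upwards [h, h1] with y h2 h3 using h2.log h3
theorem gL_sm {p : E4} (hp : p.2 ≠ 0) : SmA gL p :=
  ((SmA.const.mul (rr_sm hp)).log (by have := rr_pos hp; positivity)).sub
    ((gj_sm hp).log (gj_pos p).ne')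
theorem gκ_sm {p : E4} (hp : p.2 ≠ 0) (h : 0 ≤ p.1) : SmA gκ p :=
  (SmA.const.add (gτ_sm hp)).inv (by have := gρ_pos hp; simp only [gτ]; positivity)

/-! derivatives along a general field -/
def mu (V : E4 → E4) (p : E4) : ℝ := Dv V rr p * gρ p
def nu (V : E4 → E4) (p : E4) : ℝ := Dv V gq p * ga p

variable {V : E4 → E4} {p : E4}
theorem Dv_inv {X : Type*} [NormedAddCommGroup X] [NormedSpace ℝ X] {V : X → X} {f : X → ℝ} {p : X}
    (h : SmA f p) (h0 : f p ≠ 0) :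
    Dv V (fun y => (f y)⁻¹) p = - (Dv V f p * ((f p)⁻¹) ^ 2) := by
  have := Dv_comp_real (V := V) (h := fun x : ℝ => x⁻¹) (differentiableAt_inv h0) h
  rw [this]; simp [deriv_inv']
theorem Dv_log {X : Type*} [NormedAddCommGroup X] [NormedSpace ℝ X] {V : X → X} {f : X → ℝ} {p : X}
    (h : SmA f p) (h0 : f p ≠ 0) :
    Dv V (fun y => Real.log (f y)) p = Dv V f p * (f p)⁻¹ := by
  have := Dv_comp_real (V := V) (h := Real.log) (Real.differentiableAt_log h0) h
  rw [this]; simp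
theorem Dv_fst : Dv V (fun p : E4 => p.1) p = (V p).1 := by
  simp [Dv, fderiv_fst]
theorem Dv_xi (i : Fin 3) : Dv V (fun p : E4 => p.2 i) p = (V p).2 i := by
  have : (fun p : E4 => p.2 i) = ((EuclideanSpace.proj i : Pt →L[ℝ] ℝ).comp
    (ContinuousLinearMap.snd ℝ ℝ Pt)) := by ext p; simp
  simp only [Dv]
  rw [this, ContinuousLinearMap.fderiv]; simp
theorem Dv_rr (hp : p.2 ≠ 0) : Dv V rr p = (∑ i, p.2 i * (V p).2 i) * gρ p := by
  have h1 : HasFDerivAt (fun x : Pt => ‖x‖) (‖p.2‖⁻¹ • innerSL ℝ p.2) p.2 := by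
    have := (hasStrictFDerivAt_norm_sq p.2).hasFDerivAt
    have h3 : HasFDerivAt (fun x : Pt => √(‖x‖ ^ 2)) _ p.2 := this.sqrt (by simpa using hp)
    have h4 : (fun x : Pt => √(‖x‖ ^ 2)) = fun x => ‖x‖ := by ext x; simp
    rw [h4] at h3
    refine h3.congr_fderiv ?_
    ext v
    have : ‖p.2‖ ≠ 0 := by simpa using hp
    simp
    field_simp
  have h2 := (h1.comp p hasFDerivAt_snd).fderiv
  have h3 : fderiv ℝ rr p = _ := h2
  simp only [Dv]
  rw [h3]
  simp only [gρ, ContinuousLinearMap.comp_apply, ContinuousLinearMap.smul_apply,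
    innerSL_apply_apply, PiLp.inner_apply]
  simp [mul_comm]
theorem Dv_gq (hp : p.2 ≠ 0) : Dv V gq p = Dv V rr p - (V p).1 := by
  have := Dv_sub (V := V) (rr_sm hp) (fst_sm (p := p))
  rw [Dv_fst] at this
  exact this
theorem Dv_rr' (hp : p.2 ≠ 0) : Dv V rr p = mu V p * rr p := by
  have := (rr_pos hp).ne'
  simp only [mu, gρ, rr] at *
  field_simp
theorem Dv_gq' : Dv V gq p = nu V p * gj p := by
  have := (gj_pos p).ne'
  simp only [nu, ga, gj] at *
  field_simp
theorem Dv_gρ (hp : p.2 ≠ 0) : Dv V gρ p = - (mu V p * gρ p) := by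
  have := Dv_inv (V := V) (rr_sm hp) (rr_pos hp).ne'
  refine this.trans ?_
  simp only [mu, gρ, rr]; ring
theorem Dv_gj (hp : p.2 ≠ 0) : Dv V gj p = nu V p * gb p * gj p := by
  have := Dv_comp_real (V := V) (h := jb) (jb_hasDerivAt (gq p)).differentiableAt (gq_sm hp)
  refine this.trans ?_
  rw [(jb_hasDerivAt (gq p)).deriv, Dv_gq']
  simp only [gb, ga, smul_eq_mul]; ring
theorem Dv_ga (hp : p.2 ≠ 0) : Dv V ga p = - (nu V p * gb p * ga p) := by
  have := Dv_inv (V := V) (gj_sm hp) (gj_pos p).ne'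
  refine this.trans ?_
  rw [Dv_gj hp]
  have h := (gj_pos p).ne'
  simp only [ga]
  simp only [gj] at *
  field_simp
theorem ga_gj : ga p * gj p = 1 := inv_mul_cancel₀ (gj_pos p).ne'
theorem gρ_rr (hp : p.2 ≠ 0) : gρ p * rr p = 1 := inv_mul_cancel₀ (rr_pos hp).ne'
theorem gab_sq : ga p ^ 2 + gb p ^ 2 = 1 := by
  have h := (gj_pos p).ne'
  have h2 := jb_sq (gq p)
  simp only [gb, ga]
  simp only [gj] at *
  field_simp
  linarith
theorem Dv_gb (hp : p.2 ≠ 0) : Dv V gb p = nu V p * ga p ^ 2 := by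
  have := Dv_mul (V := V) (gq_sm hp) (ga_sm hp)
  refine this.trans ?_
  rw [Dv_ga hp, Dv_gq']
  have h1 := ga_gj (p := p)
  have h2 := gab_sq (p := p)
  have h3 : gq p * ga p = gb p := rfl
  linear_combination nu V p * h1 - nu V p * h2 - nu V p * gb p * h3
theorem Dv_gs (hp : p.2 ≠ 0) : Dv V gs p = nu V p * gb p * gs p - mu V p * gs p := by
  refine (Dv_mul (V := V) (gj_sm hp) (gρ_sm hp)).trans ?_
  rw [Dv_gj hp, Dv_gρ hp]; simp only [gs]; ring
theorem Dv_gω (i : Fin 3) (hp : p.2 ≠ 0) :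
    Dv V (gω i) p = (V p).2 i * gρ p - mu V p * gω i p := by
  refine (Dv_mul (V := V) xi_sm (gρ_sm hp)).trans ?_
  rw [Dv_xi, Dv_gρ hp]; simp only [gω]; ring
theorem Dv_gτ (hp : p.2 ≠ 0) :
    Dv V gτ p = (V p).1 * gρ p - mu V p * gτ p := by
  refine (Dv_mul (V := V) fst_sm (gρ_sm hp)).trans ?_
  rw [Dv_fst, Dv_gρ hp]; simp only [gτ]; ring
theorem Dv_gL (hp : p.2 ≠ 0) : Dv V gL p = mu V p - nu V p * gb p := by
  have hr := rr_pos hp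
  refine (Dv_sub (V := V) ((SmA.const.mul (rr_sm hp)).log (by positivity))
    ((gj_sm hp).log (gj_pos p).ne')).trans ?_
  rw [Dv_log (SmA.const.mul (rr_sm hp)) (by positivity), Dv_log (gj_sm hp) (gj_pos p).ne',
    Dv_mul SmA.const (rr_sm hp), Dv_const, Dv_gj hp, Dv_rr' hp]
  have := (gj_pos p).ne'
  field_simp
  ring
theorem Dv_gκ (hp : p.2 ≠ 0) (h : 0 ≤ p.1) :
    Dv V gκ p = - (Dv V gτ p * gκ p ^ 2) := by
  have h0 : 1 + gτ p ≠ 0 := by have := gρ_pos hp; simp only [gτ]; positivity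
  refine (Dv_inv (V := V) (SmA.const.add (gτ_sm hp)) h0).trans ?_
  rw [Dv_add SmA.const (gτ_sm hp), Dv_const]
  simp only [gκ]; ring
theorem gω_sq (hp : p.2 ≠ 0) : ∑ i, gω i p ^ 2 = 1 := by
  have h := rr_pos hp
  have h1 : rr p ^ 2 = ∑ i, p.2 i ^ 2 := by simp [rr, EuclideanSpace.norm_sq_eq]
  have h2 := gρ_rr hp
  simp only [gω, mul_pow, ← Finset.sum_mul, ← h1]
  linear_combination (gρ p * rr p + 1) * h2
end PartTwo

section PartThree
open scoped ContDiff

theorem OB.reparam {F : Type*} [NormedAddCommGroup F] [NormedSpace ℝ F]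
    {X : Type*} [NormedAddCommGroup X] [NormedSpace ℝ X] {ι Θ Θ' : Type*}
    {V : ι → X → X} {P : Θ → X → Prop} {P' : Θ' → X → Prop} {n : ℕ} {f : Θ → X → F}
    {w : Θ → X → ℝ} (h : OB V P n f w) (φ : Θ' → Θ) (hP : ∀ θ p, P' θ p → P (φ θ) p) :
    OB V P' n (fun θ => f (φ θ)) (fun θ => w (φ θ)) := by
  obtain ⟨C, hC, h⟩ := h
  exact ⟨C, hC, fun θ p hp => h _ _ (hP _ _ hp)⟩

def one' {Θ X : Type*} : Θ → X → ℝ := fun _ _ => 1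

section alg
variable {F : Type*} [NormedAddCommGroup F] [NormedSpace ℝ F]
  {X : Type*} [NormedAddCommGroup X] [NormedSpace ℝ X] {ι Θ : Type*}
  {V : ι → X → X} {P : Θ → X → Prop} {n : ℕ} {w w' : Θ → X → ℝ}

theorem OB.ofReal {f : Θ → X → ℝ} (hV : ∀ i p, SmA (V i) p) (h : OB V P n f w) :
    OB V P n (fun θ p => ((f θ p : ℝ) : ℂ)) w := by
  obtain ⟨C, hC, h⟩ := h
  exact ⟨C, hC, fun θ p hp => Bd.clm Complex.ofRealCLM (by simp) hV (h θ p hp)⟩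

theorem OB.mul1 {𝔸 : Type*} [NormedCommRing 𝔸] [NormedAlgebra ℝ 𝔸] {f g : Θ → X → 𝔸}
    (hV : ∀ i p, SmA (V i) p) (hf : OB V P n f one') (hg : OB V P n g w) :
    OB V P n (fun θ y => f θ y * g θ y) w := by
  simpa [one'] using OB.mul hV hf hg

theorem OB.eigen [Fintype ι] (hV : ∀ i p, SmA (V i) p) {𝔸 : Type*} [NormedCommRing 𝔸]
    [NormedAlgebra ℝ 𝔸] {f : Θ → X → 𝔸} {h : ι → Θ → X → 𝔸}
    (hs : ∀ θ p, P θ p → SmA (f θ) p)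
    (hw : ∀ θ p, P θ p → 0 ≤ w θ p)
    (h0 : ∃ C : ℝ, 0 ≤ C ∧ ∀ θ p, P θ p → ‖f θ p‖ ≤ C * w θ p)
    (hd : ∀ i θ p, P θ p → Dv (V i) (f θ) =ᶠ[𝓝 p] fun y => h i θ y * f θ y)
    (n : ℕ) (hh : ∀ i, ∀ m < n, OB V P m (h i) one') : OB V P n f w := by
  induction n with
  | zero => exact OB.zeroth hs h0
  | succ n ih =>
    refine OB.succ hs hw h0 fun i => ?_
    refine (OB.mul1 hV (hh i n (Nat.lt_succ_self n))
      (ih fun i m hm => hh i m (Nat.lt_succ_of_lt hm))).congr fun θ p hp => ?_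
    exact (hd i θ p hp).symm
end alg

/-- the good region -/
def Good (p : E4) : Prop := p.2 ≠ 0 ∧ gρ p ≤ 30 ∧ |gτ p| ≤ 30

def muZ : VF → E4 → ℝ
  | .time => fun _ => 0
  | .space i => fun p => gρ p * gω i p
  | .rot _ _ => fun _ => 0
  | .boost i => fun p => gτ p * gω i p
  | .scal => fun _ => 1

def nuZ : VF → E4 → ℝ
  | .time => fun p => - ga p
  | .space i => fun p => gω i p * ga p
  | .rot _ _ => fun _ => 0
  | .boost i => fun p => - (gω i p * gb p)
  | .scal => fun p => gb p

theorem sum_ee (f : Fin 3 → ℝ) (i : Fin 3) : ∑ j, f j * (ee i) j = f i := by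
  simp [ee, EuclideanSpace.single_apply]

theorem Dv_rr_Z (z : VF) {p : E4} (hp : p.2 ≠ 0) : Dv (ZV z) rr p = muZ z p * rr p := by
  have h1 := gρ_rr hp
  have h2 := gω_sq hp
  rw [Dv_rr hp]
  cases z with
  | time => simp [ZV, muZ]
  | space i => simp only [ZV, muZ, sum_ee, gω]; linear_combination (-p.2 i * gρ p) * h1
  | rot i j =>
    simp only [ZV, muZ, PiLp.sub_apply, PiLp.smul_apply, smul_eq_mul, mul_sub, ← mul_assoc,
      Finset.sum_sub_distrib, sum_ee]
    ring
  | boost i =>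
    simp only [ZV, muZ, PiLp.smul_apply, smul_eq_mul, ← mul_assoc, sum_ee, gω, gτ]
    linear_combination (-p.1 * p.2 i * gρ p) * h1
  | scal =>
    simp only [ZV, muZ]
    have : ∑ i, p.2 i * p.2 i = rr p ^ 2 := by
      simp only [← sq]; simp [rr, EuclideanSpace.norm_sq_eq]
    rw [this]; linear_combination rr p * h1

theorem mu_ZV (z : VF) {p : E4} (hp : p.2 ≠ 0) : mu (ZV z) p = muZ z p := by
  have h1 := gρ_rr hp
  rw [mu, Dv_rr_Z z hp]; linear_combination muZ z p * h1

theorem nu_ZV (z : VF) {p : E4} (hp : p.2 ≠ 0) : nu (ZV z) p = nuZ z p := by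
  have h1 := gρ_rr hp
  rw [nu, Dv_gq hp, Dv_rr_Z z hp]
  cases z with
  | time => simp [ZV, muZ, nuZ]
  | space i => simp only [ZV, muZ, nuZ]; linear_combination gω i p * ga p * h1
  | rot i j => simp [ZV, muZ, nuZ]
  | boost i =>
    simp only [ZV, muZ, nuZ, gb, gω, gτ, gq]
    simp only [rr] at h1 ⊢
    linear_combination (p.1 * p.2 i * gρ p * ga p + p.2 i * ga p) * h1
  | scal => simp only [ZV, muZ, nuZ, gb, gq, rr]; ring

theorem Z_hV : ∀ i p, SmA (ZV i) p := ZV_smooth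
theorem R_hV : ∀ i p, SmA (RV i) p := RV_smooth

theorem abs_gω_le {p : E4} (hp : p.2 ≠ 0) (i : Fin 3) : |gω i p| ≤ 1 := by
  have h := gω_sq hp
  have h2 : gω i p ^ 2 ≤ ∑ i, gω i p ^ 2 :=
    Finset.single_le_sum (f := fun i => gω i p ^ 2) (fun i _ => sq_nonneg _) (Finset.mem_univ i)
  rw [h] at h2
  exact (sq_le_one_iff_abs_le_one _).1 h2
theorem abs_ga_le (p : E4) : |ga p| ≤ 1 := by
  rw [abs_of_pos (ga_pos p)]; exact inv_le_one_of_one_le₀ (jb_ge_one _)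
theorem abs_gb_le (p : E4) : |gb p| ≤ 1 := by
  have h := gab_sq (p := p)
  exact (sq_le_one_iff_abs_le_one _).1 (by nlinarith [sq_nonneg (ga p)])

section gens
variable {Θ : Type*} {P : Θ → E4 → Prop}

theorem one'_nonneg {X : Type*} {P : Θ → X → Prop} :
    ∀ θ p, P θ p → 0 ≤ (one' : Θ → X → ℝ) θ p := fun _ _ _ => by simp [one']

theorem OB.const' {F X ι : Type*} [NormedAddCommGroup F] [NormedSpace ℝ F]
    [NormedAddCommGroup X] [NormedSpace ℝ X] {V : ι → X → X} {P : Θ → X → Prop} {n : ℕ} (k : F) :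
    OB V P n (fun _ _ => k) one' := OB.const k

/-- the generators of the symbol algebra are bounded -/
theorem gens_OB (hP : ∀ θ p, P θ p → Good p) (n : ℕ) :
    OB ZV P n (fun _ => ga) one' ∧ OB ZV P n (fun _ => gb) one' ∧
    (∀ i, OB ZV P n (fun _ => gω i) one') ∧ OB ZV P n (fun _ => gρ) (fun _ => gρ) ∧
    OB ZV P n (fun _ => gρ) one' ∧ OB ZV P n (fun _ => gτ) one' ∧
    (∀ z, OB ZV P n (fun _ => muZ z) one') ∧ (∀ z, OB ZV P n (fun _ => nuZ z) one') := by
  have hV := Z_hV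
  have hx : ∀ θ p, P θ p → p.2 ≠ 0 := fun θ p hp => (hP θ p hp).1
  -- the last two follow
  have key : ∀ m, (OB ZV P m (fun _ => ga) one' ∧ OB ZV P m (fun _ => gb) one' ∧
    (∀ i, OB ZV P m (fun _ => gω i) one') ∧ OB ZV P m (fun _ => gρ) (fun _ => gρ) ∧
    OB ZV P m (fun _ => gρ) one' ∧ OB ZV P m (fun _ => gτ) one') →
    (∀ z, OB ZV P m (fun _ => muZ z) one') ∧ (∀ z, OB ZV P m (fun _ => nuZ z) one') := by
    rintro m ⟨ha, hb, hω, -, hρ, hτ⟩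
    refine ⟨fun z => ?_, fun z => ?_⟩
    · cases z with
      | time => exact OB.const' 0
      | space i => exact OB.mul1 hV hρ (hω i)
      | rot i j => exact OB.const' 0
      | boost i => exact OB.mul1 hV hτ (hω i)
      | scal => exact OB.const' 1
    · cases z with
      | time => exact OB.neg hV ha
      | space i => exact OB.mul1 hV (hω i) ha
      | rot i j => exact OB.const' 0
      | boost i => exact OB.neg hV (OB.mul1 hV (hω i) hb)
      | scal => exact hb
  suffices H : OB ZV P n (fun _ => ga) one' ∧ OB ZV P n (fun _ => gb) one' ∧
    (∀ i, OB ZV P n (fun _ => gω i) one') ∧ OB ZV P n (fun _ => gρ) (fun _ => gρ) ∧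
    OB ZV P n (fun _ => gρ) one' ∧ OB ZV P n (fun _ => gτ) one' by
    obtain ⟨h1, h2⟩ := key n H
    obtain ⟨a, b, c, d, e, f⟩ := H
    exact ⟨a, b, c, d, e, f, h1, h2⟩
  have sa : ∀ θ p, P θ p → SmA ((fun _ => ga : Θ → E4 → ℝ) θ) p := fun θ p hp => ga_sm (hx θ p hp)
  have sb : ∀ θ p, P θ p → SmA ((fun _ => gb : Θ → E4 → ℝ) θ) p := fun θ p hp => gb_sm (hx θ p hp)
  have sω : ∀ i, ∀ θ p, P θ p → SmA ((fun _ => gω i : Θ → E4 → ℝ) θ) p :=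
    fun i θ p hp => gω_sm (hx θ p hp)
  have sρ : ∀ θ p, P θ p → SmA ((fun _ => gρ : Θ → E4 → ℝ) θ) p := fun θ p hp => gρ_sm (hx θ p hp)
  have sτ : ∀ θ p, P θ p → SmA ((fun _ => gτ : Θ → E4 → ℝ) θ) p := fun θ p hp => gτ_sm (hx θ p hp)
  have ba : ∃ C : ℝ, 0 ≤ C ∧ ∀ (θ : Θ) p, P θ p → ‖ga p‖ ≤ C * (one' : Θ → E4 → ℝ) θ p :=
    ⟨1, zero_le_one, fun θ p hp => by simpa [one'] using abs_ga_le p⟩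
  have bb : ∃ C : ℝ, 0 ≤ C ∧ ∀ (θ : Θ) p, P θ p → ‖gb p‖ ≤ C * (one' : Θ → E4 → ℝ) θ p :=
    ⟨1, zero_le_one, fun θ p hp => by simpa [one'] using abs_gb_le p⟩
  have bω : ∀ i, ∃ C : ℝ, 0 ≤ C ∧ ∀ (θ : Θ) p, P θ p → ‖gω i p‖ ≤ C * (one' : Θ → E4 → ℝ) θ p :=
    fun i => ⟨1, zero_le_one, fun θ p hp => by simpa [one'] using abs_gω_le (hx θ p hp) i⟩
  have bρ : ∃ C : ℝ, 0 ≤ C ∧ ∀ (θ : Θ) p, P θ p → ‖gρ p‖ ≤ C * gρ p :=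
    ⟨1, zero_le_one, fun θ p hp => by
      rw [Real.norm_of_nonneg (gρ_pos (hx θ p hp)).le, one_mul]⟩
  have bρ1 : ∃ C : ℝ, 0 ≤ C ∧ ∀ (θ : Θ) p, P θ p → ‖gρ p‖ ≤ C * (one' : Θ → E4 → ℝ) θ p :=
    ⟨30, by norm_num, fun θ p hp => by
      rw [Real.norm_of_nonneg (gρ_pos (hx θ p hp)).le]; simpa [one'] using (hP θ p hp).2.1⟩
  have bτ : ∃ C : ℝ, 0 ≤ C ∧ ∀ (θ : Θ) p, P θ p → ‖gτ p‖ ≤ C * (one' : Θ → E4 → ℝ) θ p :=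
    ⟨30, by norm_num, fun θ p hp => by simpa [one'] using (hP θ p hp).2.2⟩
  have wρ : ∀ (θ : Θ) p, P θ p → 0 ≤ gρ p := fun θ p hp => (gρ_pos (hx θ p hp)).le
  induction n with
  | zero =>
    exact ⟨OB.zeroth sa ba, OB.zeroth sb bb, fun i => OB.zeroth (sω i) (bω i), OB.zeroth sρ bρ,
      OB.zeroth sρ bρ1, OB.zeroth sτ bτ⟩
  | succ n ih =>
    obtain ⟨hmu, hnu⟩ := key n ih
    obtain ⟨ha, hb, hω, hρ, hρ1, hτ⟩ := ih
    refine ⟨?_, ?_, fun i => ?_, ?_, ?_, ?_⟩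
    · refine OB.succ sa one'_nonneg ba fun z => ?_
      refine (OB.neg hV (OB.mul1 hV (OB.mul1 hV (hnu z) hb) ha)).congr fun θ p hp => ?_
      refine eq_of_x0 (hx θ p hp) fun y hy => ?_
      rw [Dv_ga hy, nu_ZV z hy]
    · refine OB.succ sb one'_nonneg bb fun z => ?_
      refine (OB.mul1 hV (hnu z) (OB.mul1 hV ha ha)).congr fun θ p hp => ?_
      refine eq_of_x0 (hx θ p hp) fun y hy => ?_
      rw [Dv_gb hy, nu_ZV z hy, sq]
    · refine OB.succ (sω i) one'_nonneg (bω i) fun z => ?_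
      have hcoef : OB ZV P n (fun _ p => (ZV z p).2 i * gρ p) one' := by
        cases z with
        | time => simpa [ZV] using OB.const' (0 : ℝ)
        | space j => exact OB.mul1 hV (OB.const' ((ee j) i)) hρ1
        | rot j k =>
          refine (OB.sub hV (OB.mul1 hV (OB.const' ((ee k) i)) (hω j))
            (OB.mul1 hV (OB.const' ((ee j) i)) (hω k))).congr fun θ p hp => ?_
          refine eq_of_x0 (hx θ p hp) fun y hy => ?_
          simp only [ZV, gω, PiLp.sub_apply, PiLp.smul_apply, smul_eq_mul]; ring
        | boost j =>
          refine (OB.mul1 hV (OB.const' ((ee j) i)) hτ).congr fun θ p hp => ?_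
          refine eq_of_x0 (hx θ p hp) fun y hy => ?_
          simp only [ZV, gτ, PiLp.smul_apply, smul_eq_mul]; ring
        | scal => exact hω i
      refine (OB.sub hV hcoef (OB.mul1 hV (hmu z) (hω i))).congr fun θ p hp => ?_
      refine eq_of_x0 (hx θ p hp) fun y hy => ?_
      rw [Dv_gω i hy, mu_ZV z hy]
    · refine OB.succ sρ wρ bρ fun z => ?_
      refine (OB.neg hV (OB.mul1 hV (hmu z) hρ)).congr fun θ p hp => ?_
      refine eq_of_x0 (hx θ p hp) fun y hy => ?_
      rw [Dv_gρ hy, mu_ZV z hy]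
    · refine OB.succ sρ one'_nonneg bρ1 fun z => ?_
      refine (OB.neg hV (OB.mul1 hV (hmu z) hρ1)).congr fun θ p hp => ?_
      refine eq_of_x0 (hx θ p hp) fun y hy => ?_
      rw [Dv_gρ hy, mu_ZV z hy]
    · refine OB.succ sτ one'_nonneg bτ fun z => ?_
      have hcoef : OB ZV P n (fun _ p => (ZV z p).1 * gρ p) one' := by
        cases z with
        | time => simpa [ZV] using hρ1
        | space j => simpa [ZV] using OB.const' (0 : ℝ)
        | rot j k => simpa [ZV] using OB.const' (0 : ℝ)
        | boost j => exact hω j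
        | scal => exact hτ
      refine (OB.sub hV hcoef (OB.mul1 hV (hmu z) hτ)).congr fun θ p hp => ?_
      refine eq_of_x0 (hx θ p hp) fun y hy => ?_
      rw [Dv_gτ hy, mu_ZV z hy]

theorem ga_OB (hP : ∀ θ p, P θ p → Good p) (n : ℕ) : OB ZV P n (fun _ => ga) one' :=
  (gens_OB hP n).1
theorem gb_OB (hP : ∀ θ p, P θ p → Good p) (n : ℕ) : OB ZV P n (fun _ => gb) one' :=
  (gens_OB hP n).2.1
theorem gω_OB (hP : ∀ θ p, P θ p → Good p) (n : ℕ) (i : Fin 3) : OB ZV P n (fun _ => gω i) one' :=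
  (gens_OB hP n).2.2.1 i
theorem gρ_OB (hP : ∀ θ p, P θ p → Good p) (n : ℕ) : OB ZV P n (fun _ => gρ) (fun _ => gρ) :=
  (gens_OB hP n).2.2.2.1
theorem gρ1_OB (hP : ∀ θ p, P θ p → Good p) (n : ℕ) : OB ZV P n (fun _ => gρ) one' :=
  (gens_OB hP n).2.2.2.2.1
theorem gτ_OB (hP : ∀ θ p, P θ p → Good p) (n : ℕ) : OB ZV P n (fun _ => gτ) one' :=
  (gens_OB hP n).2.2.2.2.2.1
theorem mu_OB (hP : ∀ θ p, P θ p → Good p) (n : ℕ) (z : VF) : OB ZV P n (fun _ => muZ z) one' :=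
  (gens_OB hP n).2.2.2.2.2.2.1 z
theorem nu_OB (hP : ∀ θ p, P θ p → Good p) (n : ℕ) (z : VF) : OB ZV P n (fun _ => nuZ z) one' :=
  (gens_OB hP n).2.2.2.2.2.2.2 z

theorem gs_OB (hP : ∀ θ p, P θ p → Good p) (hs : ∀ θ p, P θ p → gs p ≤ 1) (n : ℕ) :
    OB ZV P n (fun _ => gs) one' := by
  have hx : ∀ θ p, P θ p → p.2 ≠ 0 := fun θ p hp => (hP θ p hp).1
  refine OB.eigen (h := fun z _ p => nuZ z p * gb p - muZ z p) Z_hV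
    (fun θ p hp => gs_sm (hx θ p hp)) one'_nonneg
    ⟨1, zero_le_one, fun θ p hp => ?_⟩ (fun z θ p hp => ?_) n (fun z m _ => ?_)
  · have := gj_pos p
    have := gρ_pos (hx θ p hp)
    rw [Real.norm_of_nonneg (by simp only [gs]; positivity)]
    simpa [one'] using hs θ p hp
  · refine eq_of_x0 (hx θ p hp) fun y hy => ?_
    rw [Dv_gs hy, nu_ZV z hy, mu_ZV z hy]; ring
  · exact OB.sub Z_hV (OB.mul1 Z_hV (nu_OB hP m z) (gb_OB hP m)) (mu_OB hP m z)

theorem gL_OB (hP : ∀ θ p, P θ p → Good p) (n : ℕ) :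
    OB ZV P n (fun _ => gL) (fun _ p => 1 + |gL p|) := by
  have hx : ∀ θ p, P θ p → p.2 ≠ 0 := fun θ p hp => (hP θ p hp).1
  have h0 : ∃ C : ℝ, 0 ≤ C ∧ ∀ (θ : Θ) p, P θ p → ‖gL p‖ ≤ C * (1 + |gL p|) :=
    ⟨1, zero_le_one, fun θ p hp => by rw [Real.norm_eq_abs]; linarith⟩
  cases n with
  | zero => exact OB.zeroth (fun θ p hp => gL_sm (hx θ p hp)) h0
  | succ n =>
    refine OB.succ (fun θ p hp => gL_sm (hx θ p hp)) (fun θ p hp => by positivity) h0 fun z => ?_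
    have h1 : OB ZV P n (fun _ p => muZ z p - nuZ z p * gb p) one' :=
      OB.sub Z_hV (mu_OB hP n z) (OB.mul1 Z_hV (nu_OB hP n z) (gb_OB hP n))
    refine (h1.weight (w' := fun _ p => 1 + |gL p|) 1 zero_le_one fun θ p hp => ?_).congr
      fun θ p hp => ?_
    · simp only [one', one_mul]; linarith [abs_nonneg (gL p)]
    · refine eq_of_x0 (hx θ p hp) fun y hy => ?_
      rw [Dv_gL hy, nu_ZV z hy, mu_ZV z hy]

/-- smooth functions of the bounded variable `gs` -/
theorem chi_OB (hP : ∀ θ p, P θ p → Good p) (hs : ∀ θ p, P θ p → gs p ≤ 1) (n : ℕ)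
    {h : ℝ → ℝ} (hh : ContDiff ℝ ∞ h) : OB ZV P n (fun _ p => h (gs p)) one' := by
  have hx : ∀ θ p, P θ p → p.2 ≠ 0 := fun θ p hp => (hP θ p hp).1
  have hsm : ∀ (h : ℝ → ℝ), ContDiff ℝ ∞ h → ∀ (θ : Θ) p, P θ p → SmA (fun p => h (gs p)) p :=
    fun h hh θ p hp => SmA.comp (f := h) (SmA.of_contDiff hh) (gs_sm (hx θ p hp))
  have hb : ∀ (h : ℝ → ℝ), ContDiff ℝ ∞ h → ∃ C : ℝ, 0 ≤ C ∧ ∀ (θ : Θ) p, P θ p →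
      ‖h (gs p)‖ ≤ C * (one' : Θ → E4 → ℝ) θ p := by
    intro h hh
    obtain ⟨C, hC⟩ := (isCompact_Icc (a := (0 : ℝ)) (b := 1)).exists_bound_of_continuousOn
      hh.continuous.continuousOn
    refine ⟨max C 0, le_max_right _ _, fun θ p hp => ?_⟩
    have := gj_pos p
    have := gρ_pos (hx θ p hp)
    have h2 := hC (gs p) ⟨by simp only [gs]; positivity, hs θ p hp⟩
    simpa [one'] using Or.inl h2
  induction n generalizing h with
  | zero => exact OB.zeroth (hsm h hh) (hb h hh)
  | succ n ih =>
    refine OB.succ (hsm h hh) one'_nonneg (hb h hh) fun z => ?_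
    have hd : ContDiff ℝ ∞ (deriv h) := (contDiff_infty_iff_deriv.1 hh).2
    have h1 := OB.mul1 Z_hV (OB.mul1 Z_hV (OB.sub Z_hV (OB.mul1 Z_hV (nu_OB hP n z) (gb_OB hP n))
      (mu_OB hP n z)) (gs_OB hP hs n)) (ih hd)
    refine h1.congr fun θ p hp => ?_
    refine eq_of_x0 (hx θ p hp) fun y hy => ?_
    rw [Dv_comp_real (hh.differentiable (by simp) _) (gs_sm hy), Dv_gs hy, nu_ZV z hy, mu_ZV z hy,
      smul_eq_mul]
    ring

end gens
end PartThree

section PartFour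
open scoped ContDiff

/-- pull back of a function of `(q,x)` to spacetime -/
def pull (F : E4 → ℂ) : E4 → ℂ := fun p => F (gq p, p.2)

theorem qx_sm {p : E4} (hp : p.2 ≠ 0) : SmA (fun p : E4 => (gq p, p.2)) p := by
  filter_upwards [gq_sm hp] with y hy using hy.prodMk contDiffAt_snd

theorem pull_sm {F : E4 → ℂ} {p : E4} (hp : p.2 ≠ 0) (hF : SmA F (gq p, p.2)) : SmA (pull F) p :=
  SmA.comp (f := F) hF (qx_sm hp)

theorem pull_ev {F G : E4 → ℂ} {p : E4} (hp : p.2 ≠ 0) (h : F =ᶠ[𝓝 (gq p, p.2)] G) :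
    pull F =ᶠ[𝓝 p] pull G :=
  (qx_sm hp).at.continuousAt.eventually h

theorem pull_sm_ev {F : E4 → ℂ} {p : E4} (hp : p.2 ≠ 0) (hF : SmA F (gq p, p.2)) :
    ∀ᶠ y in 𝓝 p, SmA F (gq y, y.2) :=
  (qx_sm hp).at.continuousAt.eventually hF.ev

theorem Dv_pull {V : E4 → E4} {F : E4 → ℂ} {p : E4} (hp : p.2 ≠ 0) (hF : SmA F (gq p, p.2)) :
    Dv V (pull F) p = fderiv ℝ F (gq p, p.2) (Dv V gq p, (V p).2) := by
  have h1 : HasFDerivAt (fun p : E4 => (gq p, p.2))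
      ((fderiv ℝ gq p).prod (ContinuousLinearMap.snd ℝ ℝ Pt)) p :=
    (gq_sm hp).diff.hasFDerivAt.prodMk hasFDerivAt_snd
  have h2 : HasFDerivAt F (fderiv ℝ F (gq p, p.2)) ((fun p : E4 => (gq p, p.2)) p) :=
    hF.diff.hasFDerivAt
  have h3 := (h2.comp p h1).fderiv
  have h4 : fderiv ℝ (pull F) p = _ := h3
  simp only [Dv]
  rw [h4]
  simp

def crZ : VF → Fin 3 → Fin 3 → E4 → ℝ
  | .time => fun _ _ _ => 0
  | .space i => fun j k p => (if k = i then 1 else 0) * (gρ p * gω j p)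
  | .rot a b => fun j k _ => if j = a ∧ k = b then 1 else 0
  | .boost i => fun j k p => (if k = i then 1 else 0) * (gτ p * gω j p)
  | .scal => fun _ _ _ => 0

theorem ee_decomp {p : E4} (hp : p.2 ≠ 0) (i : Fin 3) :
    (ee i : Pt) = (gρ p * gω i p) • p.2
      + ∑ j, (gρ p * gω j p) • (p.2 j • ee i - p.2 i • ee j) := by
  have h1 := gρ_rr hp
  have h2 := gω_sq hp
  have h3 : ∀ j, gρ p * gω j p * p.2 j = gω j p ^ 2 := fun j => by simp only [gω]; ring
  ext k
  simp only [PiLp.add_apply, PiLp.smul_apply, smul_eq_mul, WithLp.ofLp_sum, Finset.sum_apply,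
    PiLp.sub_apply, mul_sub, Finset.sum_sub_distrib]
  have e1 : ∑ j, gρ p * gω j p * (p.2 j * (ee i) k) = (ee i) k := by
    have : ∀ j, gρ p * gω j p * (p.2 j * (ee i) k) = gω j p ^ 2 * (ee i) k := fun j => by
      rw [← mul_assoc, h3]
    simp only [this, ← Finset.sum_mul, h2, one_mul]
  have e2 : ∑ j, gρ p * gω j p * (p.2 i * (ee j) k) = gρ p * gω i p * p.2 k := by
    simp [gω]
    ring
  have e1' : ∑ j, gρ p * gω j p * (p.2 j * (ee i : Pt).ofLp k) = (ee i : Pt).ofLp k := e1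
  rw [e1', e2]; ring

theorem ZV_decomp (z : VF) {p : E4} (hp : p.2 ≠ 0) :
    (Dv (ZV z) gq p, (ZV z p).2) = nuZ z p • RV .qd (gq p, p.2) + muZ z p • RV .eul (gq p, p.2)
      + ∑ j, ∑ k, crZ z j k p • RV (.rot j k) (gq p, p.2) := by
  refine Prod.ext ?_ ?_
  · rw [Dv_gq', nu_ZV z hp]
    simp [RV, gj, Prod.fst_sum]
  · simp only [RV, Prod.snd_add, Prod.smul_snd, Prod.snd_sum, smul_zero, zero_add]
    cases z with
    | time => simp [ZV, muZ, crZ]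
    | space i =>
      simp only [ZV, muZ, crZ]
      conv_lhs => rw [ee_decomp hp i]
      congr 1
      refine Finset.sum_congr rfl fun j _ => ?_
      simp [ite_mul, ite_smul]
    | rot a b =>
      simp only [ZV, muZ, crZ, zero_smul, zero_add, ite_smul, one_smul, ite_and]
      simp
    | boost i =>
      simp only [ZV, muZ, crZ]
      conv_lhs => rw [ee_decomp hp i]
      simp only [smul_add, Finset.smul_sum, smul_smul]
      have h1 := gρ_rr hp
      congr 1
      · congr 1; simp only [gω, gτ]; ring
      · refine Finset.sum_congr rfl fun j _ => ?_
        simp [ite_mul, ite_smul, gω, gτ]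
        congr 1; ring
    | scal => simp [ZV, muZ, crZ]

theorem Dv_pull_Z (z : VF) {F : E4 → ℂ} {p : E4} (hp : p.2 ≠ 0) (hF : SmA F (gq p, p.2)) :
    Dv (ZV z) (pull F) p = (nuZ z p : ℂ) * pull (Dv (RV .qd) F) p
      + (muZ z p : ℂ) * pull (Dv (RV .eul) F) p
      + ∑ j, ∑ k, (crZ z j k p : ℂ) * pull (Dv (RV (.rot j k)) F) p := by
  rw [Dv_pull hp hF, ZV_decomp z hp]
  simp only [map_add, map_sum, map_smul, pull, Dv, Complex.real_smul]

section
variable {Θ : Type*} {P : Θ → E4 → Prop}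

theorem cr_OB (hP : ∀ θ p, P θ p → Good p) (n : ℕ) (z : VF) (j k : Fin 3) :
    OB ZV P n (fun _ => crZ z j k) one' := by
  cases z with
  | time => exact OB.const' 0
  | space i => exact OB.mul1 Z_hV (OB.const' _) (OB.mul1 Z_hV (gρ1_OB hP n) (gω_OB hP n j))
  | rot a b => exact OB.const' _
  | boost i => exact OB.mul1 Z_hV (OB.const' _) (OB.mul1 Z_hV (gτ_OB hP n) (gω_OB hP n j))
  | scal => exact OB.const' 0
end

def PullP (n : ℕ) (θ : (E4 → ℂ) × ℝ) (p : E4) : Prop := Good p ∧ Bd RV n θ.1 (gq p, p.2) θ.2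

theorem pull_OB0 (n : ℕ) : OB ZV (PullP n) n (fun θ => pull θ.1) (fun θ _ => θ.2) := by
  have hg : ∀ n θ p, PullP n θ p → Good p := fun n θ p h => h.1
  have hs : ∀ n θ p, PullP n θ p → SmA (pull θ.1) p := fun n θ p h => pull_sm h.1.1 h.2.1
  have h0 : ∀ n, ∃ C : ℝ, 0 ≤ C ∧ ∀ θ p, PullP n θ p → ‖pull θ.1 p‖ ≤ C * θ.2 :=
    fun n => ⟨1, zero_le_one, fun θ p h => by rw [one_mul]; exact h.2.val⟩
  have hw : ∀ n θ p, PullP n θ p → 0 ≤ θ.2 := fun n θ p h => h.2.nonneg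
  induction n with
  | zero => exact OB.zeroth (hs 0) (h0 0)
  | succ n ih =>
    refine OB.succ (hs _) (hw _) (h0 _) fun z => ?_
    have hr : ∀ W : RF, OB ZV (PullP (n + 1)) n (fun θ => pull (Dv (RV W) θ.1)) (fun θ _ => θ.2) :=
      fun W => ih.reparam (fun θ : (E4 → ℂ) × ℝ => (Dv (RV W) θ.1, θ.2)) fun θ p hp => ⟨hp.1, hp.2.dv R_hV W⟩
    refine (OB.add Z_hV (OB.add Z_hV
      (OB.mul1 Z_hV (OB.ofReal Z_hV (nu_OB (hg _) n z)) (hr .qd))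
      (OB.mul1 Z_hV (OB.ofReal Z_hV (mu_OB (hg _) n z)) (hr .eul)))
      (OB.sum Finset.univ Z_hV (hw _) fun j _ => OB.sum Finset.univ Z_hV (hw _) fun k _ =>
        OB.mul1 Z_hV (OB.ofReal Z_hV (cr_OB (hg _) n z j k)) (hr (.rot j k)))).congr
      fun θ p hp => ?_
    filter_upwards [x0_ev hp.1.1, pull_sm_ev hp.1.1 hp.2.1] with y hy1 hy2
    rw [Dv_pull_Z z hy1 hy2]

theorem OB.pull {Θ : Type*} {P Q : Θ → E4 → Prop} {n : ℕ} {f : Θ → E4 → ℂ} {w : Θ → E4 → ℝ}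
    (h : OB RV Q n f w) (hPQ : ∀ θ p, P θ p → Good p ∧ Q θ (gq p, p.2)) :
    OB ZV P n (fun θ => pull (f θ)) (fun θ p => w θ (gq p, p.2)) := by
  obtain ⟨C, hC, h⟩ := h
  obtain ⟨C', hC', h'⟩ := pull_OB0 n
  refine ⟨C' * C, by positivity, fun θ p hp => ?_⟩
  have h2 := h' (f θ, C * w θ (gq p, p.2)) p ⟨(hPQ θ p hp).1, h θ _ (hPQ θ p hp).2⟩
  exact h2.le (le_of_eq (by ring))

/-! the null frame -/
theorem mu_MV {p : E4} (hp : p.2 ≠ 0) : mu MV p = 1 ∧ nu MV p = 0 ∧ mu NV p = 1 ∧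
    nu NV p = 2 * rr p * ga p := by
  have h1 := gρ_rr hp
  have h2 : ∑ i, p.2 i * p.2 i = rr p ^ 2 := by
    simp only [← sq]; simp [rr, EuclideanSpace.norm_sq_eq]
  have e1 : Dv MV rr p = rr p := by
    rw [Dv_rr hp]; simp only [MV, h2]; linear_combination rr p * h1
  have e2 : Dv NV rr p = rr p := by
    rw [Dv_rr hp]; simp only [NV, h2]; linear_combination rr p * h1
  refine ⟨?_, ?_, ?_, ?_⟩
  · rw [mu, e1]; linarith
  · rw [nu, Dv_gq hp, e1]; simp [MV, rr]
  · rw [mu, e2]; linarith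
  · rw [nu, Dv_gq hp, e2]; simp only [NV, rr]; ring

theorem Dv_pull_M {F : E4 → ℂ} {p : E4} (hp : p.2 ≠ 0) (hF : SmA F (gq p, p.2)) :
    Dv MV (pull F) p = pull (Dv (RV .eul) F) p := by
  rw [Dv_pull hp hF, Dv_gq', (mu_MV hp).2.1]
  simp [pull, Dv, RV, MV]

theorem Dv_pull_N {F : E4 → ℂ} {p : E4} (hp : p.2 ≠ 0) (hF : SmA F (gq p, p.2)) :
    Dv NV (pull F) p = ((2 * rr p * ga p : ℝ) : ℂ) * pull (Dv (RV .qd) F) p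
      + pull (Dv (RV .eul) F) p := by
  rw [Dv_pull hp hF, Dv_gq', (mu_MV hp).2.2.2]
  have : ((2 * rr p * ga p * gj p, (NV p).2) : E4)
    = (2 * rr p * ga p) • RV .qd (gq p, p.2) + RV .eul (gq p, p.2) := by
    simp [RV, NV, gj]
  rw [this]
  simp only [map_add, map_smul, pull, Dv, Complex.real_smul]

end PartFour

section PartFive
open scoped ContDiff

def bT : E4 := (1, 0)
def bX (i : Fin 3) : E4 := (0, ee i)

theorem E4_decomp (v : E4) : v = v.1 • bT + ∑ i, v.2 i • bX i := by
  refine Prod.ext ?_ ?_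
  · simp [bT, bX, Prod.fst_sum]
  · simp only [bT, bX, Prod.snd_add, Prod.smul_snd, Prod.snd_sum, smul_zero, zero_add]
    ext k
    simp [WithLp.ofLp_sum, Pi.single_apply]

theorem lin_expand (g : E4 →L[ℝ] ℂ) (v : E4) :
    g v = (v.1 : ℂ) * g bT + ∑ i, (v.2 i : ℂ) * g (bX i) := by
  conv_lhs => rw [E4_decomp v]
  simp only [map_add, map_sum, map_smul, Complex.real_smul]

theorem bil_expand (B : E4 →L[ℝ] E4 →L[ℝ] ℂ) (v w : E4) :
    B v w = (v.1 : ℂ) * ((w.1 : ℂ) * B bT bT + ∑ j, (w.2 j : ℂ) * B bT (bX j))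
      + ∑ i, (v.2 i : ℂ) * ((w.1 : ℂ) * B (bX i) bT + ∑ j, (w.2 j : ℂ) * B (bX i) (bX j)) := by
  conv_lhs => rw [E4_decomp v]
  simp only [map_add, map_sum, map_smul, add_apply,
    sum_apply, smul_apply, Complex.real_smul]
  rw [lin_expand (B bT) w]
  simp only [fun i => lin_expand (B (bX i)) w]

theorem deriv_fst_eq {f : E4 → ℂ} {p : E4} (h : DifferentiableAt ℝ f p) :
    deriv (fun s => f (s, p.2)) p.1 = fderiv ℝ f p bT := by
  have h1 : HasDerivAt (fun s : ℝ => (s, p.2)) (1, 0) p.1 :=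
    (hasDerivAt_id p.1).prodMk (hasDerivAt_const _ _)
  have h2 : HasFDerivAt f (fderiv ℝ f p) (p.1, p.2) := h.hasFDerivAt
  exact (h2.comp_hasDerivAt p.1 h1).deriv

theorem fderiv_snd_eq {f : E4 → ℂ} {p : E4} (h : DifferentiableAt ℝ f p) (v : Pt) :
    fderiv ℝ (fun y => f (p.1, y)) p.2 v = fderiv ℝ f p (0, v) := by
  have h1 : HasFDerivAt (fun y : Pt => (p.1, y)) (ContinuousLinearMap.inr ℝ ℝ Pt) p.2 :=
    hasFDerivAt_prodMk_right p.1 p.2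
  have h2 : HasFDerivAt f (fderiv ℝ f p) (p.1, p.2) := h.hasFDerivAt
  have h3 : fderiv ℝ (fun y => f (p.1, y)) p.2 = _ := (h2.comp p.2 h1).fderiv
  rw [h3]; simp

theorem app_eq (z : VF) {f : ℝ → Pt → ℂ} {p : E4} (hp : p.2 ≠ 0)
    (h : DifferentiableAt ℝ (Function.uncurry f) p) :
    z.app f p.1 p.2 = Dv (ZV z) (Function.uncurry f) p := by
  have hT : dT f p.1 p.2 = fderiv ℝ (Function.uncurry f) p bT := deriv_fst_eq h
  have hX : ∀ i, dX i f p.1 p.2 = fderiv ℝ (Function.uncurry f) p (bX i) :=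
    fun i => fderiv_snd_eq h (ee i)
  simp only [Dv]
  cases z with
  | time => exact hT
  | space i => exact hX i
  | rot i j =>
    simp only [VF.app, vrot, hX]
    have : ZV (.rot i j) p = p.2 i • bX j - p.2 j • bX i := by simp [ZV, bX]
    rw [this]; simp [Complex.real_smul]
  | boost i =>
    simp only [VF.app, vboost, hX, hT]
    have : ZV (.boost i) p = p.1 • bX i + p.2 i • bT := by simp [ZV, bX, bT]
    rw [this]; simp [Complex.real_smul]
  | scal =>
    simp only [VF.app, vscal, dR, hX, hT]
    have h0 : ((rad p.2 : ℝ) : ℂ) ≠ 0 := by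
      have : rad p.2 ≠ 0 := by simpa [rad] using hp
      exact_mod_cast this
    rw [mul_inv_cancel_left₀ h0]
    conv_rhs => rw [lin_expand _ (ZV .scal p)]
    simp [ZV]

theorem Ziter_eq (l : List VF) {f : ℝ → Pt → ℂ} {p : E4} (hp : p.2 ≠ 0)
    (h : SmA (Function.uncurry f) p) :
    Function.uncurry (Ziter l f) =ᶠ[𝓝 p] It ZV l (Function.uncurry f) := by
  induction l with
  | nil => exact EventuallyEq.rfl
  | cons z l ih =>
    have hs : SmA (Function.uncurry (Ziter l f)) p := (It_smooth Z_hV l h).congr ih.symm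
    have h1 : Function.uncurry (Ziter (z :: l) f) =ᶠ[𝓝 p]
        Dv (ZV z) (Function.uncurry (Ziter l f)) := by
      filter_upwards [hs.ev, x0_ev hp] with y hy hy2
      exact app_eq z hy2 hy.diff
    exact h1.trans (Dv_congr ih)

def boxV (f : E4 → ℂ) : E4 → ℂ := fun p => - Dv (ZV .time) (Dv (ZV .time) f) p
  + ∑ i, Dv (ZV (.space i)) (Dv (ZV (.space i)) f) p

theorem box_eq {f : ℝ → Pt → ℂ} {p : E4} (hp : p.2 ≠ 0) (h : SmA (Function.uncurry f) p) :
    Function.uncurry (box f) =ᶠ[𝓝 p] boxV (Function.uncurry f) := by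
  have h1 := Ziter_eq [.time, .time] hp h
  have h2 : ∀ i, _ := fun i => Ziter_eq [.space i, .space i] hp h
  filter_upwards [h1, h2 0, h2 1, h2 2] with y a b c d
  have e : Function.uncurry (box f) y = - Function.uncurry (Ziter [.time, .time] f) y
    + ∑ i, Function.uncurry (Ziter [.space i, .space i] f) y := rfl
  rw [e, Fin.sum_univ_three, a, b, c, d]
  simp only [boxV, Fin.sum_univ_three, It]

theorem boxV_congr {f g : E4 → ℂ} {p : E4} (h : f =ᶠ[𝓝 p] g) : boxV f =ᶠ[𝓝 p] boxV g := by
  have h1 := Dv_congr (V := ZV .time) (Dv_congr (V := ZV .time) h)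
  have h2 : ∀ i, _ := fun i =>
    Dv_congr (V := ZV (.space i)) (Dv_congr (V := ZV (.space i)) h)
  filter_upwards [h1, h2 0, h2 1, h2 2] with y a b c d
  simp only [boxV, Fin.sum_univ_three, a, b, c, d]

theorem Dv2_add {f g : E4 → ℂ} {V W : E4 → E4} {p : E4} (hW : SmA W p) (hf : SmA f p)
    (hg : SmA g p) : Dv V (Dv W (fun y => f y + g y)) p = Dv V (Dv W f) p + Dv V (Dv W g) p := by
  rw [← Dv_add (SmA.dv hW hf) (SmA.dv hW hg)]
  apply Dv_congr_at
  filter_upwards [hf.ev, hg.ev] with y h1 h2 using Dv_add h1 h2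

theorem boxV_add {f g : E4 → ℂ} {p : E4} (hf : SmA f p) (hg : SmA g p) :
    boxV (fun y => f y + g y) p = boxV f p + boxV g p := by
  simp only [boxV, fun z : VF => Dv2_add (V := ZV z) (Z_hV z p) hf hg, Finset.sum_add_distrib]
  ring

theorem OB.boxV {Θ : Type*} {P : Θ → E4 → Prop} {n : ℕ} {f : Θ → E4 → ℂ} {w : Θ → E4 → ℝ}
    (hw : ∀ θ p, P θ p → 0 ≤ w θ p) (h : OB ZV P (n + 2) f w) :
    OB ZV P n (fun θ => boxV (f θ)) w :=
  OB.add Z_hV (OB.neg Z_hV ((h.dv Z_hV _).dv Z_hV _))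
    (OB.sum Finset.univ Z_hV hw fun _ _ => (h.dv Z_hV _).dv Z_hV _)

theorem MV_sm {p : E4} (hp : p.2 ≠ 0) : SmA MV p := by
  filter_upwards [rr_sm hp] with y hy using hy.prodMk contDiffAt_snd
theorem NV_sm {p : E4} (hp : p.2 ≠ 0) : SmA NV p := by
  filter_upwards [rr_sm hp] with y hy using hy.neg.prodMk contDiffAt_snd

theorem fderiv_MV {p : E4} (hp : p.2 ≠ 0) : fderiv ℝ MV p (NV p) = MV p := by
  have h1 : HasFDerivAt MV ((fderiv ℝ rr p).prod (ContinuousLinearMap.snd ℝ ℝ Pt)) p :=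
    (rr_sm hp).diff.hasFDerivAt.prodMk hasFDerivAt_snd
  rw [h1.fderiv]
  have h2 : Dv NV rr p = rr p := by
    rw [Dv_rr' hp, (mu_MV hp).2.2.1, one_mul]
  simp only [Dv] at h2
  refine Prod.ext ?_ ?_
  · simpa [MV, rr] using h2
  · simp [NV, MV]

def rotL (i j : Fin 3) : E4 →L[ℝ] E4 :=
  (ContinuousLinearMap.inr ℝ ℝ Pt).comp
    (((EuclideanSpace.proj i : Pt →L[ℝ] ℝ).smulRight (ee j)
      - (EuclideanSpace.proj j : Pt →L[ℝ] ℝ).smulRight (ee i)).comp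
      (ContinuousLinearMap.snd ℝ ℝ Pt))

theorem rotL_eq (i j : Fin 3) : ZV (.rot i j) = rotL i j := by
  ext p <;> simp [ZV, rotL]

theorem box_polar {f : E4 → ℂ} {p : E4} (hp : p.2 ≠ 0) (hf : SmA f p) :
    (rr p : ℂ) ^ 2 * boxV f p = Dv NV (Dv MV f) p + Dv NV f p
      + (1 / 2) * ∑ i, ∑ j, Dv (ZV (.rot i j)) (Dv (ZV (.rot i j)) f) p := by
  have hsymm : ∀ v w, fderiv ℝ (fderiv ℝ f) p v w = fderiv ℝ (fderiv ℝ f) p w v := by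
    intro v w
    have := (hf.at.isSymmSndFDerivAt (by simpa [minSmoothness] using (WithTop.coe_le_coe.2 (le_top : (2 : ℕ∞) ≤ ⊤)))).eq v w
    exact this
  have hr : (rr p : ℂ) ^ 2 = ∑ i, (p.2 i : ℂ) ^ 2 := by
    have : rr p ^ 2 = ∑ i, p.2 i ^ 2 := by simp [rr, EuclideanSpace.norm_sq_eq]
    exact_mod_cast this
  have hrot : ∀ i j, Dv (ZV (.rot i j)) (Dv (ZV (.rot i j)) f) p =
      fderiv ℝ (fderiv ℝ f) p (rotL i j p) (rotL i j p) + fderiv ℝ f p (rotL i j (rotL i j p)) := by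
    intro i j
    rw [Dv_Dv (Z_hV _ p) hf, rotL_eq, ContinuousLinearMap.fderiv]
  have hbT : ∀ z, (z = .time ∨ ∃ i, z = .space i) → Dv (ZV z) (Dv (ZV z) f) p =
      fderiv ℝ (fderiv ℝ f) p (ZV z p) (ZV z p) := by
    intro z hz
    rw [Dv_Dv (Z_hV _ p) hf]
    rcases hz with rfl | ⟨i, rfl⟩ <;> simp [ZV]
  have e1 : boxV f p = - fderiv ℝ (fderiv ℝ f) p bT bT
      + ∑ i, fderiv ℝ (fderiv ℝ f) p (bX i) (bX i) := by
    simp only [boxV]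
    rw [hbT _ (Or.inl rfl)]
    congr 1
    exact Finset.sum_congr rfl fun i _ => hbT _ (Or.inr ⟨i, rfl⟩)
  rw [e1, Dv_Dv (MV_sm hp) hf, fderiv_MV hp]
  simp only [hrot]
  simp only [Dv]
  generalize hB : fderiv ℝ (fderiv ℝ f) p = B at *
  generalize hG : fderiv ℝ f p = G at *
  simp only [bil_expand B (NV p), bil_expand B (rotL _ _ p), lin_expand G (NV p), lin_expand G (MV p),
    lin_expand G (rotL _ _ _)]
  have s0 : ∀ i, B (bX i) bT = B bT (bX i) := fun i => hsymm _ _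
  have s1 := hsymm (bX 1) (bX 0)
  have s2 := hsymm (bX 2) (bX 0)
  have s3 := hsymm (bX 2) (bX 1)
  have hr2 : ((‖p.2‖ : ℝ) : ℂ) ^ 2 = ∑ i, (p.2 i : ℂ) ^ 2 := hr
  have r1 : ∀ (i j : Fin 3) (v : E4), (rotL i j v).1 = 0 := fun i j v => by simp [rotL]
  have r2 : ∀ (i j k : Fin 3) (v : E4), (rotL i j v).2 k =
      v.2 i * (if k = j then 1 else 0) - v.2 j * (if k = i then 1 else 0) := fun i j k v => by
    simp [rotL]
  rw [hr]
  simp only [r1, r2, NV, MV, s0, Fin.sum_univ_three] at hr2 ⊢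
  simp only [s1, s2, s3]
  have d1 : ((0 : Fin 3) = 1) = False := by decide
  have d2 : ((0 : Fin 3) = 2) = False := by decide
  have d3 : ((1 : Fin 3) = 2) = False := by decide
  have d4 : ((1 : Fin 3) = 0) = False := by decide
  have d5 : ((2 : Fin 3) = 0) = False := by decide
  have d6 : ((2 : Fin 3) = 1) = False := by decide
  simp only [d1, d2, d3, d4, d5, d6, if_true, if_false, mul_one, mul_zero, sub_zero, zero_sub,
    Complex.ofReal_zero, zero_mul, zero_add, add_zero, sub_self, Complex.ofReal_neg]
  linear_combination (B bT bT) * hr2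

theorem gρC {p : E4} (hp : p.2 ≠ 0) : (gρ p : ℂ) * (rr p : ℂ) = 1 := by
  exact_mod_cast gρ_rr hp

theorem Dv_ρmul {V : E4 → E4} {ψ : E4 → ℂ} {p : E4} (hp : p.2 ≠ 0) (hψ : SmA ψ p) :
    Dv V (fun y => (gρ y : ℂ) * ψ y) p = (gρ p : ℂ) * (Dv V ψ p - (mu V p : ℂ) * ψ p) := by
  rw [Dv_mul (gρ_sm hp).ofReal hψ, Dv_ofReal (gρ_sm hp), Dv_gρ hp]
  push_cast; ring

theorem box_rho {ψ : E4 → ℂ} {p : E4} (hp : p.2 ≠ 0) (hψ : SmA ψ p) :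
    boxV (fun y => (gρ y : ℂ) * ψ y) p = (gρ p : ℂ) ^ 3 * (Dv NV (Dv MV ψ) p - Dv MV ψ p
      + (1 / 2) * ∑ i, ∑ j, Dv (ZV (.rot i j)) (Dv (ZV (.rot i j)) ψ) p) := by
  have hρ := gρC hp
  have hsm : SmA (fun y => (gρ y : ℂ) * ψ y) p := (gρ_sm hp).ofReal.mul hψ
  have h := box_polar hp hsm
  have hM : Dv MV (fun y => (gρ y : ℂ) * ψ y) =ᶠ[𝓝 p]
      fun y => (gρ y : ℂ) * (Dv MV ψ y - ψ y) := by
    filter_upwards [x0_ev hp, hψ.ev] with y hy h2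
    rw [Dv_ρmul hy h2, (mu_MV hy).1]; simp
  have hR : ∀ i j, Dv (ZV (.rot i j)) (fun y => (gρ y : ℂ) * ψ y) =ᶠ[𝓝 p]
      fun y => (gρ y : ℂ) * Dv (ZV (.rot i j)) ψ y := by
    intro i j
    filter_upwards [x0_ev hp, hψ.ev] with y hy h2
    rw [Dv_ρmul hy h2, mu_ZV _ hy]; simp [muZ]
  have hMs := SmA.dv (MV_sm hp) hψ
  rw [Dv_congr_at hM, Dv_ρmul hp (hMs.sub hψ), Dv_ρmul hp hψ, (mu_MV hp).2.2.1, Dv_sub hMs hψ] at h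
  have h2 : ∀ i j, Dv (ZV (.rot i j)) (Dv (ZV (.rot i j)) (fun y => (gρ y : ℂ) * ψ y)) p
      = (gρ p : ℂ) * Dv (ZV (.rot i j)) (Dv (ZV (.rot i j)) ψ) p := by
    intro i j
    rw [Dv_congr_at (hR i j), Dv_ρmul hp (SmA.dv (Z_hV _ p) hψ), mu_ZV _ hp]; simp [muZ]
  simp only [h2, ← Finset.mul_sum] at h
  push_cast at h
  have h3 : ∀ B : ℂ, B = (gρ p : ℂ) ^ 2 * ((rr p : ℂ) ^ 2 * B) := fun B => by
    linear_combination (-((gρ p : ℂ) * (rr p : ℂ) + 1) * B) * hρ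
  rw [h3 (boxV _ p), h]
  ring

end PartFive

section PartSix
open scoped ContDiff

/-- homogeneous extension of a radiation field -/
def rf (F : ℝ → Pt → ℂ) : E4 → ℂ := fun p => F p.1 (‖p.2‖⁻¹ • p.2)

theorem unit_sm {p : E4} (hp : p.2 ≠ 0) : SmA (fun p : E4 => (p.1, ‖p.2‖⁻¹ • p.2)) p := by
  filter_upwards [gρ_sm hp] with y hy
  exact contDiffAt_fst.prodMk (ContDiffAt.smul hy contDiffAt_snd)

theorem rf_sm {F : ℝ → Pt → ℂ} (hF : Smooth2 F) {p : E4} (hp : p.2 ≠ 0) : SmA (rf F) p :=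
  SmA.comp (f := Function.uncurry F) (SmA.of_contDiff hF) (unit_sm hp)

theorem dq_eq {F : ℝ → Pt → ℂ} (hF : Smooth2 F) (p : E4) :
    dq F p.1 p.2 = fderiv ℝ (Function.uncurry F) p bT :=
  deriv_fst_eq (f := Function.uncurry F) (hF.differentiable (by simp) p)

theorem dOm_eq {F : ℝ → Pt → ℂ} (hF : Smooth2 F) (i : Fin 3) (p : E4) :
    dOm i F p.1 p.2 = fderiv ℝ (Function.uncurry F) p (bX i) :=
  fderiv_snd_eq (f := Function.uncurry F) (hF.differentiable (by simp) p) (ee i)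

theorem qdq_eq {F : ℝ → Pt → ℂ} (hF : Smooth2 F) :
    Function.uncurry (qdq F) = Dv (RV .qd) (Function.uncurry F) := by
  funext p
  have : RV .qd p = jb p.1 • bT := by simp [RV, bT]
  simp only [Dv, this, map_smul, Complex.real_smul, ← dq_eq hF]
  rfl

theorem aRot_eq {F : ℝ → Pt → ℂ} (hF : Smooth2 F) (i j : Fin 3) :
    Function.uncurry (aRot i j F) = Dv (RV (.rot i j)) (Function.uncurry F) := by
  funext p
  have : RV (.rot i j) p = p.2 i • bX j - p.2 j • bX i := by simp [RV, bX]
  simp only [Dv, this, map_sub, map_smul, Complex.real_smul, ← dOm_eq hF]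
  rfl

theorem Dv_contDiff (W : RF) {f : E4 → ℂ} (hf : ContDiff ℝ ∞ f) : ContDiff ℝ ∞ (Dv (RV W) f) := by
  have hW : ContDiff ℝ ∞ (RV W) := contDiff_iff_contDiffAt.2 fun p => (R_hV W p).at
  exact (hf.fderiv_right (m := ∞) (by simp)).clm_apply hW

theorem qdq_smooth {F : ℝ → Pt → ℂ} (hF : Smooth2 F) : Smooth2 (qdq F) := by
  unfold Smooth2; rw [qdq_eq hF]; exact Dv_contDiff _ hF
theorem aRot_smooth {F : ℝ → Pt → ℂ} (hF : Smooth2 F) (i j : Fin 3) : Smooth2 (aRot i j F) := by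
  unfold Smooth2; rw [aRot_eq hF]; exact Dv_contDiff _ hF

theorem aRot_qdq {F : ℝ → Pt → ℂ} (hF : Smooth2 F) (i j : Fin 3) :
    aRot i j (qdq F) = qdq (aRot i j F) := by
  have h : Function.uncurry (aRot i j (qdq F)) = Function.uncurry (qdq (aRot i j F)) := by
    rw [aRot_eq (qdq_smooth hF), qdq_eq hF, qdq_eq (aRot_smooth hF i j), aRot_eq hF]
    funext p
    have hs : SmA (Function.uncurry F) p := SmA.of_contDiff hF
    rw [Dv_Dv (R_hV _ p) hs, Dv_Dv (R_hV _ p) hs,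
      (hs.at.isSymmSndFDerivAt (by
        simpa [minSmoothness] using (WithTop.coe_le_coe.2 (le_top : (2 : ℕ∞) ≤ ⊤)))).eq]
    congr 1
    have e1 : fderiv ℝ (RV .qd) p (RV (.rot i j) p) = 0 := by
      have : HasFDerivAt (RV .qd) ((((p.1 * (jb p.1)⁻¹) • ContinuousLinearMap.fst ℝ ℝ Pt)).prod
        (0 : E4 →L[ℝ] Pt)) p := by
        refine HasFDerivAt.prodMk ?_ (hasFDerivAt_const _ _)
        exact (jb_hasDerivAt p.1).comp_hasFDerivAt p hasFDerivAt_fst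
      rw [this.fderiv]; simp [RV]
    have e2 : fderiv ℝ (RV (.rot i j)) p (RV .qd p) = 0 := by
      have : RV (.rot i j) = rotL i j := by
        rw [← rotL_eq]; rfl
      rw [this, ContinuousLinearMap.fderiv]; simp [RV, rotL]
    rw [e1, e2]
  funext q σ
  exact congrFun h (q, σ)

theorem qdq_iter_smooth {F : ℝ → Pt → ℂ} (hF : Smooth2 F) (k : ℕ) : Smooth2 (qdq^[k] F) := by
  induction k with
  | zero => exact hF
  | succ k ih => rw [Function.iterate_succ_apply']; exact qdq_smooth ih

theorem aIter_smooth {F : ℝ → Pt → ℂ} (hF : Smooth2 F) (l : List (Fin 3 × Fin 3)) :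
    Smooth2 (aIter l F) := by
  induction l with
  | nil => exact hF
  | cons a l ih => exact aRot_smooth ih _ _

theorem aRot_qdq_iter {F : ℝ → Pt → ℂ} (hF : Smooth2 F) (i j : Fin 3) (k : ℕ) :
    aRot i j (qdq^[k] F) = qdq^[k] (aRot i j F) := by
  induction k with
  | zero => rfl
  | succ k ih =>
    rw [Function.iterate_succ_apply', Function.iterate_succ_apply', ← ih,
      aRot_qdq (qdq_iter_smooth hF k)]

theorem Dv_rf {V : E4 → E4} {F : ℝ → Pt → ℂ} (hF : Smooth2 F) {p : E4} (hp : p.2 ≠ 0) :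
    Dv V (rf F) p = fderiv ℝ (Function.uncurry F) (p.1, ‖p.2‖⁻¹ • p.2)
      ((V p).1, ‖p.2‖⁻¹ • (V p).2 - (mu V p * gρ p) • p.2) := by
  have h1 : HasFDerivAt (fun p : E4 => ‖p.2‖⁻¹ • p.2)
      (gρ p • ContinuousLinearMap.snd ℝ ℝ Pt + (fderiv ℝ gρ p).smulRight p.2) p :=
    (gρ_sm hp).diff.hasFDerivAt.smul hasFDerivAt_snd
  have h2 : HasFDerivAt (fun p : E4 => (p.1, ‖p.2‖⁻¹ • p.2)) _ p := hasFDerivAt_fst.prodMk h1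
  have h3 : HasFDerivAt (Function.uncurry F)
    (fderiv ℝ (Function.uncurry F) (p.1, ‖p.2‖⁻¹ • p.2)) (p.1, ‖p.2‖⁻¹ • p.2) :=
    (hF.differentiable (by simp) _).hasFDerivAt
  have h3' := (HasFDerivAt.comp (g := Function.uncurry F)
    (f := fun p : E4 => (p.1, ‖p.2‖⁻¹ • p.2)) p h3 h2).fderiv
  have h4 : fderiv ℝ (rf F) p = _ := h3'
  have h5 : fderiv ℝ gρ p (V p) = - (mu V p * gρ p) := Dv_gρ hp
  simp only [Dv]
  rw [h4]
  simp only [ContinuousLinearMap.comp_apply]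
  congr 1
  refine Prod.ext (by simp) ?_
  simp [h5, gρ, sub_eq_add_neg]

theorem mu_RV {p : E4} (hp : p.2 ≠ 0) : mu (RV .qd) p = 0 ∧ mu (RV .eul) p = 1 ∧
    ∀ i j, mu (RV (.rot i j)) p = 0 := by
  refine ⟨?_, ?_, fun i j => ?_⟩
  · rw [mu, Dv_rr hp]; simp [RV]
  · have h2 : ∑ i, p.2 i * p.2 i = rr p ^ 2 := by
      simp only [← sq]; simp [rr, EuclideanSpace.norm_sq_eq]
    have h1 := gρ_rr hp
    rw [mu, Dv_rr hp]; simp only [RV, h2]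
    linear_combination (gρ p * rr p + 1) * h1
  · have := mu_ZV (.rot i j) hp
    exact this

theorem Dv_rf_qd {F : ℝ → Pt → ℂ} (hF : Smooth2 F) {p : E4} (hp : p.2 ≠ 0) :
    Dv (RV .qd) (rf F) p = rf (qdq F) p := by
  rw [Dv_rf hF hp, (mu_RV hp).1]
  have := congrFun (qdq_eq hF) (p.1, ‖p.2‖⁻¹ • p.2)
  refine Eq.trans ?_ this.symm
  simp [Dv, RV]

theorem Dv_rf_eul {F : ℝ → Pt → ℂ} (hF : Smooth2 F) {p : E4} (hp : p.2 ≠ 0) :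
    Dv (RV .eul) (rf F) p = 0 := by
  rw [Dv_rf hF hp, (mu_RV hp).2.1]
  have : (((RV .eul p).1, ‖p.2‖⁻¹ • (RV .eul p).2 - (1 * gρ p) • p.2) : E4) = 0 := by
    simp [RV, gρ]
  rw [this, map_zero]

theorem Dv_rf_rot {F : ℝ → Pt → ℂ} (hF : Smooth2 F) {p : E4} (hp : p.2 ≠ 0) (i j : Fin 3) :
    Dv (RV (.rot i j)) (rf F) p = rf (aRot i j F) p := by
  rw [Dv_rf hF hp, (mu_RV hp).2.2]
  have := congrFun (aRot_eq hF i j) (p.1, ‖p.2‖⁻¹ • p.2)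
  refine Eq.trans ?_ this.symm
  simp [Dv, RV, smul_sub, smul_smul]

theorem rf_words {F : ℝ → Pt → ℂ} (hF : Smooth2 F) (l : List RF) :
    (∀ p : E4, p.2 ≠ 0 → It RV l (rf F) p = 0) ∨
    ∃ (k : ℕ) (l' : List (Fin 3 × Fin 3)), k + l'.length = l.length ∧
      ∀ p : E4, p.2 ≠ 0 → It RV l (rf F) p = rf (qdq^[k] (aIter l' F)) p := by
  induction l with
  | nil => exact Or.inr ⟨0, [], rfl, fun p _ => rfl⟩
  | cons W l ih =>
    rcases ih with h | ⟨k, l', hk, h⟩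
    · refine Or.inl fun p hp => ?_
      have : It RV l (rf F) =ᶠ[𝓝 p] fun _ => (0 : ℂ) := eq_of_x0 hp h
      simp only [It]
      rw [Dv_congr_at this, Dv_const]
    · have hc : ∀ p : E4, p.2 ≠ 0 → It RV (W :: l) (rf F) p
          = Dv (RV W) (rf (qdq^[k] (aIter l' F))) p := fun p hp => by
        simp only [It]
        exact Dv_congr_at (eq_of_x0 hp h)
      have hs := aIter_smooth hF l'
      have hs2 := qdq_iter_smooth hs k
      cases W with
      | qd =>
        refine Or.inr ⟨k + 1, l', by simp; omega, fun p hp => ?_⟩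
        rw [hc p hp, Dv_rf_qd hs2 hp, Function.iterate_succ_apply']
      | eul => exact Or.inl fun p hp => by rw [hc p hp, Dv_rf_eul hs2 hp]
      | rot i j =>
        refine Or.inr ⟨k, (i, j) :: l', by simp; omega, fun p hp => ?_⟩
        rw [hc p hp, Dv_rf_rot hs2 hp, aRot_qdq_iter hs]
        rfl

theorem rf_Bd {F : ℝ → Pt → ℂ} {n : ℕ} {γ D : ℝ} (hF : Smooth2 F) (hb : RadBound n γ D F)
    {p : E4} (hp : p.2 ≠ 0) : Bd RV n (rf F) p (D * jb p.1 ^ (-γ)) := by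
  have hj := jb_pos p.1
  have hu : rad (‖p.2‖⁻¹ • p.2) = 1 := by
    have : ‖p.2‖ ≠ 0 := by simpa using hp
    simp [rad, norm_smul, this]
  have key : ∀ k (l : List (Fin 3 × Fin 3)), k + l.length ≤ n →
      ‖rf (qdq^[k] (aIter l F)) p‖ ≤ D * jb p.1 ^ (-γ) := by
    intro k l hk
    have := hb k l hk p.1 _ hu
    rw [Real.rpow_neg hj.le, ← div_eq_mul_inv, le_div_iff₀ (Real.rpow_pos_of_pos hj _)]
    exact this
  refine ⟨rf_sm hF hp, fun l hl => ?_⟩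
  rcases rf_words hF l with h | ⟨k, l', hk, h⟩
  · rw [h p hp, norm_zero]
    exact (norm_nonneg _).trans (key 0 [] (by simp))
  · rw [h p hp]
    exact key k l' (by omega)

end PartSix

section PartSeven
open scoped ContDiff

/-- functions of `q` only, in the radiation frame -/
theorem qfun_OB {Θ : Type*} {P : Θ → E4 → Prop} (H : (ℝ → ℝ) → Prop) {w : ℝ → ℝ}
    (hsm : ∀ h, H h → ContDiff ℝ ∞ h) (hbd : ∀ h, H h → ∃ C, 0 ≤ C ∧ ∀ s, |h s| ≤ C * w s)
    (hw : ∀ s, 0 ≤ w s) (hd : ∀ h, H h → H (fun s => jb s * deriv h s))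
    (n : ℕ) {h : ℝ → ℝ} (hh : H h) :
    OB RV P n (fun _ p => h p.1) (fun _ p => w p.1) := by
  have hs : ∀ h, H h → ∀ p : E4, SmA (fun p : E4 => h p.1) p := fun h hh p =>
    SmA.of_contDiff ((hsm h hh).comp contDiff_fst)
  have h0 : ∀ h, H h → ∃ C, 0 ≤ C ∧ ∀ (θ : Θ) (p : E4), P θ p → ‖h p.1‖ ≤ C * w p.1 := by
    intro h hh
    obtain ⟨C, hC, h2⟩ := hbd h hh
    exact ⟨C, hC, fun θ p _ => h2 _⟩
  have hD : ∀ h, H h → ∀ W p, Dv (RV W) (fun p : E4 => h p.1) p = (RV W p).1 • deriv h p.1 := by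
    intro h hh W p
    rw [Dv_comp_real (f := fun p : E4 => p.1) ((hsm h hh).differentiable (by simp) _) fst_sm, Dv_fst]
  induction n generalizing h with
  | zero => exact OB.zeroth (fun _ p _ => hs h hh p) (h0 h hh)
  | succ n ih =>
    refine OB.succ (fun _ p _ => hs h hh p) (fun _ p _ => hw _) (h0 h hh) fun W => ?_
    cases W with
    | qd =>
      refine (ih (hd h hh)).congr fun θ p _ => Eventually.of_forall fun y => ?_
      simp only [hD h hh]; rfl
    | eul =>
      refine (OB.zero fun _ p _ => hw _).congr fun θ p _ => Eventually.of_forall fun y => ?_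
      simp only [hD h hh]; simp [RV]
    | rot i j =>
      refine (OB.zero fun _ p _ => hw _).congr fun θ p _ => Eventually.of_forall fun y => ?_
      simp only [hD h hh]; simp [RV]

theorem qb_abs (s : ℝ) : |s * (jb s)⁻¹| ≤ 1 := by
  rw [abs_mul, abs_inv, abs_of_pos (jb_pos s), ← div_eq_mul_inv, div_le_one (jb_pos s)]
  exact jb_ge_abs s

theorem qb_deriv (s : ℝ) : HasDerivAt (fun s => s * (jb s)⁻¹) ((1 - (s * (jb s)⁻¹) ^ 2) * (jb s)⁻¹) s := by
  have h1 := (hasDerivAt_id s).mul ((jb_hasDerivAt s).inv (jb_pos s).ne')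
  refine h1.congr_deriv ?_
  have := (jb_pos s).ne'
  simp only [id, Pi.inv_apply]
  field_simp
  ring

/-- powers of the Japanese bracket -/
theorem jpow_OB {Θ : Type*} {P : Θ → E4 → Prop} (κ : ℝ) (n : ℕ) (Q : Polynomial ℝ) :
    OB RV P n (fun _ p => jb p.1 ^ κ * Q.eval (p.1 * (jb p.1)⁻¹)) (fun _ p => jb p.1 ^ κ) := by
  have hjs : ContDiff ℝ ∞ (fun s => jb s ^ κ) := jb_contDiff.rpow_const_of_ne fun s => (jb_pos s).ne'
  have hbs : ContDiff ℝ ∞ (fun s => s * (jb s)⁻¹) :=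
    contDiff_id.mul (jb_contDiff.inv fun s => (jb_pos s).ne')
  refine qfun_OB (w := fun s => jb s ^ κ)
    (h := fun s => jb s ^ κ * Q.eval (s * (jb s)⁻¹))
    (fun h => ∃ Q : Polynomial ℝ, h = fun s => jb s ^ κ * Q.eval (s * (jb s)⁻¹)) ?_ ?_ ?_ ?_ n ⟨Q, rfl⟩
  · rintro h ⟨Q, rfl⟩
    exact hjs.mul ((show ContDiff ℝ ∞ (fun x => Q.eval x) by simpa using Q.contDiff_aeval (𝕜 := ℝ) ∞).comp hbs)
  · rintro h ⟨Q, rfl⟩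
    obtain ⟨C, hC⟩ := (isCompact_Icc (a := (-1 : ℝ)) (b := 1)).exists_bound_of_continuousOn
      Q.continuous.continuousOn
    refine ⟨max C 0, le_max_right _ _, fun s => ?_⟩
    rw [abs_mul, abs_of_pos (Real.rpow_pos_of_pos (jb_pos s) _), mul_comm]
    refine mul_le_mul_of_nonneg_right ?_ (Real.rpow_pos_of_pos (jb_pos s) _).le
    exact (hC _ (abs_le.1 (qb_abs s))).trans (le_max_left _ _)
  · exact fun s => (Real.rpow_pos_of_pos (jb_pos s) _).le
  · rintro h ⟨Q, rfl⟩
    refine ⟨Polynomial.C κ * Polynomial.X * Q + (1 - Polynomial.X ^ 2) * Q.derivative, ?_⟩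
    funext s
    have h1 := ((jb_hasDerivAt s).rpow_const (p := κ) (Or.inl (jb_pos s).ne')).mul
      ((Q.hasDerivAt (s * (jb s)⁻¹)).comp s (qb_deriv s))
    have h2 : deriv (fun s => jb s ^ κ * Q.eval (s * (jb s)⁻¹)) s = _ := h1.deriv
    rw [h2]
    have hj := (jb_pos s).ne'
    rw [Real.rpow_sub_one hj]
    simp only [Polynomial.eval_add, Polynomial.eval_mul, Polynomial.eval_C, Polynomial.eval_X,
      Polynomial.eval_sub, Polynomial.eval_one, Polynomial.eval_pow, Function.comp]
    field_simp

theorem jpow1_OB {Θ : Type*} {P : Θ → E4 → Prop} (κ : ℝ) (n : ℕ) :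
    OB RV P n (fun _ p => jb p.1 ^ κ) (fun _ p => jb p.1 ^ κ) := by
  simpa using jpow_OB (P := P) κ n 1

/-- compactly supported smooth cutoffs -/
def Cut0 (h : ℝ → ℝ) : Prop := ContDiff ℝ ∞ h ∧ (∀ s < -1, h s = 0) ∧ (∀ s > 0, h s = 0)

theorem Cut0.deriv {h : ℝ → ℝ} (hh : Cut0 h) : Cut0 (deriv h) := by
  refine ⟨(contDiff_infty_iff_deriv.1 hh.1).2, fun s hs => ?_, fun s hs => ?_⟩
  · have : h =ᶠ[𝓝 s] fun _ => 0 := by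
      filter_upwards [Iio_mem_nhds hs] with y hy using hh.2.1 y hy
    rw [this.deriv_eq]; simp
  · have : h =ᶠ[𝓝 s] fun _ => 0 := by
      filter_upwards [Ioi_mem_nhds hs] with y hy using hh.2.2 y hy
    rw [this.deriv_eq]; simp

theorem Cut0.mul {h g : ℝ → ℝ} (hh : Cut0 h) (hg : ContDiff ℝ ∞ g) : Cut0 (fun s => g s * h s) :=
  ⟨hg.mul hh.1, fun s hs => by simp [hh.2.1 s hs], fun s hs => by simp [hh.2.2 s hs]⟩

theorem cut0_OB {Θ : Type*} {P : Θ → E4 → Prop} (κ : ℝ) (n : ℕ) {h : ℝ → ℝ} (hh : Cut0 h) :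
    OB RV P n (fun _ p => h p.1) (fun _ p => jb p.1 ^ κ) := by
  refine qfun_OB (w := fun s => jb s ^ κ) Cut0 (fun h hh => hh.1) ?_
    (fun s => (Real.rpow_pos_of_pos (jb_pos s) _).le) (fun h hh => hh.deriv.mul jb_contDiff) n hh
  intro h hh
  have hc : Continuous (fun s => h s * jb s ^ (-κ)) :=
    hh.1.continuous.mul (jb_contDiff.continuous.rpow_const fun s => Or.inl (jb_pos s).ne')
  obtain ⟨C, hC⟩ := (isCompact_Icc (a := (-1 : ℝ)) (b := 0)).exists_bound_of_continuousOn
      hc.continuousOn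
  refine ⟨max C 0, le_max_right _ _, fun s => ?_⟩
  have hp := Real.rpow_pos_of_pos (jb_pos s) κ
  by_cases hs : s ∈ Set.Icc (-1 : ℝ) 0
  · have := (hC s hs).trans (le_max_left C 0)
    rw [Real.norm_eq_abs, abs_mul, Real.rpow_neg (jb_pos s).le, abs_inv, abs_of_pos hp,
      ← div_eq_mul_inv, div_le_iff₀ hp] at this
    exact this
  · have : h s = 0 := by
      by_contra h0
      exact hs ⟨not_lt.1 fun h1 => h0 (hh.2.1 s h1), not_lt.1 fun h1 => h0 (hh.2.2 s h1)⟩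
    rw [this, abs_zero]; positivity

theorem gωR_OB {Θ : Type*} {P : Θ → E4 → Prop} (hP : ∀ θ p, P θ p → p.2 ≠ 0) (n : ℕ) (i : Fin 3) :
    OB RV P n (fun _ => gω i) one' := by
  have h0 : ∀ i, ∃ C, 0 ≤ C ∧ ∀ (θ : Θ) (p : E4), P θ p → ‖gω i p‖ ≤ C * (one' : Θ → E4 → ℝ) θ p :=
    fun i => ⟨1, zero_le_one, fun θ p hp => by simpa [one'] using abs_gω_le (hP θ p hp) i⟩
  induction n generalizing i with
  | zero => exact OB.zeroth (fun θ p hp => gω_sm (hP θ p hp)) (h0 i)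
  | succ n ih =>
    refine OB.succ (fun θ p hp => gω_sm (hP θ p hp)) one'_nonneg (h0 i) fun W => ?_
    cases W with
    | qd =>
      refine (OB.zero one'_nonneg).congr fun θ p hp => eq_of_x0 (hP θ p hp) fun y hy => ?_
      rw [Dv_gω i hy, (mu_RV hy).1]; simp [RV]
    | eul =>
      refine (OB.zero one'_nonneg).congr fun θ p hp => eq_of_x0 (hP θ p hp) fun y hy => ?_
      rw [Dv_gω i hy, (mu_RV hy).2.1]; simp [RV, gω]
    | rot j k =>
      have h1 : OB RV P n (fun _ p => (ee k : Pt) i * gω j p - (ee j : Pt) i * gω k p) one' :=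
        (OB.mul1 R_hV (OB.const' _) (ih j)).sub R_hV (OB.mul1 R_hV (OB.const' _) (ih k))
      refine h1.congr fun θ p hp => eq_of_x0 (hP θ p hp) fun y hy => ?_
      rw [Dv_gω i hy, (mu_RV hy).2.2]
      simp only [RV, gω, PiLp.sub_apply, PiLp.smul_apply, smul_eq_mul]
      ring

/-- the data -/
structure Dat (γ : ℝ) (nI : ℕ) where
  Φ : ℝ → Pt → ℂ
  𝒜 : Ix → ℝ → Pt → ℝ
  D : ℕ → ℝ
  hΦ : Smooth2 Φ
  h𝒜 : ∀ α, Smooth2 (fun q σ => ((𝒜 α q σ : ℝ) : ℂ))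
  hb : ∀ k : ℕ, RadBound k γ (D k) Φ ∧
          ∀ α, RadBound k γ (D k) (fun q σ => ((𝒜 α q σ : ℝ) : ℂ))
  hD : D (nI + 3) ≤ 1

theorem Dat.nonneg {γ : ℝ} {nI : ℕ} (d : Dat γ nI) (k : ℕ) : 0 ≤ d.D k := by
  have := (d.hb k).1 0 [] (by simp) 0 (EuclideanSpace.single 0 1) (by simp [rad])
  exact le_trans (mul_nonneg (norm_nonneg _) (Real.rpow_pos_of_pos (jb_pos 0) _).le) this

theorem RadBound.mono {N M : ℕ} {γ ε : ℝ} {F : ℝ → Pt → ℂ} (h : RadBound N γ ε F) (hM : M ≤ N) :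
    RadBound M γ ε F := fun k l hk => h k l (hk.trans hM)

/-- the region `x ≠ 0` -/
def X0 {Θ : Type*} : Θ → E4 → Prop := fun _ p => p.2 ≠ 0

theorem Phi_OB (γ : ℝ) (nI n N : ℕ) (hN : n ≤ N) :
    OB RV (X0 : Dat γ nI → E4 → Prop) n (fun d => rf d.Φ) (fun d p => d.D N * jb p.1 ^ (-γ)) :=
  ⟨1, zero_le_one, fun d p hp => by
    simpa using rf_Bd d.hΦ ((d.hb N).1.mono hN) hp⟩

theorem A_OB (γ : ℝ) (nI n N : ℕ) (hN : n ≤ N) :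
    OB RV (X0 : Dat γ nI × Ix → E4 → Prop) n (fun d => rf (fun q σ => ((d.1.𝒜 d.2 q σ : ℝ) : ℂ)))
      (fun d p => d.1.D N * jb p.1 ^ (-γ)) :=
  ⟨1, zero_le_one, fun d p hp => by
    simpa using rf_Bd (d.1.h𝒜 d.2) (((d.1.hb N).2 d.2).mono hN) hp⟩

theorem rf_dq {F : ℝ → Pt → ℂ} (hF : Smooth2 F) {p : E4} (hp : p.2 ≠ 0) :
    rf (dq F) p = ((jb p.1 ^ (-1 : ℝ) : ℝ) : ℂ) * Dv (RV .qd) (rf F) p := by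
  rw [Dv_rf_qd hF hp]
  simp only [rf, qdq, Real.rpow_neg_one]
  push_cast
  have := (jb_pos p.1).ne'
  have h2 : ((jb p.1 : ℝ) : ℂ) ≠ 0 := by exact_mod_cast this
  field_simp

theorem dPhi_OB (γ : ℝ) (nI n N : ℕ) (hN : n + 1 ≤ N) :
    OB RV (X0 : Dat γ nI → E4 → Prop) n (fun d => rf (dq d.Φ))
      (fun d p => d.D N * jb p.1 ^ (-γ - 1)) := by
  have h := OB.mul R_hV (OB.ofReal R_hV (jpow1_OB (P := (X0 : Dat γ nI → E4 → Prop)) (-1) n))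
    ((Phi_OB γ nI (n + 1) N hN).dv R_hV .qd)
  refine (h.congr fun d p hp => eq_of_x0 hp fun y hy => (rf_dq d.hΦ hy).symm).weight 1 zero_le_one ?_
  intro d p hp
  rw [sub_eq_add_neg, Real.rpow_add (jb_pos _)]
  exact le_of_eq (by ring)

/-- complexified current -/
def Jf {γ : ℝ} {nI : ℕ} (d : Dat γ nI × Ix) : E4 → ℂ :=
  rf fun q σ => ((Jr d.1.Φ d.2 q σ : ℝ) : ℂ)

/-- `L_α` as homogeneous function -/
def gl : Ix → E4 → ℝ
  | none => fun _ => -1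
  | some i => gω i

theorem OB.ix {ι : Type*} {V : ι → E4 → E4} {Θ F : Type*} [NormedAddCommGroup F] [NormedSpace ℝ F]
    {P : Θ × Ix → E4 → Prop} {n : ℕ} {f : Θ × Ix → E4 → F}
    {w : Θ × Ix → E4 → ℝ} (hw : ∀ θ p, P θ p → 0 ≤ w θ p)
    (h : ∀ α, OB V (fun θ p => P (θ, α) p) n (fun θ => f (θ, α)) (fun θ => w (θ, α))) :
    OB V P n f w := by
  choose C hC h using h
  refine ⟨∑ α, C α, Finset.sum_nonneg fun α _ => hC α, fun θ p hp => ?_⟩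
  refine (h θ.2 θ.1 p hp).le (mul_le_mul_of_nonneg_right ?_ (hw θ p hp))
  exact Finset.single_le_sum (f := C) (fun i _ => hC i) (Finset.mem_univ θ.2)

theorem gl_OB {Θ : Type*} (n : ℕ) :
    OB RV (X0 : Θ × Ix → E4 → Prop) n (fun d => gl d.2) one' := by
  refine OB.ix one'_nonneg fun α => ?_
  cases α with
  | none => exact OB.const' _
  | some i => exact gωR_OB (fun _ _ h => h) n i

theorem Jf_eq {γ : ℝ} {nI : ℕ} (d : Dat γ nI × Ix) (p : E4) :
    Jf d p = ((gl d.2 p : ℝ) : ℂ) * (Complex.ofRealCLM.comp Complex.imCLM)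
      (rf d.1.Φ p * (Complex.conjCLE.toContinuousLinearMap) (rf (dq d.1.Φ) p)) := by
  obtain ⟨d, α⟩ := d
  have : Llow α (‖p.2‖⁻¹ • p.2) = gl α p := by
    cases α with
    | none => rfl
    | some i => simp [Llow, gl, gω, gρ, mul_comm]
  simp [Jf, rf, Jr, this]

theorem OB.clm {ι X Θ F G : Type*} [NormedAddCommGroup X] [NormedSpace ℝ X]
    [NormedAddCommGroup F] [NormedSpace ℝ F]
    [NormedAddCommGroup G] [NormedSpace ℝ G] (L : F →L[ℝ] G) (hL : ∀ v, ‖L v‖ ≤ ‖v‖)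
    {V : ι → X → X} {P : Θ → X → Prop} {n : ℕ} {f : Θ → X → F} {w : Θ → X → ℝ}
    (hV : ∀ i p, SmA (V i) p) (h : OB V P n f w) : OB V P n (fun θ p => L (f θ p)) w := by
  obtain ⟨C, hC, h⟩ := h
  exact ⟨C, hC, fun θ p hp => Bd.clm L hL hV (h θ p hp)⟩

theorem Jf_OB (γ : ℝ) (nI n N : ℕ) (hN : n + 1 ≤ N) :
    OB RV (X0 : Dat γ nI × Ix → E4 → Prop) n Jf
      (fun d p => d.1.D N ^ 2 * jb p.1 ^ (-(2 * γ + 1))) := by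
  have h1 := (Phi_OB γ nI n N (by omega)).reparam (P' := (X0 : Dat γ nI × Ix → E4 → Prop))
    Prod.fst (fun _ _ h => h)
  have h2 := (dPhi_OB γ nI n N hN).reparam (P' := (X0 : Dat γ nI × Ix → E4 → Prop))
    Prod.fst (fun _ _ h => h)
  have h3 := OB.clm (Complex.conjCLE.toContinuousLinearMap) (by simp) R_hV h2
  have h4 := OB.mul R_hV h1 h3
  have h5 := OB.clm (Complex.ofRealCLM.comp Complex.imCLM) (fun v => by
      simpa using Complex.abs_im_le_norm v) R_hV h4
  have h6 := OB.mul1 R_hV (OB.ofReal R_hV (gl_OB n)) h5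
  refine (h6.congr fun d p hp => Eventually.of_forall fun y => (Jf_eq d y).symm).weight 1 zero_le_one ?_
  intro d p hp
  have : -(2 * γ + 1) = -γ + (-γ - 1) := by ring
  rw [this, Real.rpow_add (jb_pos _)]
  exact le_of_eq (by ring)

end PartSeven

section PartEight
open scoped ContDiff

/-- a class of differentiable functions closed under derivatives along a smooth frame consists
of smooth functions -/
theorem class_smooth {X F ι : Type*} [NormedAddCommGroup X] [NormedSpace ℝ X]
    [NormedAddCommGroup F] [NormedSpace ℝ F] [Fintype ι] {U : Set X} (hU : IsOpen U)
    (V : ι → X → X) (c : ι → X → X →L[ℝ] ℝ) (hc : ∀ i, ContDiffOn ℝ ∞ (c i) U)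
    (hdec : ∀ p ∈ U, ∀ v, ∑ i, c i p v • V i p = v) (K : (X → F) → Prop)
    (hd : ∀ f, K f → ∀ p ∈ U, DifferentiableAt ℝ f p)
    (hcl : ∀ f, K f → ∀ i, ∃ g, K g ∧ ∀ p ∈ U, fderiv ℝ f p (V i p) = g p)
    {f : X → F} (hf : K f) : ContDiffOn ℝ ∞ f U := by
  rw [contDiffOn_infty]
  intro n
  induction n generalizing f with
  | zero =>
    simp only [Nat.cast_zero, contDiffOn_zero]
    exact fun p hp => (hd f hf p hp).continuousAt.continuousWithinAt
  | succ n ih =>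
    have : ((n + 1 : ℕ) : ℕ∞ω) = (n : ℕ∞ω) + 1 := by simp
    rw [this, contDiffOn_succ_iff_fderiv_of_isOpen hU]
    refine ⟨fun p hp => (hd f hf p hp).differentiableWithinAt, fun h => by simp at h, ?_⟩
    choose g hg1 hg2 using hcl f hf
    have h1 : ∀ p ∈ U, fderiv ℝ f p = ∑ i, (c i p).smulRight (g i p) := by
      intro p hp
      ext v
      conv_lhs => rw [← hdec p hp v]
      simp [hg2 _ p hp]
    refine ContDiffOn.congr ?_ h1
    refine ContDiffOn.sum fun i _ => ?_
    exact ((hc i).of_le (WithTop.coe_le_coe.2 le_top)).smulRight (ih (hg1 i))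

theorem jb_shift {a b : ℝ} (h : |a - b| ≤ 1) : jb a ≤ 2 * jb b := by
  have h1 := jb_sq a
  have h2 := jb_sq b
  have h3 := abs_le.1 h
  have := jb_pos b
  have := jb_pos a
  nlinarith [sq_nonneg (a - 2 * b)]

theorem jb_rpow_shift {a b s : ℝ} (hs : 0 ≤ s) (h : |a - b| ≤ 1) :
    jb a ^ (-s) ≤ 2 ^ s * jb b ^ (-s) := by
  have h1 : jb b ≤ 2 * jb a := jb_shift (by rwa [abs_sub_comm])
  have ha := jb_pos a
  have hb := jb_pos b
  have h2 : (2 * jb a) ^ (-s) ≤ jb b ^ (-s) :=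
    Real.rpow_le_rpow_of_nonpos hb h1 (by linarith)
  rw [Real.mul_rpow (by norm_num) ha.le] at h2
  have h3 : (2 : ℝ) ^ s * 2 ^ (-s) = 1 := by
    rw [← Real.rpow_add (by norm_num)]; simp
  calc jb a ^ (-s) = 2 ^ s * (2 ^ (-s) * jb a ^ (-s)) := by rw [← mul_assoc, h3, one_mul]
    _ ≤ _ := mul_le_mul_of_nonneg_left h2 (by positivity)

theorem jb_int {s : ℝ} (hs : 1 < s) : Integrable (fun η : ℝ => jb η ^ (-s)) := by
  have := integrable_rpow_neg_one_add_norm_sq (E := ℝ) (μ := volume) (r := s) (by simpa using hs)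
  refine this.congr (Eventually.of_forall fun η => ?_)
  simp only [jb, Real.norm_eq_abs, sq_abs]
  rw [Real.sqrt_eq_rpow, ← Real.rpow_mul (by positivity)]
  congr 1; ring

theorem jb_int' {s : ℝ} (hs : 1 < s) (q : ℝ) : Integrable (fun η : ℝ => jb (η + q) ^ (-s)) :=
  (jb_int hs).comp_add_right q

theorem jb_tendsto_top {s : ℝ} (hs : 0 < s) (q : ℝ) :
    Tendsto (fun η : ℝ => jb (η + q) ^ (-s)) atTop (𝓝 0) := by
  refine (tendsto_rpow_neg_atTop hs).comp (tendsto_atTop_mono (f := fun η => η + q) (fun η => ?_)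
    (tendsto_atTop_add_const_right _ _ tendsto_id))
  exact (le_abs_self _).trans (jb_ge_abs _)

theorem jb_tendsto_bot {s : ℝ} (hs : 0 < s) (q : ℝ) :
    Tendsto (fun η : ℝ => jb (η + q) ^ (-s)) atBot (𝓝 0) := by
  refine ((jb_tendsto_top hs (-q)).comp tendsto_neg_atBot_atTop).congr fun η => ?_
  simp only [Function.comp]
  rw [← jb_neg]; congr 2; ring

/-- functions with symbol decay in `q` -/
def FF (s : ℝ) (F : E4 → ℂ) : Prop :=
  ∀ n, OB RV (X0 : Unit → E4 → Prop) n (fun _ => F) (fun _ p => jb p.1 ^ (-s))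

/-- frame without weight -/
def VB : RF → E4 → E4
  | .qd => fun _ => bT
  | .eul => RV .eul
  | .rot i j => RV (.rot i j)

theorem FF.dv {s : ℝ} {F : E4 → ℂ} (h : FF s F) (W : RF) : FF s (Dv (RV W) F) :=
  fun n => (h (n + 1)).dv R_hV W

theorem Dv_bT (F : E4 → ℂ) (p : E4) :
    Dv (VB .qd) F p = ((jb p.1 ^ (-1 : ℝ) : ℝ) : ℂ) * Dv (RV .qd) F p := by
  have : RV .qd p = jb p.1 • bT := by simp [RV, bT]
  simp only [Dv, this, map_smul, Complex.real_smul, Real.rpow_neg_one, VB]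
  rw [← mul_assoc, ← Complex.ofReal_mul, inv_mul_cancel₀ (jb_pos _).ne']
  simp

theorem Dv_qd_bT (F : E4 → ℂ) (p : E4) :
    Dv (RV .qd) F p = ((jb p.1 : ℝ) : ℂ) * Dv (VB .qd) F p := by
  have : RV .qd p = jb p.1 • bT := by simp [RV, bT]
  simp only [Dv, this, map_smul, Complex.real_smul, VB]

theorem FF.dvB {s : ℝ} {F : E4 → ℂ} (h : FF s F) (W : RF) : FF s (Dv (VB W) F) := by
  cases W with
  | qd =>
    intro n
    have h2 := OB.mul R_hV (OB.ofReal R_hV (jpow1_OB (P := (X0 : Unit → E4 → Prop)) (-1) n))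
      (h.dv .qd n)
    refine (h2.congr fun _ p _ => Eventually.of_forall fun y => (Dv_bT F y).symm).weight 1
      zero_le_one fun _ p _ => ?_
    refine mul_le_mul_of_nonneg_right ?_ (Real.rpow_pos_of_pos (jb_pos _) _).le
    exact Real.rpow_le_one_of_one_le_of_nonpos (jb_ge_one _) (by norm_num)
  | eul => exact h.dv .eul
  | rot i j => exact h.dv (.rot i j)

theorem FF.sm {s : ℝ} {F : E4 → ℂ} (h : FF s F) {p : E4} (hp : p.2 ≠ 0) : SmA F p :=
  (h 0).sm (θ := ()) hp

theorem FF.bd {s : ℝ} {F : E4 → ℂ} (h : FF s F) :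
    ∃ C : ℝ, 0 ≤ C ∧ ∀ p : E4, p.2 ≠ 0 → ‖F p‖ ≤ C * jb p.1 ^ (-s) := by
  obtain ⟨C, hC, h2⟩ := (h 0).val
  exact ⟨C, hC, fun p hp => h2 () p hp⟩

/-- dual frame -/
def cR : RF → E4 → (E4 →L[ℝ] ℝ)
  | .qd => fun _ => ContinuousLinearMap.fst ℝ ℝ Pt
  | .eul => fun p => (gρ p ^ 2) • ((innerSL ℝ p.2).comp (ContinuousLinearMap.snd ℝ ℝ Pt))
  | .rot i j => fun p => (gρ p ^ 2 * p.2 i) •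
      ((EuclideanSpace.proj j : Pt →L[ℝ] ℝ).comp (ContinuousLinearMap.snd ℝ ℝ Pt))

theorem cR_sm (W : RF) : ContDiffOn ℝ ∞ (cR W) {p : E4 | p.2 ≠ 0} := by
  have hρ : ContDiffOn ℝ ∞ gρ {p : E4 | p.2 ≠ 0} := fun p hp => (gρ_sm hp).at.contDiffWithinAt
  cases W with
  | qd => exact contDiffOn_const
  | eul =>
    refine (hρ.pow 2).smul ?_
    exact (((innerSL ℝ).contDiff.comp contDiff_snd).clm_comp contDiff_const).contDiffOn
  | rot i j => exact ((hρ.pow 2).mul (xx_contDiff i).contDiffOn).smul contDiffOn_const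

theorem RF_sum {M : Type*} [AddCommMonoid M] (f : RF → M) :
    ∑ W, f W = f .qd + f .eul + ∑ i, ∑ j, f (.rot i j) := by
  have h : (Finset.univ : Finset RF) = {RF.qd, RF.eul} ∪
      (Finset.univ : Finset (Fin 3 × Fin 3)).image (fun x => RF.rot x.1 x.2) := by
    ext W; cases W <;> simp
  rw [h, Finset.sum_union (by
    rw [Finset.disjoint_left]; intro a ha; simp at ha ⊢; rcases ha with rfl | rfl <;> simp),
    Finset.sum_image (by rintro ⟨a, b⟩ _ ⟨c, d⟩ _ h; simpa using h), Finset.sum_pair (by simp),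
    Fintype.sum_prod_type]

theorem cR_dec {p : E4} (hp : p.2 ≠ 0) (v : E4) : ∑ W, cR W p v • VB W p = v := by
  have h1 := gρ_rr hp
  have h2 : ∑ i, p.2 i ^ 2 = rr p ^ 2 := by simp [rr, EuclideanSpace.norm_sq_eq]
  have h3 : gρ p ^ 2 * (p.2 0 ^ 2 + p.2 1 ^ 2 + p.2 2 ^ 2) = 1 := by
    rw [Fin.sum_univ_three] at h2; rw [h2]; linear_combination (gρ p * rr p + 1) * h1
  rw [RF_sum]
  refine Prod.ext ?_ ?_
  · simp [cR, VB, RV, bT, Fin.sum_univ_three]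
  · ext k
    fin_cases k
    · simp [cR, VB, RV, bT, Fin.sum_univ_three, PiLp.inner_apply]
      linear_combination (v.2 0) * h3
    · simp [cR, VB, RV, bT, Fin.sum_univ_three, PiLp.inner_apply]
      linear_combination (v.2 1) * h3
    · simp [cR, VB, RV, bT, Fin.sum_univ_three, PiLp.inner_apply]
      linear_combination (v.2 2) * h3

theorem cR_norm {p : E4} (hp : p.2 ≠ 0) (W : RF) : ‖cR W p‖ ≤ 1 + gρ p := by
  have hρ := gρ_pos hp
  have hr := gρ_rr hp
  have hx : ∀ i, |p.2 i| ≤ rr p := fun i => by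
    simpa [rr] using EuclideanSpace.norm_eq p.2 ▸ PiLp.norm_apply_le p.2 i
  refine ContinuousLinearMap.opNorm_le_bound _ (by positivity) fun v => ?_
  have hv1 : ‖v.1‖ ≤ ‖v‖ := norm_fst_le v
  have hv2 : ‖v.2‖ ≤ ‖v‖ := norm_snd_le v
  have hk : gρ p ^ 2 * rr p = gρ p := by rw [sq, mul_assoc, hr, mul_one]
  have hv := norm_nonneg v
  cases W with
  | qd => simp only [cR]; change ‖v.1‖ ≤ _; nlinarith
  | eul =>
    have : ‖inner ℝ p.2 v.2‖ ≤ rr p * ‖v.2‖ := norm_inner_le_norm _ _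
    have h4 : ‖cR .eul p v‖ = gρ p ^ 2 * ‖inner ℝ p.2 v.2‖ := by
      simp [cR]
    rw [h4]
    calc _ ≤ gρ p ^ 2 * (rr p * ‖v.2‖) := mul_le_mul_of_nonneg_left this (by positivity)
      _ = gρ p * ‖v.2‖ := by rw [← mul_assoc, hk]
      _ ≤ _ := by nlinarith [norm_nonneg v.2]
  | rot i j =>
    have h5 : |v.2 j| ≤ ‖v.2‖ := by simpa using PiLp.norm_apply_le v.2 j
    have h4 : ‖cR (.rot i j) p v‖ = gρ p ^ 2 * |p.2 i| * |v.2 j| := by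
      simp [cR, abs_mul]
    rw [h4]
    calc _ ≤ gρ p ^ 2 * rr p * ‖v.2‖ := by
          have hrr := (rr_pos hp).le
          gcongr; exact hx i
      _ = gρ p * ‖v.2‖ := by rw [hk]
      _ ≤ _ := by nlinarith [norm_nonneg v.2]

theorem FF.fderiv_bd {s : ℝ} {F : E4 → ℂ} (h : FF s F) :
    ∃ C : ℝ, 0 ≤ C ∧ ∀ p : E4, p.2 ≠ 0 → ‖fderiv ℝ F p‖ ≤ C * (1 + gρ p) * jb p.1 ^ (-s) := by
  choose C hC hb using fun W => (h.dvB W).bd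
  refine ⟨∑ W, C W, Finset.sum_nonneg fun W _ => hC W, fun p hp => ?_⟩
  have hρ := gρ_pos hp
  have hj := Real.rpow_pos_of_pos (jb_pos p.1) (-s)
  have hs : 0 ≤ ∑ W, C W := Finset.sum_nonneg fun W _ => hC W
  refine ContinuousLinearMap.opNorm_le_bound _ (by positivity) fun v => ?_
  conv_lhs => rw [← cR_dec hp v]
  rw [map_sum]
  refine (norm_sum_le _ _).trans ?_
  rw [Finset.sum_mul, Finset.sum_mul, Finset.sum_mul]
  refine Finset.sum_le_sum fun W _ => ?_
  rw [map_smul, norm_smul]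
  have h1 : ‖cR W p v‖ ≤ (1 + gρ p) * ‖v‖ := (ContinuousLinearMap.le_opNorm _ _).trans
    (mul_le_mul_of_nonneg_right (cR_norm hp W) (norm_nonneg _))
  have h2 := hb W p hp
  calc ‖cR W p v‖ * ‖fderiv ℝ F p (VB W p)‖ ≤ ((1 + gρ p) * ‖v‖) * (C W * jb p.1 ^ (-s)) := by
        gcongr
        exact h2
    _ = _ := by ring

/-- partial integration in `q` -/
def PI (μ : Measure ℝ) (F : E4 → ℂ) : E4 → ℂ := fun p => ∫ η, F (((η, 0) : E4) + p) ∂μ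

theorem sh_snd (η : ℝ) (p : E4) : (((η, 0) : E4) + p).2 = p.2 := by simp
theorem sh_fst (η : ℝ) (p : E4) : (((η, 0) : E4) + p).1 = η + p.1 := by simp

theorem sh_cont {F : Type*} [TopologicalSpace F] {f : E4 → F} (h : ∀ p : E4, p.2 ≠ 0 → ContinuousAt f p)
    {p : E4} (hp : p.2 ≠ 0) : Continuous (fun η : ℝ => f (((η, 0) : E4) + p)) := by
  rw [continuous_iff_continuousAt]
  intro η
  have h1 : Continuous (fun η : ℝ => ((η, 0) : E4) + p) := by fun_prop
  exact ContinuousAt.comp (f := fun η : ℝ => ((η, 0) : E4) + p) (h _ (by simpa using hp)) h1.continuousAt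

theorem FF.integrable {s : ℝ} (hs : 1 < s) {F : E4 → ℂ} (h : FF s F) {p : E4} (hp : p.2 ≠ 0) :
    Integrable (fun η => F (((η, 0) : E4) + p)) := by
  obtain ⟨C, hC, hb⟩ := h.bd
  refine ((jb_int' hs p.1).const_mul C).mono'
    (sh_cont (fun p hp => (h.sm hp).at.continuousAt) hp).aestronglyMeasurable
    (Eventually.of_forall fun η => ?_)
  have := hb (((η, 0) : E4) + p) (by simpa using hp)
  rwa [sh_fst] at this

theorem FF.cont_fderiv {s : ℝ} {F : E4 → ℂ} (h : FF s F) {p : E4} (hp : p.2 ≠ 0) :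
    ContinuousAt (fderiv ℝ F) p :=
  ((h.sm hp).at.fderiv_right (m := 0) (by simp)).continuousAt

theorem FF.hasFDerivAt {s : ℝ} (hs : 1 < s) {F : E4 → ℂ} (h : FF s F) (S : Set ℝ) {p : E4}
    (hp : p.2 ≠ 0) : HasFDerivAt (PI (volume.restrict S) F)
      (∫ η in S, fderiv ℝ F (((η, 0) : E4) + p)) p := by
  obtain ⟨C, hC, hb⟩ := h.fderiv_bd
  have hr := rr_pos hp
  have hρ := gρ_pos hp
  have hball : {y : E4 | |y.1 - p.1| < 1 ∧ rr p / 2 < ‖y.2‖} ∈ 𝓝 p := by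
    refine IsOpen.mem_nhds ?_ ?_
    · exact (isOpen_lt (f := fun y : E4 => |y.1 - p.1|) (g := fun _ => (1:ℝ)) (by fun_prop)
        (by fun_prop)).inter (isOpen_lt (f := fun _ : E4 => rr p / 2) (g := fun y => ‖y.2‖)
        (by fun_prop) (by fun_prop))
    · refine ⟨by simp, ?_⟩
      change rr p / 2 < rr p; linarith
  refine hasFDerivAt_integral_of_dominated_of_fderiv_le (𝕜 := ℝ)
    (F := fun (p : E4) η => F (((η, 0) : E4) + p))
    (F' := fun p η => fderiv ℝ F (((η, 0) : E4) + p))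
    (bound := fun η => C * (1 + 2 * gρ p) * 2 ^ s * jb (η + p.1) ^ (-s)) hball ?_ ?_ ?_ ?_ ?_ ?_
  · filter_upwards [x0_ev hp] with y hy
    exact (sh_cont (fun p hp => (h.sm hp).at.continuousAt) hy).aestronglyMeasurable
  · exact (h.integrable hs hp).integrableOn
  · exact (sh_cont (fun p hp => h.cont_fderiv hp) hp).aestronglyMeasurable
  · refine Eventually.of_forall fun η y hy => ?_
    have hy2 : y.2 ≠ 0 := by
      intro h0; have := hy.2; rw [h0, norm_zero] at this; linarith
    have h1 := hb (((η, 0) : E4) + y) (by simpa using hy2)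
    have h2 : gρ (((η, 0) : E4) + y) ≤ 2 * gρ p := by
      simp only [gρ, sh_snd]
      have : ‖y.2‖⁻¹ ≤ (rr p / 2)⁻¹ := inv_anti₀ (by positivity) hy.2.le
      refine this.trans (le_of_eq ?_)
      simp [rr, div_eq_mul_inv, mul_comm]
    have h3 : jb (((η, 0) : E4) + y).1 ^ (-s) ≤ 2 ^ s * jb (η + p.1) ^ (-s) := by
      refine jb_rpow_shift (by linarith) ?_
      rw [sh_fst]
      have := hy.1.le
      rwa [show η + y.1 - (η + p.1) = y.1 - p.1 by ring]
    refine h1.trans ?_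
    rw [mul_assoc (C * (1 + 2 * gρ p))]
    have := (Real.rpow_pos_of_pos (jb_pos (((η, 0) : E4) + y).1) (-s)).le
    gcongr
  · exact ((jb_int' hs p.1).const_mul _).integrableOn
  · refine Eventually.of_forall fun η y hy => ?_
    have hy2 : y.2 ≠ 0 := by
      intro h0; have := hy.2; rw [h0, norm_zero] at this; linarith
    have h1 := (h.sm (p := ((η, 0) : E4) + y) (by simpa using hy2)).diff.hasFDerivAt
    have h2 := HasFDerivAt.comp y h1 ((hasFDerivAt_id y).const_add ((η, 0) : E4))
    rw [ContinuousLinearMap.comp_id] at h2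
    exact h2

theorem FF.Dv_PI {s : ℝ} (hs : 1 < s) {F : E4 → ℂ} (h : FF s F) (S : Set ℝ) {p : E4}
    (hp : p.2 ≠ 0) (W : RF) :
    Dv (VB W) (PI (volume.restrict S) F) p = PI (volume.restrict S) (Dv (VB W) F) p := by
  rw [Dv, (h.hasFDerivAt hs S hp).fderiv]
  have hi : Integrable (fun η => fderiv ℝ F (((η, 0) : E4) + p)) (volume.restrict S) := by
    obtain ⟨C, hC, hb⟩ := h.fderiv_bd
    refine (((jb_int' hs p.1).const_mul (C * (1 + gρ p))).mono'
      (sh_cont (fun p hp => h.cont_fderiv hp) hp).aestronglyMeasurable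
      (Eventually.of_forall fun η => ?_)).integrableOn
    have := hb (((η, 0) : E4) + p) (by simpa using hp)
    rw [sh_fst] at this
    simpa [gρ] using this
  rw [ContinuousLinearMap.integral_apply hi]
  simp only [PI]
  refine integral_congr_ae (Eventually.of_forall fun η => ?_)
  have : VB W p = VB W (((η, 0) : E4) + p) := by cases W <;> simp [VB, RV]
  simp only [Dv, ← this]

theorem FF.PI_sm {s : ℝ} (hs : 1 < s) {F : E4 → ℂ} (h : FF s F) (S : Set ℝ) {p : E4}
    (hp : p.2 ≠ 0) : SmA (PI (volume.restrict S) F) p := by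
  have := class_smooth (F := ℂ) x0_open VB cR cR_sm (fun p hp v => cR_dec hp v)
    (fun f => ∃ F, FF s F ∧ f = PI (volume.restrict S) F)
    (by rintro f ⟨F, hF, rfl⟩ p hp; exact (hF.hasFDerivAt hs S hp).differentiableAt)
    (by
      rintro f ⟨F, hF, rfl⟩ W
      exact ⟨_, ⟨_, hF.dvB W, rfl⟩, fun p hp => hF.Dv_PI hs S hp W⟩) ⟨F, h, rfl⟩
  exact SmA.of_x0 hp (fun p hp => (this p hp).contDiffAt (x0_open.mem_nhds hp))

theorem FF.line {s : ℝ} {F : E4 → ℂ} (h : FF s F) {p : E4} (hp : p.2 ≠ 0) (η : ℝ) :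
    HasDerivAt (fun η : ℝ => F (((η, 0) : E4) + p)) (Dv (VB .qd) F (((η, 0) : E4) + p)) η := by
  have h1 := (h.sm (p := ((η, 0) : E4) + p) (by simpa using hp)).diff.hasFDerivAt
  have h2 : HasDerivAt (fun η : ℝ => ((η, 0) : E4) + p) bT η :=
    ((hasDerivAt_id η).prodMk (hasDerivAt_const η (0 : Pt))).add_const p
  exact h1.comp_hasDerivAt η h2

theorem FF.PI_Iic {s : ℝ} (hs : 1 < s) {F : E4 → ℂ} (h : FF s F) {p : E4} (hp : p.2 ≠ 0) :
    Dv (VB .qd) (PI (volume.restrict (Set.Iic 0)) F) p = F p := by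
  rw [h.Dv_PI hs _ hp]
  obtain ⟨C, hC, hb⟩ := h.bd
  have ht : Tendsto (fun η : ℝ => F (((η, 0) : E4) + p)) atBot (𝓝 0) := by
    refine squeeze_zero_norm (fun η => ?_)
      (by simpa using (jb_tendsto_bot (s := s) (by linarith) p.1).const_mul C)
    have := hb (((η, 0) : E4) + p) (by simpa using hp)
    rwa [sh_fst] at this
  have := integral_Iic_of_hasDerivAt_of_tendsto' (a := (0 : ℝ)) (fun η _ => h.line hp η)
    ((h.dvB .qd).integrable hs hp).integrableOn ht
  simp only [PI]
  rw [this, sub_zero]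
  congr 1
  exact zero_add p

theorem FF.PI_univ {s : ℝ} (hs : 1 < s) {F : E4 → ℂ} (h : FF s F) {p : E4} (hp : p.2 ≠ 0) :
    Dv (VB .qd) (PI (volume.restrict Set.univ) F) p = 0 := by
  rw [h.Dv_PI hs _ hp]
  obtain ⟨C, hC, hb⟩ := h.bd
  have ht : Tendsto (fun η : ℝ => F (((η, 0) : E4) + p)) atBot (𝓝 0) := by
    refine squeeze_zero_norm (fun η => ?_)
      (by simpa using (jb_tendsto_bot (s := s) (by linarith) p.1).const_mul C)
    have := hb (((η, 0) : E4) + p) (by simpa using hp)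
    rwa [sh_fst] at this
  have ht2 : Tendsto (fun η : ℝ => F (((η, 0) : E4) + p)) atTop (𝓝 0) := by
    refine squeeze_zero_norm (fun η => ?_)
      (by simpa using (jb_tendsto_top (s := s) (by linarith) p.1).const_mul C)
    have := hb (((η, 0) : E4) + p) (by simpa using hp)
    rwa [sh_fst] at this
  have := integral_of_hasDerivAt_of_tendsto (fun η => h.line hp η)
    ((h.dvB .qd).integrable hs hp) ht ht2
  simp only [PI, Measure.restrict_univ]
  rw [this]
  simp

end PartEight

section PartNine
open scoped ContDiff

theorem jb_rpow_pos (a κ : ℝ) : 0 < jb a ^ κ := Real.rpow_pos_of_pos (jb_pos a) κ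

theorem tail_pos {s : ℝ} (hs : 1 < s) {q : ℝ} (hq : 0 ≤ q) :
    ∫ η in Set.Ioi (0:ℝ), jb (η + q) ^ (-s) ≤ 2 ^ s / (s - 1) * jb q ^ (-(s - 1)) := by
  have ha := jb_pos q
  have hd : ∀ η ∈ Set.Ici (0:ℝ), HasDerivAt (fun η => -(η + jb q) ^ (-(s - 1)) / (s - 1))
      ((η + jb q) ^ (-s)) η := by
    intro η hη
    have h0 : 0 < η + jb q := by have : (0:ℝ) ≤ η := hη; linarith
    have h1 : HasDerivAt (fun η => η + jb q) 1 η := (hasDerivAt_id η).add_const _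
    have h2 := h1.rpow_const (p := -(s - 1)) (Or.inl h0.ne')
    have h3 := (h2.neg).div_const (s - 1)
    have e : -(s - 1) - 1 = -s := by ring
    rw [e] at h3
    have hs1 : s - 1 ≠ 0 := by linarith
    refine h3.congr_deriv ?_
    field_simp
  have hpos : ∀ η ∈ Set.Ioi (0:ℝ), 0 ≤ (η + jb q) ^ (-s) := fun η hη =>
    Real.rpow_nonneg (by have : (0:ℝ) < η := hη; linarith) _
  have ht : Tendsto (fun η => -(η + jb q) ^ (-(s - 1)) / (s - 1)) atTop (𝓝 0) := by
    have h1 : Tendsto (fun η => (η + jb q) ^ (-(s - 1))) atTop (𝓝 0) :=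
      (tendsto_rpow_neg_atTop (by linarith : 0 < s - 1)).comp
        (tendsto_atTop_add_const_right _ _ tendsto_id)
    simpa using h1.neg.div_const (s - 1)
  have hi := integrableOn_Ioi_deriv_of_nonneg' hd hpos ht
  have hv := integral_Ioi_of_hasDerivAt_of_nonneg' hd hpos ht
  have hle : ∀ η ∈ Set.Ioi (0:ℝ), jb (η + q) ^ (-s) ≤ 2 ^ s * (η + jb q) ^ (-s) := by
    intro η hη
    have hη' : (0:ℝ) < η := hη
    have h1 : (η + jb q) ≤ 2 * jb (η + q) := by
      have e1 := jb_ge_one (η + q)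
      have e2 := jb_ge_abs (η + q)
      have e3 := le_abs_self (η + q)
      have e4 : jb q ≤ 1 + q := by
        have := jb_le q; rwa [abs_of_nonneg hq] at this
      linarith
    have h2 : (2 * jb (η + q)) ^ (-s) ≤ (η + jb q) ^ (-s) :=
      Real.rpow_le_rpow_of_nonpos (by linarith) h1 (by linarith)
    rw [Real.mul_rpow (by norm_num) (jb_pos _).le] at h2
    have h3 : (2 : ℝ) ^ s * 2 ^ (-s) = 1 := by
      rw [← Real.rpow_add (by norm_num)]; simp
    calc jb (η + q) ^ (-s) = 2 ^ s * (2 ^ (-s) * jb (η + q) ^ (-s)) := by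
          rw [← mul_assoc, h3, one_mul]
      _ ≤ _ := mul_le_mul_of_nonneg_left h2 (by positivity)
  calc _ ≤ ∫ η in Set.Ioi (0:ℝ), 2 ^ s * (η + jb q) ^ (-s) :=
        setIntegral_mono_on (jb_int' hs q).integrableOn (hi.const_mul _) measurableSet_Ioi hle
    _ = 2 ^ s * (0 - -(0 + jb q) ^ (-(s - 1)) / (s - 1)) := by
        rw [integral_const_mul, hv]
    _ = _ := by rw [zero_add]; ring

theorem tail_neg {s : ℝ} (hs : 1 < s) {q : ℝ} (hq : q ≤ 0) :
    ∫ η in Set.Iic (0:ℝ), jb (η + q) ^ (-s) ≤ 2 ^ s / (s - 1) * jb q ^ (-(s - 1)) := by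
  have h1 := tail_pos hs (q := -q) (by linarith)
  rw [jb_neg] at h1
  refine le_of_eq_of_le ?_ h1
  have := integral_comp_neg_Iic (0:ℝ) (fun η => jb (η + -q) ^ (-s))
  rw [neg_zero] at this
  rw [← this]
  congr 1
  ext η
  rw [← neg_add, jb_neg]

/-- total integral -/
def KK (f : E4 → ℂ) : E4 → ℂ := PI (volume.restrict Set.univ) f
/-- partial integral -/
def PP (f : E4 → ℂ) : E4 → ℂ := PI (volume.restrict (Set.Iic 0)) f
/-- renormalized partial integral -/
def GG (χin : ℝ → ℝ) (f : E4 → ℂ) : E4 → ℂ :=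
  fun p => PP f p - ((1 - χin p.1 : ℝ) : ℂ) * KK f p

variable {Θ : Type*} {s : ℝ} {c : Θ → ℝ} {χin : ℝ → ℝ}

theorem PI_bd (hs : 1 < s) {f : E4 → ℂ} (S : Set ℝ) {p : E4} {A : ℝ}
    (hb : ∀ p : E4, p.2 ≠ 0 → ‖f p‖ ≤ A * jb p.1 ^ (-s)) (hp : p.2 ≠ 0) :
    ‖PI (volume.restrict S) f p‖ ≤ A * ∫ η in S, jb (η + p.1) ^ (-s) := by
  rw [← integral_const_mul]
  refine norm_integral_le_of_norm_le ((jb_int' hs p.1).const_mul A).integrableOn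
    (Eventually.of_forall fun η => ?_)
  have := hb (((η, 0) : E4) + p) (by simpa using hp)
  rwa [sh_fst] at this

theorem PI_bd_all (hs : 1 < s) {f : E4 → ℂ} (S : Set ℝ) {p : E4} {A : ℝ} (hA : 0 ≤ A)
    (hb : ∀ p : E4, p.2 ≠ 0 → ‖f p‖ ≤ A * jb p.1 ^ (-s)) (hp : p.2 ≠ 0) :
    ‖PI (volume.restrict S) f p‖ ≤ A * ∫ η, jb η ^ (-s) := by
  refine (PI_bd hs S hb hp).trans (mul_le_mul_of_nonneg_left ?_ hA)
  refine (setIntegral_le_integral (jb_int' hs p.1)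
    (Eventually.of_forall fun η => (jb_rpow_pos _ _).le)).trans (le_of_eq ?_)
  exact integral_add_right_eq_self (fun η => jb η ^ (-s)) p.1

theorem Dv_PI_nq (hs : 1 < s) {f : E4 → ℂ} (h : FF s f) (S : Set ℝ) {W : RF} (hW : VB W = RV W)
    {p : E4} (hp : p.2 ≠ 0) :
    Dv (RV W) (PI (volume.restrict S) f) p = PI (volume.restrict S) (Dv (RV W) f) p := by
  rw [← hW]; exact h.Dv_PI hs S hp W

theorem KK_OB (hs : 1 < s) (hc : ∀ θ, 0 ≤ c θ) {n : ℕ} {f : Θ → E4 → ℂ} (hf : ∀ θ, FF s (f θ))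
    (h : OB RV (X0 : Θ → E4 → Prop) n f (fun θ p => c θ * jb p.1 ^ (-s))) :
    OB RV (X0 : Θ → E4 → Prop) n (fun θ => KK (f θ)) (fun θ _ => c θ) := by
  have base : ∃ C : ℝ, 0 ≤ C ∧ ∀ θ (p : E4), X0 θ p → ‖KK (f θ) p‖ ≤ C * c θ := by
    obtain ⟨C, hC, hb⟩ := h.val
    refine ⟨C * ∫ η, jb η ^ (-s), mul_nonneg hC (integral_nonneg fun η => (jb_rpow_pos _ _).le),
      fun θ p hp => ?_⟩
    have := PI_bd_all hs Set.univ (mul_nonneg hC (hc θ))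
      (fun p hp => (hb θ p hp).trans (le_of_eq (mul_assoc _ _ _).symm)) hp
    refine this.trans (le_of_eq (by ring))
  induction n generalizing f with
  | zero => exact OB.zeroth (fun θ p hp => (hf θ).PI_sm hs _ hp) base
  | succ n ih =>
    refine OB.succ (fun θ p hp => (hf θ).PI_sm hs _ hp) (fun θ p _ => hc θ) base fun W => ?_
    have key : ∀ W, VB W = RV W → OB RV (X0 : Θ → E4 → Prop) n
        (fun θ => Dv (RV W) (KK (f θ))) (fun θ _ => c θ) := by
      intro W hW
      have hb : ∃ C : ℝ, 0 ≤ C ∧ ∀ θ (p : E4), X0 θ p → ‖KK (Dv (RV W) (f θ)) p‖ ≤ C * c θ := by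
        obtain ⟨C, hC, hb⟩ := (h.dv R_hV W).val
        refine ⟨C * ∫ η, jb η ^ (-s), mul_nonneg hC (integral_nonneg fun η => (jb_rpow_pos _ _).le),
          fun θ p hp => ?_⟩
        have := PI_bd_all hs Set.univ (mul_nonneg hC (hc θ))
          (fun p hp => (hb θ p hp).trans (le_of_eq (mul_assoc _ _ _).symm)) hp
        refine this.trans (le_of_eq (by ring))
      refine (ih (fun θ => (hf θ).dv W) (h.dv R_hV W) hb).congr fun θ p hp => ?_
      exact eq_of_x0 hp fun y hy => (Dv_PI_nq hs (hf θ) _ hW hy).symm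
    cases W with
    | qd =>
      refine (OB.zero (fun θ p _ => hc θ)).congr fun θ p hp => ?_
      refine eq_of_x0 hp fun y hy => ?_
      rw [Dv_qd_bT, KK, (hf θ).PI_univ hs hy, mul_zero]
    | eul => exact key _ rfl
    | rot i j => exact key _ rfl

theorem χin_bd (hχin : ContDiff ℝ ∞ χin) : ∃ M : ℝ, 0 ≤ M ∧ ∀ q ∈ Set.Icc (-1:ℝ) 0, |1 - χin q| ≤ M := by
  obtain ⟨M, hM⟩ := (isCompact_Icc (a := (-1 : ℝ)) (b := 0)).exists_bound_of_continuousOn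
      (f := fun q => 1 - χin q) (continuous_const.sub hχin.continuous).continuousOn
  refine ⟨|M|, abs_nonneg _, fun q hq => ?_⟩
  exact (hM q hq).trans (le_abs_self M)

theorem GG_base (hs : 1 < s) (hχin : ContDiff ℝ ∞ χin) (h1 : ∀ s ≤ -1, χin s = 1)
    (h0 : ∀ s, -(1/2) ≤ s → χin s = 0) (hc : ∀ θ, 0 ≤ c θ) {n : ℕ} {f : Θ → E4 → ℂ}
    (hf : ∀ θ, FF s (f θ))
    (h : OB RV (X0 : Θ → E4 → Prop) n f (fun θ p => c θ * jb p.1 ^ (-s))) :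
    ∃ C : ℝ, 0 ≤ C ∧ ∀ θ (p : E4), X0 θ p → ‖GG χin (f θ) p‖ ≤ C * (c θ * jb p.1 ^ (-(s - 1))) := by
  obtain ⟨C, hC, hb'⟩ := h.val
  have hb : ∀ θ (p : E4), p.2 ≠ 0 → ‖f θ p‖ ≤ (C * c θ) * jb p.1 ^ (-s) :=
    fun θ p hp => (hb' θ p hp).trans (le_of_eq (mul_assoc _ _ _).symm)
  obtain ⟨M, hM0, hM⟩ := χin_bd hχin
  have hA : ∀ θ, 0 ≤ C * c θ := fun θ => mul_nonneg hC (hc θ)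
  set I := ∫ η, jb η ^ (-s) with hI
  have hI0 : 0 ≤ I := integral_nonneg fun η => (jb_rpow_pos _ _).le
  set T := (2:ℝ) ^ s / (s - 1) with hT
  have hT0 : 0 ≤ T := div_nonneg (by positivity) (by linarith)
  refine ⟨C * (T + (1 + M) * I * 2 ^ (s - 1)), by positivity, fun θ p hp => ?_⟩
  have hJ := jb_rpow_pos p.1 (-(s - 1))
  have hq : p.1 < -1 ∨ 0 < p.1 ∨ p.1 ∈ Set.Icc (-1:ℝ) 0 := by
    rcases lt_or_ge p.1 (-1) with h | h
    · exact Or.inl h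
    · rcases lt_or_ge 0 p.1 with h' | h'
      · exact Or.inr (Or.inl h')
      · exact Or.inr (Or.inr ⟨h, h'⟩)
  have fin1 : ∀ a : ℝ, a ≤ (C * c θ) * (T * jb p.1 ^ (-(s - 1))) →
      a ≤ C * (T + (1 + M) * I * 2 ^ (s - 1)) * (c θ * jb p.1 ^ (-(s - 1))) := by
    intro a ha
    have : 0 ≤ (C * c θ) * ((1 + M) * I * 2 ^ (s - 1)) * jb p.1 ^ (-(s - 1)) := by
      have := hA θ; positivity
    linarith
  rcases hq with hq | hq | hq
  · refine fin1 _ ?_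
    have : GG χin (f θ) p = PP (f θ) p := by simp [GG, h1 _ hq.le]
    rw [this]
    exact (PI_bd hs _ (hb θ) hp).trans
      (mul_le_mul_of_nonneg_left (tail_neg hs (by linarith)) (hA θ))
  · refine fin1 _ ?_
    have : GG χin (f θ) p = - PI (volume.restrict (Set.Ioi 0)) (f θ) p := by
      have := integral_add_compl (measurableSet_Iic (a := (0:ℝ))) ((hf θ).integrable hs hp)
      rw [Set.compl_Iic] at this
      simp only [GG, h0 _ (by linarith : -(1/2) ≤ p.1), PP, KK, PI, Measure.restrict_univ]
      rw [← this]
      simp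
    rw [this, norm_neg]
    exact (PI_bd hs _ (hb θ) hp).trans
      (mul_le_mul_of_nonneg_left (tail_pos hs hq.le) (hA θ))
  · have e1 : ‖PP (f θ) p‖ ≤ C * c θ * I := PI_bd_all hs _ (hA θ) (hb θ) hp
    have e2 : ‖KK (f θ) p‖ ≤ C * c θ * I := PI_bd_all hs _ (hA θ) (hb θ) hp
    have e3 : ‖GG χin (f θ) p‖ ≤ (1 + M) * (C * c θ * I) := by
      have e4 : ‖((1 - χin p.1 : ℝ) : ℂ) * KK (f θ) p‖ ≤ M * (C * c θ * I) := by
        rw [norm_mul, Complex.norm_real]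
        exact mul_le_mul (hM _ hq) e2 (norm_nonneg _) hM0
      calc _ ≤ _ := norm_sub_le _ _
        _ ≤ _ := add_le_add e1 e4
        _ = _ := by ring
    have e5 : 1 ≤ 2 ^ (s - 1) * jb p.1 ^ (-(s - 1)) := by
      have : jb p.1 ≤ 2 := by
        have := jb_le p.1
        have : |p.1| ≤ 1 := abs_le.2 ⟨hq.1, by linarith [hq.2]⟩
        linarith
      have h2 : (2:ℝ) ^ (-(s - 1)) ≤ jb p.1 ^ (-(s - 1)) :=
        Real.rpow_le_rpow_of_nonpos (jb_pos _) this (by linarith)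
      have h3 : (2 : ℝ) ^ (s - 1) * 2 ^ (-(s - 1)) = 1 := by
        rw [← Real.rpow_add (by norm_num)]; simp
      refine h3.symm.le.trans ?_
      exact mul_le_mul_of_nonneg_left h2 (by positivity)
    have hcI : 0 ≤ (1 + M) * (C * c θ * I) := by have := hA θ; positivity
    have : 0 ≤ C * c θ * (T * jb p.1 ^ (-(s - 1))) := by have := hA θ; positivity
    calc _ ≤ (1 + M) * (C * c θ * I) * 1 := by rw [mul_one]; exact e3
      _ ≤ (1 + M) * (C * c θ * I) * (2 ^ (s - 1) * jb p.1 ^ (-(s - 1))) :=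
          mul_le_mul_of_nonneg_left e5 hcI
      _ ≤ _ := by linarith

theorem fq_sm {h : ℝ → ℝ} (hh : ContDiff ℝ ∞ h) (p : E4) : SmA (fun p : E4 => h p.1) p :=
  SmA.of_contDiff (hh.comp contDiff_fst)

theorem Dv_fq {h : ℝ → ℝ} (hh : ContDiff ℝ ∞ h) (V : E4 → E4) (p : E4) :
    Dv V (fun p : E4 => h p.1) p = (V p).1 * deriv h p.1 := by
  have := Dv_comp_real (V := V) (h := h) (f := fun p : E4 => p.1) (p := p)
    (hh.differentiable (by simp) _) (SmA.of_contDiff contDiff_fst)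
  rw [Dv_fst] at this
  exact this

theorem GG_sm (hs : 1 < s) (hχin : ContDiff ℝ ∞ χin) {f : E4 → ℂ} (hf : FF s f) {p : E4}
    (hp : p.2 ≠ 0) : SmA (GG χin f) p :=
  (hf.PI_sm hs _ hp).sub (((fq_sm (h := fun q => 1 - χin q) (contDiff_const.sub hχin) p).ofReal).mul
    (hf.PI_sm hs _ hp))

theorem Dv_GG (hs : 1 < s) (hχin : ContDiff ℝ ∞ χin) {f : E4 → ℂ} (hf : FF s f) {p : E4}
    (hp : p.2 ≠ 0) (V : E4 → E4) : Dv V (GG χin f) p =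
      Dv V (PP f) p - ((1 - χin p.1 : ℝ) : ℂ) * Dv V (KK f) p
        + (((V p).1 * deriv χin p.1 : ℝ) : ℂ) * KK f p := by
  have h1 := fq_sm (h := fun q => 1 - χin q) (contDiff_const.sub hχin) p
  have e : (GG χin f) = fun y => PP f y - ((1 - χin y.1 : ℝ) : ℂ) * KK f y := rfl
  have hP : SmA (PP f) p := hf.PI_sm hs _ hp
  have hK : SmA (KK f) p := hf.PI_sm hs _ hp
  rw [e, Dv_sub hP (h1.ofReal.mul hK), Dv_mul h1.ofReal hK, Dv_ofReal h1,
    Dv_fq (contDiff_const.sub hχin)]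
  have : deriv (fun q => 1 - χin q) p.1 = - deriv χin p.1 := by
    rw [deriv_const_sub]
  rw [this]
  push_cast
  ring

theorem Dv_GG_qd (hs : 1 < s) (hχin : ContDiff ℝ ∞ χin) {f : E4 → ℂ} (hf : FF s f) {p : E4}
    (hp : p.2 ≠ 0) : Dv (RV .qd) (GG χin f) p =
      ((jb p.1 : ℝ) : ℂ) * f p + ((jb p.1 * deriv χin p.1 : ℝ) : ℂ) * KK f p := by
  rw [Dv_GG hs hχin hf hp, Dv_qd_bT (PP f), Dv_qd_bT (KK f), PP, hf.PI_Iic hs hp]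
  rw [show Dv (VB .qd) (KK f) p = 0 from hf.PI_univ hs hp]
  simp [RV]

theorem GG_OB (hs : 1 < s) (hχin : ContDiff ℝ ∞ χin) (h1 : ∀ s ≤ -1, χin s = 1)
    (h0 : ∀ s, -(1/2) ≤ s → χin s = 0) (hc : ∀ θ, 0 ≤ c θ) {n : ℕ} {f : Θ → E4 → ℂ}
    (hf : ∀ θ, FF s (f θ))
    (h : OB RV (X0 : Θ → E4 → Prop) n f (fun θ p => c θ * jb p.1 ^ (-s))) :
    OB RV (X0 : Θ → E4 → Prop) n (fun θ => GG χin (f θ))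
      (fun θ p => c θ * jb p.1 ^ (-(s - 1))) := by
  have hcut : Cut0 (deriv χin) := by
    refine ⟨(contDiff_infty_iff_deriv.1 hχin).2, fun q hq => ?_, fun q hq => ?_⟩
    · have : χin =ᶠ[𝓝 q] fun _ => 1 := by
        filter_upwards [Iio_mem_nhds hq] with y hy using h1 y (le_of_lt hy)
      rw [this.deriv_eq]; simp
    · have : χin =ᶠ[𝓝 q] fun _ => 0 := by
        filter_upwards [Ioi_mem_nhds hq] with y hy
        have : (0:ℝ) < y := hy
        exact h0 y (by linarith)
      rw [this.deriv_eq]; simp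
  induction n generalizing f with
  | zero => exact OB.zeroth (fun θ p hp => GG_sm hs hχin (hf θ) hp) (GG_base hs hχin h1 h0 hc hf h)
  | succ n ih =>
    refine OB.succ (fun θ p hp => GG_sm hs hχin (hf θ) hp)
      (fun θ p _ => mul_nonneg (hc θ) (jb_rpow_pos _ _).le) (GG_base hs hχin h1 h0 hc hf h)
      fun W => ?_
    have key : ∀ W, VB W = RV W → (∀ p, (RV W p).1 = 0) → OB RV (X0 : Θ → E4 → Prop) n
        (fun θ => Dv (RV W) (GG χin (f θ))) (fun θ p => c θ * jb p.1 ^ (-(s - 1))) := by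
      intro W hW hW0
      refine (ih (fun θ => (hf θ).dv W) (h.dv R_hV W)).congr fun θ p hp => ?_
      refine eq_of_x0 hp fun y hy => ?_
      rw [Dv_GG hs hχin (hf θ) hy, hW0, PP, KK, Dv_PI_nq hs (hf θ) _ hW hy,
        Dv_PI_nq hs (hf θ) _ hW hy]
      simp [GG, PP, KK]
    cases W with
    | qd =>
      have a1 := OB.mul R_hV (OB.ofReal R_hV (jpow1_OB (P := (X0 : Θ → E4 → Prop)) 1 n))
        (h.mono n.le_succ)
      have a2 := OB.mul R_hV (OB.ofReal R_hV (cut0_OB (P := (X0 : Θ → E4 → Prop)) (-(s-1)) n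
        (hcut.mul jb_contDiff))) (KK_OB hs hc hf (h.mono n.le_succ))
      have a3 := OB.add R_hV (a1.weight 1 zero_le_one
          (w' := fun θ p => c θ * jb p.1 ^ (-(s - 1))) (fun θ p _ => ?_))
        (a2.weight 1 zero_le_one (fun θ p _ => ?_))
      · refine a3.congr fun θ p hp => eq_of_x0 hp fun y hy => ?_
        rw [Dv_GG_qd hs hχin (hf θ) hy]
        simp
      · rw [one_mul, show -(s - 1) = 1 + -s by ring, Real.rpow_add (jb_pos _)]
        exact le_of_eq (by ring)
      · exact le_of_eq (by ring)
    | eul => exact key _ rfl (fun p => by simp [RV])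
    | rot i j => exact key _ rfl (fun p => by simp [RV])

end PartNine

section PartTen
open scoped ContDiff

theorem Dv_pull_rot (i j : Fin 3) {F : E4 → ℂ} {p : E4} (hp : p.2 ≠ 0) (hF : SmA F (gq p, p.2)) :
    Dv (ZV (.rot i j)) (pull F) p = pull (Dv (RV (.rot i j)) F) p := by
  rw [Dv_pull hp hF, Dv_gq', nu_ZV _ hp]
  simp [pull, Dv, RV, ZV, nuZ]

theorem box_B {B MB F : E4 → ℂ} {p : E4} (hp : p.2 ≠ 0) (hB : SmA B p) (hMB : SmA MB p)
    (hM : Dv MV B =ᶠ[𝓝 p] MB) (hrot : ∀ i j, Dv (ZV (.rot i j)) B =ᶠ[𝓝 p] fun _ => 0)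
    (hF : ∀ y : E4, y.2 ≠ 0 → SmA F y) (hE : ∀ y : E4, y.2 ≠ 0 → Dv (RV .eul) F y = 0) :
    boxV (fun y => (gρ y : ℂ) * (B y * pull F y)) p = (gρ p : ℂ) ^ 3 *
      ((Dv NV MB p - MB p) * pull F p
        + MB p * (((2 * rr p * ga p : ℝ) : ℂ) * pull (Dv (RV .qd) F) p)
        + (1 / 2) * ∑ i, ∑ j, B p * pull (Dv (RV (.rot i j)) (Dv (RV (.rot i j)) F)) p) := by
  have hPF : SmA (pull F) p := pull_sm hp (hF _ hp)
  rw [box_rho hp (hB.mul hPF)]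
  have h1 : Dv MV (fun y => B y * pull F y) =ᶠ[𝓝 p] fun y => MB y * pull F y := by
    filter_upwards [hB.ev, hM, x0_ev hp] with y h1 h2 hy
    rw [Dv_mul h1 (pull_sm hy (hF _ hy)), Dv_pull_M hy (hF _ hy), h2]
    have : pull (Dv (RV .eul) F) y = 0 := hE _ hy
    rw [this, mul_zero, add_zero]
  have h2 : ∀ G : E4 → ℂ, (∀ y : E4, y.2 ≠ 0 → SmA G y) → ∀ i j,
      Dv (ZV (.rot i j)) (fun y => B y * pull G y) =ᶠ[𝓝 p]
        fun y => B y * pull (Dv (RV (.rot i j)) G) y := by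
    intro G hG i j
    filter_upwards [hB.ev, hrot i j, x0_ev hp] with y h1 h2 hy
    rw [Dv_mul h1 (pull_sm hy (hG _ hy)), Dv_pull_rot i j hy (hG _ hy), h2]
    simp
  have h3 : ∀ i j, Dv (ZV (.rot i j)) (Dv (ZV (.rot i j)) (fun y => B y * pull F y)) p
      = B p * pull (Dv (RV (.rot i j)) (Dv (RV (.rot i j)) F)) p := by
    intro i j
    rw [(Dv_congr (V := ZV (.rot i j)) (h2 F hF i j)).self_of_nhds,
      (h2 (Dv (RV (.rot i j)) F) (fun y hy => SmA.dv (R_hV _ _) (hF y hy)) i j).self_of_nhds]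
  simp only [h3]
  rw [(Dv_congr (V := NV) h1).self_of_nhds, h1.self_of_nhds, Dv_mul hMB hPF, Dv_pull_N hp (hF _ hp)]
  have : pull (Dv (RV .eul) F) p = 0 := hE _ hp
  rw [this]
  ring

/-- the phase -/
def eE (k : ℝ) : E4 → ℂ := fun p => Complex.exp (-Complex.I * (k : ℂ) * ((Real.log (rr p) : ℝ) : ℂ))

theorem lr_sm {p : E4} (hp : p.2 ≠ 0) : SmA (fun p => Real.log (rr p)) p :=
  (rr_sm hp).log (rr_pos hp).ne'

theorem eE_sm (k : ℝ) {p : E4} (hp : p.2 ≠ 0) : SmA (eE k) p := by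
  have h : ContDiff ℝ ∞ (fun u : ℝ => Complex.exp (-Complex.I * (k : ℂ) * (u : ℂ))) :=
    (contDiff_const.mul Complex.ofRealCLM.contDiff).cexp
  exact SmA.comp (f := fun u : ℝ => Complex.exp (-Complex.I * (k : ℂ) * (u : ℂ)))
    (SmA.of_contDiff h) (lr_sm hp)

theorem Dv_eE (k : ℝ) {p : E4} (hp : p.2 ≠ 0) (V : E4 → E4) :
    Dv V (eE k) p = (-Complex.I * (k : ℂ)) * ((mu V p : ℝ) : ℂ) * eE k p := by
  have hd : HasDerivAt (fun u : ℝ => Complex.exp (-Complex.I * (k : ℂ) * (u : ℂ)))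
      (Complex.exp (-Complex.I * (k : ℂ) * ((Real.log (rr p) : ℝ) : ℂ)) * (-Complex.I * (k : ℂ) * 1))
      (Real.log (rr p)) := by
    have := ((hasDerivAt_id (Real.log (rr p))).ofReal_comp.const_mul (-Complex.I * (k : ℂ))).cexp
    simpa using this
  have := Dv_comp_real (V := V) (h := fun u : ℝ => Complex.exp (-Complex.I * (k : ℂ) * (u : ℂ)))
    (f := fun p : E4 => Real.log (rr p)) (p := p) hd.differentiableAt (lr_sm hp)
  rw [hd.deriv, Dv_log (rr_sm hp) (rr_pos hp).ne'] at this
  refine Eq.trans this ?_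
  simp only [mu, gρ, eE, Complex.real_smul, rr]
  ring

theorem eE_norm (k : ℝ) (p : E4) : ‖eE k p‖ = 1 := by
  rw [eE, show -Complex.I * (k : ℂ) * ((Real.log (rr p) : ℝ) : ℂ)
    = ((-(k * Real.log (rr p)) : ℝ) : ℂ) * Complex.I by push_cast; ring]
  exact Complex.norm_exp_ofReal_mul_I _

theorem OB.theta {Θ X ι F : Type*} [NormedAddCommGroup X] [NormedSpace ℝ X] [NormedAddCommGroup F]
    [NormedSpace ℝ F] {V : ι → X → X} {P : Θ → X → Prop} {n : ℕ}
    (c : Θ → F) {K : ℝ} (hK : 0 ≤ K) (hc : ∀ θ p, P θ p → ‖c θ‖ ≤ K) : OB V P n (fun θ _ => c θ) one' :=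
  ⟨K, hK, fun θ p hp => (Bd.const n (c θ)).le (by simpa [one'] using hc θ p hp)⟩

theorem eE_OB {Θ : Type*} {P : Θ → E4 → Prop} (hP : ∀ θ p, P θ p → Good p) (k : Θ → ℝ) {K : ℝ}
    (hK : 0 ≤ K) (hk : ∀ θ p, P θ p → |k θ| ≤ K) (n : ℕ) :
    OB ZV P n (fun θ => eE (k θ)) one' := by
  refine OB.eigen (h := fun z θ p => (-Complex.I * (k θ : ℂ)) * ((muZ z p : ℝ) : ℂ)) Z_hV
    (fun θ p hp => eE_sm _ (hP θ p hp).1) (fun _ _ _ => zero_le_one)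
    ⟨1, zero_le_one, fun θ p hp => by rw [eE_norm]; simp⟩ ?_ n ?_
  · intro z θ p hp
    refine eq_of_x0 (hP θ p hp).1 fun y hy => ?_
    rw [Dv_eE _ hy, mu_ZV z hy]
  · intro z m _
    refine OB.mul1 Z_hV ?_ (OB.ofReal Z_hV (mu_OB hP m z))
    refine OB.theta (fun θ => -Complex.I * (k θ : ℂ)) hK fun θ p hp => ?_
    simpa using hk θ p hp

theorem χs_sm {h : ℝ → ℝ} (hh : ContDiff ℝ ∞ h) {p : E4} (hp : p.2 ≠ 0) :
    SmA (fun p => h (gs p)) p := SmA.comp (f := h) (SmA.of_contDiff hh) (gs_sm hp)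

theorem Dv_χs {h : ℝ → ℝ} (hh : ContDiff ℝ ∞ h) {p : E4} (hp : p.2 ≠ 0) (V : E4 → E4) :
    Dv V (fun p => h (gs p)) p = (nu V p * gb p * gs p - mu V p * gs p) * deriv h (gs p) := by
  have := Dv_comp_real (V := V) (h := h) (f := gs) (p := p)
    (hh.differentiable (by simp) _) (gs_sm hp)
  rw [Dv_gs hp] at this
  exact this

theorem rs_a {p : E4} (hp : p.2 ≠ 0) : rr p * ga p * gs p = 1 := by
  have h1 := gρ_rr hp
  have h2 := ga_gj (p := p)
  rw [gs]; linear_combination h1 + gρ p * rr p * h2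

/-- radial derivative of cutoffs in `s` -/
theorem Dv_χs_N {h : ℝ → ℝ} (hh : ContDiff ℝ ∞ h) {p : E4} (hp : p.2 ≠ 0) :
    Dv NV (fun p => h (gs p)) p = (2 * gb p - gs p) * deriv h (gs p) := by
  rw [Dv_χs hh hp, (mu_MV hp).2.2.1, (mu_MV hp).2.2.2]
  linear_combination 2 * gb p * deriv h (gs p) * rs_a hp

theorem Dv_χs_M {h : ℝ → ℝ} (hh : ContDiff ℝ ∞ h) {p : E4} (hp : p.2 ≠ 0) :
    Dv MV (fun p => h (gs p)) p = - gs p * deriv h (gs p) := by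
  rw [Dv_χs hh hp, (mu_MV hp).1, (mu_MV hp).2.1]
  ring

/-- `s h'(s)` -/
def sD (h : ℝ → ℝ) : ℝ → ℝ := fun s => s * deriv h s

theorem deriv_smooth {h : ℝ → ℝ} (hh : ContDiff ℝ ∞ h) : ContDiff ℝ ∞ (deriv h) :=
  (contDiff_infty_iff_deriv.1 hh).2

theorem sD_smooth {h : ℝ → ℝ} (hh : ContDiff ℝ ∞ h) : ContDiff ℝ ∞ (sD h) :=
  contDiff_id.mul (deriv_smooth hh)

theorem wave1 {χ : ℝ → ℝ} (hχ : ContDiff ℝ ∞ χ) (k : ℝ) {F : E4 → ℂ} {p : E4} (hp : p.2 ≠ 0)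
    (hF : ∀ y : E4, y.2 ≠ 0 → SmA F y) (hE : ∀ y : E4, y.2 ≠ 0 → Dv (RV .eul) F y = 0) :
    boxV (fun y => (gρ y : ℂ) * ((eE k y * ((χ (gs y) : ℝ) : ℂ)) * pull F y)) p
      + Complex.I * eE k p * ((2 * k : ℝ) : ℂ) * (((ga p : ℝ) : ℂ) * pull (Dv (RV .qd) F) p)
        * ((χ (gs p) : ℝ) : ℂ) * (gρ p : ℂ) ^ 2
    = (gρ p : ℂ) ^ 3 * (eE k p * (
      (((-Complex.I * k - 1) * (-Complex.I * k * ((χ (gs p) : ℝ) : ℂ) - ((sD χ (gs p) : ℝ) : ℂ))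
        + ((2 * gb p - gs p : ℝ) : ℂ) * (-Complex.I * k * ((deriv χ (gs p) : ℝ) : ℂ)
            - ((deriv (sD χ) (gs p) : ℝ) : ℂ))) * pull F p
        - 2 * ((deriv χ (gs p) : ℝ) : ℂ) * pull (Dv (RV .qd) F) p)
      + (1 / 2) * (((χ (gs p) : ℝ) : ℂ) * ∑ i, ∑ j, pull (Dv (RV (.rot i j)) (Dv (RV (.rot i j)) F)) p))) := by
  have hsχ := sD_smooth hχ
  have h1 : ∀ y : E4, y.2 ≠ 0 → SmA (fun y => eE k y * ((χ (gs y) : ℝ) : ℂ)) y :=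
    fun y hy => (eE_sm k hy).mul (χs_sm hχ hy).ofReal
  have h2s : ∀ y : E4, y.2 ≠ 0 → SmA (fun y => -Complex.I * k * ((χ (gs y) : ℝ) : ℂ)
      - ((sD χ (gs y) : ℝ) : ℂ)) y :=
    fun y hy => (SmA.const.mul (χs_sm hχ hy).ofReal).sub (χs_sm hsχ hy).ofReal
  have h2 : ∀ y : E4, y.2 ≠ 0 → SmA (fun y => eE k y * (-Complex.I * k * ((χ (gs y) : ℝ) : ℂ)
      - ((sD χ (gs y) : ℝ) : ℂ))) y := fun y hy => (eE_sm k hy).mul (h2s y hy)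
  rw [box_B (MB := fun y => eE k y * (-Complex.I * k * ((χ (gs y) : ℝ) : ℂ)
      - ((sD χ (gs y) : ℝ) : ℂ))) hp (h1 p hp) (h2 p hp) ?_ ?_ hF hE]
  · have hN : Dv NV (fun y => eE k y * (-Complex.I * k * ((χ (gs y) : ℝ) : ℂ)
        - ((sD χ (gs y) : ℝ) : ℂ))) p = eE k p * (-Complex.I * k * (-Complex.I * k * ((χ (gs p) : ℝ) : ℂ)
        - ((sD χ (gs p) : ℝ) : ℂ)) + ((2 * gb p - gs p : ℝ) : ℂ) *
        (-Complex.I * k * ((deriv χ (gs p) : ℝ) : ℂ) - ((deriv (sD χ) (gs p) : ℝ) : ℂ))) := by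
      rw [Dv_mul (eE_sm k hp) (h2s p hp), Dv_eE k hp, (mu_MV hp).2.2.1,
        Dv_sub (SmA.const.mul (χs_sm hχ hp).ofReal) (χs_sm hsχ hp).ofReal,
        Dv_mul SmA.const (χs_sm hχ hp).ofReal, Dv_ofReal (χs_sm hχ hp), Dv_ofReal (χs_sm hsχ hp),
        Dv_χs_N hχ hp, Dv_χs_N hsχ hp, Dv_const]
      push_cast
      ring
    rw [hN]
    have hρ := gρC hp
    have e1 : ((rr p : ℝ) : ℂ) * ((ga p : ℝ) : ℂ) * ((gs p : ℝ) : ℂ) = 1 := by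
      exact_mod_cast congrArg (fun x : ℝ => (x : ℂ)) (rs_a hp)
    have e2 : (gρ p : ℂ) * (rr p : ℂ) = 1 := by
      exact_mod_cast congrArg (fun x : ℝ => (x : ℂ)) (gρ_rr hp)
    have e3 : ((sD χ (gs p) : ℝ) : ℂ) = ((gs p : ℝ) : ℂ) * ((deriv χ (gs p) : ℝ) : ℂ) := by
      simp [sD]
    have e4 : ∑ i, ∑ j, eE k p * ((χ (gs p) : ℝ) : ℂ)
        * pull (Dv (RV (.rot i j)) (Dv (RV (.rot i j)) F)) p
      = eE k p * ((χ (gs p) : ℝ) : ℂ) * ∑ i, ∑ j, pull (Dv (RV (.rot i j)) (Dv (RV (.rot i j)) F)) p := by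
      simp only [Finset.mul_sum]
    rw [e4, e3]
    push_cast
    linear_combination (-2 * (gρ p : ℂ) ^ 3 * eE k p * ((deriv χ (gs p) : ℝ) : ℂ)
        * pull (Dv (RV .qd) F) p) * e1
      - (2 * Complex.I * k * (gρ p : ℂ) ^ 2 * eE k p * ((χ (gs p) : ℝ) : ℂ) * ga p
        * pull (Dv (RV .qd) F) p) * e2
  · refine eq_of_x0 hp fun y hy => ?_
    rw [Dv_mul (eE_sm k hy) (χs_sm hχ hy).ofReal, Dv_eE k hy, (mu_MV hy).1, Dv_ofReal (χs_sm hχ hy),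
      Dv_χs_M hχ hy]
    simp only [sD]
    push_cast
    ring
  · intro i j
    refine eq_of_x0 hp fun y hy => ?_
    rw [Dv_mul (eE_sm k hy) (χs_sm hχ hy).ofReal, Dv_eE k hy, Dv_ofReal (χs_sm hχ hy),
      Dv_χs hχ hy, mu_ZV _ hy, nu_ZV _ hy]
    simp [muZ, nuZ]

end PartTen

section PartEleven
open scoped ContDiff

theorem wave2 {χ : ℝ → ℝ} (hχ : ContDiff ℝ ∞ χ) {G : E4 → ℂ} {p : E4} (hp : p.2 ≠ 0)
    (hF : ∀ y : E4, y.2 ≠ 0 → SmA G y) (hE : ∀ y : E4, y.2 ≠ 0 → Dv (RV .eul) G y = 0) :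
    boxV (fun y => (gρ y : ℂ) * (((-(1/2) * (gL y * χ (gs y)) : ℝ) : ℂ) * pull G y)) p
      + (gρ p : ℂ) ^ 2 * ((χ (gs p) : ℝ) : ℂ) * (((ga p : ℝ) : ℂ) * pull (Dv (RV .qd) G) p)
    = (gρ p : ℂ) ^ 3 * (
      ((((2 * gb p - gs p) * (-deriv χ (gs p) + (1/2) * (gL p * deriv (sD χ) (gs p)))
          + (1/2) * (χ (gs p) - gL p * sD χ (gs p)) : ℝ) : ℂ) * pull G p
        + ((gL p * deriv χ (gs p) : ℝ) : ℂ) * pull (Dv (RV .qd) G) p)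
      - ((((1 / 4) * (gL p * χ (gs p)) : ℝ) : ℂ)
          * ∑ i, ∑ j, pull (Dv (RV (.rot i j)) (Dv (RV (.rot i j)) G)) p)) := by
  have hsχ := sD_smooth hχ
  have h1 : ∀ y : E4, y.2 ≠ 0 → SmA (fun y => (-(1/2) * (gL y * χ (gs y)) : ℝ)) y :=
    fun y hy => SmA.const.mul ((gL_sm hy).mul (χs_sm hχ hy))
  have h2 : ∀ y : E4, y.2 ≠ 0 → SmA (fun y => (-(1/2) * (χ (gs y) - gL y * sD χ (gs y)) : ℝ)) y :=
    fun y hy => SmA.const.mul ((χs_sm hχ hy).sub ((gL_sm hy).mul (χs_sm hsχ hy)))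
  have D1 : ∀ (V : E4 → E4) (y : E4), y.2 ≠ 0 → Dv V (fun y => (-(1/2) * (gL y * χ (gs y)) : ℝ)) y =
      -(1/2) * ((mu V y - nu V y * gb y) * χ (gs y) + gL y *
        ((nu V y * gb y * gs y - mu V y * gs y) * deriv χ (gs y))) := by
    intro V y hy
    rw [Dv_mul SmA.const ((gL_sm hy).mul (χs_sm hχ hy)), Dv_mul (gL_sm hy) (χs_sm hχ hy),
      Dv_gL hy, Dv_χs hχ hy, Dv_const]
    ring
  rw [box_B (MB := fun y => ((-(1/2) * (χ (gs y) - gL y * sD χ (gs y)) : ℝ) : ℂ)) hp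
    (h1 p hp).ofReal (h2 p hp).ofReal ?_ ?_ hF hE]
  · have hN : Dv NV (fun y => (-(1/2) * (χ (gs y) - gL y * sD χ (gs y)) : ℝ)) p =
        (2 * gb p - gs p) * (-deriv χ (gs p) + (1/2) * (gL p * deriv (sD χ) (gs p))) := by
      rw [Dv_mul SmA.const ((χs_sm hχ hp).sub ((gL_sm hp).mul (χs_sm hsχ hp))),
        Dv_sub (χs_sm hχ hp) ((gL_sm hp).mul (χs_sm hsχ hp)), Dv_mul (gL_sm hp) (χs_sm hsχ hp),
        Dv_χs_N hχ hp, Dv_χs_N hsχ hp, Dv_gL hp, Dv_const, (mu_MV hp).2.2.1, (mu_MV hp).2.2.2]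
      have := rs_a hp
      simp only [sD]
      linear_combination (-gb p * deriv χ (gs p)) * this
    rw [Dv_ofReal (h2 p hp), hN]
    have e1 : ((rr p : ℝ) : ℂ) * ((ga p : ℝ) : ℂ) * ((gs p : ℝ) : ℂ) = 1 := by
      exact_mod_cast congrArg (fun x : ℝ => (x : ℂ)) (rs_a hp)
    have e2 : (gρ p : ℂ) * (rr p : ℂ) = 1 := by
      exact_mod_cast congrArg (fun x : ℝ => (x : ℂ)) (gρ_rr hp)
    have e3 : ((sD χ (gs p) : ℝ) : ℂ) = ((gs p : ℝ) : ℂ) * ((deriv χ (gs p) : ℝ) : ℂ) := by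
      simp [sD]
    simp only [← Finset.mul_sum]
    push_cast
    rw [e3]
    linear_combination ((gρ p : ℂ) ^ 3 * gL p * ((deriv χ (gs p) : ℝ) : ℂ)
        * pull (Dv (RV .qd) G) p) * e1
      - ((gρ p : ℂ) ^ 2 * ((χ (gs p) : ℝ) : ℂ) * ga p * pull (Dv (RV .qd) G) p) * e2
  · refine eq_of_x0 hp fun y hy => ?_
    rw [Dv_ofReal (h1 y hy), D1 _ y hy, (mu_MV hy).1, (mu_MV hy).2.1]
    simp only [sD]
    push_cast
    ring
  · intro i j
    refine eq_of_x0 hp fun y hy => ?_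
    rw [Dv_ofReal (h1 y hy), D1 _ y hy, mu_ZV _ hy, nu_ZV _ hy]
    simp [muZ, nuZ]

/-- the wave zone -/
def PW {Θ : Type*} : Θ → E4 → Prop := fun _ p => 0 ≤ p.1 ∧ p.2 ≠ 0 ∧ gj p ≤ 3 / 4 * rr p

theorem PW_facts {Θ : Type*} {θ : Θ} {p : E4} (h : PW θ p) :
    4 / 3 ≤ rr p ∧ p.1 ≤ 7 / 4 * rr p ∧ gs p ≤ 3 / 4 ∧ gρ p ≤ 3 / 4 ∧ gτ p ≤ 7 / 4 := by
  obtain ⟨h0, hp, hj⟩ := h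
  have hr := rr_pos hp
  have h1 : 1 ≤ gj p := jb_ge_one _
  have h2 : |gq p| ≤ gj p := jb_ge_abs _
  have h3 := neg_abs_le (gq p)
  have h4 : gq p = rr p - p.1 := rfl
  have hρ := gρ_pos hp
  have e := gρ_rr hp
  have e1 : 4 / 3 ≤ rr p := by linarith
  have e2 : p.1 ≤ 7 / 4 * rr p := by linarith
  refine ⟨e1, e2, ?_, ?_, ?_⟩
  · rw [gs]; nlinarith
  · nlinarith
  · rw [gτ]; nlinarith

theorem PW_good {Θ : Type*} (θ : Θ) (p : E4) (h : PW θ p) : Good p := by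
  have h1 := PW_facts h
  refine ⟨h.2.1, by linarith [h1.2.2.2.1], ?_⟩
  have : 0 ≤ gτ p := mul_nonneg h.1 (gρ_pos h.2.1).le
  rw [abs_of_nonneg this]; linarith [h1.2.2.2.2]

theorem PW_gs {Θ : Type*} (θ : Θ) (p : E4) (h : PW θ p) : gs p ≤ 1 := by
  have h1 := (PW_facts h).2.2.1
  linarith

/-- the decay weight -/
theorem PW_weight {Θ : Type*} {θ : Θ} {p : E4} (h : PW θ p) :
    gρ p ^ 3 ≤ 64 * jb (p.1 + rr p) ^ (-(3 : ℝ)) := by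
  have h1 := PW_facts h
  have hr := rr_pos h.2.1
  have hj := jb_pos (p.1 + rr p)
  have h2 : jb (p.1 + rr p) ≤ 4 * rr p := by
    have := jb_le (p.1 + rr p)
    rw [abs_of_nonneg (by linarith [h.1])] at this
    linarith
  rw [Real.rpow_neg hj.le, show (3:ℝ) = ((3:ℕ):ℝ) by norm_num, Real.rpow_natCast]
  have h3 : jb (p.1 + rr p) ^ 3 ≤ (4 * rr p) ^ 3 := pow_le_pow_left₀ hj.le h2 3
  have h4 : gρ p ^ 3 = (rr p ^ 3)⁻¹ := by rw [← inv_pow]; rfl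
  rw [h4]
  calc (rr p ^ 3)⁻¹ = 64 * ((4 * rr p) ^ 3)⁻¹ := by
        rw [mul_pow, mul_inv]; ring
    _ ≤ _ := by gcongr

theorem rho3_OB {Θ : Type*} (n : ℕ) : OB ZV (PW : Θ → E4 → Prop) n (fun _ p => (gρ p : ℂ) ^ 3)
    (fun _ p => jb (p.1 + rr p) ^ (-(3 : ℝ))) := by
  have h := OB.ofReal Z_hV (gρ_OB (P := (PW : Θ → E4 → Prop)) PW_good n)
  have h3 := OB.mul Z_hV h (OB.mul Z_hV h h)
  refine (h3.congr fun θ p _ => Eventually.of_forall fun y => ?_).weight 64 (by norm_num) fun θ p hp => ?_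
  · show (gρ y : ℂ) * ((gρ y : ℂ) * (gρ y : ℂ)) = (gρ y : ℂ) ^ 3
    ring
  · have := PW_weight hp
    calc _ = gρ p ^ 3 := by ring
      _ ≤ _ := this

theorem hchi {Θ : Type*} {h : ℝ → ℝ} (hh : ContDiff ℝ ∞ h) (n : ℕ) :
    OB ZV (PW : Θ → E4 → Prop) n (fun _ p => ((h (gs p) : ℝ) : ℂ)) one' :=
  OB.ofReal Z_hV (chi_OB PW_good PW_gs n hh)

theorem hbs {Θ : Type*} (n : ℕ) :
    OB ZV (PW : Θ → E4 → Prop) n (fun _ p => ((2 * gb p - gs p : ℝ) : ℂ)) one' :=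
  OB.ofReal Z_hV (OB.sub Z_hV (OB.mul1 Z_hV (OB.const' 2) (gb_OB PW_good n)) (gs_OB PW_good PW_gs n))

theorem OB.sum2 {Θ : Type*} {P : Θ → E4 → Prop} {n : ℕ} {f : Fin 3 → Fin 3 → Θ → E4 → ℂ}
    {w : Θ → E4 → ℝ} (hw : ∀ θ p, P θ p → 0 ≤ w θ p) (h : ∀ i j, OB ZV P n (f i j) w) :
    OB ZV P n (fun θ y => ∑ i, ∑ j, f i j θ y) w :=
  OB.sum _ Z_hV hw fun i _ => OB.sum _ Z_hV hw fun j _ => h i j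

/-- error bound for the transport part -/
theorem wave1_OB {Θ : Type*} {χ : ℝ → ℝ} (hχ : ContDiff ℝ ∞ χ) {n : ℕ} {F : Θ → E4 → ℂ} {w : Θ → ℝ → ℝ}
    (hw : ∀ θ q, 0 ≤ w θ q)
    (h : OB RV (X0 : Θ → E4 → Prop) (n + 2) F (fun θ p => w θ p.1))
    (hE : ∀ θ, ∀ y : E4, y.2 ≠ 0 → Dv (RV .eul) (F θ) y = 0)
    (k : Θ → ℝ) {K : ℝ} (hK : 0 ≤ K) (hk : ∀ θ, |k θ| ≤ K) :
    OB ZV (PW : Θ → E4 → Prop) n (fun θ p =>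
      boxV (fun y => (gρ y : ℂ) * ((eE (k θ) y * ((χ (gs y) : ℝ) : ℂ)) * pull (F θ) y)) p
      + Complex.I * eE (k θ) p * ((2 * k θ : ℝ) : ℂ) * (((ga p : ℝ) : ℂ) * pull (Dv (RV .qd) (F θ)) p)
        * ((χ (gs p) : ℝ) : ℂ) * (gρ p : ℂ) ^ 2)
      (fun θ p => jb (p.1 + rr p) ^ (-(3 : ℝ)) * w θ (gq p)) := by
  have hsχ := sD_smooth hχ
  have hPQ : ∀ θ p, (PW : Θ → E4 → Prop) θ p → Good p ∧ (X0 : Θ → E4 → Prop) θ (gq p, p.2) :=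
    fun θ p hp => ⟨PW_good θ p hp, hp.2.1⟩
  have pF := OB.pull (h.mono (show n ≤ n + 2 by omega)) hPQ
  have pq := OB.pull ((h.mono (show n + 1 ≤ n + 2 by omega)).dv R_hV .qd) hPQ
  have pr : ∀ i j, _ := fun i j => OB.pull ((h.dv R_hV (.rot i j)).dv R_hV (.rot i j)) hPQ
  have hk' : OB ZV (PW : Θ → E4 → Prop) n (fun θ _ => -Complex.I * (k θ : ℂ)) one' :=
    OB.theta _ hK fun θ p _ => by simpa using hk θ
  have hone : OB ZV (PW : Θ → E4 → Prop) n (fun θ _ => (1 : ℂ)) one' := OB.const' 1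
  have htwo : OB ZV (PW : Θ → E4 → Prop) n (fun θ _ => (2 : ℂ)) one' := OB.const' 2
  have hhalf : OB ZV (PW : Θ → E4 → Prop) n (fun θ _ => (1 / 2 : ℂ)) one' := OB.const' _
  have c1 := OB.mul1 Z_hV (hk'.sub Z_hV hone) ((OB.mul1 Z_hV hk' (hchi hχ n)).sub Z_hV (hchi hsχ n))
  have c2 := OB.mul1 Z_hV (hbs n) ((OB.mul1 Z_hV hk' (hchi (deriv_smooth hχ) n)).sub Z_hV
    (hchi (deriv_smooth hsχ) n))
  have t1 := OB.mul1 Z_hV (c1.add Z_hV c2) pF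
  have t2 := OB.mul1 Z_hV (OB.mul1 Z_hV htwo (hchi (deriv_smooth hχ) n)) pq
  have t3 := OB.mul1 Z_hV hhalf (OB.mul1 Z_hV (hchi hχ n) (OB.sum2 (fun θ p _ => hw θ _) pr))
  have t4 := OB.mul Z_hV (rho3_OB n) (OB.mul1 Z_hV (eE_OB PW_good k hK (fun θ p _ => hk θ) n)
    ((t1.sub Z_hV t2).add Z_hV t3))
  refine t4.congr fun θ p hp => ?_
  refine eq_of_x0 hp.2.1 fun y hy => ?_
  exact (wave1 hχ (k θ) hy (fun y hy => h.sm hy) (hE θ)).symm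

theorem gL_nonneg {Θ : Type*} {θ : Θ} {p : E4} (hp : PW θ p) : 0 ≤ gL p := by
  have := rr_pos hp.2.1
  rw [gL]
  have h : gj p ≤ 2 * rr p := by linarith [hp.2.2]
  linarith [Real.log_le_log (gj_pos p) h]

/-- error bound for the logarithmic part -/
theorem wave2_OB {Θ : Type*} {χ : ℝ → ℝ} (hχ : ContDiff ℝ ∞ χ) {n : ℕ} {F : Θ → E4 → ℂ} {w : Θ → ℝ → ℝ}
    (hw : ∀ θ q, 0 ≤ w θ q)
    (h : OB RV (X0 : Θ → E4 → Prop) (n + 2) F (fun θ p => w θ p.1))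
    (hE : ∀ θ, ∀ y : E4, y.2 ≠ 0 → Dv (RV .eul) (F θ) y = 0) :
    OB ZV (PW : Θ → E4 → Prop) n (fun θ p =>
      boxV (fun y => (gρ y : ℂ) * (((-(1/2) * (gL y * χ (gs y)) : ℝ) : ℂ) * pull (F θ) y)) p
      + (gρ p : ℂ) ^ 2 * ((χ (gs p) : ℝ) : ℂ) * (((ga p : ℝ) : ℂ) * pull (Dv (RV .qd) (F θ)) p))
      (fun θ p => jb (p.1 + rr p) ^ (-(3 : ℝ)) * ((1 + gL p) * w θ (gq p))) := by
  have hsχ := sD_smooth hχ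
  have hPQ : ∀ θ p, (PW : Θ → E4 → Prop) θ p → Good p ∧ (X0 : Θ → E4 → Prop) θ (gq p, p.2) :=
    fun θ p hp => ⟨PW_good θ p hp, hp.2.1⟩
  have pF := OB.pull (h.mono (show n ≤ n + 2 by omega)) hPQ
  have pq := OB.pull ((h.mono (show n + 1 ≤ n + 2 by omega)).dv R_hV .qd) hPQ
  have pr : ∀ i j, _ := fun i j => OB.pull ((h.dv R_hV (.rot i j)).dv R_hV (.rot i j)) hPQ
  have L0 : OB ZV (PW : Θ → E4 → Prop) n (fun _ => gL) (fun _ p => 1 + gL p) :=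
    (gL_OB PW_good n).weight 1 zero_le_one fun θ p hp => by
      rw [abs_of_nonneg (gL_nonneg hp), one_mul]
  have up : ∀ {f : Θ → E4 → ℝ}, OB ZV (PW : Θ → E4 → Prop) n f one' →
      OB ZV (PW : Θ → E4 → Prop) n f (fun _ p => 1 + gL p) := fun hf =>
    hf.weight 1 zero_le_one fun θ p hp => by
      have := gL_nonneg hp; simp only [one']; linarith
  have ch : ∀ {h : ℝ → ℝ}, ContDiff ℝ ∞ h → OB ZV (PW : Θ → E4 → Prop) n (fun _ p => h (gs p)) one' :=
    fun hh => chi_OB PW_good PW_gs n hh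
  have Lch : ∀ {h : ℝ → ℝ}, ContDiff ℝ ∞ h →
      OB ZV (PW : Θ → E4 → Prop) n (fun _ p => gL p * h (gs p)) (fun _ p => 1 + gL p) :=
    fun hh => (OB.mul1 Z_hV (ch hh) L0).congr fun _ _ _ => Eventually.of_forall fun y => mul_comm _ _
  have hhalf : OB ZV (PW : Θ → E4 → Prop) n (fun θ _ => (1 / 2 : ℝ)) one' := OB.const' _
  have hq : OB ZV (PW : Θ → E4 → Prop) n (fun θ _ => (1 / 4 : ℝ)) one' := OB.const' _
  have hb : OB ZV (PW : Θ → E4 → Prop) n (fun _ p => (2 * gb p - gs p : ℝ)) one' :=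
    (OB.sub Z_hV (OB.mul1 Z_hV (OB.const' 2) (gb_OB PW_good n)) (gs_OB PW_good PW_gs n))
  have c1 := OB.mul1 Z_hV hb ((up ((ch (deriv_smooth hχ)).neg Z_hV)).add Z_hV
    (OB.mul1 Z_hV hhalf (Lch (deriv_smooth hsχ))))
  have c2 := OB.mul1 Z_hV hhalf ((up (ch hχ)).sub Z_hV (Lch hsχ))
  have t1 := OB.mul Z_hV (OB.ofReal Z_hV (c1.add Z_hV c2)) pF
  have t2 := OB.mul Z_hV (OB.ofReal Z_hV (Lch (deriv_smooth hχ))) pq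
  have t3 := OB.mul Z_hV (OB.ofReal Z_hV (OB.mul1 Z_hV hq (Lch hχ)))
    (OB.sum2 (fun θ p _ => hw θ _) pr)
  have t4 := OB.mul Z_hV (rho3_OB n) ((t1.add Z_hV t2).sub Z_hV t3)
  refine t4.congr fun θ p hp => ?_
  refine eq_of_x0 hp.2.1 fun y hy => ?_
  exact (wave2 hχ hy (fun y hy => h.sm hy) (hE θ)).symm

end PartEleven

section PartTwelve
open scoped ContDiff

variable {γ : ℝ} {nI : ℕ}

theorem Jf_FF (d : Dat γ nI × Ix) : FF (2 * γ + 1) (Jf d) := by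
  intro n
  obtain ⟨C, hC, h⟩ := Jf_OB γ nI n (n + 1) le_rfl
  refine ⟨C * d.1.D (n + 1) ^ 2, by positivity, fun _ p hp => (h d p hp).le (by rw [mul_assoc])⟩

theorem eul_zero {f : E4 → ℂ} {p : E4} (hf : SmA f p)
    (hom : ∀ s : ℝ, 0 < s → f (p.1, s • p.2) = f p) : Dv (RV .eul) f p = 0 := by
  refine Dv_of_curve hf.diff ?_
  refine (hasDerivAt_const (0 : ℝ) (f p)).congr_of_eventuallyEq ?_
  filter_upwards [lt_mem_nhds (show (-1 : ℝ) < 0 by norm_num)] with ε hε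
  have : p + ε • RV .eul p = (p.1, (1 + ε) • p.2) := by
    ext <;> simp [RV, add_mul]
  rw [this, hom _ (by linarith)]

theorem rf_hom (F : ℝ → Pt → ℂ) (p : E4) (s : ℝ) (hs : 0 < s) : rf F (p.1, s • p.2) = rf F p := by
  simp only [rf, norm_smul, Real.norm_eq_abs, abs_of_pos hs, mul_inv, smul_smul]
  congr 2
  field_simp

theorem PI_hom (μ : Measure ℝ) {f : E4 → ℂ} (h : ∀ (p : E4) (s : ℝ), 0 < s → f (p.1, s • p.2) = f p)
    (p : E4) (s : ℝ) (hs : 0 < s) : PI μ f (p.1, s • p.2) = PI μ f p := by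
  unfold PI
  congr 1
  funext η
  have := h (((η, 0) : E4) + p) s hs
  rw [← this]
  congr 1
  ext <;> simp

theorem Jf_hom (d : Dat γ nI × Ix) (p : E4) (s : ℝ) (hs : 0 < s) : Jf d (p.1, s • p.2) = Jf d p :=
  rf_hom _ p s hs

theorem Jf_eul (d : Dat γ nI × Ix) {p : E4} (hp : p.2 ≠ 0) : Dv (RV .eul) (Jf d) p = 0 :=
  eul_zero ((Jf_FF d).sm hp) (Jf_hom d p)

theorem GG_eul (hγ : 1 / 2 < γ) {χin : ℝ → ℝ} (hχin : ContDiff ℝ ∞ χin) (d : Dat γ nI × Ix) {p : E4}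
    (hp : p.2 ≠ 0) : Dv (RV .eul) (GG χin (Jf d)) p = 0 := by
  refine eul_zero (GG_sm (by linarith) hχin (Jf_FF d) hp) fun s hs => ?_
  unfold GG PP KK
  rw [PI_hom _ (Jf_hom d) p s hs, PI_hom _ (Jf_hom d) p s hs]

theorem GJ_OB (hγ : 1 / 2 < γ) {χin : ℝ → ℝ} (hχin : ContDiff ℝ ∞ χin) (h1 : ∀ s ≤ -1, χin s = 1)
    (h0 : ∀ s, -(1/2) ≤ s → χin s = 0) (n N : ℕ) (hN : n + 1 ≤ N) :
    OB RV (X0 : Dat γ nI × Ix → E4 → Prop) n (fun d => GG χin (Jf d))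
      (fun d p => d.1.D N ^ 2 * jb p.1 ^ (-(2 * γ))) := by
  have := GG_OB (s := 2 * γ + 1) (by linarith) hχin h1 h0 (c := fun d : Dat γ nI × Ix => d.1.D N ^ 2)
    (fun d => by positivity) (fun d => Jf_FF d) (Jf_OB γ nI n N hN)
  simpa using this

theorem KJ_OB (hγ : 1 / 2 < γ) (n N : ℕ) (hN : n + 1 ≤ N) :
    OB RV (X0 : Dat γ nI × Ix → E4 → Prop) n (fun d => KK (Jf d)) (fun d _ => d.1.D N ^ 2) :=
  KK_OB (s := 2 * γ + 1) (by linarith) (c := fun d : Dat γ nI × Ix => d.1.D N ^ 2)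
    (fun d => by positivity) (fun d => Jf_FF d) (Jf_OB γ nI n N hN)

theorem KJ_hom (d : Dat γ nI × Ix) (p : E4) (s : ℝ) (hs : 0 < s) :
    KK (Jf d) (p.1, s • p.2) = KK (Jf d) p := PI_hom _ (Jf_hom d) p s hs

theorem KK_q (f : E4 → ℂ) (q q' : ℝ) (x : Pt) : KK f (q, x) = KK f (q', x) := by
  have h : ∀ q : ℝ, KK f (q, x) = ∫ η, f (η, x) := by
    intro q
    unfold KK PI
    rw [Measure.restrict_univ, ← integral_add_right_eq_self (fun η => f (η, x)) q]
    congr 1; funext η; congr 1; ext <;> simp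
  rw [h, h]

theorem KK_eq (f : E4 → ℂ) (q : ℝ) (x : Pt) : KK f (q, x) = ∫ η, f (η, x) := by
  rw [KK_q f q 0]
  unfold KK PI
  rw [Measure.restrict_univ]
  congr 1; funext η; congr 1; ext <;> simp

theorem PP_eq (f : E4 → ℂ) (q : ℝ) (x : Pt) : PP f (q, x) = ∫ η in Set.Iic q, f (η, x) := by
  have h := (measurePreserving_add_right volume q).setIntegral_preimage_emb
    (measurableEmbedding_addRight q) (fun η => f (η, x)) (Set.Iic q)
  rw [← h]
  unfold PP PI
  have : (fun y : ℝ => y + q) ⁻¹' Set.Iic q = Set.Iic 0 := by ext; simp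
  rw [this]
  congr 1; funext η; congr 1; ext <;> simp

theorem Jf_int (hγ : 1 / 2 < γ) (d : Dat γ nI × Ix) {x : Pt} (hx : x ≠ 0) :
    Integrable (fun η => Jf d (η, x)) := by
  have := (Jf_FF d).integrable (p := (0, x)) (by linarith) hx
  refine this.congr (Eventually.of_forall fun η => ?_)
  simp

theorem charge_bd (hγ : 1 / 2 < γ) : ∃ K : ℝ, 0 ≤ K ∧ ∀ d : Dat γ nI, |charge d.Φ| ≤ K := by
  obtain ⟨C, hC, h⟩ := (Jf_OB γ nI 0 (nI + 3) (by omega)).val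
  have hf : IsFiniteMeasure sphM := by unfold sphM; infer_instance
  refine ⟨∫ q, (C * jb q ^ (-(2 * γ + 1))) * sphM.real Set.univ, ?_, fun d => ?_⟩
  · exact integral_nonneg fun q => by have := (jb_rpow_pos q (-(2 * γ + 1))).le; positivity
  · unfold charge
    rw [← Real.norm_eq_abs]
    refine norm_integral_le_of_norm_le
      (((jb_int (s := 2 * γ + 1) (by linarith)).const_mul C).mul_const _)
      (Eventually.of_forall fun q => ?_)
    refine norm_integral_le_of_norm_le_const (Eventually.of_forall fun σ => ?_)
    have hσ : ‖(σ : Pt)‖ = 1 := by simp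
    have h1 := h (d, none) (q, (σ : Pt)) (by intro h0; rw [show (σ : Pt) = 0 from h0] at hσ; simp at hσ)
    have h2 : Jf (d, none) (q, (σ : Pt)) = ((Jr d.Φ none q σ : ℝ) : ℂ) := by
      simp [Jf, rf]
    rw [h2, Complex.norm_real] at h1
    refine h1.trans ?_
    have h3 : d.D (nI + 3) ^ 2 ≤ 1 := pow_le_one₀ (d.nonneg _) d.hD
    have := (jb_rpow_pos q (-(2 * γ + 1))).le
    gcongr
    exact mul_le_of_le_one_left this h3

theorem box_const {c : ℂ} {h : ℝ → ℝ} (hh : ContDiff ℝ ∞ h) {p : E4} (hp : p.2 ≠ 0) :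
    boxV (fun y => (gρ y : ℂ) * (1 * pull (fun y => c * ((h y.1 : ℝ) : ℂ)) y)) p = 0 := by
  have hF : ∀ y : E4, SmA (fun y : E4 => c * ((h y.1 : ℝ) : ℂ)) y := fun y =>
    SmA.const.mul (fq_sm hh y).ofReal
  have hD : ∀ (V : E4 → E4) (y : E4), (V y).1 = 0 → Dv V (fun y : E4 => c * ((h y.1 : ℝ) : ℂ)) y = 0 := by
    intro V y hV
    rw [Dv_mul SmA.const (fq_sm hh y).ofReal, Dv_const, Dv_ofReal (fq_sm hh y), Dv_fq hh, hV]
    simp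
  rw [box_B (B := fun _ => 1) (MB := fun _ => 0) hp SmA.const SmA.const
    (Eventually.of_forall fun y => Dv_const) (fun i j => Eventually.of_forall fun y => Dv_const)
    (fun y _ => hF y) (fun y _ => hD _ y rfl)]
  have h2 : ∀ i j : Fin 3, Dv (RV (.rot i j)) (fun y : E4 => c * ((h y.1 : ℝ) : ℂ)) = fun _ => 0 :=
    fun i j => funext fun y => hD _ y rfl
  have h3 : ∀ (V : E4 → E4) (y : E4), Dv V (fun _ : E4 => (0 : ℂ)) y = 0 := fun V y => Dv_const
  simp [h2, pull, h3]

end PartTwelve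

section PartThirteen
open scoped ContDiff Pointwise

abbrev Sph : Type := Metric.sphere (0 : Pt) 1

instance sphM_fin : IsFiniteMeasure sphM := by unfold sphM; infer_instance

theorem sph_norm (σ : Sph) : ‖(σ : Pt)‖ = 1 := by simp

theorem sph_ne (σ : Sph) : (σ : Pt) ≠ 0 := by
  intro h; have := sph_norm σ; rw [h] at this; simp at this

theorem sphM_mass : sphM.real Set.univ = 4 * π := by
  unfold sphM
  rw [Measure.toSphere_real_apply_univ, measureReal_def, EuclideanSpace.volume_ball_fin_three]
  have : (0 : ℝ) ≤ π * (4 / 3) := by positivity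
  simp [mul_div_assoc, ENNReal.toReal_ofReal this]
  ring

/-- action of an isometry on the sphere -/
def sphMap (A : Pt ≃ₗᵢ[ℝ] Pt) : Sph → Sph := fun σ => ⟨A σ, by simp⟩

theorem sphMap_cont (A : Pt ≃ₗᵢ[ℝ] Pt) : Continuous (sphMap A) :=
  Continuous.subtype_mk (A.continuous.comp continuous_subtype_val) _

theorem sphMap_mp (A : Pt ≃ₗᵢ[ℝ] Pt) : MeasurePreserving (sphMap A) sphM sphM := by
  refine ⟨(sphMap_cont A).measurable, ?_⟩
  ext s hs
  rw [Measure.map_apply (sphMap_cont A).measurable hs]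
  unfold sphM
  rw [Measure.toSphere_apply' _ hs, Measure.toSphere_apply' _ ((sphMap_cont A).measurable hs)]
  congr 1
  have : Set.Ioo (0 : ℝ) 1 • (Subtype.val '' (sphMap A ⁻¹' s)) = A ⁻¹' (Set.Ioo (0 : ℝ) 1 • (Subtype.val '' s)) := by
    ext x
    simp only [Set.mem_smul, Set.mem_image, Set.mem_preimage]
    constructor
    · rintro ⟨a, ha, y, ⟨σ, hσ, rfl⟩, rfl⟩
      exact ⟨a, ha, A σ, ⟨sphMap A σ, hσ, rfl⟩, by simp⟩
    · rintro ⟨a, ha, y, ⟨σ, hσ, rfl⟩, h⟩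
      refine ⟨a, ha, A.symm σ, ⟨sphMap A.symm σ, ?_, rfl⟩, ?_⟩
      · have : sphMap A (sphMap A.symm σ) = σ := Subtype.ext (by simp [sphMap])
        rwa [this]
      · apply A.injective; simp [h]
  rw [this]
  exact A.measurePreserving.measure_preimage_emb A.toHomeomorph.measurableEmbedding _

theorem sph_inv (A : Pt ≃ₗᵢ[ℝ] Pt) (g : Pt → ℂ) :
    ∫ σ : Sph, g (A σ) ∂sphM = ∫ σ : Sph, g σ ∂sphM := by
  have hinj : Function.Injective (sphMap A) := fun a b h => Subtype.ext (A.injective (congrArg Subtype.val h))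
  have := (sphMap_mp A).integral_comp
    ((sphMap_cont A).isClosedEmbedding hinj).measurableEmbedding (fun σ : Sph => g σ)
  exact this

/-- rotation in the coordinate plane -/
def rotM (i j : Fin 3) (s : ℝ) : Pt →ₗ[ℝ] Pt where
  toFun x := x + (cos s - 1) • (x i • ee i + x j • ee j) + sin s • (x i • ee j - x j • ee i)
  map_add' x y := by
    simp only [PiLp.add_apply]; module
  map_smul' c x := by
    simp only [PiLp.smul_apply, smul_eq_mul, RingHom.id_apply]; module

theorem rotM_norm {i j : Fin 3} (hij : i ≠ j) (s : ℝ) (x : Pt) : ‖rotM i j s x‖ = ‖x‖ := by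
  have h := Real.sin_sq_add_cos_sq s
  have : ‖rotM i j s x‖ ^ 2 = ‖x‖ ^ 2 := by
    rw [EuclideanSpace.real_norm_sq_eq, EuclideanSpace.real_norm_sq_eq]
    simp only [rotM, LinearMap.coe_mk, AddHom.coe_mk, Fin.sum_univ_three]
    fin_cases i <;> fin_cases j <;> simp at hij <;>
      simp [ee]
    · linear_combination (x 0 ^ 2 + x 1 ^ 2) * h
    · linear_combination (x 0 ^ 2 + x 2 ^ 2) * h
    · linear_combination (x 0 ^ 2 + x 1 ^ 2) * h
    · linear_combination (x 1 ^ 2 + x 2 ^ 2) * h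
    · linear_combination (x 0 ^ 2 + x 2 ^ 2) * h
    · linear_combination (x 1 ^ 2 + x 2 ^ 2) * h
  exact (pow_left_inj₀ (norm_nonneg _) (norm_nonneg _) two_ne_zero).1 this

/-- rotation as isometry -/
def rotI {i j : Fin 3} (hij : i ≠ j) (s : ℝ) : Pt ≃ₗᵢ[ℝ] Pt :=
  LinearIsometry.toLinearIsometryEquiv ⟨rotM i j s, rotM_norm hij s⟩ rfl

theorem rotI_apply {i j : Fin 3} (hij : i ≠ j) (s : ℝ) (x : Pt) : rotI hij s x =
    x + (cos s - 1) • (x i • ee i + x j • ee j) + sin s • (x i • ee j - x j • ee i) := rfl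

theorem rotI_deriv {i j : Fin 3} (hij : i ≠ j) (s : ℝ) (x : Pt) :
    HasDerivAt (fun s => rotI hij s x) ((rotI hij s x) i • ee j - (rotI hij s x) j • ee i) s := by
  have h1 := ((((hasDerivAt_cos s).sub_const 1).smul_const (x i • ee i + x j • ee j)).const_add x).add
    ((hasDerivAt_sin s).smul_const (x i • ee j - x j • ee i))
  refine h1.congr_deriv ?_
  have e1 : (rotI hij s x) i = cos s * x i - sin s * x j := by
    rw [rotI_apply]; simp [ee, hij]; ring
  have e2 : (rotI hij s x) j = cos s * x j + sin s * x i := by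
    rw [rotI_apply]; simp [ee, hij.symm]; ring
  rw [e1, e2]
  module

/-- restriction of a function to the sphere is continuous -/
theorem sph_cont {g : E4 → ℂ} (hg : ∀ p : E4, p.2 ≠ 0 → ContinuousAt g p) :
    Continuous (fun σ : Sph => g (0, (σ : Pt))) := by
  refine continuous_iff_continuousAt.2 fun σ => ?_
  exact ContinuousAt.comp (g := g) (f := fun σ : Sph => ((0, (σ : Pt)) : E4)) (hg _ (sph_ne σ)) (by fun_prop)

theorem cont_bdd {k : Sph → ℂ} (hk : Continuous k) : ∃ M : ℝ, 0 ≤ M ∧ ∀ σ, ‖k σ‖ ≤ M := by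
  obtain ⟨M, hM⟩ := isCompact_univ.exists_bound_of_continuousOn (f := k) hk.continuousOn
  exact ⟨max M 0, le_max_right _ _, fun σ => (hM σ trivial).trans (le_max_left _ _)⟩

theorem cont_int {k : Sph → ℂ} (hk : Continuous k) : Integrable k sphM := by
  obtain ⟨M, _, hM⟩ := cont_bdd hk
  exact (integrable_const M).mono' hk.aestronglyMeasurable (Eventually.of_forall hM)

theorem sph_rot {f : E4 → ℂ} (hf : ∀ p : E4, p.2 ≠ 0 → SmA f p) (i j : Fin 3) :
    ∫ σ : Sph, Dv (RV (.rot i j)) f (0, (σ : Pt)) ∂sphM = 0 := by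
  by_cases hij : i = j
  · subst hij
    simp [Dv, RV, show ((0 : ℝ), (0 : Pt)) = 0 from rfl]
  have hD : ∀ p : E4, p.2 ≠ 0 → SmA (Dv (RV (.rot i j)) f) p := fun p hp => SmA.dv (R_hV _ _) (hf p hp)
  have hc := sph_cont (fun p hp => (hD p hp).at.continuousAt)
  have hc0 := sph_cont (fun p hp => (hf p hp).at.continuousAt)
  obtain ⟨M, hM, hb⟩ := cont_bdd hc
  have key : ∀ (σ : Sph) (s : ℝ), HasDerivAt (fun s => f (0, rotI hij s σ))
      (Dv (RV (.rot i j)) f (0, rotI hij s σ)) s := by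
    intro σ s
    have hne : rotI hij s (σ : Pt) ≠ 0 := sph_ne (sphMap (rotI hij s) σ)
    have h1 := (hf (0, rotI hij s (σ : Pt)) hne).diff.hasFDerivAt
    have h2 : HasDerivAt (fun s => ((0, rotI hij s (σ : Pt)) : E4))
      (0, (rotI hij s σ) i • ee j - (rotI hij s σ) j • ee i) s :=
      (hasDerivAt_const s (0 : ℝ)).prodMk (rotI_deriv hij s σ)
    exact h1.comp_hasDerivAt s h2
  have h := hasDerivAt_integral_of_dominated_loc_of_deriv_le (μ := sphM) (x₀ := (0 : ℝ)) (s := Set.univ)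
    (F := fun s (σ : Sph) => f (0, rotI hij s σ))
    (F' := fun s (σ : Sph) => Dv (RV (.rot i j)) f (0, rotI hij s σ))
    (bound := fun _ => M) univ_mem
    (Eventually.of_forall fun s => (hc0.comp (sphMap_cont (rotI hij s))).aestronglyMeasurable)
    (cont_int (hc0.comp (sphMap_cont (rotI hij 0))))
    (hc.comp (sphMap_cont (rotI hij 0))).aestronglyMeasurable
    (Eventually.of_forall fun σ s _ => hb (sphMap (rotI hij s) σ))
    (integrable_const M)
    (Eventually.of_forall fun σ s _ => key σ s)
  have h2 := h.2
  have e1 : (fun s : ℝ => ∫ σ : Sph, f (0, rotI hij s σ) ∂sphM) = fun _ => ∫ σ : Sph, f (0, (σ : Pt)) ∂sphM :=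
    funext fun s => sph_inv (rotI hij s) (fun x => f (0, x))
  rw [e1] at h2
  have e2 := h2.unique (hasDerivAt_const _ _)
  rw [← e2]
  exact (sph_inv (rotI hij 0) (fun x => Dv (RV (.rot i j)) f (0, x))).symm

end PartThirteen

section PartFourteen
open scoped ContDiff

/-- the functional `t - ⟨x,σ⟩` -/
def lS (σ : Pt) : E4 →L[ℝ] ℝ :=
  ContinuousLinearMap.fst ℝ ℝ Pt - (innerSL ℝ σ).comp (ContinuousLinearMap.snd ℝ ℝ Pt)

theorem lS_apply (σ : Pt) (p : E4) : lS σ p = p.1 - ⟪σ, p.2⟫ := rfl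

theorem lS_ge (σ : Sph) (p : E4) : p.1 - ‖p.2‖ ≤ lS σ p := by
  have := real_inner_le_norm (σ : Pt) p.2
  rw [sph_norm, one_mul] at this
  rw [lS_apply]; linarith

theorem lS_cont : Continuous lS := by
  unfold lS
  fun_prop

theorem lS_norm (σ : Sph) : ‖lS σ‖ ≤ 2 := by
  refine ContinuousLinearMap.opNorm_le_bound _ (by norm_num) fun v => ?_
  rw [lS_apply]
  have h1 := abs_real_inner_le_norm (σ : Pt) v.2
  rw [sph_norm, one_mul] at h1
  have h2 := norm_fst_le v
  have h3 := norm_snd_le v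
  rw [Real.norm_eq_abs] at h2 ⊢
  have := abs_sub v.1 ⟪(σ : Pt), v.2⟫
  linarith

/-- the open forward cone -/
def Cone : Set E4 := {p | ‖p.2‖ < p.1}

theorem Cone_open : IsOpen Cone :=
  isOpen_lt (f := fun p : E4 => ‖p.2‖) (g := fun p => p.1) (by fun_prop) (by fun_prop)

/-- spherical potentials -/
def UU (n : ℕ) (k : Sph → ℂ) : E4 → ℂ :=
  fun p => ∫ σ : Sph, k σ * (((lS σ p)⁻¹ ^ n : ℝ) : ℂ) ∂sphM

theorem lS_pos {p : E4} (hp : p ∈ Cone) (σ : Sph) : 0 < lS σ p := by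
  have : ‖p.2‖ < p.1 := hp
  linarith [lS_ge σ p]

theorem lS_inv_cont {p : E4} (hp : p ∈ Cone) (n : ℕ) : Continuous fun σ : Sph => (lS σ p)⁻¹ ^ n := by
  have h : Continuous fun σ : Sph => lS σ p := by
    have := lS_cont
    fun_prop
  exact (h.inv₀ fun σ => (lS_pos hp σ).ne').pow n

theorem UU_cont {k : Sph → ℂ} (hk : Continuous k) {p : E4} (hp : p ∈ Cone) (n : ℕ) :
    Continuous fun σ : Sph => k σ * (((lS σ p)⁻¹ ^ n : ℝ) : ℂ) :=
  hk.mul (Complex.continuous_ofReal.comp (lS_inv_cont hp n))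

theorem lS_inv_fd {p : E4} (hp : p ∈ Cone) (n : ℕ) (c : ℂ) (σ : Sph) :
    HasFDerivAt (fun p => c * (((lS σ p)⁻¹ ^ n : ℝ) : ℂ))
      ((lS σ).smulRight (c * (((-(n : ℝ)) * (lS σ p)⁻¹ ^ (n + 1) : ℝ) : ℂ))) p := by
  have h0 := (lS_pos hp σ).ne'
  have h1 : HasDerivAt (fun u : ℝ => c * ((u⁻¹ ^ n : ℝ) : ℂ))
      (c * (((-(n : ℝ)) * (lS σ p)⁻¹ ^ (n + 1) : ℝ) : ℂ)) (lS σ p) := by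
    have := (((hasDerivAt_inv h0).pow n).ofReal_comp).const_mul c
    refine this.congr_deriv ?_
    congr 2
    rcases n with _ | n
    · simp
    · simp only [Nat.add_sub_cancel]
      rw [← inv_pow]; ring
  have h2 := h1.hasFDerivAt.comp p (lS σ).hasFDerivAt
  refine h2.congr_fderiv ?_
  ext v <;> simp

theorem UU_fd {k : Sph → ℂ} (hk : Continuous k) {p : E4} (hp : p ∈ Cone) (n : ℕ) :
    HasFDerivAt (UU n k)
      (∫ σ : Sph, (lS σ).smulRight (k σ * (((-(n : ℝ)) * (lS σ p)⁻¹ ^ (n + 1) : ℝ) : ℂ)) ∂sphM) p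
    ∧ Integrable (fun σ : Sph =>
      (lS σ).smulRight (k σ * (((-(n : ℝ)) * (lS σ p)⁻¹ ^ (n + 1) : ℝ) : ℂ))) sphM := by
  have hp' : ‖p.2‖ < p.1 := hp
  obtain ⟨M, hM, hkM⟩ := cont_bdd hk
  set δ := (p.1 - ‖p.2‖) / 2 with hδ
  have hδ0 : 0 < δ := by rw [hδ]; linarith
  have hU : {y : E4 | ‖y.2‖ + δ < y.1} ∈ 𝓝 p := by
    refine IsOpen.mem_nhds (isOpen_lt (f := fun p : E4 => ‖p.2‖ + δ) (g := fun p => p.1)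
      (by fun_prop) (by fun_prop)) ?_
    change ‖p.2‖ + δ < p.1
    rw [hδ]; linarith
  have hUC : ∀ y : E4, ‖y.2‖ + δ < y.1 → y ∈ Cone := fun y hy => by
    change ‖y.2‖ < y.1; linarith
  have hmeas : Continuous fun σ : Sph =>
      (lS σ).smulRight (k σ * (((-(n : ℝ)) * (lS σ p)⁻¹ ^ (n + 1) : ℝ) : ℂ)) := by
    have h1 : Continuous fun σ : Sph => k σ * (((-(n : ℝ)) * (lS σ p)⁻¹ ^ (n + 1) : ℝ) : ℂ) :=
      hk.mul (Complex.continuous_ofReal.comp (continuous_const.mul (lS_inv_cont hp (n + 1))))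
    have h2 : Continuous fun σ : Sph => lS (σ : Pt) := lS_cont.comp continuous_subtype_val
    have h3 : Continuous fun q : (E4 →L[ℝ] ℝ) × ℂ => q.1.smulRight q.2 :=
      (ContinuousLinearMap.smulRightL ℝ E4 ℂ).isBoundedBilinearMap.continuous
    exact h3.comp (h2.prodMk h1)
  have hbound : ∀ (σ : Sph) (y : E4), ‖y.2‖ + δ < y.1 →
      ‖(lS σ).smulRight (k σ * (((-(n : ℝ)) * (lS σ y)⁻¹ ^ (n + 1) : ℝ) : ℂ))‖
        ≤ 2 * (M * (n * δ⁻¹ ^ (n + 1))) := by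
    intro σ y hy
    have h1 : δ ≤ lS σ y := by linarith [lS_ge σ y]
    have h2 : 0 < lS σ y := hδ0.trans_le h1
    rw [ContinuousLinearMap.norm_smulRight_apply, norm_mul, Complex.norm_real, norm_mul, norm_neg,
      Real.norm_natCast, Real.norm_eq_abs, abs_of_nonneg (by positivity)]
    have := lS_norm σ
    have := hkM σ
    have h3 : (lS σ y)⁻¹ ≤ δ⁻¹ := inv_anti₀ hδ0 h1
    have h4 : 0 ≤ (lS σ y)⁻¹ := by positivity
    gcongr
  refine ⟨?_, (integrable_const (2 * (M * (n * δ⁻¹ ^ (n + 1))))).mono' hmeas.aestronglyMeasurable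
    (Eventually.of_forall fun σ => hbound σ p (by rw [hδ]; linarith))⟩
  refine hasFDerivAt_integral_of_dominated_of_fderiv_le (𝕜 := ℝ)
    (F := fun (p : E4) (σ : Sph) => k σ * (((lS σ p)⁻¹ ^ n : ℝ) : ℂ))
    (F' := fun p (σ : Sph) => (lS σ).smulRight (k σ * (((-(n : ℝ)) * (lS σ p)⁻¹ ^ (n + 1) : ℝ) : ℂ)))
    (bound := fun _ => 2 * (M * (n * δ⁻¹ ^ (n + 1)))) hU ?_ ?_ ?_ ?_ ?_ ?_
  · filter_upwards [hU] with y hy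
    exact (UU_cont hk (hUC y hy) n).aestronglyMeasurable
  · exact cont_int (UU_cont hk hp n)
  · exact hmeas.aestronglyMeasurable
  · exact Eventually.of_forall fun σ y hy => hbound σ y hy
  · exact integrable_const _
  · exact Eventually.of_forall fun σ y hy => lS_inv_fd (hUC y hy) n (k σ) σ

theorem UU_dv {k : Sph → ℂ} (hk : Continuous k) {p : E4} (hp : p ∈ Cone) (n : ℕ) (V : E4 → E4) :
    Dv V (UU n k) p = ∫ σ : Sph, k σ * ((-(n : ℝ) * lS σ (V p) * (lS σ p)⁻¹ ^ (n + 1) : ℝ) : ℂ) ∂sphM := by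
  obtain ⟨h1, h2⟩ := UU_fd hk hp n
  unfold Dv
  rw [h1.fderiv, ContinuousLinearMap.integral_apply h2]
  congr 1; funext σ
  simp only [ContinuousLinearMap.smulRight_apply, Complex.real_smul]
  push_cast; ring

/-- multiplication by a coordinate -/
def sk (i : Fin 3) (k : Sph → ℂ) : Sph → ℂ := fun σ => (((σ : Pt) i : ℝ) : ℂ) * k σ

theorem sk_cont (i : Fin 3) {k : Sph → ℂ} (hk : Continuous k) : Continuous (sk i k) := by
  unfold sk
  have : Continuous fun σ : Sph => (σ : Pt) i :=
    (EuclideanSpace.proj (𝕜 := ℝ) i).continuous.comp continuous_subtype_val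
  exact (Complex.continuous_ofReal.comp this).mul hk

theorem lS_ee (σ : Pt) (i : Fin 3) : lS σ (bX i) = - σ i := by
  simp [lS_apply, bX, EuclideanSpace.inner_single_right]

theorem UU_dT {k : Sph → ℂ} (hk : Continuous k) {p : E4} (hp : p ∈ Cone) (n : ℕ) :
    Dv (fun _ => bT) (UU n k) p = -(n : ℂ) * UU (n + 1) k p := by
  rw [UU_dv hk hp, UU, ← integral_const_mul]
  congr 1; funext σ
  simp [lS_apply, bT]; ring

theorem UU_dX {k : Sph → ℂ} (hk : Continuous k) {p : E4} (hp : p ∈ Cone) (n : ℕ) (i : Fin 3) :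
    Dv (fun _ => bX i) (UU n k) p = (n : ℂ) * UU (n + 1) (sk i k) p := by
  rw [UU_dv hk hp, UU, ← integral_const_mul]
  congr 1; funext σ
  rw [lS_ee]
  simp [sk]; ring

theorem UU_sm {k : Sph → ℂ} (hk : Continuous k) {p : E4} (hp : p ∈ Cone) (n : ℕ) : SmA (UU n k) p := by
  have := class_smooth (F := ℂ) (ι := Option (Fin 3)) Cone_open
    (fun i => match i with | none => fun _ => bT | some i => fun _ => bX i)
    (fun i => match i with
      | none => fun _ => ContinuousLinearMap.fst ℝ ℝ Pt
      | some i => fun _ => (EuclideanSpace.proj (𝕜 := ℝ) i).comp (ContinuousLinearMap.snd ℝ ℝ Pt))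
    (by intro i; cases i <;> exact contDiffOn_const)
    (by
      intro p _ v
      rw [Fintype.sum_option]
      exact (E4_decomp v).symm)
    (fun f => ∃ (c : ℂ) (n : ℕ) (k : Sph → ℂ), Continuous k ∧ f = fun p => c * UU n k p)
    (by
      rintro f ⟨c, n, k, hk, rfl⟩ p hp
      exact (UU_fd hk hp n).1.differentiableAt.const_mul c)
    (by
      rintro f ⟨c, n, k, hk, rfl⟩ i
      have e : ∀ p ∈ Cone, ∀ v : E4, fderiv ℝ (fun p => c * UU n k p) p v = c * fderiv ℝ (UU n k) p v := by
        intro p hp v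
        rw [fderiv_const_mul (UU_fd hk hp n).1.differentiableAt]; rfl
      cases i with
      | none =>
        refine ⟨_, ⟨c * -(n : ℂ), n + 1, k, hk, rfl⟩, fun p hp => ?_⟩
        rw [e p hp, mul_assoc, ← UU_dT hk hp]; rfl
      | some i =>
        refine ⟨_, ⟨c * (n : ℂ), n + 1, sk i k, sk_cont i hk, rfl⟩, fun p hp => ?_⟩
        rw [e p hp, mul_assoc, ← UU_dX hk hp]; rfl)
    (f := fun p => 1 * UU n k p) ⟨1, n, k, hk, rfl⟩
  simp only [one_mul] at this
  exact SmA.of_open Cone_open hp fun y hy => this.contDiffAt (Cone_open.mem_nhds hy)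

end PartFourteen

section PartFifteen
open scoped ContDiff

/-- smooth functions of the angle alone -/
structure Hs (f : E4 → ℂ) : Prop where
  sm : ∀ p : E4, p.2 ≠ 0 → SmA f p
  hom : ∀ (p : E4) (a s : ℝ), 0 < s → f (p.1 + a, s • p.2) = f p

/-- restriction to the sphere -/
def res (f : E4 → ℂ) : Sph → ℂ := fun σ => f (0, (σ : Pt))

theorem Hs.cont {f : E4 → ℂ} (h : Hs f) : Continuous (res f) :=
  sph_cont fun p hp => (h.sm p hp).at.continuousAt

theorem Hs.eul {f : E4 → ℂ} (h : Hs f) {p : E4} (hp : p.2 ≠ 0) : fderiv ℝ f p (0, p.2) = 0 :=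
  eul_zero (h.sm p hp) fun s hs => by simpa using h.hom p 0 s hs

theorem Hs.time {f : E4 → ℂ} (h : Hs f) {p : E4} (hp : p.2 ≠ 0) : fderiv ℝ f p bT = 0 := by
  refine Dv_of_curve (V := fun _ => bT) (h.sm p hp).diff ?_
  refine (hasDerivAt_const (0 : ℝ) (f p)).congr_of_eventuallyEq (Eventually.of_forall fun ε => ?_)
  have := h.hom p ε 1 one_pos
  have e : p + ε • bT = (p.1 + ε, (1 : ℝ) • p.2) := by ext <;> simp [bT]
  change f (p + ε • bT) = f p
  rw [e, this]

theorem Hs.dv {f : E4 → ℂ} (h : Hs f) (i j : Fin 3) : Hs (Dv (RV (.rot i j)) f) := by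
  refine ⟨fun p hp => SmA.dv (R_hV _ _) (h.sm p hp), fun p a s hs => ?_⟩
  by_cases hp : p.2 = 0
  · have e1 : RV (.rot i j) (p.1 + a, s • p.2) = 0 := by simp [RV, hp]
    have e2 : RV (.rot i j) p = 0 := by simp [RV, hp]
    simp [Dv, e1, e2]
  · have hne : s • p.2 ≠ 0 := smul_ne_zero hs.ne' hp
    refine (Dv_of_curve (h.sm p hp).diff ?_).symm
    have h1 := (h.sm (p.1 + a, s • p.2) hne).diff.hasFDerivAt.hasLineDerivAt
      (RV (.rot i j) (p.1 + a, s • p.2))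
    refine HasDerivAt.congr_of_eventuallyEq h1 (Eventually.of_forall fun ε => ?_)
    have := h.hom (p + ε • RV (.rot i j) p) a s hs
    change f (p + ε • RV (.rot i j) p) = f ((p.1 + a, s • p.2) + ε • RV (.rot i j) (p.1 + a, s • p.2))
    rw [← this]
    congr 1
    refine Prod.ext (by simp [RV]) ?_
    simp only [RV, Prod.snd_add, Prod.smul_snd, PiLp.smul_apply, smul_eq_mul]
    module

theorem Hs.mul {f g : E4 → ℂ} (hf : Hs f) (hg : Hs g) : Hs (fun p => f p * g p) :=
  ⟨fun p hp => (hf.sm p hp).mul (hg.sm p hp), fun p a s hs => by rw [hf.hom p a s hs, hg.hom p a s hs]⟩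

theorem Hs.sum {f : Fin 3 → E4 → ℂ} (h : ∀ j, Hs (f j)) : Hs (fun p => ∑ j, f j p) :=
  ⟨fun p hp => SmA.sum fun j _ => (h j).sm p hp, fun p a s hs =>
    Finset.sum_congr rfl fun j _ => (h j).hom p a s hs⟩

theorem Hs.om (j : Fin 3) : Hs (fun p => (gω j p : ℂ)) := by
  refine ⟨fun p hp => (gω_sm hp).ofReal, fun p a s hs => ?_⟩
  simp only [gω, gρ, norm_smul, Real.norm_eq_abs, abs_of_pos hs, mul_inv, PiLp.smul_apply, smul_eq_mul]
  congr 1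
  field_simp

/-- the boosted angular function -/
def kB (i : Fin 3) (f : E4 → ℂ) : E4 → ℂ :=
  fun p => ∑ j, (gω j p : ℂ) * Dv (RV (.rot j i)) f p

theorem Hs.kB {f : E4 → ℂ} (h : Hs f) (i : Fin 3) : Hs (kB i f) :=
  Hs.sum fun j => (Hs.om j).mul (h.dv j i)

theorem Hs.grad {f : E4 → ℂ} (h : Hs f) {p : E4} (hp : p.2 ≠ 0) (i : Fin 3) :
    (rr p : ℂ) * fderiv ℝ f p (bX i) = _root_.kB i f p := by
  have e : ∀ j, RV (.rot j i) p = p.2 j • bX i - p.2 i • bX j := by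
    intro j; ext <;> simp [RV, bX]
  have e0 := h.eul hp
  have e1 : ((0, p.2) : E4) = ∑ j, p.2 j • bX j := by
    have := E4_decomp (0, p.2); simpa using this
  rw [e1, map_sum] at e0
  simp only [map_smul, Complex.real_smul] at e0
  have e2 := gω_sq hp
  have e3 := gρ_rr hp
  simp only [_root_.kB, Dv, e, map_sub, map_smul, Complex.real_smul]
  set g := fun j => fderiv ℝ f p (bX j) with hg
  have e4 : ∀ j, (gω j p : ℂ) = (p.2 j : ℂ) * (gρ p : ℂ) := fun j => by simp [gω]
  have e5 : (rr p : ℂ) = ∑ j, (gω j p : ℂ) * (p.2 j : ℂ) := by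
    have : rr p = ∑ j, gω j p * p.2 j := by
      have : ∑ j, gω j p * p.2 j = rr p * ∑ j, gω j p ^ 2 := by
        rw [Finset.mul_sum]
        refine Finset.sum_congr rfl fun j _ => ?_
        simp only [gω]
        linear_combination (-(p.2 j ^ 2 * gρ p)) * e3
      rw [this, e2, mul_one]
    rw [this]; push_cast; rfl
  have e6 : ∑ j, (gω j p : ℂ) * ((p.2 j : ℂ) * g i - (p.2 i : ℂ) * g j)
      = (∑ j, (gω j p : ℂ) * (p.2 j : ℂ)) * g i - (p.2 i : ℂ) * (gρ p : ℂ) * ∑ j, (p.2 j : ℂ) * g j := by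
    rw [Finset.sum_mul, Finset.mul_sum, ← Finset.sum_sub_distrib]
    refine Finset.sum_congr rfl fun j _ => ?_
    rw [e4]; ring
  change (rr p : ℂ) * g i = ∑ j, (gω j p : ℂ) * ((p.2 j : ℂ) * g i - (p.2 i : ℂ) * g j)
  have e0' : ∑ j, (p.2 j : ℂ) * g j = 0 := e0
  rw [e6, e0', ← e5]; ring

theorem Hs.boost {f : E4 → ℂ} (h : Hs f) {p : E4} (hp : p.2 ≠ 0) (i : Fin 3) :
    Dv (ZV (.boost i)) f p = (gτ p : ℂ) * _root_.kB i f p := by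
  have e : ZV (.boost i) p = p.2 i • bT + p.1 • bX i := by ext <;> simp [ZV, bT, bX]
  rw [Dv, e, map_add, map_smul, map_smul, h.time hp, ← h.grad hp i]
  have e3 : (gρ p : ℂ) * (rr p : ℂ) = 1 := by exact_mod_cast gρ_rr hp
  simp only [gτ, Complex.real_smul]
  push_cast
  linear_combination (-(p.1 : ℂ) * fderiv ℝ f p (bX i)) * e3

theorem Hs.scal {f : E4 → ℂ} (h : Hs f) {p : E4} (hp : p.2 ≠ 0) : Dv (ZV .scal) f p = 0 := by
  have e : ZV .scal p = p.1 • bT + (0, p.2) := by ext <;> simp [ZV, bT]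
  rw [Dv, e, map_add, map_smul, h.time hp, h.eul hp]; simp

/-- homogeneous kernel -/
def hD (p : E4) : E4 → ℝ := fun y => p.1 - gρ y * ⟪y.2, p.2⟫

theorem hD_sph (p : E4) (σ : Sph) : hD p (0, (σ : Pt)) = lS σ p := by
  simp [hD, gρ, lS_apply]

theorem hD_pos {p : E4} (hp : p ∈ Cone) {y : E4} (hy : y.2 ≠ 0) : 0 < hD p y := by
  have hp' : ‖p.2‖ < p.1 := hp
  have h1 := real_inner_le_norm y.2 p.2
  have h2 : gρ y * ⟪y.2, p.2⟫ ≤ ‖p.2‖ := by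
    have h3 := gρ_rr hy
    have := mul_le_mul_of_nonneg_left h1 (gρ_pos hy).le
    have e : gρ y * (‖y.2‖ * ‖p.2‖) = ‖p.2‖ := by
      have : gρ y * ‖y.2‖ = 1 := h3
      rw [← mul_assoc, this, one_mul]
    linarith
  unfold hD; linarith

theorem inner_sm (x : Pt) (y : E4) : SmA (fun y : E4 => ⟪y.2, x⟫) y :=
  SmA.of_contDiff (contDiff_snd.inner ℝ contDiff_const)

theorem Dv_inner (x : Pt) (V : E4 → E4) (y : E4) :
    Dv V (fun y : E4 => ⟪y.2, x⟫) y = ⟪(V y).2, x⟫ := by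
  have : (fun y : E4 => ⟪y.2, x⟫) = ((innerSL ℝ x).comp (ContinuousLinearMap.snd ℝ ℝ Pt)) := by
    ext y; simp [real_inner_comm]
  simp only [Dv]
  rw [this, ContinuousLinearMap.fderiv]; simp [real_inner_comm]

theorem hD_sm (p : E4) {y : E4} (hy : y.2 ≠ 0) : SmA (hD p) y :=
  SmA.const.sub ((gρ_sm hy).mul (inner_sm _ _))

theorem Dv_hD (p : E4) {y : E4} (hy : y.2 ≠ 0) (i j : Fin 3) :
    Dv (RV (.rot i j)) (hD p) y = - (gρ y * (y.2 i * p.2 j - y.2 j * p.2 i)) := by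
  have e : hD p = fun y => p.1 - gρ y * ⟪y.2, p.2⟫ := rfl
  rw [e, Dv_sub SmA.const ((gρ_sm hy).mul (inner_sm _ _)), Dv_const, Dv_mul (gρ_sm hy) (inner_sm _ _),
    Dv_inner, Dv_gρ hy, (mu_RV hy).2.2]
  simp [RV, inner_sub_left, inner_smul_left, EuclideanSpace.inner_single_left]

/-- powers of the kernel -/
def hP (p : E4) (n : ℕ) : E4 → ℝ := fun y => (hD p y)⁻¹ ^ n

theorem hP_sm {p : E4} (hp : p ∈ Cone) (n : ℕ) {y : E4} (hy : y.2 ≠ 0) : SmA (hP p n) y := by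
  filter_upwards [(hD_sm p hy).inv (hD_pos hp hy).ne'] with z hz using hz.pow n

theorem Dv_hP {p : E4} (hp : p ∈ Cone) (n : ℕ) {y : E4} (hy : y.2 ≠ 0) (V : E4 → E4) :
    Dv V (hP p n) y = -(n : ℝ) * hP p (n + 1) y * Dv V (hD p) y := by
  have h0 := (hD_pos hp hy).ne'
  have := Dv_comp_real (V := V) (h := fun u : ℝ => u⁻¹ ^ n) (f := hD p) (p := y)
    ((differentiableAt_inv h0).pow n) (hD_sm p hy)
  have e : hP p n = fun y => (fun u : ℝ => u⁻¹ ^ n) (hD p y) := rfl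
  rw [e, this]
  have h1 := (hasDerivAt_inv h0).fun_pow n
  rw [h1.deriv]
  simp only [hP, smul_eq_mul]
  rcases n with _ | n
  · simp
  · simp only [Nat.add_sub_cancel]
    rw [← inv_pow]; ring

theorem UU_scal {k : Sph → ℂ} (hk : Continuous k) {p : E4} (hp : p ∈ Cone) (n : ℕ) :
    Dv (ZV .scal) (UU n k) p = -(n : ℂ) * UU n k p := by
  rw [UU_dv hk hp, UU, ← integral_const_mul]
  congr 1; funext σ
  have h := (lS_pos hp σ).ne'
  have : (lS σ p) * (lS σ p)⁻¹ ^ (n + 1) = (lS σ p)⁻¹ ^ n := by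
    rw [pow_succ]; field_simp
  change k σ * ((-(n : ℝ) * lS σ p * (lS σ p)⁻¹ ^ (n + 1) : ℝ) : ℂ) = _
  rw [mul_assoc, this]; push_cast; ring

theorem UU_rot {f : E4 → ℂ} (hf : Hs f) {p : E4} (hp : p ∈ Cone) (n : ℕ) (i j : Fin 3) :
    Dv (ZV (.rot i j)) (UU n (res f)) p = UU n (res (Dv (RV (.rot i j)) f)) p := by
  have h0 := sph_rot (f := fun y => f y * ((hP p n y : ℝ) : ℂ))
    (fun y hy => (hf.sm y hy).mul (hP_sm hp n hy).ofReal) i j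
  have e : ∀ σ : Sph, Dv (RV (.rot i j)) (fun y => f y * ((hP p n y : ℝ) : ℂ)) (0, (σ : Pt))
      = res (Dv (RV (.rot i j)) f) σ * (((lS σ p)⁻¹ ^ n : ℝ) : ℂ)
        - res f σ * ((-(n : ℝ) * lS σ (ZV (.rot i j) p) * (lS σ p)⁻¹ ^ (n + 1) : ℝ) : ℂ) := by
    intro σ
    have hσ : ((0, (σ : Pt)) : E4).2 ≠ 0 := sph_ne σ
    rw [Dv_mul (hf.sm _ hσ) (hP_sm hp n hσ).ofReal, Dv_ofReal (hP_sm hp n hσ), Dv_hP hp n hσ,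
      Dv_hD p hσ]
    have h1 : lS σ (ZV (.rot i j) p) = - (p.2 i * (σ : Pt) j - p.2 j * (σ : Pt) i) := by
      simp [lS_apply, ZV, inner_sub_right, inner_smul_right, EuclideanSpace.inner_single_right]
    have h2 : gρ ((0, (σ : Pt)) : E4) = 1 := by simp [gρ]
    rw [h1, h2]
    simp only [hP, hD_sph, res]
    push_cast; ring
  have c1 := UU_cont (hf.dv i j).cont hp n
  have c2 : Continuous fun σ : Sph =>
      res f σ * ((-(n : ℝ) * lS σ (ZV (.rot i j) p) * (lS σ p)⁻¹ ^ (n + 1) : ℝ) : ℂ) := by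
    have h := lS_inv_cont hp (n + 1)
    have h' := hf.cont
    have h3 : Continuous fun σ : Sph => lS σ (ZV (.rot i j) p) := by
      have := lS_cont; fun_prop
    exact h'.mul (Complex.continuous_ofReal.comp ((continuous_const.mul h3).mul h))
  rw [integral_congr_ae (Eventually.of_forall e), integral_sub (cont_int c1) (cont_int c2)] at h0
  rw [UU_dv hf.cont hp]
  exact (sub_eq_zero.1 h0).symm

theorem UU_boost {f : E4 → ℂ} (hf : Hs f) {p : E4} (hp : p ∈ Cone) (i : Fin 3) :
    Dv (ZV (.boost i)) (UU 2 (res f)) p = UU 2 (res (kB i f)) p := by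
  have hs : ∀ j, ∀ y : E4, y.2 ≠ 0 → SmA (fun y => (gω j y : ℂ) * (f y * ((hP p 2 y : ℝ) : ℂ))) y :=
    fun j y hy => (gω_sm hy).ofReal.mul ((hf.sm y hy).mul (hP_sm hp 2 hy).ofReal)
  have h0 : ∑ j, ∫ σ : Sph, Dv (RV (.rot j i)) (fun y => (gω j y : ℂ) * (f y * ((hP p 2 y : ℝ) : ℂ)))
      (0, (σ : Pt)) ∂sphM = 0 :=
    Finset.sum_eq_zero fun j _ => sph_rot (hs j) j i
  rw [← integral_finsetSum _ fun j _ => cont_int (sph_cont fun y hy =>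
    (SmA.dv (R_hV _ _) (hs j y hy)).at.continuousAt)] at h0
  have e : ∀ σ : Sph, ∑ j, Dv (RV (.rot j i)) (fun y => (gω j y : ℂ) * (f y * ((hP p 2 y : ℝ) : ℂ)))
      (0, (σ : Pt)) = res (kB i f) σ * (((lS σ p)⁻¹ ^ 2 : ℝ) : ℂ)
        - res f σ * ((-((2 : ℕ) : ℝ) * lS σ (ZV (.boost i) p) * (lS σ p)⁻¹ ^ (2 + 1) : ℝ) : ℂ) := by
    intro σ
    have hσ : ((0, (σ : Pt)) : E4).2 ≠ 0 := sph_ne σ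
    have h2 : gρ ((0, (σ : Pt)) : E4) = 1 := by simp [gρ]
    have h3 : ∀ j, Dv (RV (.rot j i)) (fun y => (gω j y : ℂ) * (f y * ((hP p 2 y : ℝ) : ℂ)))
        (0, (σ : Pt)) = ((((RV (.rot j i) (0, (σ : Pt))).2 j : ℝ)) : ℂ) * (f (0, (σ : Pt)) * (((lS σ p)⁻¹ ^ 2 : ℝ) : ℂ))
          + (((σ : Pt) j : ℝ) : ℂ) * (Dv (RV (.rot j i)) f (0, (σ : Pt)) * (((lS σ p)⁻¹ ^ 2 : ℝ) : ℂ)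
            + f (0, (σ : Pt)) * ((2 * (lS σ p)⁻¹ ^ 3 * ((σ : Pt) j * p.2 i - (σ : Pt) i * p.2 j) : ℝ) : ℂ)) := by
      intro j
      rw [Dv_mul (gω_sm hσ).ofReal ((hf.sm _ hσ).mul (hP_sm hp 2 hσ).ofReal), Dv_ofReal (gω_sm hσ),
        Dv_gω j hσ, (mu_RV hσ).2.2,
        Dv_mul (hf.sm _ hσ) (hP_sm hp 2 hσ).ofReal, Dv_ofReal (hP_sm hp 2 hσ), Dv_hP hp 2 hσ, Dv_hD p hσ]
      simp only [hP, hD_sph, gω, h2]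
      push_cast; ring
    rw [Finset.sum_congr rfl fun j _ => h3 j]
    have h1 : lS σ (ZV (.boost i) p) = p.2 i - p.1 * (σ : Pt) i := by
      simp [lS_apply, ZV, inner_smul_right, EuclideanSpace.inner_single_right]
    have h4 : ∑ j, (RV (.rot j i) ((0, (σ : Pt)) : E4)).2 j = -2 * (σ : Pt) i := by
      simp [RV, Pi.single_apply, Finset.sum_sub_distrib]; ring
    have h5 : ∑ j, (σ : Pt) j * ((σ : Pt) j * p.2 i - (σ : Pt) i * p.2 j)
        = p.2 i - (σ : Pt) i * (p.1 - lS σ p) := by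
      have a1 : ∑ j, (σ : Pt) j ^ 2 = 1 := by
        have := EuclideanSpace.real_norm_sq_eq (σ : Pt)
        rw [sph_norm] at this; linarith
      have a2 : p.1 - lS σ p = ∑ j, (σ : Pt) j * p.2 j := by
        rw [lS_apply]; simp [PiLp.inner_apply, mul_comm]
      rw [a2]
      simp only [Fin.sum_univ_three] at a1 ⊢
      linear_combination (p.2 i) * a1
    have h6 : ((σ : Pt) i) * (lS σ p)⁻¹ ^ 2 = (σ : Pt) i * lS σ p * (lS σ p)⁻¹ ^ 3 := by
      have := (lS_pos hp σ).ne'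
      field_simp
    have h7 : res (kB i f) σ = ∑ j, (((σ : Pt) j : ℝ) : ℂ) * Dv (RV (.rot j i)) f (0, (σ : Pt)) := by
      simp only [res, kB, gω, h2, mul_one]
    rw [h1, h7]
    have h4' : ∑ j, ((((RV (.rot j i) (0, (σ : Pt))).2 j : ℝ)) : ℂ) = ((-2 * (σ : Pt) i : ℝ) : ℂ) := by
      rw [← h4]; push_cast; rfl
    have h5' : ∑ j, ((((σ : Pt) j * ((σ : Pt) j * p.2 i - (σ : Pt) i * p.2 j) : ℝ)) : ℂ)
        = ((p.2 i - (σ : Pt) i * (p.1 - lS σ p) : ℝ) : ℂ) := by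
      rw [← h5]; push_cast; rfl
    have h8 : ∀ a b : ℂ, ∀ u v w : Fin 3 → ℂ, ∑ j, (u j * a + (((σ : Pt) j : ℝ) : ℂ) * (v j * b + w j))
        = (∑ j, u j) * a + (∑ j, (((σ : Pt) j : ℝ) : ℂ) * v j) * b + ∑ j, (((σ : Pt) j : ℝ) : ℂ) * w j := by
      intro a b u v w
      rw [Finset.sum_mul, Finset.sum_mul, ← Finset.sum_add_distrib, ← Finset.sum_add_distrib]
      exact Finset.sum_congr rfl fun j _ => by ring
    rw [h8, h4']
    have h9 : ∑ j, (((σ : Pt) j : ℝ) : ℂ) * (f (0, (σ : Pt)) *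
        ((2 * (lS σ p)⁻¹ ^ 3 * ((σ : Pt) j * p.2 i - (σ : Pt) i * p.2 j) : ℝ) : ℂ))
        = f (0, (σ : Pt)) * ((2 * (lS σ p)⁻¹ ^ 3 : ℝ) : ℂ) * ((p.2 i - (σ : Pt) i * (p.1 - lS σ p) : ℝ) : ℂ) := by
      rw [← h5', Finset.mul_sum]
      exact Finset.sum_congr rfl fun j _ => by push_cast; ring
    rw [h9]
    have h6' : (((σ : Pt) i : ℝ) : ℂ) * (((lS σ p)⁻¹ ^ 2 : ℝ) : ℂ)
      = (((σ : Pt) i : ℝ) : ℂ) * (lS σ p : ℂ) * (((lS σ p)⁻¹ ^ 3 : ℝ) : ℂ) := by exact_mod_cast h6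
    simp only [res]
    push_cast at h6' ⊢
    linear_combination (-2 * f (0, (σ : Pt))) * h6'
  have c1 := UU_cont (hf.kB i).cont hp 2
  have c2 : Continuous fun σ : Sph =>
      res f σ * ((-((2 : ℕ) : ℝ) * lS σ (ZV (.boost i) p) * (lS σ p)⁻¹ ^ (2 + 1) : ℝ) : ℂ) := by
    have h := lS_inv_cont hp (2 + 1)
    have h' := hf.cont
    have h3 : Continuous fun σ : Sph => lS σ (ZV (.boost i) p) := by
      have := lS_cont; fun_prop
    exact h'.mul (Complex.continuous_ofReal.comp ((continuous_const.mul h3).mul h))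
  rw [integral_congr_ae (Eventually.of_forall e), integral_sub (cont_int c1) (cont_int c2)] at h0
  rw [UU_dv hf.cont hp]
  exact (sub_eq_zero.1 h0).symm

end PartFifteen

section PartSixteen
open scoped ContDiff

theorem comp_OB {ι X Θ : Type*} [Fintype ι] [NormedAddCommGroup X] [NormedSpace ℝ X]
    {V : ι → X → X} {P : Θ → X → Prop} (hV : ∀ i p, SmA (V i) p)
    {K U : Set ℝ} (hK : IsCompact K) (hU : IsOpen U) (hKU : K ⊆ U)
    {g : Θ → X → ℝ} (hgK : ∀ θ p, P θ p → g θ p ∈ K) (n : ℕ) (hg : OB V P n g one')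
    {h : ℝ → ℝ} (hh : ContDiffOn ℝ ∞ h U) :
    OB V P n (fun θ p => h (g θ p)) one' := by
  have hat : ∀ (h : ℝ → ℝ), ContDiffOn ℝ ∞ h U → ∀ u ∈ U, SmA h u := fun h hh u hu =>
    SmA.of_open hU hu fun y hy => hh.contDiffAt (hU.mem_nhds hy)
  have hsm : ∀ (h : ℝ → ℝ), ContDiffOn ℝ ∞ h U → ∀ θ p, P θ p → SmA (fun p => h (g θ p)) p :=
    fun h hh θ p hp => SmA.comp (f := h) (hat h hh _ (hKU (hgK θ p hp))) (hg.sm hp)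
  have hb : ∀ (h : ℝ → ℝ), ContDiffOn ℝ ∞ h U → ∃ C : ℝ, 0 ≤ C ∧ ∀ (θ : Θ) p, P θ p →
      ‖h (g θ p)‖ ≤ C * (one' : Θ → X → ℝ) θ p := by
    intro h hh
    obtain ⟨C, hC⟩ := hK.exists_bound_of_continuousOn (hh.continuousOn.mono hKU)
    refine ⟨max C 0, le_max_right _ _, fun θ p hp => ?_⟩
    have h2 := hC (g θ p) (hgK θ p hp)
    simpa [one'] using Or.inl h2
  induction n generalizing h with
  | zero => exact OB.zeroth (hsm h hh) (hb h hh)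
  | succ n ih =>
    refine OB.succ (hsm h hh) one'_nonneg (hb h hh) fun i => ?_
    have hd : ContDiffOn ℝ ∞ (deriv h) U := hh.deriv_of_isOpen hU (by simp)
    refine (OB.mul1 hV (hg.dv hV i) (ih (hg.mono (Nat.le_succ n)) hd)).congr fun θ p hp => ?_
    have h1 := hg.sm hp
    have hc : ∀ᶠ y in 𝓝 p, g θ y ∈ U :=
      h1.at.continuousAt.eventually (hU.mem_nhds (hKU (hgK θ p hp)))
    filter_upwards [h1.ev, hc] with y hy hyU
    rw [Dv_comp_real ((hat h hh _ hyU).diff) hy, smul_eq_mul]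

section coefs
variable {Θ : Type*} {P : Θ → E4 → Prop}

theorem gj_OB (hP : ∀ θ p, P θ p → Good p) (n : ℕ) : OB ZV P n (fun _ => gj) (fun _ p => gj p) := by
  have hx : ∀ θ p, P θ p → p.2 ≠ 0 := fun θ p hp => (hP θ p hp).1
  refine OB.eigen (h := fun z _ p => nuZ z p * gb p) Z_hV
    (fun θ p hp => gj_sm (hx θ p hp)) (fun θ p _ => (gj_pos p).le)
    ⟨1, zero_le_one, fun θ p hp => ?_⟩ (fun z θ p hp => ?_) n (fun z m _ => ?_)
  · rw [Real.norm_of_nonneg (gj_pos p).le, one_mul]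
  · refine eq_of_x0 (hx θ p hp) fun y hy => ?_
    rw [Dv_gj hy, nu_ZV z hy]
  · exact OB.mul1 Z_hV (nu_OB hP m z) (gb_OB hP m)

theorem gq_gb (p : E4) : gb p * gj p = gq p := by
  have := ga_gj (p := p)
  simp only [gb]
  linear_combination gq p * this

theorem gq_OB (hP : ∀ θ p, P θ p → Good p) (hq : ∀ θ p, P θ p → |gq p| ≤ 2) (n : ℕ) :
    OB ZV P n (fun _ => gq) one' := by
  refine ((OB.mul1 Z_hV (gb_OB hP n) (gj_OB hP n)).congr fun θ p _ =>
    Eventually.of_forall fun y => gq_gb y).weight 3 (by norm_num) fun θ p hp => ?_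
  have := jb_le (gq p)
  have h2 := hq θ p hp
  simp only [one', gj]
  linarith

end coefs

theorem lor_T (p : E4) : (p.1 ^ 2 - rr p ^ 2) • bT
    = p.1 • ZV .scal p - ∑ i, p.2 i • ZV (.boost i) p := by
  have h : rr p ^ 2 = ∑ i, p.2 i ^ 2 := by rw [rr, EuclideanSpace.real_norm_sq_eq]
  rw [h]
  refine Prod.ext ?_ ?_
  · simp [bT, ZV, Fin.sum_univ_three]; ring
  · ext k
    simp [bT, ZV, Prod.snd_sum, Pi.single_apply, Finset.sum_apply]
    fin_cases k <;> simp [Fin.sum_univ_three] <;> ring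

theorem lor_X (p : E4) (i : Fin 3) : (p.1 ^ 2 - rr p ^ 2) • bX i
    = p.1 • ZV (.boost i) p - p.2 i • ZV .scal p - ∑ j, p.2 j • ZV (.rot j i) p := by
  have h : rr p ^ 2 = ∑ i, p.2 i ^ 2 := by rw [rr, EuclideanSpace.real_norm_sq_eq]
  rw [h]
  refine Prod.ext ?_ ?_
  · simp [bX, ZV, Prod.fst_sum]; ring
  · ext k
    fin_cases i <;> fin_cases k <;> simp [bX, ZV, Fin.sum_univ_three] <;> ring

theorem Hs.const (c : ℂ) : Hs (fun _ => c) := ⟨fun _ _ => SmA.const, fun _ _ _ _ => rfl⟩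

theorem res_one : res (fun _ => (1 : ℂ)) = fun _ => 1 := rfl

theorem cone_sq {p : E4} (hp : p ∈ Cone) : 0 < p.1 ^ 2 - rr p ^ 2 := by
  have h : ‖p.2‖ < p.1 := hp
  have := norm_nonneg p.2
  simp only [rr]; nlinarith

/-- the basic integral -/
theorem UU_two {p : E4} (hp : p ∈ Cone) :
    UU 2 (fun _ => 1) p = ((4 * π * (p.1 ^ 2 - rr p ^ 2)⁻¹ : ℝ) : ℂ) := by
  set g : E4 → ℂ := fun p => ((p.1 ^ 2 - ∑ i, p.2 i ^ 2 : ℝ) : ℂ) * UU 2 (fun _ => 1) p with hg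
  have hk : Continuous (fun _ : Sph => (1 : ℂ)) := continuous_const
  have hrr : ∀ p : E4, rr p ^ 2 = ∑ i, p.2 i ^ 2 := fun p => by rw [rr, EuclideanSpace.real_norm_sq_eq]
  have hzero : ∀ p ∈ Cone, fderiv ℝ g p = 0 := by
    intro p hp
    have s0 : SmA (fun p : E4 => p.1 ^ 2 - ∑ i, p.2 i ^ 2) p := by
      apply SmA.of_contDiff
      fun_prop
    have sU := UU_sm hk hp 2
    have sS := UU_scal hk hp 2
    have sB : ∀ i, Dv (ZV (.boost i)) (UU 2 (fun _ => 1)) p = 0 := fun i => by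
      have := UU_boost (Hs.const 1) hp i
      rw [res_one] at this; rw [this]
      simp [UU, res, kB, Dv_const]
    have sR : ∀ i j, Dv (ZV (.rot i j)) (UU 2 (fun _ => 1)) p = 0 := fun i j => by
      have := UU_rot (Hs.const 1) hp 2 i j
      rw [res_one] at this; rw [this]
      simp [UU, res, Dv_const]
    have hpos := (cone_sq hp).ne'
    have hT := congrArg (fderiv ℝ (UU 2 (fun _ => 1)) p) (lor_T p)
    have hX := fun i => congrArg (fderiv ℝ (UU 2 (fun _ => 1)) p) (lor_X p i)
    simp only [Dv] at sS sB sR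
    simp only [map_sub, map_smul, map_sum, sS, sB, sR] at hT hX
    simp only [smul_zero, Finset.sum_const_zero, sub_zero, zero_sub, Complex.real_smul] at hT hX
    have dv0 : ∀ v : E4, fderiv ℝ (fun p : E4 => p.1 ^ 2 - ∑ i, p.2 i ^ 2) p v
        = 2 * p.1 * v.1 - ∑ i, 2 * p.2 i * v.2 i := by
      intro v
      have h1 : HasDerivAt (fun ε : ℝ => (p.1 + ε * v.1) ^ 2 - ∑ i, (p.2 i + ε * v.2 i) ^ 2)
          (2 * p.1 * v.1 - ∑ i, 2 * p.2 i * v.2 i) 0 := by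
        have a : ∀ x y : ℝ, HasDerivAt (fun ε : ℝ => (x + ε * y) ^ 2) (2 * x * y) 0 := fun x y => by
          have := (((hasDerivAt_id (0 : ℝ)).mul_const y).const_add x).pow 2
          refine this.congr_deriv ?_
          simp
        exact (a _ _).sub (HasDerivAt.fun_sum fun i _ => a _ _)
      exact Dv_of_curve (V := fun _ => v) s0.diff h1
    have key : ∀ v, fderiv ℝ g p v = ((p.1 ^ 2 - ∑ i, p.2 i ^ 2 : ℝ) : ℂ) * fderiv ℝ (UU 2 (fun _ => 1)) p v
        + ((2 * p.1 * v.1 - ∑ i, 2 * p.2 i * v.2 i : ℝ) : ℂ) * UU 2 (fun _ => 1) p := by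
      intro v
      have h1 := Dv_mul (V := fun _ => v) s0.ofReal sU
      rw [Dv_ofReal s0] at h1
      simp only [Dv] at h1
      rw [dv0] at h1
      rw [h1]; ring
    have kT : fderiv ℝ g p bT = 0 := by
      rw [key, ← hrr, hT]; simp [bT]; ring
    have kX : ∀ i, fderiv ℝ g p (bX i) = 0 := fun i => by
      rw [key, ← hrr, hX]; simp [bX, Pi.single_apply]; ring
    refine ContinuousLinearMap.ext fun v => ?_
    rw [E4_decomp v]
    simp only [map_add, map_smul, map_sum, kT, kX]; simp
  have hconn : IsPreconnected Cone := by
    refine Convex.isPreconnected ?_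
    intro x hx y hy a b ha hb hab
    have hx' : ‖x.2‖ < x.1 := hx
    have hy' : ‖y.2‖ < y.1 := hy
    change ‖a • x.2 + b • y.2‖ < a * x.1 + b * y.1
    have h1 := norm_add_le (a • x.2) (b • y.2)
    rw [norm_smul, norm_smul, Real.norm_of_nonneg ha, Real.norm_of_nonneg hb] at h1
    rcases ha.lt_or_eq with h | h
    · nlinarith
    · have : b = 1 := by linarith
      subst this; subst h; simpa using hy'
  have hdiff : DifferentiableOn ℝ g Cone := by
    intro p hp
    have s0 : SmA (fun p : E4 => p.1 ^ 2 - ∑ i, p.2 i ^ 2) p := by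
      apply SmA.of_contDiff
      fun_prop
    exact (s0.ofReal.mul (UU_sm hk hp 2)).diff.differentiableWithinAt
  have h1 : ((1, 0) : E4) ∈ Cone := by simp [Cone]
  have hc := Cone_open.is_const_of_fderiv_eq_zero hconn hdiff hzero hp h1
  have h2 : g (1, 0) = ((4 * π : ℝ) : ℂ) := by
    have : UU 2 (fun _ => 1) ((1, 0) : E4) = ((4 * π : ℝ) : ℂ) := by
      simp only [UU, lS_apply]
      simp [sphM_mass]
    simp only [hg]
    rw [this]; simp
  rw [h2] at hc
  simp only [hg] at hc
  rw [← hrr] at hc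
  have hpos := (cone_sq hp).ne'
  have : ((p.1 ^ 2 - rr p ^ 2 : ℝ) : ℂ) ≠ 0 := by exact_mod_cast hpos
  have e : UU 2 (fun _ => 1) p = ((p.1 ^ 2 - rr p ^ 2 : ℝ) : ℂ)⁻¹ * ((4 * π : ℝ) : ℂ) := by
    rw [← hc]; field_simp
  rw [e]; push_cast; ring

/-- the logarithmic integral -/
theorem UU_one_bd {p : E4} (hp : p ∈ Cone) (h0 : p.2 ≠ 0) (h2 : p.1 ≤ 2 * rr p) :
    ∫ σ : Sph, (lS σ p)⁻¹ ∂sphM ≤ gρ p * (4 * π + 2 * π * (Real.log (p.1 + rr p) - Real.log (p.1 - rr p))) := by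
  obtain ⟨t, x⟩ := p
  have hk : Continuous (fun _ : Sph => (1 : ℂ)) := continuous_const
  have hr : 0 < ‖x‖ := norm_pos_iff.2 h0
  have htr : ‖x‖ < t := hp
  have h2' : t ≤ 2 * ‖x‖ := h2
  set r := ‖x‖ with hrdef
  have hcone : ∀ s, r < s → ((s, x) : E4) ∈ Cone := fun s hs => hs
  have hU : ∀ s, r < s → UU 1 (fun _ => 1) ((s, x) : E4) = ((∫ σ : Sph, (lS σ (s, x))⁻¹ ∂sphM : ℝ) : ℂ) := by
    intro s hs
    simp only [UU, one_mul, pow_one]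
    exact integral_ofReal
  set G : ℝ → ℂ := fun s => UU 1 (fun _ => 1) ((s, x) : E4)
    - ((2 * π * r⁻¹ * (Real.log (s + r) - Real.log (s - r)) : ℝ) : ℂ) with hG
  have hd : ∀ s ∈ Set.Ioi r, HasDerivAt G 0 s := by
    intro s hs
    have hs' : r < s := hs
    have h1 : HasDerivAt (fun s : ℝ => UU 1 (fun _ => 1) ((s, x) : E4)) (Dv (fun _ => bT) (UU 1 (fun _ => 1)) (s, x)) s := by
      have := (UU_sm hk (hcone s hs) 1).diff.hasFDerivAt.comp_hasDerivAt s
        ((hasDerivAt_id s).prodMk (hasDerivAt_const s x))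
      exact this
    rw [UU_dT hk (hcone s hs), UU_two (hcone s hs)] at h1
    have h3 : HasDerivAt (fun s : ℝ => 2 * π * r⁻¹ * (Real.log (s + r) - Real.log (s - r)))
        (2 * π * r⁻¹ * (1 / (s + r) - 1 / (s - r))) s := by
      refine HasDerivAt.const_mul _ (HasDerivAt.sub ?_ ?_)
      · exact ((hasDerivAt_id s).add_const r).log (by simp; linarith)
      · exact ((hasDerivAt_id s).sub_const r).log (by simp; linarith)
    refine (h1.sub h3.ofReal_comp).congr_deriv ?_
    have e : 4 * π * (s ^ 2 - r ^ 2)⁻¹ + 2 * π * r⁻¹ * (1 / (s + r) - 1 / (s - r)) = 0 := by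
      have a1 : s + r ≠ 0 := by linarith
      have a2 : s - r ≠ 0 := by linarith
      have a3 : s ^ 2 - r ^ 2 = (s + r) * (s - r) := by ring
      rw [a3]; field_simp; ring
    have e' : ((4 * π * (s ^ 2 - r ^ 2)⁻¹ + 2 * π * r⁻¹ * (1 / (s + r) - 1 / (s - r)) : ℝ) : ℂ) = 0 := by
      rw [e]; simp
    simp only [rr]
    rw [← hrdef]
    push_cast at e' ⊢
    linear_combination (-1) * e'
  have hc : G t = G (2 * r) := by
    refine isOpen_Ioi.is_const_of_deriv_eq_zero isPreconnected_Ioi (f := G)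
      (fun s hs => (hd s hs).differentiableAt.differentiableWithinAt)
      (fun s hs => (hd s hs).deriv) htr (show r < 2 * r by linarith)
  simp only [hG] at hc
  rw [hU t htr, hU (2 * r) (by linarith)] at hc
  have hc' : (∫ σ : Sph, (lS σ (t, x))⁻¹ ∂sphM) - 2 * π * r⁻¹ * (Real.log (t + r) - Real.log (t - r))
      = (∫ σ : Sph, (lS σ (2 * r, x))⁻¹ ∂sphM) - 2 * π * r⁻¹ * (Real.log (2 * r + r) - Real.log (2 * r - r)) := by
    exact_mod_cast hc
  have hb : (∫ σ : Sph, (lS σ (2 * r, x))⁻¹ ∂sphM) ≤ 4 * π * r⁻¹ := by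
    have h1 : ∀ σ : Sph, ‖(lS σ ((2 * r, x) : E4))⁻¹‖ ≤ r⁻¹ := by
      intro σ
      have h1 := real_inner_le_norm (σ : Pt) x
      rw [sph_norm, one_mul] at h1
      have h3 : r ≤ lS σ ((2 * r, x) : E4) := by
        rw [lS_apply]; change r ≤ 2 * r - ⟪(σ : Pt), x⟫; linarith
      rw [norm_inv, Real.norm_of_nonneg (hr.le.trans h3)]
      exact inv_anti₀ hr h3
    have h4 := norm_integral_le_of_norm_le_const (μ := sphM) (Eventually.of_forall h1)
    rw [sphM_mass] at h4
    have h5 := (Real.le_norm_self _).trans h4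
    linarith
  have hl : 0 ≤ Real.log (2 * r + r) - Real.log (2 * r - r) := by
    have : Real.log (2 * r - r) ≤ Real.log (2 * r + r) := Real.log_le_log (by linarith) (by linarith)
    linarith
  have hπ := Real.pi_pos
  have hri : 0 < r⁻¹ := by positivity
  have : 0 ≤ 2 * π * r⁻¹ * (Real.log (2 * r + r) - Real.log (2 * r - r)) := by positivity
  change (∫ σ : Sph, (lS σ (t, x))⁻¹ ∂sphM) ≤ r⁻¹ * (4 * π + 2 * π * (Real.log (t + r) - Real.log (t - r)))
  linarith

end PartSixteen

section PartSeventeen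
open scoped ContDiff

theorem Hs.dir {f : E4 → ℂ} (h : Hs f) {p : E4} (hp : p.2 ≠ 0) (w : Pt) :
    fderiv ℝ f p (0, w) = ∑ i, (w i : ℂ) * ((gρ p : ℂ) * _root_.kB i f p) := by
  have e1 : ((0, w) : E4) = ∑ j, w j • bX j := by
    have := E4_decomp (0, w); simpa using this
  rw [e1, map_sum]
  refine Finset.sum_congr rfl fun i _ => ?_
  have e3 : (gρ p : ℂ) * (rr p : ℂ) = 1 := by exact_mod_cast gρ_rr hp
  rw [map_smul, Complex.real_smul, ← h.grad hp i]
  linear_combination (-(w i : ℂ) * fderiv ℝ f p (bX i)) * e3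

theorem second_diff {f : E4 → ℂ} (h : Hs f) {M : ℝ} (hM : 0 ≤ M)
    (b1 : ∀ (p : E4), p.2 ≠ 0 → ∀ i, ‖kB i f p‖ ≤ M)
    (b2 : ∀ (p : E4), p.2 ≠ 0 → ∀ i j, ‖kB j (kB i f) p‖ ≤ M)
    {u w : Pt} (hu : ‖u‖ = 1) (huw : ⟪u, w⟫ = 0) :
    ‖f (0, u + w) + f (0, u - w) - 2 * f (0, u)‖ ≤ 24 * M * ‖w‖ ^ 2 := by
  set y : ℝ → E4 := fun s => (0, u + s • w) with hy
  have hn : ∀ s, 1 ≤ ‖(y s).2‖ := by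
    intro s
    have : ‖u + s • w‖ ^ 2 = 1 + s ^ 2 * ‖w‖ ^ 2 := by
      rw [norm_add_sq_real, inner_smul_right, huw, norm_smul, hu, mul_pow, Real.norm_eq_abs, sq_abs]; ring
    change 1 ≤ ‖u + s • w‖
    nlinarith [norm_nonneg (u + s • w), sq_nonneg (s * ‖w‖)]
  have hne : ∀ s, (y s).2 ≠ 0 := fun s h0 => by
    have := hn s; rw [h0, norm_zero] at this; linarith
  have hρ : ∀ s, gρ (y s) ≤ 1 := fun s => inv_le_one_of_one_le₀ (hn s)
  have hρ0 : ∀ s, 0 < gρ (y s) := fun s => gρ_pos (hne s)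
  have hyd : ∀ s, HasDerivAt y ((0, w) : E4) s := by
    intro s
    have := ((hasDerivAt_id s).smul_const w).const_add u
    have h2 := (hasDerivAt_const s (0 : ℝ)).prodMk this
    simpa using h2
  have hwi : ∀ i, |w i| ≤ ‖w‖ := fun i => by
    have := PiLp.norm_apply_le w i
    simpa using this
  set g' : ℝ → ℂ := fun s => ∑ i, (w i : ℂ) * ((gρ (y s) : ℂ) * kB i f (y s)) with hg'
  have hg : ∀ s, HasDerivAt (fun s => f (y s)) (g' s) s := by
    intro s
    have := (h.sm (y s) (hne s)).diff.hasFDerivAt.comp_hasDerivAt s (hyd s)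
    rw [h.dir (hne s)] at this
    exact this
  have hgg : ∀ i s, ∃ c : ℂ, HasDerivAt (fun s => (gρ (y s) : ℂ) * kB i f (y s)) c s
      ∧ ‖c‖ ≤ 4 * M * ‖w‖ := by
    intro i s
    have hz := hρ0 s
    have s1 := (gρ_sm (hne s)).ofReal
    have s2 := (h.kB i).sm (y s) (hne s)
    refine ⟨_, (s1.mul s2).diff.hasFDerivAt.comp_hasDerivAt s (hyd s), ?_⟩
    have e := Dv_mul (V := fun _ => ((0, w) : E4)) s1 s2
    rw [Dv_ofReal (gρ_sm (hne s)), Dv_gρ (hne s)] at e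
    have e' : Dv (fun _ => ((0, w) : E4)) (kB i f) (y s)
        = ∑ j, (w j : ℂ) * ((gρ (y s) : ℂ) * kB j (kB i f) (y s)) := (h.kB i).dir (hne s) w
    rw [e'] at e
    have e2 : fderiv ℝ (fun p => (gρ p : ℂ) * kB i f p) (y s) ((0, w) : E4) = _ := e
    rw [e2]
    have m1 : |mu (fun _ => ((0, w) : E4)) (y s)| ≤ ‖w‖ := by
      rw [mu, Dv_rr (hne s)]
      have a : ∑ i, (y s).2 i * w i = ⟪(y s).2, w⟫ := by simp [PiLp.inner_apply, mul_comm]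
      have a2 := abs_real_inner_le_norm (y s).2 w
      have a3 : gρ (y s) * ‖(y s).2‖ = 1 := gρ_rr (hne s)
      change |(∑ i, (y s).2 i * w i) * gρ (y s) * gρ (y s)| ≤ ‖w‖
      rw [a, abs_mul, abs_mul, abs_of_pos (hρ0 s)]
      calc |⟪(y s).2, w⟫| * gρ (y s) * gρ (y s) ≤ (‖(y s).2‖ * ‖w‖) * gρ (y s) * gρ (y s) := by
            gcongr <;> exact (hρ0 s).le
        _ = ‖w‖ * gρ (y s) := by linear_combination (‖w‖ * gρ (y s)) * a3
        _ ≤ ‖w‖ * 1 := by gcongr; exact hρ s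
        _ = ‖w‖ := mul_one _
    have n1 : ‖((-(mu (fun _ => ((0, w) : E4)) (y s) * gρ (y s)) : ℝ) : ℂ) * kB i f (y s)‖ ≤ ‖w‖ * 1 * M := by
      rw [norm_mul, Complex.norm_real, norm_neg, norm_mul, Real.norm_eq_abs, Real.norm_of_nonneg (hρ0 s).le]
      gcongr
      · exact hρ s
      · exact b1 _ (hne s) i
    have n2 : ‖(gρ (y s) : ℂ) * ∑ j, (w j : ℂ) * ((gρ (y s) : ℂ) * kB j (kB i f) (y s))‖ ≤ 1 * ∑ j : Fin 3, ‖w‖ * (1 * M) := by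
      rw [norm_mul, Complex.norm_real, Real.norm_of_nonneg (hρ0 s).le]
      gcongr
      · exact hρ s
      · refine norm_sum_le_of_le _ fun j _ => ?_
        rw [norm_mul, norm_mul, Complex.norm_real, Complex.norm_real, Real.norm_of_nonneg (hρ0 s).le,
          Real.norm_eq_abs]
        gcongr
        · exact hwi j
        · exact hρ s
        · exact b2 _ (hne s) i j
    refine (norm_add_le_of_le n1 n2).trans (le_of_eq ?_)
    simp; ring
  choose c hc1 hc2 using hgg
  have hg2 : ∀ s, HasDerivAt g' (∑ i, (w i : ℂ) * c i s) s := fun s =>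
    HasDerivAt.fun_sum fun i _ => (hc1 i s).const_mul _
  have hb2 : ∀ s, ‖∑ i, (w i : ℂ) * c i s‖ ≤ 12 * M * ‖w‖ ^ 2 := by
    intro s
    have : ‖∑ i, (w i : ℂ) * c i s‖ ≤ ∑ i : Fin 3, ‖w‖ * (4 * M * ‖w‖) := by
      refine norm_sum_le_of_le _ fun i _ => ?_
      rw [norm_mul, Complex.norm_real, Real.norm_eq_abs]
      gcongr
      · exact hwi i
      · exact hc2 i s
    refine this.trans (le_of_eq ?_)
    simp; ring
  have hlip : ∀ s, ‖g' s - g' (-s)‖ ≤ 12 * M * ‖w‖ ^ 2 * ‖s - (-s)‖ := fun s =>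
    Convex.norm_image_sub_le_of_norm_hasDerivWithin_le (s := Set.univ)
      (fun x _ => (hg2 x).hasDerivWithinAt) (fun x _ => hb2 x) convex_univ trivial trivial
  have hG : ∀ s, HasDerivAt (fun s => f (y s) + f (y (-s))) (g' s - g' (-s)) s := by
    intro s
    have := HasDerivAt.scomp s (hg (-s)) (hasDerivAt_neg s)
    refine ((hg s).add this).congr_deriv ?_
    simp; ring
  have fin := norm_image_sub_le_of_norm_deriv_le_segment_01' (f := fun s => f (y s) + f (y (-s)))
    (f' := fun s => g' s - g' (-s)) (C := 24 * M * ‖w‖ ^ 2) (fun s _ => (hG s).hasDerivWithinAt)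
    (fun s hs => by
      refine (hlip s).trans ?_
      have : ‖s - (-s)‖ ≤ 2 := by
        rw [Real.norm_eq_abs, abs_of_nonneg (by linarith [hs.1])]; linarith [hs.2]
      have h0 : 0 ≤ 12 * M * ‖w‖ ^ 2 := by positivity
      nlinarith)
  have e : (f (y 1) + f (y (-1))) - (f (y 0) + f (y (-0)))
      = f (0, u + w) + f (0, u - w) - 2 * f (0, u) := by
    simp [hy, sub_eq_add_neg]; ring
  simp only [e] at fin
  exact fin

/-- remainder of the kernel of order two -/
def RR (f : E4 → ℂ) : E4 → ℂ :=
  fun p => UU 2 (res f) p - ((4 * π * (p.1 ^ 2 - rr p ^ 2)⁻¹ : ℝ) : ℂ) * f p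

theorem RR_base {f : E4 → ℂ} (h : Hs f) {M : ℝ} (hM : 0 ≤ M)
    (b0 : ∀ (p : E4), p.2 ≠ 0 → ‖f p‖ ≤ M)
    (b1 : ∀ (p : E4), p.2 ≠ 0 → ∀ i, ‖kB i f p‖ ≤ M)
    (b2 : ∀ (p : E4), p.2 ≠ 0 → ∀ i j, ‖kB j (kB i f) p‖ ≤ M)
    {p : E4} (hp : p ∈ Cone) (h0 : p.2 ≠ 0) :
    ‖RR f p‖ ≤ 100 * M * gρ p * ∫ σ : Sph, (lS σ p)⁻¹ ∂sphM := by
  have hr := rr_pos h0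
  have hρ := gρ_pos h0
  have hρr := gρ_rr h0
  set u : Pt := gρ p • p.2 with hu
  have hu1 : ‖u‖ = 1 := by rw [hu, norm_smul, Real.norm_of_nonneg hρ.le]; exact hρr
  have hxu : p.2 = rr p • u := by rw [hu, smul_smul, mul_comm, hρr, one_smul]
  have hfu : f (0, u) = f p := by
    have := h.hom p (-p.1) (gρ p) hρ
    rw [← this, add_neg_cancel]
  set A := (ℝ ∙ u).reflection with hA
  have hAap : ∀ v, A v = (2 * ⟪u, v⟫) • u - v := by
    intro v
    rw [hA, Submodule.reflection_apply, Submodule.starProjection_unit_singleton ℝ hu1]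
    rw [two_smul, ← add_smul, two_mul]
  have hAin : ∀ v, ⟪A v, p.2⟫ = ⟪v, p.2⟫ := by
    intro v
    have k : ⟪A v, u⟫ = ⟪v, u⟫ := by
      rw [hAap, inner_sub_left, inner_smul_left, real_inner_self_eq_norm_sq, hu1, real_inner_comm u v]
      simp; ring
    have k2 : ∀ v : Pt, ⟪v, p.2⟫ = rr p * ⟪v, u⟫ := fun v => by
      rw [← inner_smul_right, ← hxu]
    rw [k2, k2, k]
  set g : Pt → ℂ := fun y => f (0, y) * (((p.1 - ⟪y, p.2⟫)⁻¹ ^ 2 : ℝ) : ℂ) with hg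
  have hgA : ∀ σ : Sph, g (A σ) = f (0, A σ) * (((lS σ p)⁻¹ ^ 2 : ℝ) : ℂ) := by
    intro σ; simp only [hg]; rw [hAin, lS_apply]
  have hgs : ∀ σ : Sph, g σ = f (0, (σ : Pt)) * (((lS σ p)⁻¹ ^ 2 : ℝ) : ℂ) := by
    intro σ; simp only [hg]; rw [lS_apply]
  have hk1 : Continuous (fun _ : Sph => (1 : ℂ)) := continuous_const
  have i1 : UU 2 (res f) p = ∫ σ : Sph, g σ ∂sphM := by
    simp only [UU, res]; exact integral_congr_ae (Eventually.of_forall fun σ => (hgs σ).symm)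
  have i2 := sph_inv A g
  have c1 : Continuous fun σ : Sph => g σ := by
    have := UU_cont h.cont hp 2
    exact this.congr fun σ => (hgs σ).symm
  have c2 : Continuous fun σ : Sph => g (A σ) := c1.comp (sphMap_cont A)
  have c3 : Continuous fun σ : Sph => (1 : ℂ) * (((lS σ p)⁻¹ ^ 2 : ℝ) : ℂ) := UU_cont hk1 hp 2
  have i3 : RR f p = ∫ σ : Sph, ((g σ + g (A σ)) - 2 * f p * (1 * (((lS σ p)⁻¹ ^ 2 : ℝ) : ℂ))) * (1 / 2) ∂sphM := by
    have c12 : Continuous fun σ : Sph => g σ + g (A σ) := c1.add c2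
    rw [integral_mul_const, integral_sub (cont_int c12) ((cont_int c3).const_mul _),
      integral_add (cont_int c1) (cont_int c2), i2, ← i1, integral_const_mul]
    have := UU_two hp
    simp only [UU] at this
    rw [this, RR, UU]; ring
  have hpt : ∀ σ : Sph, ‖f (0, (σ : Pt)) + f (0, A σ) - 2 * f p‖ ≤ 200 * M * (1 - ⟪u, (σ : Pt)⟫) := by
    intro σ
    set a := ⟪u, (σ : Pt)⟫ with ha
    have hσ1 := sph_norm σ
    have ha1 : a ≤ 1 := by
      have := real_inner_le_norm u (σ : Pt); rw [hu1, hσ1] at this; linarith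
    rcases le_or_gt (1 / 2) a with hh | hh
    · have ha0 : 0 < a := by linarith
      set w : Pt := a⁻¹ • ((σ : Pt) - a • u) with hw
      have huw : ⟪u, w⟫ = 0 := by
        rw [hw, inner_smul_right, inner_sub_right, inner_smul_right, real_inner_self_eq_norm_sq, hu1, ← ha]
        simp
      have e1 : (σ : Pt) = a • (u + w) := by
        rw [hw, smul_add, smul_inv_smul₀ ha0.ne']; abel
      have e2 : A σ = a • (u - w) := by
        rw [hAap, ← ha, hw, smul_sub, smul_inv_smul₀ ha0.ne']
        module
      have f1 : f (0, (σ : Pt)) = f (0, u + w) := by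
        have := h.hom (0, u + w) 0 a ha0
        rw [← this, e1]; simp
      have f2 : f (0, A σ) = f (0, u - w) := by
        have := h.hom (0, u - w) 0 a ha0
        rw [← this, e2]; simp
      have sd := second_diff h hM b1 b2 hu1 huw
      rw [f1, f2, ← hfu]
      have hnw : a ^ 2 * ‖w‖ ^ 2 = 1 - a ^ 2 := by
        have : ‖(σ : Pt)‖ ^ 2 = a ^ 2 * (1 + ‖w‖ ^ 2) := by
          rw [e1, norm_smul, mul_pow, norm_add_sq_real, huw, hu1, Real.norm_of_nonneg ha0.le]; ring
        rw [hσ1] at this; linarith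
      have hw8 : ‖w‖ ^ 2 ≤ 8 * (1 - a) := by
        have : ‖w‖ ^ 2 = (1 - a ^ 2) / a ^ 2 := by rw [← hnw]; field_simp
        rw [this, div_le_iff₀ (by positivity)]
        have q1 : 1 / 4 ≤ a ^ 2 := by nlinarith
        have q2 : 0 ≤ 8 * a ^ 2 - 1 - a := by linarith
        nlinarith [mul_nonneg (sub_nonneg.2 ha1) q2]
      have : 24 * M * ‖w‖ ^ 2 ≤ 24 * M * (8 * (1 - a)) := by gcongr
      nlinarith [mul_nonneg hM (sub_nonneg.2 ha1)]
    · have n1 := b0 (0, (σ : Pt)) (sph_ne σ)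
      have n2 := b0 (0, A σ) (by
        intro hz
        have : ‖A σ‖ = 1 := by rw [A.norm_map, hσ1]
        rw [show A σ = 0 from hz, norm_zero] at this; norm_num at this)
      have n3 := b0 p h0
      have : ‖f (0, (σ : Pt)) + f (0, A σ) - 2 * f p‖ ≤ M + M + 2 * M := by
        refine norm_sub_le_of_le (norm_add_le_of_le n1 n2) ?_
        rw [norm_mul]; simpa using n3
      nlinarith
  have c4 : Continuous fun σ : Sph => (lS σ p)⁻¹ := by
    simpa using lS_inv_cont hp 1
  have i4 : Integrable (fun σ : Sph => 100 * M * gρ p * (lS σ p)⁻¹) sphM := by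
    have c5 : Continuous fun σ : Sph => ((100 * M * gρ p * (lS σ p)⁻¹ : ℝ) : ℂ) := by fun_prop
    have := (cont_int c5).re
    simpa using this
  rw [i3, ← integral_const_mul]
  refine norm_integral_le_of_norm_le i4 (Eventually.of_forall fun σ => ?_)
  rw [hgs, hgA]
  have hl := lS_pos hp σ
  have e : (f (0, (σ : Pt)) * (((lS σ p)⁻¹ ^ 2 : ℝ) : ℂ) + f (0, A σ) * (((lS σ p)⁻¹ ^ 2 : ℝ) : ℂ)
      - 2 * f p * (1 * (((lS σ p)⁻¹ ^ 2 : ℝ) : ℂ))) * (1 / 2)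
      = (f (0, (σ : Pt)) + f (0, A σ) - 2 * f p) * (((lS σ p)⁻¹ ^ 2 * (1 / 2) : ℝ) : ℂ) := by
    push_cast; ring
  rw [e, norm_mul, Complex.norm_real, Real.norm_of_nonneg (by positivity)]
  have h5 : rr p * (1 - ⟪u, (σ : Pt)⟫) ≤ lS σ p := by
    have : rr p * ⟪u, (σ : Pt)⟫ = ⟪(σ : Pt), p.2⟫ := by
      conv_rhs => rw [hxu]
      rw [inner_smul_right, real_inner_comm]
    rw [lS_apply]
    have h6 : rr p < p.1 := hp
    linarith
  have h6 : 1 - ⟪u, (σ : Pt)⟫ ≤ gρ p * lS σ p := by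
    have := mul_le_mul_of_nonneg_left h5 hρ.le
    rw [← mul_assoc, hρr, one_mul] at this; exact this
  calc ‖f (0, (σ : Pt)) + f (0, A σ) - 2 * f p‖ * ((lS σ p)⁻¹ ^ 2 * (1 / 2))
      ≤ (200 * M * (gρ p * lS σ p)) * ((lS σ p)⁻¹ ^ 2 * (1 / 2)) := by
        gcongr
        exact (hpt σ).trans (by gcongr)
    _ = 100 * M * gρ p * (lS σ p)⁻¹ := by field_simp; ring

end PartSeventeen

section PartEighteen
open scoped ContDiff

theorem eq_of_cx {F : Type*} {f g : E4 → F} {p : E4} (hp : p ∈ Cone) (h0 : p.2 ≠ 0)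
    (h : ∀ y ∈ Cone, y.2 ≠ 0 → f y = g y) : f =ᶠ[𝓝 p] g := by
  filter_upwards [x0_ev h0, Cone_open.mem_nhds hp] with y hy hc using h y hc hy

theorem RR_alt (f : E4 → ℂ) {p : E4} (hp : p ∈ Cone) :
    RR f p = UU 2 (res f) p - UU 2 (fun _ => 1) p * f p := by
  rw [UU_two hp]; rfl

theorem RR_ev (f : E4 → ℂ) {p : E4} (hp : p ∈ Cone) :
    RR f =ᶠ[𝓝 p] fun p => UU 2 (res f) p - UU 2 (fun _ => 1) p * f p := by
  filter_upwards [Cone_open.mem_nhds hp] with y hy using RR_alt f hy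

theorem U1_cont : Continuous (fun _ : Sph => (1 : ℂ)) := continuous_const

theorem RR_sm {f : E4 → ℂ} (h : Hs f) {p : E4} (hp : p ∈ Cone) (h0 : p.2 ≠ 0) : SmA (RR f) p :=
  ((UU_sm h.cont hp 2).sub ((UU_sm U1_cont hp 2).mul (h.sm p h0))).congr (RR_ev f hp).symm

theorem Dv_RR {f : E4 → ℂ} (h : Hs f) {p : E4} (hp : p ∈ Cone) (h0 : p.2 ≠ 0) (V : E4 → E4) :
    Dv V (RR f) p = Dv V (UU 2 (res f)) p - (Dv V (UU 2 (fun _ => 1)) p * f p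
      + UU 2 (fun _ => 1) p * Dv V f p) := by
  rw [Dv_congr_at (RR_ev f hp), Dv_sub (UU_sm h.cont hp 2) ((UU_sm U1_cont hp 2).mul (h.sm p h0)),
    Dv_mul (UU_sm U1_cont hp 2) (h.sm p h0)]

theorem U1_rot {p : E4} (hp : p ∈ Cone) (i j : Fin 3) :
    Dv (ZV (.rot i j)) (UU 2 (fun _ => 1)) p = 0 := by
  have := UU_rot (Hs.const 1) hp 2 i j
  rw [res_one] at this; rw [this]
  simp [UU, res, Dv_const]

theorem U1_boost {p : E4} (hp : p ∈ Cone) (i : Fin 3) :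
    Dv (ZV (.boost i)) (UU 2 (fun _ => 1)) p = 0 := by
  have := UU_boost (Hs.const 1) hp i
  rw [res_one] at this; rw [this]
  simp [UU, res, kB, Dv_const]

theorem RR_rot {f : E4 → ℂ} (h : Hs f) {p : E4} (hp : p ∈ Cone) (h0 : p.2 ≠ 0) (i j : Fin 3) :
    Dv (ZV (.rot i j)) (RR f) p = RR (Dv (RV (.rot i j)) f) p := by
  rw [Dv_RR h hp h0, UU_rot h hp, U1_rot hp, RR_alt _ hp, zero_mul, zero_add]
  rfl

theorem RR_scal {f : E4 → ℂ} (h : Hs f) {p : E4} (hp : p ∈ Cone) (h0 : p.2 ≠ 0) :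
    Dv (ZV .scal) (RR f) p = -2 * RR f p := by
  rw [Dv_RR h hp h0, UU_scal h.cont hp, UU_scal U1_cont hp, RR_alt _ hp, h.scal h0]
  push_cast; ring

theorem inv_form {p : E4} (hp : p ∈ Cone) (h0 : p.2 ≠ 0) :
    (p.1 ^ 2 - rr p ^ 2)⁻¹ = -((gq p)⁻¹ * gρ p * gκ p) := by
  have hr := rr_pos h0
  have hp' : rr p < p.1 := hp
  have e1 : gq p = rr p - p.1 := rfl
  have e2 : gκ p = (1 + p.1 * (rr p)⁻¹)⁻¹ := rfl
  have e3 : gρ p = (rr p)⁻¹ := rfl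
  have e4 : (1 + p.1 * (rr p)⁻¹) = (rr p + p.1) * (rr p)⁻¹ := by field_simp
  rw [e1, e2, e3, e4]
  have a1 : rr p - p.1 ≠ 0 := by linarith
  have a2 : rr p + p.1 ≠ 0 := by linarith
  have a3 : p.1 ^ 2 - rr p ^ 2 = -((rr p - p.1) * (rr p + p.1)) := by ring
  rw [a3]
  field_simp

theorem RR_boost {f : E4 → ℂ} (h : Hs f) {p : E4} (hp : p ∈ Cone) (h0 : p.2 ≠ 0) (i : Fin 3) :
    Dv (ZV (.boost i)) (RR f) p
      = RR (kB i f) p - ((4 * π * gρ p ^ 2 * gκ p : ℝ) : ℂ) * kB i f p := by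
  rw [Dv_RR h hp h0, UU_boost h hp, U1_boost hp, RR_alt _ hp, h.boost h0, UU_two hp, inv_form hp h0]
  have e : 4 * π * -((gq p)⁻¹ * gρ p * gκ p) * (1 - gτ p) = -(4 * π * gρ p ^ 2 * gκ p) := by
    have hp' : rr p < p.1 := hp
    have e1 : gq p = rr p - p.1 := rfl
    have a1 : gq p ≠ 0 := by rw [e1]; linarith
    have e2 : 1 - gτ p = gq p * gρ p := by
      have := gρ_rr h0
      rw [e1, gτ]; linear_combination (-1) * this
    rw [e2]; field_simp
  have e' : ((4 * π * -((gq p)⁻¹ * gρ p * gκ p) * (1 - gτ p) : ℝ) : ℂ)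
    = ((-(4 * π * gρ p ^ 2 * gκ p) : ℝ) : ℂ) := by rw [e]
  push_cast at e' ⊢
  linear_combination (kB i f p) * e'

theorem lor_time (F : E4 → ℂ) {p : E4} (hp : p ∈ Cone) (h0 : p.2 ≠ 0) :
    Dv (ZV .time) F p = ((-((gq p)⁻¹ * gτ p * gκ p) : ℝ) : ℂ) * Dv (ZV .scal) F p
      + ∑ i, (((gq p)⁻¹ * gω i p * gκ p : ℝ) : ℂ) * Dv (ZV (.boost i)) F p := by
  have hT := congrArg (fderiv ℝ F p) (lor_T p)
  simp only [map_sub, map_smul, map_sum, Complex.real_smul] at hT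
  have hpos := (cone_sq hp).ne'
  have hi := inv_form hp h0
  have e : Dv (ZV .time) F p = ((p.1 ^ 2 - rr p ^ 2 : ℝ) : ℂ)⁻¹ * (((p.1 ^ 2 - rr p ^ 2 : ℝ) : ℂ) * fderiv ℝ F p bT) := by
    rw [inv_mul_cancel_left₀ (by exact_mod_cast hpos)]; rfl
  rw [e, hT, ← Complex.ofReal_inv, hi, mul_sub, Finset.mul_sum, sub_eq_add_neg, ← Finset.sum_neg_distrib]
  congr 1
  · simp only [Dv, gτ]; push_cast; ring
  · refine Finset.sum_congr rfl fun i _ => ?_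
    simp only [Dv, gω]; push_cast; ring

theorem lor_space (F : E4 → ℂ) {p : E4} (hp : p ∈ Cone) (h0 : p.2 ≠ 0) (i : Fin 3) :
    Dv (ZV (.space i)) F p = (((-((gq p)⁻¹ * gτ p * gκ p) : ℝ) : ℂ) * Dv (ZV (.boost i)) F p
      + (((gq p)⁻¹ * gω i p * gκ p : ℝ) : ℂ) * Dv (ZV .scal) F p)
      + ∑ j, (((gq p)⁻¹ * gω j p * gκ p : ℝ) : ℂ) * Dv (ZV (.rot j i)) F p := by
  have hT := congrArg (fderiv ℝ F p) (lor_X p i)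
  simp only [map_sub, map_smul, map_sum, Complex.real_smul] at hT
  have hpos := (cone_sq hp).ne'
  have hi := inv_form hp h0
  have e : Dv (ZV (.space i)) F p = ((p.1 ^ 2 - rr p ^ 2 : ℝ) : ℂ)⁻¹ * (((p.1 ^ 2 - rr p ^ 2 : ℝ) : ℂ) * fderiv ℝ F p (bX i)) := by
    rw [inv_mul_cancel_left₀ (by exact_mod_cast hpos)]; rfl
  rw [e, hT, ← Complex.ofReal_inv, hi, mul_sub, Finset.mul_sum, sub_eq_add_neg, ← Finset.sum_neg_distrib]
  congr 1
  · simp only [Dv, gτ, gω]; push_cast; ring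
  · refine Finset.sum_congr rfl fun i _ => ?_
    simp only [Dv, gω]; push_cast; ring

/-- transition region -/
def PR {Θ : Type*} : Θ → E4 → Prop :=
  fun _ p => 12 < p.1 ∧ p.2 ≠ 0 ∧ -1 ≤ gq p ∧ gq p ≤ -(1 / 2)

theorem PR_facts {Θ : Type*} {θ : Θ} {p : E4} (h : PR θ p) :
    PW θ p ∧ p ∈ Cone ∧ gj p ≤ 2 ∧ 11 ≤ rr p ∧ p.1 ≤ 2 * rr p ∧ Good p := by
  obtain ⟨h1, h2, h3, h4⟩ := h
  have e1 : gq p = rr p - p.1 := rfl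
  have hj : gj p ≤ 2 := by
    have h5 := jb_le (gq p)
    have h6 : |gq p| ≤ 1 := abs_le.2 ⟨h3, by linarith⟩
    change jb (gq p) ≤ 2
    linarith
  have hPW : PW θ p := ⟨by linarith, h2, by linarith⟩
  refine ⟨hPW, ?_, hj, by linarith, by linarith, PW_good θ p hPW⟩
  change rr p < p.1
  linarith

section PRcoefs
variable {Θ : Type*}

theorem PR_good (θ : Θ) (p : E4) (h : PR θ p) : Good p := (PR_facts h).2.2.2.2.2

theorem gκ_OB (n : ℕ) : OB ZV (PR : Θ → E4 → Prop) n (fun _ => gκ) one' := by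
  refine comp_OB (h := fun u : ℝ => (1 + u)⁻¹) Z_hV (isCompact_Icc (a := (0 : ℝ)) (b := 30))
    (isOpen_Ioi (a := (-1 : ℝ))) (fun x hx => ?_) (fun θ p hp => ?_) n (gτ_OB PR_good n) ?_
  · have := hx.1; simp only [Set.mem_Ioi]; linarith
  · have h := PR_facts hp
    exact ⟨mul_nonneg h.1.1 (gρ_pos h.1.2.1).le, (le_abs_self _).trans h.2.2.2.2.2.2.2⟩
  · intro x hx
    have : (1 + x) ≠ 0 := by have : -1 < x := hx; linarith
    exact (ContDiffAt.inv (by fun_prop) this).contDiffWithinAt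

theorem gβ_OB (n : ℕ) : OB ZV (PR : Θ → E4 → Prop) n (fun _ p => (gq p)⁻¹) one' := by
  refine comp_OB (h := fun u : ℝ => u⁻¹) Z_hV (isCompact_Icc (a := (-1 : ℝ)) (b := -(1 / 2)))
    (isOpen_Iio (a := (0 : ℝ))) (fun x hx => ?_) (fun θ p hp => hp.2.2) n
    (gq_OB PR_good (fun θ p hp => abs_le.2 ⟨by linarith [hp.2.2.1], by linarith [hp.2.2.2]⟩) n) ?_
  · have := hx.2; simp only [Set.mem_Iio]; linarith
  · intro x hx
    have : x ≠ 0 := by have : x < 0 := hx; exact this.ne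
    exact (contDiffAt_inv ℝ this).contDiffWithinAt

theorem cτ_OB (n : ℕ) : OB ZV (PR : Θ → E4 → Prop) n
    (fun _ p => ((-((gq p)⁻¹ * gτ p * gκ p) : ℝ) : ℂ)) one' :=
  OB.ofReal Z_hV (OB.neg Z_hV (OB.mul1 Z_hV (OB.mul1 Z_hV (gβ_OB n) (gτ_OB PR_good n)) (gκ_OB n)))

theorem cω_OB (n : ℕ) (i : Fin 3) : OB ZV (PR : Θ → E4 → Prop) n
    (fun _ p => (((gq p)⁻¹ * gω i p * gκ p : ℝ) : ℂ)) one' :=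
  OB.ofReal Z_hV (OB.mul1 Z_hV (OB.mul1 Z_hV (gβ_OB n) (gω_OB PR_good n i)) (gκ_OB n))

theorem kB_OB {n : ℕ} {f : Θ → E4 → ℂ} {w : Θ → E4 → ℝ} (hw : ∀ θ p, 0 ≤ w θ p)
    (h : OB RV X0 (n + 1) f w) (i : Fin 3) : OB RV X0 n (fun θ => kB i (f θ)) w :=
  OB.sum Finset.univ R_hV (fun θ p _ => hw θ p) fun j _ =>
    OB.mul1 R_hV (OB.ofReal R_hV (gωR_OB (fun _ _ h => h) n j)) (h.dv R_hV _)

theorem Hs.pull {f : E4 → ℂ} (h : Hs f) : _root_.pull f = f := by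
  funext p
  have := h.hom p (gq p - p.1) 1 one_pos
  rw [← this]
  simp [_root_.pull]

theorem log_bd {θ : Θ} {p : E4} (h : PR θ p) :
    4 * π + 2 * π * (Real.log (p.1 + rr p) - Real.log (p.1 - rr p)) ≤ 100 * (1 + gL p) := by
  obtain ⟨hW, hc, hj, hr, ht, -⟩ := PR_facts h
  obtain ⟨h1, h2, h3, h4⟩ := h
  have e1 : gq p = rr p - p.1 := rfl
  have l2 : Real.log 2 ≤ 1 := by have := Real.log_two_lt_d9; linarith
  have hg := gL_nonneg hW
  have a1 : Real.log (p.1 + rr p) ≤ Real.log (2 * (2 * rr p)) :=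
    Real.log_le_log (by linarith) (by linarith)
  rw [Real.log_mul (by norm_num) (by linarith)] at a1
  have a2 : Real.log (2⁻¹) ≤ Real.log (p.1 - rr p) := Real.log_le_log (by norm_num) (by linarith)
  rw [Real.log_inv] at a2
  have a3 : Real.log (gj p) ≤ Real.log 2 := Real.log_le_log (gj_pos p) hj
  have a4 : gL p = Real.log (2 * rr p) - Real.log (gj p) := rfl
  have a5 : Real.log (p.1 + rr p) - Real.log (p.1 - rr p) ≤ gL p + 3 := by linarith
  have hπ := Real.pi_pos
  have hπ4 := Real.pi_le_four
  have : 2 * π * (Real.log (p.1 + rr p) - Real.log (p.1 - rr p)) ≤ 2 * π * (gL p + 3) := by gcongr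
  nlinarith

theorem RR_OB {c : Θ → ℝ} (hc : ∀ θ, 0 ≤ c θ) (n : ℕ) {f : Θ → E4 → ℂ} (hs : ∀ θ, Hs (f θ))
    (hf : OB RV X0 (n + 2) f (fun θ _ => c θ)) :
    OB ZV PR n (fun θ => RR (f θ)) (fun θ p => c θ * (gρ p ^ 2 * (1 + gL p))) := by
  have hw : ∀ θ p, PR θ p → 0 ≤ c θ * (gρ p ^ 2 * (1 + gL p)) := fun θ p hp => by
    have := gL_nonneg (PR_facts hp).1
    have := hc θ
    positivity
  have hc' : ∀ θ (p : E4), (0 : ℝ) ≤ (fun θ (_ : E4) => c θ) θ p := fun θ _ => hc θ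
  have hsm : ∀ {f : Θ → E4 → ℂ}, (∀ θ, Hs (f θ)) → ∀ θ p, PR θ p → SmA (RR (f θ)) p :=
    fun hs θ p hp => RR_sm (hs θ) (PR_facts hp).2.1 hp.2.1
  have h0 : ∀ {f : Θ → E4 → ℂ}, (∀ θ, Hs (f θ)) → OB RV X0 2 f (fun θ _ => c θ) →
      ∃ C : ℝ, 0 ≤ C ∧ ∀ θ p, PR θ p → ‖RR (f θ) p‖ ≤ C * (c θ * (gρ p ^ 2 * (1 + gL p))) := by
    intro f hs hf
    obtain ⟨C0, hC0, H0⟩ := hf.val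
    have k1 := fun i => kB_OB (n := 1) hc' hf i
    choose C1 hC1 H1 using fun i => (k1 i).val
    choose C2 hC2 H2 using fun i j => (kB_OB (n := 0) hc' (k1 i) j).val
    set C := C0 + ∑ i, C1 i + ∑ i, ∑ j, C2 i j with hC
    have s1 : 0 ≤ ∑ i, C1 i := Finset.sum_nonneg fun i _ => hC1 i
    have s2 : 0 ≤ ∑ i, ∑ j, C2 i j := Finset.sum_nonneg fun i _ => Finset.sum_nonneg fun j _ => hC2 i j
    have hCp : 0 ≤ C := by positivity
    refine ⟨100 * C * 100, by positivity, fun θ p hp => ?_⟩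
    have F := PR_facts hp
    have b := RR_base (hs θ) (M := C * c θ) (mul_nonneg hCp (hc θ))
      (fun y hy => (H0 θ y hy).trans (mul_le_mul_of_nonneg_right (by linarith) (hc θ)))
      (fun y hy i => (H1 i θ y hy).trans (mul_le_mul_of_nonneg_right (by
        have := Finset.single_le_sum (f := C1) (fun i _ => hC1 i) (Finset.mem_univ i)
        linarith) (hc θ)))
      (fun y hy i j => (H2 i j θ y hy).trans (mul_le_mul_of_nonneg_right (by
        have a := Finset.single_le_sum (f := C2 i) (fun j _ => hC2 i j) (Finset.mem_univ j)
        have a' := Finset.single_le_sum (f := fun i => ∑ j, C2 i j)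
          (fun i _ => Finset.sum_nonneg fun j _ => hC2 i j) (Finset.mem_univ i)
        linarith) (hc θ)))
      F.2.1 hp.2.1
    have hρ := gρ_pos hp.2.1
    have hcθ := hc θ
    have u := UU_one_bd F.2.1 hp.2.1 F.2.2.2.2.1
    have u2 := u.trans (mul_le_mul_of_nonneg_left (log_bd hp) hρ.le)
    calc ‖RR (f θ) p‖ ≤ _ := b
      _ ≤ 100 * (C * c θ) * gρ p * (gρ p * (100 * (1 + gL p))) := by gcongr
      _ = _ := by ring
  induction n generalizing f with
  | zero => exact OB.zeroth (hsm hs) (h0 hs hf)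
  | succ n ih =>
    have cx : ∀ {F G : Θ → E4 → ℂ}, (∀ θ, ∀ y ∈ Cone, y.2 ≠ 0 → F θ y = G θ y) →
        ∀ θ p, PR θ p → F θ =ᶠ[𝓝 p] G θ := fun h θ p hp =>
      eq_of_cx (PR_facts hp).2.1 hp.2.1 (h θ)
    have hrot : ∀ i j, OB ZV PR n (fun θ => Dv (ZV (.rot i j)) (RR (f θ)))
        (fun θ p => c θ * (gρ p ^ 2 * (1 + gL p))) := fun i j =>
      (ih (fun θ => (hs θ).dv i j) (hf.dv R_hV (.rot i j))).congr
        (cx fun θ y hy h => (RR_rot (hs θ) hy h i j).symm)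
    have hscal : OB ZV PR n (fun θ => Dv (ZV .scal) (RR (f θ)))
        (fun θ p => c θ * (gρ p ^ 2 * (1 + gL p))) :=
      (OB.mul1 Z_hV (OB.const (-2 : ℂ)) (ih hs (hf.mono (Nat.le_succ _)))).congr
        (cx fun θ y hy h => (RR_scal (hs θ) hy h).symm)
    have hboost : ∀ i, OB ZV PR n (fun θ => Dv (ZV (.boost i)) (RR (f θ)))
        (fun θ p => c θ * (gρ p ^ 2 * (1 + gL p))) := by
      intro i
      have k := kB_OB (n := n + 2) hc' hf i
      have k1 := ih (fun θ => (hs θ).kB i) k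
      have k2 : OB ZV PR n (fun θ => kB i (f θ)) (fun θ _ => c θ) :=
        ((k.mono (by omega : n ≤ n + 2)).pull (P := PR) fun θ p hp => ⟨PR_good θ p hp, hp.2.1⟩).congr
          fun θ p hp => by rw [((hs θ).kB i).pull]
      have k3 : OB ZV (PR : Θ → E4 → Prop) n (fun _ p => ((4 * π * gρ p ^ 2 * gκ p : ℝ) : ℂ))
          (fun _ p => gρ p * gρ p) := by
        refine ((OB.ofReal Z_hV (OB.mul1 Z_hV (OB.mul1 Z_hV (OB.const' (4 * π)) (gκ_OB n))
          (OB.mul Z_hV (gρ_OB PR_good n) (gρ_OB PR_good n)))).congr fun θ p hp =>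
          Eventually.of_forall fun y => ?_)
        push_cast; ring
      have k4 := (OB.mul Z_hV k3 k2).weight (w' := fun θ p => c θ * (gρ p ^ 2 * (1 + gL p))) 1 zero_le_one
        fun θ p hp => by
          have a1 := gL_nonneg (PR_facts hp).1
          have a2 := hc θ
          have a3 : 0 ≤ gρ p ^ 2 * c θ * gL p := by positivity
          nlinarith
      exact (OB.sub Z_hV k1 k4).congr (cx fun θ y hy h => (RR_boost (hs θ) hy h i).symm)
    refine OB.succ (hsm hs) hw (h0 hs (hf.mono (by omega))) fun z => ?_
    cases z with
    | time =>
      exact (OB.add Z_hV (OB.mul1 Z_hV (cτ_OB n) hscal)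
        (OB.sum Finset.univ Z_hV hw fun i _ => OB.mul1 Z_hV (cω_OB n i) (hboost i))).congr
        (cx fun θ y hy h => (lor_time _ hy h).symm)
    | space i =>
      exact (OB.add Z_hV (OB.add Z_hV (OB.mul1 Z_hV (cτ_OB n) (hboost i)) (OB.mul1 Z_hV (cω_OB n i) hscal))
        (OB.sum Finset.univ Z_hV hw fun j _ => OB.mul1 Z_hV (cω_OB n j) (hrot j i))).congr
        (cx fun θ y hy h => (lor_space _ hy h i).symm)
    | rot i j => exact hrot i j
    | boost i => exact hboost i
    | scal => exact hscal

end PRcoefs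
end PartEighteen

section PartT
open scoped ContDiff

theorem sph_sq (σ : Sph) : ∑ i, (σ : Pt) i ^ 2 = 1 := by
  rw [← EuclideanSpace.real_norm_sq_eq, sph_norm]; norm_num

theorem sph_sq_C (σ : Sph) : ∑ i, (((σ : Pt) i : ℝ) : ℂ) ^ 2 = 1 := by
  have := congrArg (fun u : ℝ => (u : ℂ)) (sph_sq σ)
  simpa using this

theorem cone_ev {p : E4} (hp : p ∈ Cone) : ∀ᶠ y in 𝓝 p, y ∈ Cone := Cone_open.mem_nhds hp

/-- spherical potentials of degree one solve the wave equation -/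
theorem box_UU {k : Sph → ℂ} (hk : Continuous k) {p : E4} (hp : p ∈ Cone) : boxV (UU 1 k) p = 0 := by
  have hT : Dv (ZV .time) (UU 1 k) =ᶠ[𝓝 p] fun y => -1 * UU 2 k y := by
    filter_upwards [cone_ev hp] with y hy
    have : Dv (ZV .time) (UU 1 k) y = _ := UU_dT hk hy 1
    simpa using this
  have hX : ∀ i, Dv (ZV (.space i)) (UU 1 k) =ᶠ[𝓝 p] UU 2 (sk i k) := by
    intro i
    filter_upwards [cone_ev hp] with y hy
    have : Dv (ZV (.space i)) (UU 1 k) y = _ := UU_dX hk hy 1 i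
    simpa using this
  have e1 : Dv (ZV .time) (Dv (ZV .time) (UU 1 k)) p = 2 * UU 3 k p := by
    rw [Dv_congr_at hT, Dv_mul SmA.const (UU_sm hk hp 2), Dv_const]
    have := UU_dT hk hp 2
    have h2 : Dv (ZV .time) (UU 2 k) p = _ := this
    rw [h2]; push_cast; ring
  have e2 : ∀ i, Dv (ZV (.space i)) (Dv (ZV (.space i)) (UU 1 k)) p = 2 * UU 3 (sk i (sk i k)) p := by
    intro i
    rw [Dv_congr_at (hX i)]
    have h2 : Dv (ZV (.space i)) (UU 2 (sk i k)) p = _ := UU_dX (sk_cont i hk) hp 2 i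
    rw [h2]; push_cast; ring
  have e3 : ∑ i, UU 3 (sk i (sk i k)) p = UU 3 k p := by
    unfold UU
    rw [← integral_finsetSum _ fun i _ => cont_int (UU_cont (sk_cont i (sk_cont i hk)) hp 3)]
    congr 1; funext σ
    have := sph_sq_C σ
    simp only [sk]
    rw [Fin.sum_univ_three] at this ⊢
    linear_combination (k σ * (((lS σ p)⁻¹ ^ 3 : ℝ) : ℂ)) * this
  rw [boxV, e1]
  simp only [e2]
  rw [← Finset.mul_sum, e3]; ring

theorem Dv_gq_T {p : E4} (hp : p.2 ≠ 0) : Dv (ZV .time) gq p = -1 := by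
  rw [Dv_gq', nu_ZV _ hp, nuZ]
  have := @ga_gj p
  linear_combination -this

theorem Dv_gq_X {p : E4} (hp : p.2 ≠ 0) (i : Fin 3) : Dv (ZV (.space i)) gq p = gω i p := by
  rw [Dv_gq', nu_ZV _ hp, nuZ]
  have := @ga_gj p
  linear_combination gω i p * this

theorem hq_sm {h : ℝ → ℝ} (hh : ContDiff ℝ ∞ h) {p : E4} (hp : p.2 ≠ 0) :
    SmA (fun y => h (gq y)) p :=
  SmA.comp (f := h) (SmA.of_contDiff hh) (gq_sm hp)

theorem Dv_hq {h : ℝ → ℝ} (hh : ContDiff ℝ ∞ h) (V : E4 → E4) {p : E4} (hp : p.2 ≠ 0) :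
    Dv V (fun y => h (gq y)) p = Dv V gq p * deriv h (gq p) :=
  Dv_comp_real (hh.differentiable (by simp) _) (gq_sm hp)

theorem Dv2_mul {z : VF} {f g : E4 → ℂ} {p : E4} (hf : SmA f p) (hg : SmA g p) :
    Dv (ZV z) (Dv (ZV z) (fun y => f y * g y)) p = Dv (ZV z) (Dv (ZV z) f) p * g p
      + 2 * (Dv (ZV z) f p * Dv (ZV z) g p) + f p * Dv (ZV z) (Dv (ZV z) g) p := by
  have h : Dv (ZV z) (fun y => f y * g y) =ᶠ[𝓝 p]
      fun y => Dv (ZV z) f y * g y + f y * Dv (ZV z) g y := by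
    filter_upwards [hf.ev, hg.ev] with y a b
    exact Dv_mul a b
  have sf := SmA.dv (Z_hV z p) hf
  have sg := SmA.dv (Z_hV z p) hg
  rw [Dv_congr_at h, Dv_add (sf.mul hg) (hf.mul sg), Dv_mul sf hg, Dv_mul hf sg]
  ring

theorem box_cut {h : ℝ → ℝ} (hh : ContDiff ℝ ∞ h) {f : E4 → ℂ} {p : E4} (hp : p.2 ≠ 0) (hf : SmA f p) :
    boxV (fun y => ((h (gq y) : ℝ) : ℂ) * f y) p = ((h (gq p) : ℝ) : ℂ) * boxV f p
      + 2 * ((deriv h (gq p) : ℝ) : ℂ) * ((gρ p : ℂ) * f p + Dv (ZV .time) f p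
        + ∑ i, (gω i p : ℂ) * Dv (ZV (.space i)) f p) := by
  have sh := (hq_sm hh hp).ofReal
  have hd : ContDiff ℝ ∞ (deriv h) := deriv_smooth hh
  have D1 : ∀ z : VF, ∀ y : E4, y.2 ≠ 0 → Dv (ZV z) (fun y => ((h (gq y) : ℝ) : ℂ)) y
      = ((Dv (ZV z) gq y * deriv h (gq y) : ℝ) : ℂ) := fun z y hy => by
    rw [Dv_ofReal (hq_sm hh hy), Dv_hq hh _ hy]
  have T1 : Dv (ZV .time) (fun y => ((h (gq y) : ℝ) : ℂ)) =ᶠ[𝓝 p]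
      fun y => ((-1 * deriv h (gq y) : ℝ) : ℂ) :=
    eq_of_x0 hp fun y hy => by rw [D1 _ y hy, Dv_gq_T hy]
  have X1 : ∀ i, Dv (ZV (.space i)) (fun y => ((h (gq y) : ℝ) : ℂ)) =ᶠ[𝓝 p]
      fun y => ((gω i y * deriv h (gq y) : ℝ) : ℂ) := fun i =>
    eq_of_x0 hp fun y hy => by rw [D1 _ y hy, Dv_gq_X hy]
  have sd := hq_sm hd hp
  have T2 : Dv (ZV .time) (Dv (ZV .time) (fun y => ((h (gq y) : ℝ) : ℂ))) p
      = ((deriv (deriv h) (gq p) : ℝ) : ℂ) := by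
    rw [Dv_congr_at T1, Dv_ofReal (SmA.const.mul sd), Dv_mul SmA.const sd, Dv_const, Dv_hq hd _ hp,
      Dv_gq_T hp]
    congr 1; ring
  have X2 : ∀ i, Dv (ZV (.space i)) (Dv (ZV (.space i)) (fun y => ((h (gq y) : ℝ) : ℂ))) p
      = (((gρ p - gρ p * gω i p ^ 2) * deriv h (gq p)
        + gω i p ^ 2 * deriv (deriv h) (gq p) : ℝ) : ℂ) := by
    intro i
    rw [Dv_congr_at (X1 i), Dv_ofReal ((gω_sm hp).mul sd), Dv_mul (gω_sm hp) sd, Dv_hq hd _ hp,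
      Dv_gq_X hp, Dv_gω i hp, mu_ZV _ hp, muZ]
    congr 1
    have : (ZV (.space i) p).2 i = 1 := by simp [ZV]
    rw [this]; ring
  have hω := congrArg (fun u : ℝ => (u : ℂ)) (gω_sq hp)
  simp only [boxV, Dv2_mul sh hf, T2, X2, T1.self_of_nhds, fun i => (X1 i).self_of_nhds]
  simp only [Fin.sum_univ_three] at hω ⊢
  push_cast at hω ⊢
  linear_combination (f p * ((deriv (deriv h) (gq p) : ℝ) : ℂ) - f p * (gρ p : ℂ) * ((deriv h (gq p) : ℝ) : ℂ)) * hω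

/-- wave operator of the cut off potential -/
theorem box_cutU {h : ℝ → ℝ} (hh : ContDiff ℝ ∞ h) {k : Sph → ℂ} (hk : Continuous k) {p : E4}
    (hp : p.2 ≠ 0) (hc : p ∈ Cone) :
    boxV (fun y => ((h (gq y) : ℝ) : ℂ) * UU 1 k y) p =
      -2 * (((gq p * deriv h (gq p)) * gρ p : ℝ) : ℂ) * UU 2 k p := by
  rw [box_cut hh hp (UU_sm hk hc 1), box_UU hk hc]
  have h1 : Dv (ZV .time) (UU 1 k) p = _ := UU_dT hk hc 1
  have h2 : ∀ i, Dv (ZV (.space i)) (UU 1 k) p = _ := fun i => UU_dX hk hc 1 i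
  rw [h1]
  simp only [h2]
  have key : (gρ p : ℂ) * UU 1 k p + -((1 : ℕ) : ℂ) * UU (1 + 1) k p
      + ∑ i, (gω i p : ℂ) * (((1 : ℕ) : ℂ) * UU (1 + 1) (sk i k) p)
      = -((gq p * gρ p : ℝ) : ℂ) * UU 2 k p := by
    simp only [UU, ← integral_const_mul]
    have I1 : Integrable (fun σ : Sph => (gρ p : ℂ) * (k σ * (((lS σ p)⁻¹ ^ 1 : ℝ) : ℂ))) sphM :=
      cont_int (continuous_const.mul (UU_cont hk hc 1))
    have I2 : Integrable (fun σ : Sph => (-((1 : ℕ) : ℂ)) * (k σ * (((lS σ p)⁻¹ ^ (1 + 1) : ℝ) : ℂ))) sphM :=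
      cont_int (continuous_const.mul (UU_cont hk hc 2))
    have I3 : ∀ i, Integrable (fun σ : Sph => (gω i p : ℂ) * (((1 : ℕ) : ℂ) *
        (sk i k σ * (((lS σ p)⁻¹ ^ (1 + 1) : ℝ) : ℂ)))) sphM := fun i =>
      cont_int (continuous_const.mul (continuous_const.mul (UU_cont (sk_cont i hk) hc 2)))
    rw [← integral_finsetSum _ fun i _ => I3 i, ← integral_add I1 I2,
      ← integral_add (f := fun σ : Sph => (gρ p : ℂ) * (k σ * (((lS σ p)⁻¹ ^ 1 : ℝ) : ℂ)) +
        (-((1 : ℕ) : ℂ)) * (k σ * (((lS σ p)⁻¹ ^ (1 + 1) : ℝ) : ℂ))) (I1.add I2)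
        (integrable_finsetSum _ fun i _ => I3 i)]
    congr 1; funext σ
    have h0 := (lS_pos hc σ).ne'
    have hr := gρ_rr hp
    have hl : lS σ p = p.1 - ∑ i, (σ : Pt) i * p.2 i := by
      rw [lS_apply, PiLp.inner_apply]; simp [mul_comm]
    have hreal : gρ p * (lS σ p)⁻¹ ^ 1 - (lS σ p)⁻¹ ^ 2 + ∑ i, gω i p * ((σ : Pt) i * (lS σ p)⁻¹ ^ 2)
        = -(gq p * gρ p) * (lS σ p)⁻¹ ^ 2 := by
      have e : ∑ i, gω i p * ((σ : Pt) i * (lS σ p)⁻¹ ^ 2)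
          = gρ p * (p.1 - lS σ p) * (lS σ p)⁻¹ ^ 2 := by
        rw [hl]
        simp only [gω, Fin.sum_univ_three]; ring
      have e1 : gq p = rr p - p.1 := rfl
      rw [e, e1]
      have e2 : lS σ p * (lS σ p)⁻¹ = 1 := mul_inv_cancel₀ h0
      linear_combination (-(gρ p) * (lS σ p)⁻¹) * e2 + (lS σ p)⁻¹ ^ 2 * hr
    have hC := congrArg (fun u : ℝ => (u : ℂ)) hreal
    simp only [Fin.sum_univ_three] at hC
    simp only [sk, Fin.sum_univ_three, Pi.add_apply]
    push_cast at hC ⊢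
    linear_combination k σ * hC
  rw [key]
  push_cast; ring

theorem box_T1 {h : ℝ → ℝ} (hh : ContDiff ℝ ∞ h) {f : E4 → ℂ} (hf : Hs f) {p : E4}
    (hp : p.2 ≠ 0) (hc : p ∈ Cone) :
    boxV (fun y => ((1 / (4 * π) : ℝ) : ℂ) * (((h (gq y) : ℝ) : ℂ) * UU 1 (res f) y)) p
      - ((gρ p ^ 2 * deriv h (gq p) : ℝ) : ℂ) * f p
    = ((deriv h (gq p) * gρ p : ℝ) : ℂ) * ((-(1 / (2 * π)) : ℝ) * ((gq p : ℂ) * RR f p)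
        + ((gq p * gρ p ^ 2 * gκ p : ℝ) : ℂ) * f p) := by
  have hU := box_cutU hh hf.cont hp hc
  have sU : SmA (fun y => ((h (gq y) : ℝ) : ℂ) * UU 1 (res f) y) p :=
    (hq_sm hh hp).ofReal.mul (UU_sm hf.cont hc 1)
  have hcst : boxV (fun y => ((1 / (4 * π) : ℝ) : ℂ) * (((h (gq y) : ℝ) : ℂ) * UU 1 (res f) y)) p
      = ((1 / (4 * π) : ℝ) : ℂ) * boxV (fun y => ((h (gq y) : ℝ) : ℂ) * UU 1 (res f) y) p := by
    have hz : ∀ z : VF, Dv (ZV z) (fun _ : E4 => ((1 / (4 * π) : ℝ) : ℂ)) = fun _ => 0 := by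
      intro z; funext y; exact Dv_const
    simp only [boxV, Dv2_mul SmA.const sU, hz, Dv_const]
    simp only [Fin.sum_univ_three]; ring
  rw [hcst, hU]
  have e := inv_form hc hp
  have hRR : UU 2 (res f) p = RR f p + ((4 * π * (p.1 ^ 2 - rr p ^ 2)⁻¹ : ℝ) : ℂ) * f p := by
    rw [RR]; ring
  have hq : gq p ≠ 0 := by
    have : ‖p.2‖ < p.1 := hc
    have e1 : gq p = ‖p.2‖ - p.1 := rfl
    rw [e1]; linarith
  have hκ : gκ p * (1 + p.1 * gρ p) = 1 := by
    rw [gκ, gτ]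
    refine inv_mul_cancel₀ ?_
    have : ‖p.2‖ < p.1 := hc
    have h2 : 0 ≤ p.1 := (norm_nonneg _).trans this.le
    have h3 := gρ_pos hp
    positivity
  have hπ : (π : ℂ) ≠ 0 := by exact_mod_cast pi_ne_zero
  have hr := gρ_rr hp
  have e1 : gq p = rr p - p.1 := rfl
  have hκ2 : 2 * gκ p - 1 = gq p * gρ p * gκ p := by
    rw [e1]; linear_combination hκ - gκ p * hr
  have hκC := congrArg (fun u : ℝ => (u : ℂ)) hκ2
  rw [hRR, e]
  have hqC : (gq p : ℂ) ≠ 0 := by exact_mod_cast hq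
  push_cast at hκC ⊢
  have e5 : (gq p : ℂ) * (gq p : ℂ)⁻¹ = 1 := mul_inv_cancel₀ hqC
  have e6 : (π : ℂ)⁻¹ * (π : ℂ) = 1 := inv_mul_cancel₀ hπ
  simp only [one_div, mul_inv]
  linear_combination ((gρ p : ℂ) ^ 2 * ((deriv h (gq p) : ℝ) : ℂ) * f p) * hκC
    + (2 * (gρ p : ℂ) ^ 2 * ((deriv h (gq p) : ℝ) : ℂ) * f p * (gκ p : ℂ)) * (((gq p : ℂ) * (gq p : ℂ)⁻¹) * e6 + e5)

end PartT

section PartU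
open scoped ContDiff
variable {γ : ℝ} {nI : ℕ}

theorem KJ_Hs (hγ : 1 / 2 < γ) (d : Dat γ nI × Ix) : Hs (KK (Jf d)) where
  sm p hp := (KJ_OB (nI := nI) hγ 0 1 le_rfl).sm (θ := d) hp
  hom p a s hs := by
    rw [KK_q _ (p.1 + a) p.1]
    exact KJ_hom d p s hs

/-- main part of the potential -/
def TT (χin χex : ℝ → ℝ) (d : Dat γ nI × Ix) : E4 → ℂ := fun y =>
  ((1 / (4 * π) : ℝ) : ℂ) * (((χex (y.1 / 12) : ℝ) : ℂ) *
    (((χin (gq y) : ℝ) : ℂ) * UU 1 (res (KK (Jf d))) y))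

/-- transition term -/
def S3 (χ χin : ℝ → ℝ) (d : Dat γ nI × Ix) : E4 → ℂ := fun y =>
  ((gρ y ^ 2 * (χ (gs y) * deriv χin (gq y)) : ℝ) : ℂ) * KK (Jf d) y

theorem PR_gq {Θ : Type*} : ∀ (θ : Θ) (p : E4), PR θ p → |gq p| ≤ 2 := fun _ _ hp =>
  abs_le.2 ⟨by linarith [hp.2.2.1], by linarith [hp.2.2.2]⟩

theorem hgq_OB {Θ : Type*} {P : Θ → E4 → Prop} (hP : ∀ θ p, P θ p → Good p)
    (hq : ∀ θ p, P θ p → |gq p| ≤ 2) (n : ℕ) {h : ℝ → ℝ} (hh : ContDiff ℝ ∞ h) :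
    OB ZV P n (fun _ p => h (gq p)) one' :=
  comp_OB (h := h) Z_hV (isCompact_Icc (a := (-2 : ℝ)) (b := 2)) isOpen_univ (Set.subset_univ _)
    (fun θ p hp => abs_le.1 (hq θ p hp)) n (gq_OB hP hq n) hh.contDiffOn

theorem gs_cont {p : E4} (hp : p.2 ≠ 0) : ContinuousAt gs p := (gs_sm hp).at.continuousAt
theorem gq_cont {p : E4} (hp : p.2 ≠ 0) : ContinuousAt gq p := (gq_sm hp).at.continuousAt

theorem lt_ev {f : E4 → ℝ} {p : E4} {c : ℝ} (hf : ContinuousAt f p) (h : f p < c) :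
    ∀ᶠ y in 𝓝 p, f y < c := hf.eventually (eventually_lt_nhds h)

theorem gt_ev {f : E4 → ℝ} {p : E4} {c : ℝ} (hf : ContinuousAt f p) (h : c < f p) :
    ∀ᶠ y in 𝓝 p, c < f y := hf.eventually (eventually_gt_nhds h)

theorem T1_PR (hγ : 1 / 2 < γ) {χ χin χex : ℝ → ℝ} (hχ1 : ∀ s : ℝ, s ≤ 1 / 2 → χ s = 1)
    (hχin : ContDiff ℝ ∞ χin) (hχex1 : ∀ s : ℝ, 1 ≤ s → χex s = 1) (n N : ℕ) (hN : n + 3 ≤ N) :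
    OB ZV (PR : Dat γ nI × Ix → E4 → Prop) n (fun d p => boxV (TT χin χex d) p - S3 χ χin d p)
      (fun d p => d.1.D N ^ 2 * (jb (p.1 + rr p) ^ (-(3 : ℝ)) * (1 + gL p))) := by
  have hK := KJ_OB (nI := nI) hγ (n + 2) N (by omega)
  have hR := RR_OB (c := fun d : Dat γ nI × Ix => d.1.D N ^ 2) (fun d => by positivity) n
    (fun d => KJ_Hs hγ d) hK
  have hK2 : OB ZV (PR : Dat γ nI × Ix → E4 → Prop) n (fun d => KK (Jf d)) (fun d _ => d.1.D N ^ 2) := by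
    refine ((hK.mono (by omega)).pull (P := (PR : Dat γ nI × Ix → E4 → Prop))
      fun θ p hp => ⟨PR_good θ p hp, hp.2.1⟩).congr fun θ p hp => ?_
    rw [(KJ_Hs hγ θ).pull]
  have hd := hgq_OB (Θ := Dat γ nI × Ix) (P := PR) PR_good PR_gq n (deriv_smooth hχin)
  have hq := gq_OB (P := (PR : Dat γ nI × Ix → E4 → Prop)) PR_good PR_gq n
  have hρ := gρ_OB (P := (PR : Dat γ nI × Ix → E4 → Prop)) PR_good n
  have hκ := gκ_OB (Θ := Dat γ nI × Ix) n
  have A1 := OB.mul1 Z_hV (OB.const' ((-(1 / (2 * π)) : ℝ) : ℂ)) (OB.mul1 Z_hV (OB.ofReal Z_hV hq) hR)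
  have A2 := OB.mul Z_hV (OB.ofReal Z_hV (OB.mul1 Z_hV hq (OB.mul1 Z_hV hκ (OB.mul Z_hV hρ hρ)))) hK2
  have A2' : OB ZV (PR : Dat γ nI × Ix → E4 → Prop) n _
      (fun d p => d.1.D N ^ 2 * (gρ p ^ 2 * (1 + gL p))) := A2.weight 1 zero_le_one fun d p hp => by
    have h1 := gL_nonneg (PR_facts hp).1
    have h2 : 0 ≤ d.1.D N ^ 2 * gρ p ^ 2 := by positivity
    nlinarith [mul_nonneg h2 h1]
  have A3 := OB.mul Z_hV (OB.mul1 Z_hV (OB.ofReal Z_hV hd) (OB.ofReal Z_hV hρ)) (OB.add Z_hV A1 A2')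
  refine (A3.congr fun d p hp => ?_).weight 64 (by norm_num) fun d p hp => ?_
  · have F := PR_facts hp
    have hx := hp.2.1
    have e1 : ∀ᶠ y : E4 in 𝓝 p, 12 < y.1 := gt_ev (f := fun y : E4 => y.1) continuous_fst.continuousAt hp.1
    have hs : gs p < 1 / 2 := by
      have h5 : gs p * rr p = gj p := by
        have := gρ_rr hx
        rw [gs, mul_assoc, this, mul_one]
      have h6 := F.2.2.1
      have h7 := F.2.2.2.1
      by_contra hcon
      push Not at hcon
      nlinarith
    filter_upwards [e1.eventually_nhds, lt_ev (gs_cont hx) hs, x0_ev hx, cone_ev F.2.1] with y h1 h2 h3 h4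
    have hT : TT χin χex d =ᶠ[𝓝 y] fun y => ((1 / (4 * π) : ℝ) : ℂ) *
        (((χin (gq y) : ℝ) : ℂ) * UU 1 (res (KK (Jf d))) y) := by
      filter_upwards [h1] with z hz
      rw [TT, hχex1 _ (by linarith)]; simp
    rw [(boxV_congr hT).self_of_nhds, S3, hχ1 _ h2.le, one_mul, box_T1 hχin (KJ_Hs hγ d) h3 h4]
    push_cast; ring
  · have h1 := gL_nonneg (PR_facts hp).1
    have h2 := PW_weight (PR_facts hp).1
    have h3 : 0 ≤ d.1.D N ^ 2 * (1 + gL p) := by positivity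
    have := mul_le_mul_of_nonneg_left h2 h3
    calc _ = d.1.D N ^ 2 * (1 + gL p) * gρ p ^ 3 := by ring
      _ ≤ _ := this
      _ = _ := by ring

/-- bounded region inside the cone -/
def PU {Θ : Type*} : Θ → E4 → Prop := fun _ p => p.1 ≤ 12 ∧ p.2 ≠ 0 ∧ gq p ≤ -(1 / 2)

theorem PU_facts {Θ : Type*} {θ : Θ} {p : E4} (h : PU θ p) :
    p ∈ Cone ∧ 0 ≤ p.1 ∧ rr p ≤ 12 ∧ ∀ σ : Sph, 1 / 2 ≤ lS σ p := by
  have e : gq p = ‖p.2‖ - p.1 := rfl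
  have h1 := h.2.2
  have h2 := h.1
  have h3 := norm_nonneg p.2
  refine ⟨show ‖p.2‖ < p.1 by linarith, by linarith, show ‖p.2‖ ≤ 12 by linarith, fun σ => ?_⟩
  have := lS_ge σ p
  linarith

theorem coord_OB {Θ : Type*} (n : ℕ) : OB ZV (PU : Θ → E4 → Prop) n (fun _ p => p.1) one' ∧
    ∀ k, OB ZV (PU : Θ → E4 → Prop) n (fun _ p => p.2 k) one' := by
  have b0 : ∃ C : ℝ, 0 ≤ C ∧ ∀ (θ : Θ) (p : E4), PU θ p → ‖p.1‖ ≤ C * one' θ p :=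
    ⟨12, by norm_num, fun θ p hp => by
      have := PU_facts hp
      rw [Real.norm_eq_abs, abs_of_nonneg this.2.1, one']
      linarith [hp.1]⟩
  have b1 : ∀ k, ∃ C : ℝ, 0 ≤ C ∧ ∀ (θ : Θ) (p : E4), PU θ p → ‖p.2 k‖ ≤ C * one' θ p := fun k =>
    ⟨12, by norm_num, fun θ p hp => by
      have := PU_facts hp
      rw [one', mul_one]
      exact (PiLp.norm_apply_le p.2 k).trans this.2.2.1⟩
  induction n with
  | zero => exact ⟨OB.zeroth (fun _ _ _ => fst_sm) b0, fun k => OB.zeroth (fun _ _ _ => xi_sm) (b1 k)⟩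
  | succ n ih =>
    obtain ⟨ht, hx⟩ := ih
    have hw : ∀ (θ : Θ) (p : E4), PU θ p → 0 ≤ one' θ p := fun _ _ _ => zero_le_one
    refine ⟨OB.succ (fun _ _ _ => fst_sm) hw b0 fun z => ?_, fun k =>
      OB.succ (fun _ _ _ => xi_sm) hw (b1 k) fun z => ?_⟩
    · have e : Dv (ZV z) (fun p : E4 => p.1) = fun p => (ZV z p).1 := by funext p; exact Dv_fst
      rw [e]
      cases z with
      | time => exact OB.const' 1
      | space i => exact OB.const' 0
      | rot i j => exact OB.const' 0
      | boost i => exact hx i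
      | scal => exact ht
    · have e : Dv (ZV z) (fun p : E4 => p.2 k) = fun p => (ZV z p).2 k := by funext p; exact Dv_xi k
      rw [e]
      cases z with
      | time => exact OB.const' 0
      | space i => exact OB.const' _
      | rot i j =>
        refine (OB.sub Z_hV (OB.mul1 Z_hV (hx i) (OB.const' (ee j k)))
          (OB.mul1 Z_hV (hx j) (OB.const' (ee i k)))).congr fun θ p _ => Eventually.of_forall fun y => ?_
        simp [ZV]
      | boost i =>
        refine (OB.mul1 Z_hV ht (OB.const' (ee i k))).congr fun θ p _ => Eventually.of_forall fun y => ?_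
        simp [ZV]
      | scal => exact hx k

theorem coef_OB {Θ : Type*} (n : ℕ) (z : VF) :
    OB ZV (PU : Θ → E4 → Prop) n (fun _ p => (ZV z p).1) one' ∧
    ∀ k, OB ZV (PU : Θ → E4 → Prop) n (fun _ p => (ZV z p).2 k) one' := by
  obtain ⟨ht, hx⟩ := coord_OB (Θ := Θ) (n + 1)
  have h1 := ht.dv Z_hV z
  have e : Dv (ZV z) (fun p : E4 => p.1) = fun p => (ZV z p).1 := by funext p; exact Dv_fst
  rw [e] at h1
  refine ⟨h1, fun k => ?_⟩
  have h2 := (hx k).dv Z_hV z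
  have e : Dv (ZV z) (fun p : E4 => p.2 k) = fun p => (ZV z p).2 k := by funext p; exact Dv_xi k
  rw [e] at h2
  exact h2

theorem UU_OB {Θ : Type*} {c : Θ → ℝ} (hc : ∀ θ, 0 ≤ c θ) (n m : ℕ) {k : Θ → Sph → ℂ}
    (hk : ∀ θ, Continuous (k θ)) (hb : ∀ θ σ, ‖k θ σ‖ ≤ c θ) :
    OB ZV (PU : Θ → E4 → Prop) n (fun θ => UU m (k θ)) (fun θ _ => c θ) := by
  have hs : ∀ (m : ℕ) (k : Θ → Sph → ℂ), (∀ θ, Continuous (k θ)) →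
      ∀ θ p, PU θ p → SmA (UU m (k θ)) p := fun m k hk θ p hp => UU_sm (hk θ) (PU_facts hp).1 m
  have h0 : ∀ (m : ℕ) (k : Θ → Sph → ℂ), (∀ θ σ, ‖k θ σ‖ ≤ c θ) →
      ∃ C : ℝ, 0 ≤ C ∧ ∀ θ p, PU θ p → ‖UU m (k θ) p‖ ≤ C * c θ := by
    intro m k hb
    refine ⟨2 ^ m * sphM.real Set.univ, by positivity, fun θ p hp => ?_⟩
    have F := PU_facts hp
    have := norm_integral_le_of_norm_le_const (μ := sphM) (C := c θ * 2 ^ m)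
      (f := fun σ : Sph => k θ σ * (((lS σ p)⁻¹ ^ m : ℝ) : ℂ))
      (Eventually.of_forall fun σ => by
        rw [norm_mul]
        refine mul_le_mul (hb θ σ) ?_ (norm_nonneg _) (hc θ)
        have h1 := F.2.2.2 σ
        have h2 : 0 < lS σ p := lS_pos F.1 σ
        rw [Complex.norm_real, Real.norm_eq_abs, abs_of_nonneg (by positivity)]
        have h3 : (lS σ p)⁻¹ ≤ 2 := by
          rw [inv_le_comm₀ h2 (by norm_num)]; linarith
        exact pow_le_pow_left₀ (by positivity) h3 m)
    refine this.trans (le_of_eq (by ring))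
  induction n generalizing m k with
  | zero => exact OB.zeroth (hs m k hk) (h0 m k hb)
  | succ n ih =>
    refine OB.succ (hs m k hk) (fun θ p _ => hc θ) (h0 m k hb) fun z => ?_
    obtain ⟨c1, c2⟩ := coef_OB (Θ := Θ) n z
    have B0 := OB.mul1 Z_hV (OB.ofReal Z_hV c1)
      (OB.mul1 Z_hV (OB.const' (-(m : ℂ))) (ih (m + 1) hk hb))
    have hbk : ∀ i θ σ, ‖sk i (k θ) σ‖ ≤ c θ := fun i θ σ => by
      rw [sk, norm_mul, Complex.norm_real]
      have h1 := PiLp.norm_apply_le (σ : Pt) i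
      rw [sph_norm] at h1
      have h2 := mul_le_mul h1 (hb θ σ) (norm_nonneg _) zero_le_one
      rwa [one_mul] at h2
    have B1 := OB.sum Finset.univ Z_hV (fun θ p _ => hc θ) fun i _ =>
      OB.mul1 Z_hV (OB.ofReal Z_hV (c2 i)) (OB.mul1 Z_hV (OB.const' (m : ℂ))
        (ih (k := fun θ => sk i (k θ)) (m + 1) (fun θ => sk_cont i (hk θ)) (hbk i)))
    refine (OB.add Z_hV B0 B1).congr fun θ p hp => ?_
    filter_upwards [cone_ev (PU_facts hp).1] with y hy
    rw [Dv, lin_expand]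
    have e1 : fderiv ℝ (UU m (k θ)) y bT = _ := UU_dT (hk θ) hy m
    have e2 : ∀ i, fderiv ℝ (UU m (k θ)) y (bX i) = _ := fun i => UU_dX (hk θ) hy m i
    rw [e1]
    simp only [e2]

end PartU

section PartVV
open scoped ContDiff
variable {γ : ℝ} {nI : ℕ}

def PA1 {Θ : Type*} : Θ → E4 → Prop := fun θ p => PU θ p ∧ 6 ≤ p.1 ∧ rr p ≤ 2
def PA2 {Θ : Type*} : Θ → E4 → Prop := fun θ p => PU θ p ∧ 2 ≤ rr p

theorem KJ_bd (hγ : 1 / 2 < γ) (N : ℕ) (hN : 1 ≤ N) : ∃ C : ℝ, 0 ≤ C ∧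
    ∀ (d : Dat γ nI × Ix) (σ : Sph), ‖res (KK (Jf d)) σ‖ ≤ C * d.1.D N ^ 2 := by
  obtain ⟨C, hC, h⟩ := (KJ_OB (nI := nI) hγ 0 N (by omega)).val
  exact ⟨C, hC, fun d σ => h d (0, (σ : Pt)) (sph_ne σ)⟩

theorem UK_OB (hγ : 1 / 2 < γ) (n N : ℕ) (hN : 1 ≤ N) :
    OB ZV (PU : Dat γ nI × Ix → E4 → Prop) n (fun d => UU 1 (res (KK (Jf d)))) (fun d _ => d.1.D N ^ 2) := by
  obtain ⟨C, hC, h⟩ := KJ_bd (nI := nI) hγ N hN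
  exact (UU_OB (c := fun d : Dat γ nI × Ix => C * d.1.D N ^ 2) (fun d => by positivity) n 1
    (fun d => (KJ_Hs hγ d).cont) h).weight C hC fun d p _ => le_rfl

theorem χex_OB {Θ : Type*} {χex : ℝ → ℝ} (hχex : ContDiff ℝ ∞ χex) (n : ℕ) :
    OB ZV (PU : Θ → E4 → Prop) n (fun _ p => ((χex (p.1 / 12) : ℝ) : ℂ)) one' :=
  OB.ofReal Z_hV (comp_OB (h := fun u => χex (u / 12)) Z_hV (isCompact_Icc (a := (0 : ℝ)) (b := 12))
    isOpen_univ (Set.subset_univ _) (fun θ p hp => ⟨(PU_facts hp).2.1, hp.1⟩) n (coord_OB n).1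
    (hχex.comp (contDiff_id.div_const 12)).contDiffOn)

theorem TT_PA1 (hγ : 1 / 2 < γ) {χin χex : ℝ → ℝ} (hχin1 : ∀ s : ℝ, s ≤ -1 → χin s = 1)
    (hχex : ContDiff ℝ ∞ χex) (n N : ℕ) (hN : 1 ≤ N) :
    OB ZV (PA1 : Dat γ nI × Ix → E4 → Prop) n (fun d => boxV (TT χin χex d)) (fun d _ => d.1.D N ^ 2) := by
  refine OB.boxV (fun d p _ => by positivity) ?_
  refine ((OB.mul1 Z_hV (OB.const' ((1 / (4 * π) : ℝ) : ℂ)) (OB.mul1 Z_hV (χex_OB hχex (n + 2))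
    (UK_OB hγ (n + 2) N hN))).restrict (P' := (PA1 : Dat γ nI × Ix → E4 → Prop)) fun d p h => h.1).congr
    fun d p hp => ?_
  have hq : gq p < -1 := by
    have e : gq p = rr p - p.1 := rfl
    linarith [hp.2.1, hp.2.2]
  filter_upwards [lt_ev (gq_cont hp.1.2.1) hq] with y hy
  rw [TT, hχin1 _ hy.le]; simp

theorem PA2_good {Θ : Type*} : ∀ (θ : Θ) (p : E4), PA2 θ p → Good p := fun θ p hp => by
  have F := PU_facts hp.1
  have hr : 0 < rr p := by linarith [hp.2]
  have h1 : gρ p ≤ 1 / 2 := by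
    rw [gρ, one_div]
    exact inv_anti₀ (by norm_num) hp.2
  have h0 := (gρ_pos hp.1.2.1).le
  refine ⟨hp.1.2.1, by linarith, ?_⟩
  have h3 := hp.1.1
  rw [gτ, abs_of_nonneg (mul_nonneg F.2.1 h0)]
  nlinarith [F.2.1]

theorem TT_PA2 (hγ : 1 / 2 < γ) {χin χex : ℝ → ℝ} (hχin : ContDiff ℝ ∞ χin)
    (hχex : ContDiff ℝ ∞ χex) (n N : ℕ) (hN : 1 ≤ N) :
    OB ZV (PA2 : Dat γ nI × Ix → E4 → Prop) n (fun d => boxV (TT χin χex d)) (fun d _ => d.1.D N ^ 2) := by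
  refine OB.boxV (fun d p _ => by positivity) ?_
  have hR : ∀ d p, PA2 d p → PU d p := fun (d : Dat γ nI × Ix) p h => h.1
  have hgq : OB ZV (PA2 : Dat γ nI × Ix → E4 → Prop) (n + 2) (fun _ => gq) one' := by
    refine ((OB.mul1 Z_hV (gb_OB PA2_good _) (gj_OB PA2_good _)).congr fun θ p _ =>
      Eventually.of_forall fun y => gq_gb y).weight 13 (by norm_num) fun θ p hp => ?_
    have h1 := jb_le (gq p)
    have e : gq p = rr p - p.1 := rfl
    have h2 : |gq p| ≤ 12 := by
      have F := PU_facts hp.1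
      have h3 := hp.1.1
      have h4 := hp.2
      rw [abs_le]; constructor <;> linarith [hp.1.2.2, F.2.1]
    rw [one', mul_one]
    exact h1.trans (by linarith)
  have hin : OB ZV (PA2 : Dat γ nI × Ix → E4 → Prop) (n + 2) (fun _ p => χin (gq p)) one' := by
    refine comp_OB (h := χin) Z_hV (isCompact_Icc (a := (-12 : ℝ)) (b := 0)) isOpen_univ
      (Set.subset_univ _) (fun θ p hp => ?_) _ hgq hχin.contDiffOn
    have e : gq p = rr p - p.1 := rfl
    constructor <;> linarith [hp.1.2.2, hp.1.1, hp.2]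
  exact OB.mul1 Z_hV (OB.const' ((1 / (4 * π) : ℝ) : ℂ)) (OB.mul1 Z_hV ((χex_OB hχex (n + 2)).restrict hR)
    (OB.mul1 Z_hV (OB.ofReal Z_hV hin) ((UK_OB hγ (n + 2) N hN).restrict hR)))

def PS {Θ : Type*} : Θ → E4 → Prop := fun θ p => PW θ p ∧ |gq p| ≤ 2

theorem S3_OB (hγ : 1 / 2 < γ) {χ χin : ℝ → ℝ} (hχ : ContDiff ℝ ∞ χ) (hχin : ContDiff ℝ ∞ χin)
    (n N : ℕ) (hN : n + 1 ≤ N) :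
    OB ZV (PS : Dat γ nI × Ix → E4 → Prop) n (fun d => S3 χ χin d) (fun d _ => d.1.D N ^ 2) := by
  have hG : ∀ (d : Dat γ nI × Ix) p, PS d p → Good p := fun d p h => PW_good d p h.1
  have hK : OB ZV (PS : Dat γ nI × Ix → E4 → Prop) n (fun d => KK (Jf d)) (fun d _ => d.1.D N ^ 2) := by
    refine ((KJ_OB (nI := nI) hγ n N hN).pull (P := (PS : Dat γ nI × Ix → E4 → Prop))
      fun θ p hp => ⟨hG θ p hp, hp.1.2.1⟩).congr fun θ p hp => ?_
    rw [(KJ_Hs hγ θ).pull]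
  have hρ := gρ1_OB hG n
  have hc := chi_OB hG (fun θ p hp => PW_gs θ p hp.1) n hχ
  have hd := hgq_OB hG (fun θ p hp => hp.2) n (deriv_smooth hχin)
  refine (OB.mul1 Z_hV (OB.ofReal Z_hV (OB.mul1 Z_hV (OB.mul1 Z_hV hρ hρ) (OB.mul1 Z_hV hc hd))) hK).congr
    fun θ p _ => Eventually.of_forall fun y => ?_
  simp only [S3]; push_cast; ring

theorem deriv_zero_of {h : ℝ → ℝ} {s : ℝ} {c : ℝ} (hh : ∀ᶠ u in 𝓝 s, h u = c) : deriv h s = 0 := by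
  have : h =ᶠ[𝓝 s] fun _ => c := hh
  rw [this.deriv_eq, deriv_const]

theorem boxV_zero {p : E4} : boxV (fun _ : E4 => (0 : ℂ)) p = 0 := by
  have hz : ∀ z : VF, Dv (ZV z) (fun _ : E4 => (0 : ℂ)) = fun _ => 0 := by
    intro z; funext y; exact Dv_const
  simp only [boxV, hz]; simp

theorem TT_zero_q {χin χex : ℝ → ℝ} (hχin0 : ∀ s : ℝ, -(1 / 2) ≤ s → χin s = 0) (d : Dat γ nI × Ix)
    {p : E4} (hp : p.2 ≠ 0) (hq : -(1 / 2) < gq p) : TT χin χex d =ᶠ[𝓝 p] fun _ => 0 := by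
  filter_upwards [gt_ev (gq_cont hp) hq] with y hy
  rw [TT, hχin0 _ hy.le]; simp

theorem S3_zero_q {χ χin : ℝ → ℝ} (hχin1 : ∀ s : ℝ, s ≤ -1 → χin s = 1)
    (hχin0 : ∀ s : ℝ, -(1 / 2) ≤ s → χin s = 0) (d : Dat γ nI × Ix)
    {p : E4} (hp : p.2 ≠ 0) (hq : -(1 / 2) < gq p ∨ gq p < -1) : S3 χ χin d =ᶠ[𝓝 p] fun _ => 0 := by
  rcases hq with hq | hq
  · filter_upwards [gt_ev (gq_cont hp) hq] with y hy
    have : deriv χin (gq y) = 0 := deriv_zero_of (c := 0)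
      ((eventually_gt_nhds hy).mono fun u hu => hχin0 u hu.le)
    rw [S3, this]; simp
  · filter_upwards [lt_ev (gq_cont hp) hq] with y hy
    have : deriv χin (gq y) = 0 := deriv_zero_of (c := 1)
      ((eventually_lt_nhds hy).mono fun u hu => hχin1 u hu.le)
    rw [S3, this]; simp

theorem gs_big {p : E4} (hp : p.2 ≠ 0) (h : ¬ gj p ≤ 3 / 4 * rr p) : 3 / 4 < gs p := by
  have h1 := gρ_rr hp
  have h2 := gρ_pos hp
  push Not at h
  rw [gs]
  nlinarith [mul_lt_mul_of_pos_right h h2]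

/-- off the wave zone the cut off vanishes -/
theorem chi_zero {χ : ℝ → ℝ} (hχ0 : ∀ s : ℝ, 3 / 4 ≤ s → χ s = 0) {p : E4} (hp : p.2 ≠ 0)
    (h : ¬ gj p ≤ 3 / 4 * rr p) : ∀ᶠ y in 𝓝 p, χ (gs y) = 0 := by
  filter_upwards [gt_ev (gs_cont hp) (gs_big hp h)] with y hy using hχ0 _ hy.le

theorem rpow_bdd {m : ℝ} : ∃ K : ℝ, 0 ≤ K ∧ ∀ u : ℝ, |u| ≤ 40 → 1 ≤ K * jb u ^ (-m) := by
  have hK : IsCompact (Set.Icc (-40 : ℝ) 40) := isCompact_Icc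
  have hc : Continuous fun u : ℝ => jb u ^ m := by
    have : Continuous jb := jb_contDiff.continuous
    exact this.rpow_const fun u => Or.inl (jb_pos u).ne'
  obtain ⟨M, hM⟩ := hK.exists_bound_of_continuousOn hc.continuousOn
  refine ⟨max M 0, le_max_right _ _, fun u hu => ?_⟩
  have h1 := hM u (abs_le.1 hu)
  have h2 := jb_rpow_pos u (-m)
  have h3 : jb u ^ m * jb u ^ (-m) = 1 := by
    rw [← Real.rpow_add (jb_pos u)]; simp
  have h4 : jb u ^ m ≤ max M 0 := ((le_abs_self _).trans h1).trans (le_max_left _ _)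
  calc (1 : ℝ) = jb u ^ m * jb u ^ (-m) := h3.symm
    _ ≤ _ := mul_le_mul_of_nonneg_right h4 h2.le

/-- the error of the main part of the potential -/
theorem T1_all (hγ : 1 / 2 < γ) {χ χin χex : ℝ → ℝ} (hχ : ContDiff ℝ ∞ χ)
    (hχ1 : ∀ s : ℝ, s ≤ 1 / 2 → χ s = 1) (hχ0 : ∀ s : ℝ, 3 / 4 ≤ s → χ s = 0)
    (hχin : ContDiff ℝ ∞ χin) (hχin1 : ∀ s : ℝ, s ≤ -1 → χin s = 1)
    (hχin0 : ∀ s : ℝ, -(1 / 2) ≤ s → χin s = 0)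
    (hχex : ContDiff ℝ ∞ χex) (hχex1 : ∀ s : ℝ, 1 ≤ s → χex s = 1)
    (hχex0 : ∀ s : ℝ, s ≤ 1 / 2 → χex s = 0) (m : ℝ) :
    ∃ C : ℝ, 0 ≤ C ∧ ∀ (d : Dat γ nI × Ix) (p : E4), 0 ≤ p.1 → p.2 ≠ 0 →
      Bd ZV nI (fun y => boxV (TT χin χex d) y - S3 χ χin d y) p
        (C * (d.1.D (nI + 1) ^ 2 * jb (p.1 + rr p) ^ (-m)
          + d.1.D (nI + 3) ^ 2 * jb (p.1 + rr p) ^ (-(3 : ℝ)) * jb (gq p) ^ (-(2 * γ)) * (1 + gL p)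
            * (if gj p ≤ 3 / 4 * rr p then 1 else 0))) := by
  obtain ⟨C1, hC1, H1⟩ := T1_PR (nI := nI) hγ hχ1 hχin hχex1 nI (nI + 3) le_rfl
  obtain ⟨C2, hC2, H2⟩ := TT_PA1 (nI := nI) hγ hχin1 hχex nI (nI + 1) (by omega)
  obtain ⟨C3, hC3, H3⟩ := TT_PA2 (nI := nI) hγ hχin hχex nI (nI + 1) (by omega)
  obtain ⟨C4, hC4, H4⟩ := S3_OB (nI := nI) hγ hχ hχin nI (nI + 1) le_rfl
  obtain ⟨K, hK, HK⟩ := rpow_bdd (m := m)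
  obtain ⟨K', hK', HK'⟩ := rpow_bdd (m := 2 * γ)
  have hW : ∀ (d : Dat γ nI × Ix) (p : E4), 0 ≤ p.1 → p.2 ≠ 0 → 0 ≤ d.1.D (nI + 1) ^ 2 * jb (p.1 + rr p) ^ (-m) ∧
      0 ≤ d.1.D (nI + 3) ^ 2 * jb (p.1 + rr p) ^ (-(3 : ℝ)) * jb (gq p) ^ (-(2 * γ)) * (1 + gL p)
            * (if gj p ≤ 3 / 4 * rr p then 1 else 0) := by
    intro d p h0 hp
    have a1 := (jb_rpow_pos (p.1 + rr p) (-m)).le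
    have a2 := (jb_rpow_pos (p.1 + rr p) (-(3 : ℝ))).le
    have a3 := (jb_rpow_pos (gq p) (-(2 * γ))).le
    refine ⟨by positivity, ?_⟩
    split_ifs with h
    · have := gL_nonneg (θ := d) (p := p) ⟨h0, hp, h⟩
      positivity
    · simp
  refine ⟨C1 * K' + (C2 + C3 + C4) * K, by positivity, fun d p h0 hp => ?_⟩
  obtain ⟨w1, w2⟩ := hW d p h0 hp
  set W1 := d.1.D (nI + 1) ^ 2 * jb (p.1 + rr p) ^ (-m) with hW1
  set W2 := d.1.D (nI + 3) ^ 2 * jb (p.1 + rr p) ^ (-(3 : ℝ)) * jb (gq p) ^ (-(2 * γ)) * (1 + gL p)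
            * (if gj p ≤ 3 / 4 * rr p then 1 else 0) with hW2
  have zer : ∀ c : ℝ, 0 ≤ c → Bd ZV nI (fun _ : E4 => (0 : ℂ)) p c := fun c hc => Bd.zero_fun nI hc
  have eqr : gq p = rr p - p.1 := rfl
  by_cases hqa : -(1 / 2) < gq p
  · refine (zer _ (by positivity)).congr ?_
    filter_upwards [boxV_congr (TT_zero_q (χex := χex) hχin0 d hp hqa), S3_zero_q (χ := χ) hχin1 hχin0 d hp (Or.inl hqa)] with y a b
    rw [a, b, boxV_zero, sub_zero]
  push Not at hqa
  by_cases ht : 12 < p.1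
  · by_cases hqb : gq p < -1
    · refine (zer _ (by positivity)).congr ?_
      have hc : p ∈ Cone := by
        show ‖p.2‖ < p.1
        have : gq p = ‖p.2‖ - p.1 := rfl
        linarith
      have hT : TT χin χex d =ᶠ[𝓝 p] fun y => ((1 / (4 * π) : ℝ) : ℂ) *
          (((((fun _ => 1 : ℝ → ℝ) (gq y) : ℝ)) : ℂ) * UU 1 (res (KK (Jf d))) y) := by
        filter_upwards [lt_ev (gq_cont hp) hqb,
          gt_ev (f := fun y : E4 => y.1) continuous_fst.continuousAt ht] with y h1 h2
        rw [TT, hχin1 _ h1.le, hχex1 _ (by linarith)]; simp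
      filter_upwards [boxV_congr hT, S3_zero_q (χ := χ) hχin1 hχin0 d hp (Or.inr hqb), cone_ev hc, x0_ev hp]
        with y a b c e
      have := box_T1 (h := fun _ => 1) contDiff_const (KJ_Hs hγ d) e c
      rw [a, b, sub_zero]
      simp only [deriv_const, mul_zero, zero_mul, Complex.ofReal_zero, sub_zero] at this
      exact this.symm
    · push Not at hqb
      have hR : PR d p := ⟨ht, hp, hqb, hqa⟩
      refine (H1 d p hR).le ?_
      have F := PR_facts hR
      have hL := gL_nonneg F.1
      have a2 := (jb_rpow_pos (p.1 + rr p) (-(3 : ℝ))).le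
      have a3 := HK' (gq p) (abs_le.2 ⟨by linarith, by linarith⟩)
      have e : W2 = d.1.D (nI + 3) ^ 2 * jb (p.1 + rr p) ^ (-(3 : ℝ)) * jb (gq p) ^ (-(2 * γ)) * (1 + gL p) := by
        rw [hW2, if_pos F.1.2.2, mul_one]
      have h5 : d.1.D (nI + 3) ^ 2 * (jb (p.1 + rr p) ^ (-(3 : ℝ)) * (1 + gL p)) ≤ K' * W2 := by
        have h6 : 0 ≤ d.1.D (nI + 3) ^ 2 * (jb (p.1 + rr p) ^ (-(3 : ℝ)) * (1 + gL p)) := by positivity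
        have h7 := mul_le_mul_of_nonneg_left a3 h6
        rw [mul_one] at h7
        refine h7.trans (le_of_eq ?_)
        rw [e]; ring
      have h8 := mul_le_mul_of_nonneg_left h5 hC1
      have h9 : 0 ≤ C1 * K' * W1 := by positivity
      have h10 : 0 ≤ (C2 + C3 + C4) * K * (W1 + W2) := by positivity
      linarith [h8, h9, h10]
  · push Not at ht
    have hr12 : rr p ≤ 12 := by linarith
    have hr0 := rr_pos hp
    have a1 := HK (p.1 + rr p) (abs_le.2 ⟨by linarith, by linarith⟩)
    have b1 : d.1.D (nI + 1) ^ 2 ≤ K * W1 := by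
      have := mul_le_mul_of_nonneg_left a1 (sq_nonneg (d.1.D (nI + 1)))
      rw [mul_one] at this
      refine this.trans (le_of_eq ?_)
      rw [hW1]; ring
    have hU : PU d p := ⟨ht, hp, hqa⟩
    have hA : Bd ZV nI (boxV (TT χin χex d)) p ((C2 + C3) * (K * W1)) := by
      have n1 : 0 ≤ C2 * (K * W1) := by positivity
      have n2 : 0 ≤ C3 * (K * W1) := by positivity
      by_cases ht6 : p.1 < 6
      · refine (zer _ (by positivity)).congr ?_
        have hT : TT χin χex d =ᶠ[𝓝 p] fun _ => 0 := by
          filter_upwards [lt_ev (f := fun y : E4 => y.1) continuous_fst.continuousAt ht6] with y h1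
          rw [TT, hχex0 _ (by linarith)]; simp
        filter_upwards [boxV_congr hT] with y a
        rw [a, boxV_zero]
      push Not at ht6
      rcases le_total (rr p) 2 with h | h
      · refine (H2 d p ⟨hU, ht6, h⟩).le ?_
        have := mul_le_mul_of_nonneg_left b1 hC2
        linarith
      · refine (H3 d p ⟨hU, h⟩).le ?_
        have := mul_le_mul_of_nonneg_left b1 hC3
        linarith
    have hB : Bd ZV nI (S3 χ χin d) p (C4 * (K * W1)) := by
      by_cases hqb : gq p < -1
      · exact (zer _ (by positivity)).congr (S3_zero_q (χ := χ) hχin1 hχin0 d hp (Or.inr hqb)).symm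
      push Not at hqb
      by_cases hj : gj p ≤ 3 / 4 * rr p
      · refine (H4 d p ⟨⟨h0, hp, hj⟩, abs_le.2 ⟨by linarith, by linarith⟩⟩).le ?_
        exact mul_le_mul_of_nonneg_left b1 hC4
      · refine (zer _ (by positivity)).congr ?_
        filter_upwards [chi_zero hχ0 hp hj] with y hy
        rw [S3, hy]; simp
    refine ((Bd.add Z_hV hA (Bd.neg Z_hV hB)).congr (Eventually.of_forall fun y => ?_)).le ?_
    · ring
    · have h9 : 0 ≤ C1 * K' * (W1 + W2) := by positivity
      have h10 : 0 ≤ (C2 + C3 + C4) * K * W2 := by positivity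
      linarith
end PartVV

section PartTwentyTwo
open scoped ContDiff
variable {γ : ℝ} {nI : ℕ}

theorem Jf_val (d : Dat γ nI × Ix) (q : ℝ) (x : Pt) :
    Jf d (q, x) = ((Jr d.1.Φ d.2 q (‖x‖⁻¹ • x) : ℝ) : ℂ) := rfl

theorem Jf_sph (d : Dat γ nI × Ix) (q : ℝ) (σ : Sph) :
    Jf d (q, (σ : Pt)) = ((Jr d.1.Φ d.2 q (σ : Pt) : ℝ) : ℂ) := by
  rw [Jf_val, sph_norm, inv_one, one_smul]

theorem fub_int (hγ : 1 / 2 < γ) (d : Dat γ nI × Ix) {p : E4} (hp : p ∈ Cone) :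
    Integrable (Function.uncurry fun (η : ℝ) (σ : Sph) =>
      Jf d (η, (σ : Pt)) * (((lS σ p)⁻¹ ^ 1 : ℝ) : ℂ)) (volume.prod sphM) := by
  obtain ⟨C, hC, hb⟩ := (Jf_FF d).bd
  have hk : Continuous fun σ : Sph => (((lS σ p)⁻¹ ^ 1 : ℝ) : ℂ) :=
    Complex.continuous_ofReal.comp (lS_inv_cont hp 1)
  obtain ⟨M, hM, hMb⟩ := cont_bdd hk
  have hJ : Continuous fun z : ℝ × Sph => Jf d (z.1, (z.2 : Pt)) := by
    refine continuous_iff_continuousAt.2 fun z => ?_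
    exact ContinuousAt.comp (g := Jf d) (f := fun z : ℝ × Sph => ((z.1, (z.2 : Pt)) : E4))
      ((Jf_FF d).sm (p := (z.1, (z.2 : Pt))) (sph_ne z.2)).at.continuousAt (by fun_prop)
  have hc : Continuous (Function.uncurry fun (η : ℝ) (σ : Sph) =>
      Jf d (η, (σ : Pt)) * (((lS σ p)⁻¹ ^ 1 : ℝ) : ℂ)) := hJ.mul (hk.comp continuous_snd)
  have hi : Integrable (fun z : ℝ × Sph => (C * jb z.1 ^ (-(2 * γ + 1))) * M) (volume.prod sphM) :=
    Integrable.mul_prod ((jb_int (s := 2 * γ + 1) (by linarith)).const_mul C)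
      (integrable_const M)
  refine hi.mono' hc.aestronglyMeasurable (Eventually.of_forall fun z => ?_)
  show ‖Jf d (z.1, (z.2 : Pt)) * (((lS z.2 p)⁻¹ ^ 1 : ℝ) : ℂ)‖ ≤ _
  rw [norm_mul]
  have h1 := hb (z.1, (z.2 : Pt)) (sph_ne z.2)
  have h2 := (jb_rpow_pos z.1 (-(2 * γ + 1))).le
  exact mul_le_mul h1 (hMb z.2) (norm_nonneg _) (by positivity)

theorem fub (hγ : 1 / 2 < γ) (d : Dat γ nI × Ix) {p : E4} (hp : p ∈ Cone) :
    (((∫ η : ℝ, ∫ σ : Sph, Jr d.1.Φ d.2 η σ / (p.1 - ⟪p.2, (σ : Pt)⟫) ∂sphM : ℝ)) : ℂ)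
      = UU 1 (res (KK (Jf d))) p := by
  have h1 := integral_integral_swap (fub_int hγ d hp)
  have h2 : ∀ (η : ℝ) (σ : Sph), Jf d (η, (σ : Pt)) * (((lS σ p)⁻¹ ^ 1 : ℝ) : ℂ)
      = ((Jr d.1.Φ d.2 η σ / (p.1 - ⟪p.2, (σ : Pt)⟫) : ℝ) : ℂ) := by
    intro η σ
    rw [Jf_sph, lS_apply, real_inner_comm, pow_one]
    push_cast
    rw [div_eq_mul_inv]
  calc _ = ∫ η : ℝ, ∫ σ : Sph, Jf d (η, (σ : Pt)) * (((lS σ p)⁻¹ ^ 1 : ℝ) : ℂ) ∂sphM := by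
        simp only [h2]
        rw [← integral_complex_ofReal]
        congr 1
        funext η
        rw [← integral_complex_ofReal]
    _ = _ := by
        rw [h1]
        unfold UU
        congr 1
        funext σ
        rw [integral_mul_const, res, KK_eq]

theorem cone_of_q {p : E4} (h : gq p < 0) : p ∈ Cone := by
  show ‖p.2‖ < p.1
  have : gq p = ‖p.2‖ - p.1 := rfl
  linarith

theorem TT_eq (hγ : 1 / 2 < γ) {χin χex : ℝ → ℝ} (hχin0 : ∀ s : ℝ, -(1 / 2) ≤ s → χin s = 0)
    (d : Dat γ nI × Ix) (t : ℝ) (x : Pt) :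
    (((1 / (4 * π)) * (∫ η : ℝ, ∫ σ : Metric.sphere (0 : Pt) 1,
      Jr d.1.Φ d.2 η σ / (t - ⟪x, (σ : Pt)⟫) ∂sphM) * χex (t / 12) * χin (rad x - t) : ℝ) : ℂ)
      = TT χin χex d (t, x) := by
  have e : gq (t, x) = rad x - t := rfl
  by_cases h : -(1 / 2) ≤ gq (t, x)
  · rw [TT, hχin0 _ h, ← e, hχin0 _ h]; simp
  · have := fub hγ d (cone_of_q (p := (t, x)) (by linarith))
    rw [TT, ← this, e]
    push_cast
    ring

theorem TT_sm (hγ : 1 / 2 < γ) {χin χex : ℝ → ℝ} (hχin0 : ∀ s : ℝ, -(1 / 2) ≤ s → χin s = 0)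
    (hχin : ContDiff ℝ ∞ χin) (hχex : ContDiff ℝ ∞ χex)
    (d : Dat γ nI × Ix) {p : E4} (hp : p.2 ≠ 0) : SmA (TT χin χex d) p := by
  by_cases h : -(1 / 2) < gq p
  · exact (SmA.const (c := (0 : ℂ))).congr (TT_zero_q hχin0 d hp h).symm
  · have hc : p ∈ Cone := cone_of_q (by linarith)
    have h1 : SmA (fun y : E4 => χex (y.1 / 12)) p :=
      SmA.of_contDiff (hχex.comp (contDiff_fst.div_const 12))
    have h2 := hq_sm hχin hp
    exact SmA.const.mul (h1.ofReal.mul (h2.ofReal.mul (UU_sm (KJ_Hs hγ d).cont hc 1)))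
end PartTwentyTwo

section PartTwentyThree
open scoped ContDiff
variable {γ : ℝ} {nI : ℕ}

/-- logarithmic part -/
def TL (χ χin : ℝ → ℝ) (d : Dat γ nI × Ix) : E4 → ℂ := fun y =>
  (gρ y : ℂ) * (((-(1/2) * (gL y * χ (gs y)) : ℝ) : ℂ) * pull (GG χin (Jf d)) y)

/-- charge part -/
def TC (χex : ℝ → ℝ) (c : ℂ) : E4 → ℂ := fun y =>
  (gρ y : ℂ) * (1 * pull (fun y => c * ((χex y.1 : ℝ) : ℂ)) y)

/-- free wave part -/
def TF (χ : ℝ → ℝ) (k : ℝ) (F : E4 → ℂ) : E4 → ℂ := fun y =>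
  (gρ y : ℂ) * ((eE k y * ((χ (gs y) : ℝ) : ℂ)) * pull F y)

theorem TF_sm {χ : ℝ → ℝ} (hχ : ContDiff ℝ ∞ χ) (k : ℝ) {F : E4 → ℂ}
    (hF : ∀ y : E4, y.2 ≠ 0 → SmA F y) {p : E4} (hp : p.2 ≠ 0) : SmA (TF χ k F) p :=
  (gρ_sm hp).ofReal.mul (((eE_sm k hp).mul (χs_sm hχ hp).ofReal).mul (pull_sm hp (hF _ hp)))

theorem TL_sm (hγ : 1 / 2 < γ) {χ χin : ℝ → ℝ} (hχ : ContDiff ℝ ∞ χ) (hχin : ContDiff ℝ ∞ χin)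
    (d : Dat γ nI × Ix) {p : E4} (hp : p.2 ≠ 0) : SmA (TL χ χin d) p :=
  (gρ_sm hp).ofReal.mul (((SmA.const.mul ((gL_sm hp).mul (χs_sm hχ hp))).ofReal).mul
    (pull_sm hp (GG_sm (by linarith) hχin (Jf_FF d) hp)))

theorem TC_sm {χex : ℝ → ℝ} (hχex : ContDiff ℝ ∞ χex) (c : ℂ) {p : E4} (hp : p.2 ≠ 0) :
    SmA (TC χex c) p :=
  (gρ_sm hp).ofReal.mul (SmA.const.mul (pull_sm hp
    (SmA.const.mul (fq_sm hχex _).ofReal)))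

theorem gL_val (t : ℝ) {x : Pt} (hx : x ≠ 0) :
    gL (t, x) = Real.log (2 * rad x / jb (t - rad x)) := by
  have hr : 0 < rad x := norm_pos_iff.2 hx
  have e : jb (t - rad x) = gj (t, x) := by
    rw [show t - rad x = -(rad x - t) by ring, jb_neg]; rfl
  rw [e, Real.log_div (by positivity) (gj_pos _).ne']
  rfl

theorem gs_val (t : ℝ) (x : Pt) : gs (t, x) = jb (rad x - t) / rad x := rfl

theorem phi_eq (χ : ℝ → ℝ) (Φ : ℝ → Pt → ℂ) (t : ℝ) (x : Pt) :
    phiApp χ Φ t x = TF χ (charge Φ / (4 * π)) (rf Φ) (t, x) := by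
  have e : gρ (t, x) = (rad x)⁻¹ := rfl
  have e2 : pull (rf Φ) (t, x) = Φ (rad x - t) ((rad x)⁻¹ • x) := rfl
  have e3 : rr (t, x) = rad x := rfl
  rw [TF, phiApp, gs_val, e, e2, eE, e3]
  push_cast
  rw [div_eq_mul_inv]
  ring

theorem A_eq (hγ : 1 / 2 < γ) {χ χin χex : ℝ → ℝ} (hχin0 : ∀ s : ℝ, -(1 / 2) ≤ s → χin s = 0)
    (d : Dat γ nI × Ix) (t : ℝ) {x : Pt} (hx : x ≠ 0) :
    AappC χ χin χex d.1.Φ d.1.𝒜 d.2 t x = TT χin χex d (t, x) + (TL χ χin d (t, x)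
      + (TC χex ((charge d.1.Φ / (4 * π) * (if d.2 = none then 1 else 0) : ℝ) : ℂ) (t, x)
      + TF χ 0 (rf (fun q σ => ((d.1.𝒜 d.2 q σ : ℝ) : ℂ))) (t, x))) := by
  have hr : 0 < rad x := norm_pos_iff.2 hx
  rw [← TT_eq hγ hχin0]
  have hP : PP (Jf d) (rad x - t, x) =
      ((∫ η in Set.Iic (rad x - t), Jr d.1.Φ d.2 η ((rad x)⁻¹ • x) : ℝ) : ℂ) := by
    rw [PP_eq, ← integral_complex_ofReal]; rfl
  have hK : KK (Jf d) (rad x - t, x) = PP (Jf d) (rad x - t, x) +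
      ((∫ η in Set.Ioi (rad x - t), Jr d.1.Φ d.2 η ((rad x)⁻¹ • x) : ℝ) : ℂ) := by
    rw [KK_eq, PP_eq, ← integral_complex_ofReal]
    have := integral_add_compl (measurableSet_Iic (a := rad x - t)) (Jf_int hγ d hx)
    rw [Set.compl_Iic] at this
    exact this.symm
  have e : gρ (t, x) = (rad x)⁻¹ := rfl
  have e2 : pull (rf (fun q σ => ((d.1.𝒜 d.2 q σ : ℝ) : ℂ))) (t, x)
    = ((d.1.𝒜 d.2 (rad x - t) ((rad x)⁻¹ • x) : ℝ) : ℂ) := rfl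
  have e3 : pull (GG χin (Jf d)) (t, x) = PP (Jf d) (rad x - t, x)
      - ((1 - χin (rad x - t) : ℝ) : ℂ) * KK (Jf d) (rad x - t, x) := rfl
  have e4 : pull (fun y : E4 => ((charge d.1.Φ / (4 * π) * (if d.2 = none then 1 else 0) : ℝ) : ℂ)
      * ((χex y.1 : ℝ) : ℂ)) (t, x) = ((charge d.1.Φ / (4 * π) * (if d.2 = none then 1 else 0) : ℝ) : ℂ)
      * ((χex (rad x - t) : ℝ) : ℂ) := rfl
  have e5 : eE 0 (t, x) = 1 := by simp [eE]
  rw [TL, TC, TF, e, e2, e3, e4, e5, gL_val t hx, gs_val, hK, hP, AappC, Aapp]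
  generalize (if d.2 = none then (1 : ℝ) else 0) = δ
  generalize Real.log (2 * rad x / jb (t - rad x)) = L
  generalize (∫ η in Set.Iic (rad x - t), Jr d.1.Φ d.2 η ((rad x)⁻¹ • x)) = P
  generalize (∫ η in Set.Ioi (rad x - t), Jr d.1.Φ d.2 η ((rad x)⁻¹ • x)) = Q
  generalize (∫ η : ℝ, ∫ σ : Metric.sphere (0 : Pt) 1,
      Jr d.1.Φ d.2 η σ / (t - ⟪x, (σ : Pt)⟫) ∂sphM) = W
  generalize χ (jb (rad x - t) / rad x) = X
  have hr' : ((rad x : ℝ) : ℂ) ≠ 0 := by exact_mod_cast hr.ne'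
  have hπ : ((π : ℝ) : ℂ) ≠ 0 := by exact_mod_cast Real.pi_ne_zero
  push_cast
  field_simp
  ring

/-- error functions -/
def E1 (χ : ℝ → ℝ) (d : Dat γ nI) : E4 → ℂ := fun p =>
  boxV (TF χ (charge d.Φ / (4 * π)) (rf d.Φ)) p
      + Complex.I * eE (charge d.Φ / (4 * π)) p * ((2 * (charge d.Φ / (4 * π)) : ℝ) : ℂ)
        * (((ga p : ℝ) : ℂ) * pull (Dv (RV .qd) (rf d.Φ)) p)
        * ((χ (gs p) : ℝ) : ℂ) * (gρ p : ℂ) ^ 2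

def E2 (χ χin : ℝ → ℝ) (d : Dat γ nI × Ix) : E4 → ℂ := fun p =>
  boxV (TL χ χin d) p
      + (gρ p : ℂ) ^ 2 * ((χ (gs p) : ℝ) : ℂ) * (((ga p : ℝ) : ℂ) * pull (Dv (RV .qd) (GG χin (Jf d))) p)

def E3 (χ : ℝ → ℝ) (d : Dat γ nI × Ix) : E4 → ℂ := fun p =>
  boxV (TF χ 0 (rf (fun q σ => ((d.1.𝒜 d.2 q σ : ℝ) : ℂ)))) p

theorem E1_bd (hγ : 1 / 2 < γ) {χ : ℝ → ℝ} (hχ : ContDiff ℝ ∞ χ) :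
    ∃ C : ℝ, 0 ≤ C ∧ ∀ (d : Dat γ nI) (p : E4), PW d p →
      Bd ZV nI (E1 χ d) p (C * (jb (p.1 + rr p) ^ (-(3 : ℝ)) * (d.D (nI + 2) * jb (gq p) ^ (-γ)))) := by
  obtain ⟨K, hK, hk⟩ := charge_bd (nI := nI) hγ
  exact wave1_OB (Θ := Dat γ nI) hχ (n := nI) (F := fun d => rf d.Φ)
    (w := fun d q => d.D (nI + 2) * jb q ^ (-γ))
    (fun d q => mul_nonneg (d.nonneg _) (jb_rpow_pos _ _).le) (Phi_OB γ nI (nI + 2) (nI + 2) le_rfl)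
    (fun d y hy => eul_zero (rf_sm d.hΦ hy) (rf_hom _ y))
    (fun d => charge d.Φ / (4 * π)) (K := K / (4 * π)) (by positivity) (fun d => by
      rw [abs_div, abs_of_pos (show 0 < 4 * π by positivity)]
      exact div_le_div_of_nonneg_right (hk d) (by positivity))

theorem E2_bd (hγ : 1 / 2 < γ) {χ χin : ℝ → ℝ} (hχ : ContDiff ℝ ∞ χ) (hχin : ContDiff ℝ ∞ χin)
    (hχin1 : ∀ s : ℝ, s ≤ -1 → χin s = 1) (hχin0 : ∀ s : ℝ, -(1 / 2) ≤ s → χin s = 0) :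
    ∃ C : ℝ, 0 ≤ C ∧ ∀ (d : Dat γ nI × Ix) (p : E4), PW d p →
      Bd ZV nI (E2 χ χin d) p (C * (jb (p.1 + rr p) ^ (-(3 : ℝ)) *
        ((1 + gL p) * (d.1.D (nI + 3) ^ 2 * jb (gq p) ^ (-(2 * γ)))))) :=
  wave2_OB (Θ := Dat γ nI × Ix) hχ (n := nI) (F := fun d => GG χin (Jf d))
    (w := fun d q => d.1.D (nI + 3) ^ 2 * jb q ^ (-(2 * γ)))
    (fun d q => mul_nonneg (sq_nonneg _) (jb_rpow_pos _ _).le)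
    (GJ_OB hγ hχin hχin1 hχin0 (nI + 2) (nI + 3) le_rfl)
    (fun d y hy => GG_eul hγ hχin d hy)

theorem E3_bd {χ : ℝ → ℝ} (hχ : ContDiff ℝ ∞ χ) :
    ∃ C : ℝ, 0 ≤ C ∧ ∀ (d : Dat γ nI × Ix) (p : E4), PW d p →
      Bd ZV nI (E3 χ d) p (C * (jb (p.1 + rr p) ^ (-(3 : ℝ)) * (d.1.D (nI + 2) * jb (gq p) ^ (-γ)))) := by
  obtain ⟨C, hC, h⟩ := wave1_OB (Θ := Dat γ nI × Ix) hχ (n := nI)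
    (F := fun d => rf (fun q σ => ((d.1.𝒜 d.2 q σ : ℝ) : ℂ)))
    (w := fun d q => d.1.D (nI + 2) * jb q ^ (-γ))
    (fun d q => mul_nonneg (d.1.nonneg _) (jb_rpow_pos _ _).le) (A_OB γ nI (nI + 2) (nI + 2) le_rfl)
    (fun d y hy => eul_zero (rf_sm (d.1.h𝒜 d.2) hy) (rf_hom _ y))
    (fun _ => 0) (K := 0) le_rfl (fun d => by simp)
  refine ⟨C, hC, fun d p hp => (h d p hp).congr (Eventually.of_forall fun y => ?_)⟩
  show _ = boxV _ y
  simp only [mul_zero, Complex.ofReal_zero, zero_mul, add_zero]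
  rfl

theorem E1_zero {χ : ℝ → ℝ} (hχ0 : ∀ s : ℝ, 3 / 4 ≤ s → χ s = 0) (d : Dat γ nI) {p : E4}
    (hp : p.2 ≠ 0) (h : ¬ gj p ≤ 3 / 4 * rr p) : E1 χ d =ᶠ[𝓝 p] fun _ => 0 := by
  have h1 := chi_zero hχ0 hp h
  have h2 : TF χ (charge d.Φ / (4 * π)) (rf d.Φ) =ᶠ[𝓝 p] fun _ => 0 := by
    filter_upwards [h1] with y hy
    rw [TF, hy]; simp
  filter_upwards [h1, boxV_congr h2] with y hy hy2
  rw [E1, hy2, boxV_zero, hy]; simp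

theorem E3_zero {χ : ℝ → ℝ} (hχ0 : ∀ s : ℝ, 3 / 4 ≤ s → χ s = 0) (d : Dat γ nI × Ix) {p : E4}
    (hp : p.2 ≠ 0) (h : ¬ gj p ≤ 3 / 4 * rr p) : E3 χ d =ᶠ[𝓝 p] fun _ => 0 := by
  have h1 := chi_zero hχ0 hp h
  have h2 : TF χ 0 (rf (fun q σ => ((d.1.𝒜 d.2 q σ : ℝ) : ℂ))) =ᶠ[𝓝 p] fun _ => 0 := by
    filter_upwards [h1] with y hy
    rw [TF, hy]; simp
  filter_upwards [boxV_congr h2] with y hy2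
  rw [E3, hy2, boxV_zero]

theorem E2_zero {χ χin : ℝ → ℝ} (hχ0 : ∀ s : ℝ, 3 / 4 ≤ s → χ s = 0) (d : Dat γ nI × Ix) {p : E4}
    (hp : p.2 ≠ 0) (h : ¬ gj p ≤ 3 / 4 * rr p) : E2 χ χin d =ᶠ[𝓝 p] fun _ => 0 := by
  have h1 := chi_zero hχ0 hp h
  have h2 : TL χ χin d =ᶠ[𝓝 p] fun _ => 0 := by
    filter_upwards [h1] with y hy
    rw [TL, hy]; simp
  filter_upwards [h1, boxV_congr h2] with y hy hy2
  rw [E2, hy2, boxV_zero, hy]; simp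

theorem ga_jb (p : E4) : ((ga p : ℝ) : ℂ) * ((jb (gq p) : ℝ) : ℂ) = 1 := by
  have := ga_gj (p := p)
  rw [← Complex.ofReal_mul]
  rw [show jb (gq p) = gj p from rfl, this]; simp

theorem err1 {χ : ℝ → ℝ} (hχ : ContDiff ℝ ∞ χ) (d : Dat γ nI) {p : E4} (hp : p.2 ≠ 0) :
    (Function.uncurry fun t x => box (phiApp χ d.Φ) t x
                + Complex.I
                  * Complex.exp (-Complex.I * ((charge d.Φ / (4 * π) : ℝ) : ℂ)
                      * ((Real.log (rad x) : ℝ) : ℂ))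
                  * ((charge d.Φ / (2 * π) : ℝ) : ℂ)
                  * dq d.Φ (rad x - t) ((rad x)⁻¹ • x)
                  * ((χ (jb (rad x - t) / rad x) : ℝ) : ℂ) / ((rad x : ℝ) : ℂ) ^ 2)
      =ᶠ[𝓝 p] E1 χ d := by
  have hu : Function.uncurry (phiApp χ d.Φ) = TF χ (charge d.Φ / (4 * π)) (rf d.Φ) :=
    funext fun y => phi_eq χ d.Φ y.1 y.2
  have hs : SmA (Function.uncurry (phiApp χ d.Φ)) p := by
    rw [hu]; exact TF_sm hχ _ (fun y hy => rf_sm d.hΦ hy) hp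
  filter_upwards [box_eq hp hs, x0_ev hp] with y hy hy0
  rw [hu] at hy
  have hb : box (phiApp χ d.Φ) y.1 y.2 = _ := hy
  have h1 := rf_dq d.hΦ (p := (gq y, y.2)) hy0
  have e2 : rf (dq d.Φ) (gq y, y.2) = dq d.Φ (rad y.2 - y.1) ((rad y.2)⁻¹ • y.2) := rfl
  have e3 : ((ga y : ℝ) : ℂ) * pull (Dv (RV .qd) (rf d.Φ)) y
      = dq d.Φ (rad y.2 - y.1) ((rad y.2)⁻¹ • y.2) := by
    rw [← e2, h1, Real.rpow_neg_one]; rfl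
  have e4 : eE (charge d.Φ / (4 * π)) y = Complex.exp (-Complex.I * ((charge d.Φ / (4 * π) : ℝ) : ℂ)
                      * ((Real.log (rad y.2) : ℝ) : ℂ)) := rfl
  have e5 : gs y = jb (rad y.2 - y.1) / rad y.2 := rfl
  have e6 : gρ y = (rad y.2)⁻¹ := rfl
  show box (phiApp χ d.Φ) y.1 y.2 + _ = _
  rw [E1, hb, e3, ← e4, e5, e6]
  rw [show (2 * (charge d.Φ / (4 * π)) : ℝ) = charge d.Φ / (2 * π) by field_simp; ring]
  congr 1
  push_cast
  ring

theorem err2 (hγ : 1 / 2 < γ) {χ χin χex : ℝ → ℝ} (hχ : ContDiff ℝ ∞ χ)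
    (hχin : ContDiff ℝ ∞ χin) (hχin0 : ∀ s : ℝ, -(1 / 2) ≤ s → χin s = 0)
    (hχex : ContDiff ℝ ∞ χex) (d : Dat γ nI × Ix) {p : E4} (hp : p.2 ≠ 0) :
    (Function.uncurry fun t x => box (AappC χ χin χex d.1.Φ d.1.𝒜 d.2) t x
                  + ((Jr d.1.Φ d.2 (rad x - t) ((rad x)⁻¹ • x) : ℝ) : ℂ)
                    * ((χ (jb (rad x - t) / rad x) : ℝ) : ℂ) / ((rad x : ℝ) : ℂ) ^ 2)
      =ᶠ[𝓝 p] fun y => (boxV (TT χin χex d) y - S3 χ χin d y) + (E2 χ χin d y + E3 χ d y) := by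
  set c : ℂ := ((charge d.1.Φ / (4 * π) * (if d.2 = none then 1 else 0) : ℝ) : ℂ) with hc
  set F := rf (fun q σ => ((d.1.𝒜 d.2 q σ : ℝ) : ℂ)) with hF
  have hu : Function.uncurry (AappC χ χin χex d.1.Φ d.1.𝒜 d.2) =ᶠ[𝓝 p]
      fun y => TT χin χex d y + (TL χ χin d y + (TC χex c y + TF χ 0 F y)) := by
    filter_upwards [x0_ev hp] with y hy
    exact A_eq hγ hχin0 d y.1 hy
  have s1 : ∀ y : E4, y.2 ≠ 0 → SmA (TT χin χex d) y := fun y hy => TT_sm hγ hχin0 hχin hχex d hy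
  have s2 : ∀ y : E4, y.2 ≠ 0 → SmA (TL χ χin d) y := fun y hy => TL_sm hγ hχ hχin d hy
  have s3 : ∀ y : E4, y.2 ≠ 0 → SmA (TC χex c) y := fun y hy => TC_sm hχex c hy
  have s4 : ∀ y : E4, y.2 ≠ 0 → SmA (TF χ 0 F) y := fun y hy =>
    TF_sm hχ 0 (fun y hy => rf_sm (d.1.h𝒜 d.2) hy) hy
  have hs : SmA (Function.uncurry (AappC χ χin χex d.1.Φ d.1.𝒜 d.2)) p :=
    ((s1 p hp).add ((s2 p hp).add ((s3 p hp).add (s4 p hp)))).congr hu.symm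
  filter_upwards [box_eq hp hs, boxV_congr hu, x0_ev hp] with y hy hy2 hy0
  have hb : box (AappC χ χin χex d.1.Φ d.1.𝒜 d.2) y.1 y.2 = boxV (TT χin χex d) y
      + (boxV (TL χ χin d) y + (0 + boxV (TF χ 0 F) y)) := by
    have : box (AappC χ χin χex d.1.Φ d.1.𝒜 d.2) y.1 y.2 = _ := hy
    rw [this, hy2, boxV_add (s1 y hy0) ((s2 y hy0).add ((s3 y hy0).add (s4 y hy0))),
      boxV_add (s2 y hy0) ((s3 y hy0).add (s4 y hy0)), boxV_add (s3 y hy0) (s4 y hy0)]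
    rw [show boxV (TC χex c) y = 0 from box_const hχex hy0]
  have e1 : pull (Dv (RV .qd) (GG χin (Jf d))) y = ((jb (gq y) : ℝ) : ℂ) * Jf d (gq y, y.2)
      + ((jb (gq y) * deriv χin (gq y) : ℝ) : ℂ) * KK (Jf d) (gq y, y.2) :=
    Dv_GG_qd (by linarith) hχin (Jf_FF d) (p := (gq y, y.2)) hy0
  have e2 : KK (Jf d) (gq y, y.2) = KK (Jf d) y := by rw [KK_eq]; exact (KK_eq _ y.1 y.2).symm
  have e3 : Jf d (gq y, y.2) = ((Jr d.1.Φ d.2 (rad y.2 - y.1) ((rad y.2)⁻¹ • y.2) : ℝ) : ℂ) := rfl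
  have e5 : jb (rad y.2 - y.1) / rad y.2 = gs y := rfl
  have e6 : rad y.2 = (gρ y)⁻¹ := by simp [gρ, rad, rr]
  have hg := ga_jb y
  show box (AappC χ χin χex d.1.Φ d.1.𝒜 d.2) y.1 y.2 + _ = _
  rw [hb, E2, E3, S3, e1, e2, ← e3, e5, e6]
  push_cast
  rw [inv_pow, div_inv_eq_mul]
  linear_combination (-(gρ y : ℂ) ^ 2 * ((χ (gs y) : ℝ) : ℂ) * (Jf d (gq y, y.2)
    + ((deriv χin (gq y) : ℝ) : ℂ) * KK (Jf d) y)) * hg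
end PartTwentyThree

theorem gL_log {t : ℝ} {x : Pt} (ht : 0 ≤ t) (hx : x ≠ 0) :
    1 + gL (t, x) ≤ 2 * (1 + Real.log (jb (t + rad x) / jb (t - rad x))) := by
  have hr : 0 < rad x := norm_pos_iff.2 hx
  have p1 := jb_pos (t + rad x)
  have p2 := jb_pos (t - rad x)
  rw [gL_val t hx, Real.log_div (by positivity) p2.ne', Real.log_div p1.ne' p2.ne',
    Real.log_mul (by norm_num) hr.ne']
  have h1 : Real.log (rad x) ≤ Real.log (jb (t + rad x)) := by
    refine Real.log_le_log hr ?_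
    have := jb_ge_abs (t + rad x)
    rw [abs_of_nonneg (by linarith)] at this
    linarith
  have h2 : Real.log (jb (t - rad x)) ≤ Real.log (jb (t + rad x)) := by
    refine Real.log_le_log p2 (Real.sqrt_le_sqrt ?_)
    nlinarith
  have h3 : Real.log 2 ≤ 1 := by linarith [Real.log_two_lt_d9]
  linarith

/-- Lemma 4.2, the approximate solution solves the reduced
system to leading order. `D` is a family of upper bounds for the norms
`‖Φ‖_{k,∞,γ} + Σ_α ‖𝒜_α‖_{k,∞,γ}`. -/
theorem stmt15 (χ χin χex : ℝ → ℝ)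
    (hχ : ContDiff ℝ (⊤ : ℕ∞) χ) (hχ1 : ∀ s : ℝ, s ≤ 1 / 2 → χ s = 1)
    (hχ0 : ∀ s : ℝ, 3 / 4 ≤ s → χ s = 0)
    (hχin : ContDiff ℝ (⊤ : ℕ∞) χin) (hχin1 : ∀ s : ℝ, s ≤ -1 → χin s = 1)
    (hχin0 : ∀ s : ℝ, -(1 / 2) ≤ s → χin s = 0)
    (hχex : ContDiff ℝ (⊤ : ℕ∞) χex) (hχex1 : ∀ s : ℝ, 1 ≤ s → χex s = 1)
    (hχex0 : ∀ s : ℝ, s ≤ 1 / 2 → χex s = 0)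
    (γ m : ℝ) (hγ : 1 / 2 < γ) (hγ1 : γ < 1) (hm : 0 < m) (nI : ℕ) :
    ∃ C : ℝ, 0 < C ∧
      ∀ (Φ : ℝ → Pt → ℂ) (𝒜 : Ix → ℝ → Pt → ℝ) (D : ℕ → ℝ),
        Smooth2 Φ → (∀ α, Smooth2 (fun q ω => ((𝒜 α q ω : ℝ) : ℂ))) →
        (∀ k : ℕ, RadBound k γ (D k) Φ ∧
          ∀ α, RadBound k γ (D k) (fun q ω => ((𝒜 α q ω : ℝ) : ℂ))) →
        D (nI + 3) ≤ 1 →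
        ∀ l : List VF, l.length = nI →
        ∀ (t : ℝ) (x : Pt), 0 ≤ t → x ≠ 0 →
          (‖Ziter l (fun t x =>
              box (phiApp χ Φ) t x
                + Complex.I
                  * Complex.exp (-Complex.I * ((charge Φ / (4 * π) : ℝ) : ℂ)
                      * ((Real.log (rad x) : ℝ) : ℂ))
                  * ((charge Φ / (2 * π) : ℝ) : ℂ)
                  * dq Φ (rad x - t) ((rad x)⁻¹ • x)
                  * ((χ (jb (rad x - t) / rad x) : ℝ) : ℂ) / ((rad x : ℝ) : ℂ) ^ 2)
              t x‖
            ≤ C * D (nI + 2) * jb (t + rad x) ^ (-(3 : ℝ)) * jb (rad x - t) ^ (-γ)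
                * indWZ t x) ∧
          (∀ α : Ix,
            ‖Ziter l (fun t x =>
                box (AappC χ χin χex Φ 𝒜 α) t x
                  + ((Jr Φ α (rad x - t) ((rad x)⁻¹ • x) : ℝ) : ℂ)
                    * ((χ (jb (rad x - t) / rad x) : ℝ) : ℂ) / ((rad x : ℝ) : ℂ) ^ 2)
                t x‖
              ≤ C * (D (nI + 2) * jb (t + rad x) ^ (-(3 : ℝ)) * jb (rad x - t) ^ (-γ)
                    * indWZ t x
                  + D (nI + 1) ^ 2 * jb (t + rad x) ^ (-m)
                  + D (nI + 3) ^ 2 * jb (t + rad x) ^ (-(3 : ℝ))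
                    * jb (rad x - t) ^ (-(2 * γ))
                    * (1 + Real.log (jb (t + rad x) / jb (t - rad x)))
                    * indWZ t x)) := by
  obtain ⟨C1, hC1, h1⟩ := E1_bd (nI := nI) hγ hχ
  obtain ⟨C2, hC2, h2⟩ := E2_bd (nI := nI) hγ hχ hχin hχin1 hχin0
  obtain ⟨C3, hC3, h3⟩ := E3_bd (γ := γ) (nI := nI) hχ
  obtain ⟨C4, hC4, h4⟩ := T1_all (nI := nI) hγ hχ hχ1 hχ0 hχin hχin1 hχin0 hχex hχex1 hχex0 m
  refine ⟨C1 + C3 + C4 + 2 * (C2 + C4) + 1, by positivity, ?_⟩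
  intro Φ 𝒜 D hΦ h𝒜 hb hD l hl t x ht hx
  let d : Dat γ nI := ⟨Φ, 𝒜, D, hΦ, h𝒜, hb, hD⟩
  let p : E4 := (t, x)
  have hp : p.2 ≠ 0 := hx
  have hr : 0 < rad x := norm_pos_iff.2 hx
  have hDn : ∀ k, 0 ≤ D k := fun k => d.nonneg k
  have a1 : 0 < jb (t + rad x) ^ (-(3 : ℝ)) := jb_rpow_pos _ _
  have a2 : 0 < jb (rad x - t) ^ (-γ) := jb_rpow_pos _ _
  have a3 : 0 < jb (rad x - t) ^ (-(2 * γ)) := jb_rpow_pos _ _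
  have a4 : 0 < jb (t + rad x) ^ (-m) := jb_rpow_pos _ _
  have b1 := hDn (nI + 1)
  have b2 := hDn (nI + 2)
  have b3 := hDn (nI + 3)
  constructor
  · have hbd : Bd ZV nI (E1 χ d) p ((C1 + C3 + C4 + 2 * (C2 + C4) + 1) * D (nI + 2)
        * jb (t + rad x) ^ (-(3 : ℝ)) * jb (rad x - t) ^ (-γ) * indWZ t x) := by
      by_cases hw : gj p ≤ 3 / 4 * rr p
      · refine (h1 d p ⟨ht, hx, hw⟩).le ?_
        have : indWZ t x = 1 := if_pos hw
        rw [this, mul_one]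
        show C1 * (jb (t + rad x) ^ (-(3 : ℝ)) * (D (nI + 2) * jb (rad x - t) ^ (-γ))) ≤ _
        have hX : 0 ≤ jb (t + rad x) ^ (-(3 : ℝ)) * (D (nI + 2) * jb (rad x - t) ^ (-γ)) := by positivity
        calc _ ≤ (C1 + C3 + C4 + 2 * (C2 + C4) + 1) *
              (jb (t + rad x) ^ (-(3 : ℝ)) * (D (nI + 2) * jb (rad x - t) ^ (-γ))) :=
              mul_le_mul_of_nonneg_right (by linarith) hX
          _ = _ := by ring
      · have : indWZ t x = 0 := if_neg hw
        rw [this, mul_zero]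
        exact (Bd.zero_fun nI le_rfl).congr (E1_zero hχ0 d hp hw).symm
    have he := err1 hχ d hp
    have hbd' := hbd.congr he.symm
    have hz := (Ziter_eq l hp hbd'.1).eq_of_nhds
    have := hbd'.2 l hl.le
    rw [← hz] at this
    exact this
  · intro α
    have k4 := h4 (d, α) p ht hp
    set Cc := C1 + C3 + C4 + 2 * (C2 + C4) + 1 with hCc
    have hbd : Bd ZV nI (fun y => (boxV (TT χin χex (d, α)) y - S3 χ χin (d, α) y)
        + (E2 χ χin (d, α) y + E3 χ (d, α) y)) p
        (Cc * (D (nI + 2) * jb (t + rad x) ^ (-(3 : ℝ)) * jb (rad x - t) ^ (-γ)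
                    * indWZ t x
                  + D (nI + 1) ^ 2 * jb (t + rad x) ^ (-m)
                  + D (nI + 3) ^ 2 * jb (t + rad x) ^ (-(3 : ℝ))
                    * jb (rad x - t) ^ (-(2 * γ))
                    * (1 + Real.log (jb (t + rad x) / jb (t - rad x)))
                    * indWZ t x)) := by
      by_cases hw : gj p ≤ 3 / 4 * rr p
      · have hPW : ∀ {Θ : Type} (θ : Θ), PW θ p := fun θ => ⟨ht, hx, hw⟩
        have hsum := k4.add Z_hV ((h2 (d, α) p ⟨ht, hx, hw⟩).add Z_hV (h3 (d, α) p ⟨ht, hx, hw⟩))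
        refine hsum.le ?_
        have hi : indWZ t x = 1 := if_pos hw
        rw [hi, if_pos hw, mul_one, mul_one, mul_one]
        have hg0 : 0 ≤ gL p := gL_nonneg (θ := ()) ⟨ht, hx, hw⟩
        have hgl := gL_log ht hx
        set G := gL p with hG
        set Lg := Real.log (jb (t + rad x) / jb (t - rad x)) with hLg
        set A3 := jb (t + rad x) ^ (-(3 : ℝ))
        set Q1 := jb (rad x - t) ^ (-γ)
        set Q2 := jb (rad x - t) ^ (-(2 * γ))
        set Am := jb (t + rad x) ^ (-m)
        show C4 * (D (nI + 1) ^ 2 * Am + D (nI + 3) ^ 2 * A3 * Q2 * (1 + G))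
          + (C2 * (A3 * ((1 + G) * (D (nI + 3) ^ 2 * Q2))) + C3 * (A3 * (D (nI + 2) * Q1))) ≤ _
        have g1 : 0 ≤ D (nI + 1) ^ 2 * Am := by positivity
        have g2 : 0 ≤ D (nI + 2) * A3 * Q1 := by positivity
        have g3 : 0 ≤ D (nI + 3) ^ 2 * A3 * Q2 := by positivity
        have g5 : 1 + G ≤ 2 * (1 + Lg) := hgl
        have g4 : 0 ≤ 1 + Lg := by linarith
        have g6 : (C2 + C4) * ((D (nI + 3) ^ 2 * A3 * Q2) * (1 + G))
          ≤ (C2 + C4) * ((D (nI + 3) ^ 2 * A3 * Q2) * (2 * (1 + Lg))) := by gcongr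
        have f1 : C3 * (D (nI + 2) * A3 * Q1) ≤ Cc * (D (nI + 2) * A3 * Q1) :=
          mul_le_mul_of_nonneg_right (by rw [hCc]; linarith) g2
        have f2 : C4 * (D (nI + 1) ^ 2 * Am) ≤ Cc * (D (nI + 1) ^ 2 * Am) :=
          mul_le_mul_of_nonneg_right (by rw [hCc]; linarith) g1
        have f3 : 2 * (C2 + C4) * ((D (nI + 3) ^ 2 * A3 * Q2) * (1 + Lg))
            ≤ Cc * ((D (nI + 3) ^ 2 * A3 * Q2) * (1 + Lg)) :=
          mul_le_mul_of_nonneg_right (by rw [hCc]; linarith) (mul_nonneg g3 g4)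
        linarith
      · have z : ∀ {f : E4 → ℂ}, f =ᶠ[𝓝 p] (fun _ => 0) → Bd ZV nI f p 0 := fun h =>
          (Bd.zero_fun nI le_rfl).congr h.symm
        have hsum := k4.add Z_hV ((z (E2_zero (χin := χin) hχ0 (d, α) hp hw)).add Z_hV
          (z (E3_zero hχ0 (d, α) hp hw)))
        refine hsum.le ?_
        have hi : indWZ t x = 0 := if_neg hw
        rw [hi, if_neg hw, mul_zero, mul_zero, mul_zero]
        set Am := jb (t + rad x) ^ (-m)
        show C4 * (D (nI + 1) ^ 2 * Am + 0) + (0 + 0) ≤ Cc * (0 + D (nI + 1) ^ 2 * Am + 0)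
        have g1 : 0 ≤ D (nI + 1) ^ 2 * Am := by positivity
        have f2 : C4 * (D (nI + 1) ^ 2 * Am) ≤ Cc * (D (nI + 1) ^ 2 * Am) :=
          mul_le_mul_of_nonneg_right (by rw [hCc]; linarith) g1
        linarith
    have he := err2 hγ hχ hχin hχin0 hχex (d, α) hp
    have hbd' := hbd.congr he.symm
    have hz := (Ziter_eq l hp hbd'.1).eq_of_nhds
    have := hbd'.2 l hl.le
    rw [← hz] at this
    exact this
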